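/- (Decay at an isolated singularity, Corollary 6.1.) Let f be a smooth conformal Willmore immersion of the punctured open unit disk D∖{0} into ℝⁿ (conformal with factor e^{2w} in Cartesian coordinates, satisfying the Willmore equation in Cartesian coordinates), and assume ∫_{D∖{0}} |A_f|² e^{2w} dx dy < ∞ and Area(f) = ∫_{D∖{0}} e^{2w} dx dy < ∞. Let f̂(t,θ) := f(e^{−t}cos θ, e^{−t}sin θ) for t > 0, which is a conformal immersion on (0,∞)×S¹. Then for every q ∈ (0,2) there exists a constant C (depending on q and f) such that for all t > 0, ∫_{(t,t+1)×S¹} |A|² dV_g ≤ C e^{−qt}, where A and dV_g are the second fundamental form and area element of f̂. -/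

import Mathlib

noncomputable section

open Real MeasureTheory Set Filter
open scoped InnerProductSpace

/-- Partial derivative in the first variable. -/
def pt {F : Type*} [NormedAddCommGroup F] [NormedSpace ℝ F] (f : ℝ → ℝ → F) (t θ : ℝ) : F :=
  deriv (fun s => f s θ) t

/-- Partial derivative in the second variable. -/
def pth {F : Type*} [NormedAddCommGroup F] [NormedSpace ℝ F] (f : ℝ → ℝ → F) (t θ : ℝ) : F :=
  deriv (fun s => f t s) θ

variable {n : ℕ}

/-- Mean curvature vector `H = e^{-2u}(∂_t² f + ∂_θ² f)`. -/
def Hmc (f : ℝ → ℝ → EuclideanSpace ℝ (Fin n)) (u : ℝ → ℝ → ℝ) :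
    ℝ → ℝ → EuclideanSpace ℝ (Fin n) :=
  fun t θ => Real.exp (-(2 * u t θ)) • (pt (pt f) t θ + pth (pth f) t θ)

/-- Component `A_tt` of the second fundamental form. -/
def Att (f : ℝ → ℝ → EuclideanSpace ℝ (Fin n)) (u : ℝ → ℝ → ℝ) :
    ℝ → ℝ → EuclideanSpace ℝ (Fin n) :=
  fun t θ => pt (pt f) t θ - pt u t θ • pt f t θ + pth u t θ • pth f t θ

/-- Component `A_tθ` of the second fundamental form. -/
def Atth (f : ℝ → ℝ → EuclideanSpace ℝ (Fin n)) (u : ℝ → ℝ → ℝ) :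
    ℝ → ℝ → EuclideanSpace ℝ (Fin n) :=
  fun t θ => pt (pth f) t θ - pth u t θ • pt f t θ - pt u t θ • pth f t θ

/-- Component `A_θθ` of the second fundamental form. -/
def Athth (f : ℝ → ℝ → EuclideanSpace ℝ (Fin n)) (u : ℝ → ℝ → ℝ) :
    ℝ → ℝ → EuclideanSpace ℝ (Fin n) :=
  fun t θ => pth (pth f) t θ + pt u t θ • pt f t θ - pth u t θ • pth f t θ

/-- `|A|²`, the squared norm of the second fundamental form. -/
def Asq (f : ℝ → ℝ → EuclideanSpace ℝ (Fin n)) (u : ℝ → ℝ → ℝ) : ℝ → ℝ → ℝ :=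
  fun t θ => Real.exp (-(4 * u t θ)) *
    (‖Att f u t θ‖ ^ 2 + 2 * ‖Atth f u t θ‖ ^ 2 + ‖Athth f u t θ‖ ^ 2)

/-- The left-hand side of the Willmore equation in conformal coordinates. -/
def willmoreOp (f : ℝ → ℝ → EuclideanSpace ℝ (Fin n)) (u : ℝ → ℝ → ℝ) :
    ℝ → ℝ → EuclideanSpace ℝ (Fin n) :=
  fun t θ =>
    (2 : ℝ) • (pt (pt (Hmc f u)) t θ + pth (pth (Hmc f u)) t θ)
    + (4 : ℝ) • pt (fun a b => Real.exp (-(2 * u a b)) •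
        (⟪Hmc f u a b, Att f u a b⟫_ℝ • pt f a b + ⟪Hmc f u a b, Atth f u a b⟫_ℝ • pth f a b)) t θ
    + (4 : ℝ) • pth (fun a b => Real.exp (-(2 * u a b)) •
        (⟪Hmc f u a b, Atth f u a b⟫_ℝ • pt f a b + ⟪Hmc f u a b, Athth f u a b⟫_ℝ • pth f a b)) t θ
    - pt (fun a b => ‖Hmc f u a b‖ ^ 2 • pt f a b) t θ
    - pth (fun a b => ‖Hmc f u a b‖ ^ 2 • pth f a b) t θ

/-- A conformal immersion of a cylinder `s × S¹` (in the `t` variable),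
with conformal factor `e^{2u}`; maps are `2π`-periodic in the second variable. -/
structure ConfImm (f : ℝ → ℝ → EuclideanSpace ℝ (Fin n)) (u : ℝ → ℝ → ℝ) (s : Set ℝ) :
    Prop where
  smooth_f : ContDiff ℝ (⊤ : ℕ∞) (fun p : ℝ × ℝ => f p.1 p.2)
  smooth_u : ContDiff ℝ (⊤ : ℕ∞) (fun p : ℝ × ℝ => u p.1 p.2)
  periodic_f : ∀ t θ, f t (θ + 2 * π) = f t θ
  periodic_u : ∀ t θ, u t (θ + 2 * π) = u t θ
  conf_t : ∀ t ∈ s, ∀ θ : ℝ, ‖pt f t θ‖ ^ 2 = Real.exp (2 * u t θ)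
  conf_th : ∀ t ∈ s, ∀ θ : ℝ, ‖pth f t θ‖ ^ 2 = Real.exp (2 * u t θ)
  conf_orth : ∀ t ∈ s, ∀ θ : ℝ, ⟪pt f t θ, pth f t θ⟫_ℝ = 0

/-- A conformal Willmore immersion of a cylinder. -/
structure ConfWillmore (f : ℝ → ℝ → EuclideanSpace ℝ (Fin n)) (u : ℝ → ℝ → ℝ) (s : Set ℝ)
    extends ConfImm f u s : Prop where
  willmore : ∀ t ∈ s, ∀ θ : ℝ, willmoreOp f u t θ = 0

/-- The first residue `τ₁(f,c)(t)`. -/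
def tau1 (f : ℝ → ℝ → EuclideanSpace ℝ (Fin n)) (u : ℝ → ℝ → ℝ)
    (c : EuclideanSpace ℝ (Fin n)) (t : ℝ) : ℝ :=
  ⟪(-2 : ℝ) • (∫ θ in (0 : ℝ)..(2 * π), pt (Hmc f u) t θ)
    - (4 : ℝ) • (∫ θ in (0 : ℝ)..(2 * π), Real.exp (-(2 * u t θ)) •
        (⟪Hmc f u t θ, Att f u t θ⟫_ℝ • pt f t θ + ⟪Hmc f u t θ, Atth f u t θ⟫_ℝ • pth f t θ))
    + ∫ θ in (0 : ℝ)..(2 * π), ‖Hmc f u t θ‖ ^ 2 • pt f t θ, c⟫_ℝ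

/-- The second residue `τ₂(f,S)(t)`, for a matrix `S`. -/
def tau2 (f : ℝ → ℝ → EuclideanSpace ℝ (Fin n)) (u : ℝ → ℝ → ℝ)
    (S : Matrix (Fin n) (Fin n) ℝ) (t : ℝ) : ℝ :=
  2 * (∫ θ in (0 : ℝ)..(2 * π),
        (⟪Hmc f u t θ, pt (fun a b => (Matrix.toEuclideanLin S) (f a b)) t θ⟫_ℝ
          - ⟪pt (Hmc f u) t θ, (Matrix.toEuclideanLin S) (f t θ)⟫_ℝ))
  - 4 * (∫ θ in (0 : ℝ)..(2 * π), Real.exp (-(2 * u t θ)) *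
        (⟪Hmc f u t θ, Att f u t θ⟫_ℝ * ⟪pt f t θ, (Matrix.toEuclideanLin S) (f t θ)⟫_ℝ
          + ⟪Hmc f u t θ, Atth f u t θ⟫_ℝ * ⟪pth f t θ, (Matrix.toEuclideanLin S) (f t θ)⟫_ℝ))
  + ∫ θ in (0 : ℝ)..(2 * π), ‖Hmc f u t θ‖ ^ 2 * ⟪pt f t θ, (Matrix.toEuclideanLin S) (f t θ)⟫_ℝ

/-- Pointwise norm of the gradient of a scalar function on the cylinder. -/
def gradNorm (u : ℝ → ℝ → ℝ) (t θ : ℝ) : ℝ :=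
  Real.sqrt ((pt u t θ) ^ 2 + (pth u t θ) ^ 2)

/-- Integral of a density over the piece `[a,b] × S¹` of the cylinder. -/
def cylInt (F : ℝ → ℝ → ℝ) (a b : ℝ) : ℝ :=
  ∫ p in Set.Icc a b ×ˢ Set.Icc (0 : ℝ) (2 * π), F p.1 p.2

/-- The density `|A|² dV_g` (with respect to `dt dθ`). -/
def Adens (f : ℝ → ℝ → EuclideanSpace ℝ (Fin n)) (u : ℝ → ℝ → ℝ) : ℝ → ℝ → ℝ :=
  fun t θ => Asq f u t θ * Real.exp (2 * u t θ)

/-- The density `|H|² dV_g` (with respect to `dt dθ`). -/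
def Hdens (f : ℝ → ℝ → EuclideanSpace ℝ (Fin n)) (u : ℝ → ℝ → ℝ) : ℝ → ℝ → ℝ :=
  fun t θ => ‖Hmc f u t θ‖ ^ 2 * Real.exp (2 * u t θ)

/-- The open unit disk in `ℝ²`. -/
def unitDisk : Set (ℝ × ℝ) := {p : ℝ × ℝ | p.1 ^ 2 + p.2 ^ 2 < 1}

/-- The punctured open unit disk in `ℝ²`. -/
def puncturedDisk : Set (ℝ × ℝ) := {p : ℝ × ℝ | 0 < p.1 ^ 2 + p.2 ^ 2 ∧ p.1 ^ 2 + p.2 ^ 2 < 1}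

/-- A conformal Willmore immersion on a planar domain `s ⊆ ℝ²`, in Cartesian
coordinates `(x,y)`; here `pt`/`pth` are the partial derivatives `∂_x`/`∂_y`. -/
structure DiskConfWillmore (f : ℝ → ℝ → EuclideanSpace ℝ (Fin n)) (w : ℝ → ℝ → ℝ)
    (s : Set (ℝ × ℝ)) : Prop where
  smooth_f : ContDiffOn ℝ (⊤ : ℕ∞) (fun p : ℝ × ℝ => f p.1 p.2) s
  smooth_w : ContDiffOn ℝ (⊤ : ℕ∞) (fun p : ℝ × ℝ => w p.1 p.2) s
  conf_x : ∀ p ∈ s, ‖pt f p.1 p.2‖ ^ 2 = Real.exp (2 * w p.1 p.2)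
  conf_y : ∀ p ∈ s, ‖pth f p.1 p.2‖ ^ 2 = Real.exp (2 * w p.1 p.2)
  conf_orth : ∀ p ∈ s, ⟪pt f p.1 p.2, pth f p.1 p.2⟫_ℝ = 0
  willmore : ∀ p ∈ s, willmoreOp f w p.1 p.2 = 0

/-- The cylinder map `f̂(t,θ) = f(e^{-t} cos θ, e^{-t} sin θ)` associated to a disk map `f`. -/
def cylOf (f : ℝ → ℝ → EuclideanSpace ℝ (Fin n)) : ℝ → ℝ → EuclideanSpace ℝ (Fin n) :=
  fun t θ => f (Real.exp (-t) * Real.cos θ) (Real.exp (-t) * Real.sin θ)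

/-- The conformal factor of `f̂` in terms of the conformal factor `w` of the disk map. -/
def cylFactor (w : ℝ → ℝ → ℝ) : ℝ → ℝ → ℝ :=
  fun t θ => w (Real.exp (-t) * Real.cos θ) (Real.exp (-t) * Real.sin θ) - t

section Proof

open Real MeasureTheory Set Filter
open scoped InnerProductSpace

/-- Smoothness on `U` of a function of two real variables, in curried form. -/
def Sm {F : Type*} [NormedAddCommGroup F] [NormedSpace ℝ F] (U : Set (ℝ × ℝ))
    (φ : ℝ → ℝ → F) : Prop :=
  ContDiffOn ℝ (⊤ : ℕ∞) (fun p : ℝ × ℝ => φ p.1 p.2) U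

section Calculus

variable {F : Type*} [NormedAddCommGroup F] [NormedSpace ℝ F]
  {U : Set (ℝ × ℝ)} {φ ψ : ℝ → ℝ → F} {c d : ℝ → ℝ → ℝ} {t θ : ℝ}

lemma Sm.contDiffAt (hφ : Sm U φ) (hU : IsOpen U) (hp : (t, θ) ∈ U) :
    ContDiffAt ℝ (⊤ : ℕ∞) (fun p : ℝ × ℝ => φ p.1 p.2) (t, θ) :=
  (hφ (t, θ) hp).contDiffAt (hU.mem_nhds hp)

lemma Sm.hasFDerivAt (hφ : Sm U φ) (hU : IsOpen U) (hp : (t, θ) ∈ U) :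
    HasFDerivAt (fun p : ℝ × ℝ => φ p.1 p.2) (fderiv ℝ (fun p : ℝ × ℝ => φ p.1 p.2) (t, θ))
      (t, θ) :=
  ((hφ.contDiffAt hU hp).differentiableAt (by simp)).hasFDerivAt

lemma Sm.hasDerivAt_fst_aux (hφ : Sm U φ) (hU : IsOpen U) (hp : (t, θ) ∈ U) :
    HasDerivAt (fun s => φ s θ) (fderiv ℝ (fun p : ℝ × ℝ => φ p.1 p.2) (t, θ) (1, 0)) t :=
  (hφ.hasFDerivAt hU hp).comp_hasDerivAt (f := fun s : ℝ => (s, θ)) t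
    ((hasDerivAt_id t).prodMk (hasDerivAt_const t θ))

lemma Sm.hasDerivAt_snd_aux (hφ : Sm U φ) (hU : IsOpen U) (hp : (t, θ) ∈ U) :
    HasDerivAt (fun s => φ t s) (fderiv ℝ (fun p : ℝ × ℝ => φ p.1 p.2) (t, θ) (0, 1)) θ :=
  (hφ.hasFDerivAt hU hp).comp_hasDerivAt (f := fun s : ℝ => (t, s)) θ
    ((hasDerivAt_const θ t).prodMk (hasDerivAt_id θ))

lemma Sm.pt_eq (hφ : Sm U φ) (hU : IsOpen U) (hp : (t, θ) ∈ U) :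
    pt φ t θ = fderiv ℝ (fun p : ℝ × ℝ => φ p.1 p.2) (t, θ) (1, 0) :=
  (hφ.hasDerivAt_fst_aux hU hp).deriv

lemma Sm.pth_eq (hφ : Sm U φ) (hU : IsOpen U) (hp : (t, θ) ∈ U) :
    pth φ t θ = fderiv ℝ (fun p : ℝ × ℝ => φ p.1 p.2) (t, θ) (0, 1) :=
  (hφ.hasDerivAt_snd_aux hU hp).deriv

lemma Sm.hasDerivAt_pt (hφ : Sm U φ) (hU : IsOpen U) (hp : (t, θ) ∈ U) :
    HasDerivAt (fun s => φ s θ) (pt φ t θ) t := by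
  rw [hφ.pt_eq hU hp]; exact hφ.hasDerivAt_fst_aux hU hp

lemma Sm.hasDerivAt_pth (hφ : Sm U φ) (hU : IsOpen U) (hp : (t, θ) ∈ U) :
    HasDerivAt (fun s => φ t s) (pth φ t θ) θ := by
  rw [hφ.pth_eq hU hp]; exact hφ.hasDerivAt_snd_aux hU hp

lemma Sm.fderiv_apply (hφ : Sm U φ) (hU : IsOpen U) (hp : (t, θ) ∈ U) (v : ℝ × ℝ) :
    fderiv ℝ (fun p : ℝ × ℝ => φ p.1 p.2) (t, θ) v = v.1 • pt φ t θ + v.2 • pth φ t θ := by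
  rw [hφ.pt_eq hU hp, hφ.pth_eq hU hp, ← map_smul, ← map_smul, ← map_add]
  congr 1
  ext <;> simp

lemma Sm.congr (hφ : Sm U φ) (h : ∀ p ∈ U, ψ p.1 p.2 = φ p.1 p.2) : Sm U ψ :=
  ContDiffOn.congr hφ h

lemma Sm.mono {V : Set (ℝ × ℝ)} (hφ : Sm U φ) (h : V ⊆ U) : Sm V φ :=
  ContDiffOn.mono hφ h

lemma sm_fderiv (hφ : Sm U φ) (hU : IsOpen U) :
    ContDiffOn ℝ (⊤ : ℕ∞) (fderiv ℝ (fun p : ℝ × ℝ => φ p.1 p.2)) U :=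
  ContDiffOn.fderiv_of_isOpen hφ hU (by simp)

lemma Sm.pt (hφ : Sm U φ) (hU : IsOpen U) : Sm U (pt φ) := by
  have := (sm_fderiv hφ hU).clm_apply (contDiffOn_const (c := ((1 : ℝ), (0 : ℝ))))
  exact this.congr fun p hp => hφ.pt_eq hU hp

lemma Sm.pth (hφ : Sm U φ) (hU : IsOpen U) : Sm U (pth φ) := by
  have := (sm_fderiv hφ hU).clm_apply (contDiffOn_const (c := ((0 : ℝ), (1 : ℝ))))
  exact this.congr fun p hp => hφ.pth_eq hU hp

lemma pt_congr (hU : IsOpen U) (h : ∀ p ∈ U, φ p.1 p.2 = ψ p.1 p.2) (hp : (t, θ) ∈ U) :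
    pt φ t θ = pt ψ t θ := by
  apply Filter.EventuallyEq.deriv_eq
  have : ∀ᶠ s in nhds t, (s, θ) ∈ U :=
    (Continuous.prodMk_left θ).continuousAt.eventually (hU.mem_nhds hp)
  filter_upwards [this] with s hs using h _ hs

lemma pth_congr (hU : IsOpen U) (h : ∀ p ∈ U, φ p.1 p.2 = ψ p.1 p.2) (hp : (t, θ) ∈ U) :
    pth φ t θ = pth ψ t θ := by
  apply Filter.EventuallyEq.deriv_eq
  have : ∀ᶠ s in nhds θ, (t, s) ∈ U :=
    (Continuous.prodMk_right t).continuousAt.eventually (hU.mem_nhds hp)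
  filter_upwards [this] with s hs using h _ hs

lemma pt_pth_comm (hφ : Sm U φ) (hU : IsOpen U) (hp : (t, θ) ∈ U) :
    pth (pt φ) t θ = pt (pth φ) t θ := by
  have hd : DifferentiableAt ℝ (fderiv ℝ (fun p : ℝ × ℝ => φ p.1 p.2)) (t, θ) :=
    (((sm_fderiv hφ hU) (t, θ) hp).contDiffAt (hU.mem_nhds hp)).differentiableAt (by simp)
  have key : ∀ v : ℝ × ℝ, fderiv ℝ (fun p : ℝ × ℝ =>
      fderiv ℝ (fun p : ℝ × ℝ => φ p.1 p.2) p v) (t, θ)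
      = (fderiv ℝ (fderiv ℝ (fun p : ℝ × ℝ => φ p.1 p.2)) (t, θ)).flip v := by
    intro v
    refine ContinuousLinearMap.ext fun w => ?_
    simp [fderiv_clm_apply hd (differentiableAt_const v)]
  have hsymm : IsSymmSndFDerivAt ℝ (fun p : ℝ × ℝ => φ p.1 p.2) (t, θ) :=
    (hφ.contDiffAt hU hp).isSymmSndFDerivAt (by
      rw [minSmoothness_of_isRCLikeNormedField]; exact WithTop.coe_le_coe.2 (le_top : (2 : ℕ∞) ≤ ⊤))
  have e1 : (fun p : ℝ × ℝ => _root_.pt φ p.1 p.2) =ᶠ[nhds (t, θ)]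
      fun p => fderiv ℝ (fun p : ℝ × ℝ => φ p.1 p.2) p (1, 0) := by
    filter_upwards [hU.mem_nhds hp] with p hp using hφ.pt_eq hU hp
  have e2 : (fun p : ℝ × ℝ => _root_.pth φ p.1 p.2) =ᶠ[nhds (t, θ)]
      fun p => fderiv ℝ (fun p : ℝ × ℝ => φ p.1 p.2) p (0, 1) := by
    filter_upwards [hU.mem_nhds hp] with p hp using hφ.pth_eq hU hp
  rw [(hφ.pt hU).pth_eq hU hp, (hφ.pth hU).pt_eq hU hp, e1.fderiv_eq, e2.fderiv_eq, key, key]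
  simp only [ContinuousLinearMap.flip_apply]
  exact hsymm (0, 1) (1, 0)

lemma Sm.add (hφ : Sm U φ) (hψ : Sm U ψ) : Sm U (fun a b => φ a b + ψ a b) :=
  ContDiffOn.add hφ hψ

lemma Sm.sub (hφ : Sm U φ) (hψ : Sm U ψ) : Sm U (fun a b => φ a b - ψ a b) :=
  ContDiffOn.sub hφ hψ

lemma Sm.neg (hφ : Sm U φ) : Sm U (fun a b => - φ a b) :=
  ContDiffOn.neg hφ

lemma Sm.smul (hc : Sm U c) (hφ : Sm U φ) : Sm U (fun a b => c a b • φ a b) :=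
  ContDiffOn.smul hc hφ

lemma Sm.mul (hc : Sm U c) (hφ : Sm U d) : Sm U (fun a b => c a b * d a b) :=
  ContDiffOn.mul hc hφ

lemma sm_const (x : F) : Sm U (fun _ _ => x) := contDiffOn_const

lemma Sm.exp (hc : Sm U c) : Sm U (fun a b => Real.exp (c a b)) :=
  ContDiffOn.exp hc

lemma pt_add (hU : IsOpen U) (hφ : Sm U φ) (hψ : Sm U ψ) (hp : (t, θ) ∈ U) :
    pt (fun a b => φ a b + ψ a b) t θ = pt φ t θ + pt ψ t θ :=
  ((hφ.hasDerivAt_pt hU hp).add (hψ.hasDerivAt_pt hU hp)).deriv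

lemma pth_add (hU : IsOpen U) (hφ : Sm U φ) (hψ : Sm U ψ) (hp : (t, θ) ∈ U) :
    pth (fun a b => φ a b + ψ a b) t θ = pth φ t θ + pth ψ t θ :=
  ((hφ.hasDerivAt_pth hU hp).add (hψ.hasDerivAt_pth hU hp)).deriv

lemma pt_sub (hU : IsOpen U) (hφ : Sm U φ) (hψ : Sm U ψ) (hp : (t, θ) ∈ U) :
    pt (fun a b => φ a b - ψ a b) t θ = pt φ t θ - pt ψ t θ :=
  ((hφ.hasDerivAt_pt hU hp).sub (hψ.hasDerivAt_pt hU hp)).deriv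

lemma pth_sub (hU : IsOpen U) (hφ : Sm U φ) (hψ : Sm U ψ) (hp : (t, θ) ∈ U) :
    pth (fun a b => φ a b - ψ a b) t θ = pth φ t θ - pth ψ t θ :=
  ((hφ.hasDerivAt_pth hU hp).sub (hψ.hasDerivAt_pth hU hp)).deriv

lemma pt_smul (hU : IsOpen U) (hc : Sm U c) (hφ : Sm U φ) (hp : (t, θ) ∈ U) :
    pt (fun a b => c a b • φ a b) t θ = c t θ • pt φ t θ + pt c t θ • φ t θ :=
  ((hc.hasDerivAt_pt hU hp).smul (hφ.hasDerivAt_pt hU hp)).deriv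

lemma pth_smul (hU : IsOpen U) (hc : Sm U c) (hφ : Sm U φ) (hp : (t, θ) ∈ U) :
    pth (fun a b => c a b • φ a b) t θ = c t θ • pth φ t θ + pth c t θ • φ t θ :=
  ((hc.hasDerivAt_pth hU hp).smul (hφ.hasDerivAt_pth hU hp)).deriv

lemma pt_const_smul (x : ℝ) (hU : IsOpen U) (hφ : Sm U φ) (hp : (t, θ) ∈ U) :
    pt (fun a b => x • φ a b) t θ = x • pt φ t θ :=
  ((hφ.hasDerivAt_pt hU hp).const_smul x).deriv

lemma pth_const_smul (x : ℝ) (hU : IsOpen U) (hφ : Sm U φ) (hp : (t, θ) ∈ U) :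
    pth (fun a b => x • φ a b) t θ = x • pth φ t θ :=
  ((hφ.hasDerivAt_pth hU hp).const_smul x).deriv

lemma pt_exp (hU : IsOpen U) (hc : Sm U c) (hp : (t, θ) ∈ U) :
    pt (fun a b => Real.exp (c a b)) t θ = Real.exp (c t θ) * pt c t θ :=
  (hc.hasDerivAt_pt hU hp).exp.deriv

lemma pth_exp (hU : IsOpen U) (hc : Sm U c) (hp : (t, θ) ∈ U) :
    pth (fun a b => Real.exp (c a b)) t θ = Real.exp (c t θ) * pth c t θ :=
  (hc.hasDerivAt_pth hU hp).exp.deriv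

end Calculus

section InnerCalculus

variable {F : Type*} [NormedAddCommGroup F] [InnerProductSpace ℝ F]
  {U : Set (ℝ × ℝ)} {φ ψ : ℝ → ℝ → F} {t θ : ℝ}

lemma Sm.inner (hφ : Sm U φ) (hψ : Sm U ψ) : Sm U (fun a b => ⟪φ a b, ψ a b⟫_ℝ) :=
  ContDiffOn.inner ℝ hφ hψ

lemma Sm.norm_sq (hφ : Sm U φ) : Sm U (fun a b => ‖φ a b‖ ^ 2) :=
  ContDiffOn.norm_sq ℝ hφ

lemma pt_inner (hU : IsOpen U) (hφ : Sm U φ) (hψ : Sm U ψ) (hp : (t, θ) ∈ U) :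
    pt (fun a b => ⟪φ a b, ψ a b⟫_ℝ) t θ = ⟪φ t θ, pt ψ t θ⟫_ℝ + ⟪pt φ t θ, ψ t θ⟫_ℝ :=
  ((hφ.hasDerivAt_pt hU hp).inner ℝ (hψ.hasDerivAt_pt hU hp)).deriv

lemma pth_inner (hU : IsOpen U) (hφ : Sm U φ) (hψ : Sm U ψ) (hp : (t, θ) ∈ U) :
    pth (fun a b => ⟪φ a b, ψ a b⟫_ℝ) t θ = ⟪φ t θ, pth ψ t θ⟫_ℝ + ⟪pth φ t θ, ψ t θ⟫_ℝ :=
  ((hφ.hasDerivAt_pth hU hp).inner ℝ (hψ.hasDerivAt_pth hU hp)).deriv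

lemma pt_norm_sq (hU : IsOpen U) (hφ : Sm U φ) (hp : (t, θ) ∈ U) :
    pt (fun a b => ‖φ a b‖ ^ 2) t θ = 2 * ⟪φ t θ, pt φ t θ⟫_ℝ :=
  (hφ.hasDerivAt_pt hU hp).norm_sq.deriv

lemma pth_norm_sq (hU : IsOpen U) (hφ : Sm U φ) (hp : (t, θ) ∈ U) :
    pth (fun a b => ‖φ a b‖ ^ 2) t θ = 2 * ⟪φ t θ, pth φ t θ⟫_ℝ :=
  (hφ.hasDerivAt_pth hU hp).norm_sq.deriv

end InnerCalculus

section Structure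

variable {f : ℝ → ℝ → EuclideanSpace ℝ (Fin n)} {u : ℝ → ℝ → ℝ} {U : Set (ℝ × ℝ)} {t θ : ℝ}

namespace DiskConfWillmore

lemma sm_f (hf : DiskConfWillmore f u U) : Sm U f := hf.smooth_f

lemma sm_u (hf : DiskConfWillmore f u U) : Sm U u := hf.smooth_w

lemma sm_Hmc (hf : DiskConfWillmore f u U) (hU : IsOpen U) : Sm U (Hmc f u) :=
  (((sm_const (2 : ℝ)).mul hf.sm_u).neg.exp).smul
    (((hf.sm_f.pt hU).pt hU).add ((hf.sm_f.pth hU).pth hU))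

lemma sm_Att (hf : DiskConfWillmore f u U) (hU : IsOpen U) : Sm U (Att f u) :=
  (((hf.sm_f.pt hU).pt hU).sub ((hf.sm_u.pt hU).smul (hf.sm_f.pt hU))).add
    ((hf.sm_u.pth hU).smul (hf.sm_f.pth hU))

lemma sm_Atth (hf : DiskConfWillmore f u U) (hU : IsOpen U) : Sm U (Atth f u) :=
  (((hf.sm_f.pth hU).pt hU).sub ((hf.sm_u.pth hU).smul (hf.sm_f.pt hU))).sub
    ((hf.sm_u.pt hU).smul (hf.sm_f.pth hU))

lemma sm_Athth (hf : DiskConfWillmore f u U) (hU : IsOpen U) : Sm U (Athth f u) :=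
  (((hf.sm_f.pth hU).pth hU).add ((hf.sm_u.pt hU).smul (hf.sm_f.pt hU))).sub
    ((hf.sm_u.pth hU).smul (hf.sm_f.pth hU))

lemma inner_first_second (hf : DiskConfWillmore f u U) (hU : IsOpen U) (hp : (t, θ) ∈ U) :
    ⟪pt f t θ, pt (pt f) t θ⟫_ℝ = Real.exp (2 * u t θ) * pt u t θ ∧
    ⟪pt f t θ, pt (pth f) t θ⟫_ℝ = Real.exp (2 * u t θ) * pth u t θ ∧
    ⟪pt f t θ, pth (pth f) t θ⟫_ℝ = - (Real.exp (2 * u t θ) * pt u t θ) ∧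
    ⟪pth f t θ, pt (pt f) t θ⟫_ℝ = - (Real.exp (2 * u t θ) * pth u t θ) ∧
    ⟪pth f t θ, pt (pth f) t θ⟫_ℝ = Real.exp (2 * u t θ) * pt u t θ ∧
    ⟪pth f t θ, pth (pth f) t θ⟫_ℝ = Real.exp (2 * u t θ) * pth u t θ := by
  have s1 := hf.sm_f.pt hU
  have s2 := hf.sm_f.pth hU
  have su : Sm U (fun a b => 2 * u a b) := (sm_const (2 : ℝ)).mul hf.sm_u
  have du : pt (fun a b => 2 * u a b) t θ = 2 * pt u t θ :=
    pt_const_smul 2 hU hf.sm_u hp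
  have du' : pth (fun a b => 2 * u a b) t θ = 2 * pth u t θ :=
    pth_const_smul 2 hU hf.sm_u hp
  have a1 := pt_congr hU (φ := fun a b => ‖pt f a b‖ ^ 2)
    (ψ := fun a b => Real.exp (2 * u a b)) hf.conf_x hp
  have a2 := pth_congr hU (φ := fun a b => ‖pt f a b‖ ^ 2)
    (ψ := fun a b => Real.exp (2 * u a b)) hf.conf_x hp
  have b1 := pt_congr hU (φ := fun a b => ‖pth f a b‖ ^ 2)
    (ψ := fun a b => Real.exp (2 * u a b)) hf.conf_y hp
  have b2 := pth_congr hU (φ := fun a b => ‖pth f a b‖ ^ 2)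
    (ψ := fun a b => Real.exp (2 * u a b)) hf.conf_y hp
  have c1 := pt_congr hU (φ := fun a b => ⟪pt f a b, pth f a b⟫_ℝ)
    (ψ := fun _ _ => (0 : ℝ)) hf.conf_orth hp
  have c2 := pth_congr hU (φ := fun a b => ⟪pt f a b, pth f a b⟫_ℝ)
    (ψ := fun _ _ => (0 : ℝ)) hf.conf_orth hp
  rw [pt_norm_sq hU s1 hp, pt_exp hU su hp, du] at a1
  rw [pth_norm_sq hU s1 hp, pth_exp hU su hp, du', pt_pth_comm hf.sm_f hU hp] at a2
  rw [pt_norm_sq hU s2 hp, pt_exp hU su hp, du] at b1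
  rw [pth_norm_sq hU s2 hp, pth_exp hU su hp, du'] at b2
  rw [pt_inner hU s1 s2 hp] at c1
  rw [pth_inner hU s1 s2 hp, pt_pth_comm hf.sm_f hU hp] at c2
  have z1 : pt (fun _ _ => (0 : ℝ)) t θ = 0 := by simp [pt]
  have z2 : pth (fun _ _ => (0 : ℝ)) t θ = 0 := by simp [pth]
  rw [z1, real_inner_comm (pth f t θ) (pt (pt f) t θ)] at c1
  rw [z2, real_inner_comm (pth f t θ) (pt (pth f) t θ)] at c2
  refine ⟨by linarith, by linarith, by linarith, by linarith, by linarith, by linarith⟩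

lemma inner_self_x (hf : DiskConfWillmore f u U) (hp : (t, θ) ∈ U) :
    ⟪pt f t θ, pt f t θ⟫_ℝ = Real.exp (2 * u t θ) := by
  rw [real_inner_self_eq_norm_sq]; exact hf.conf_x (t, θ) hp

lemma inner_self_y (hf : DiskConfWillmore f u U) (hp : (t, θ) ∈ U) :
    ⟪pth f t θ, pth f t θ⟫_ℝ = Real.exp (2 * u t θ) := by
  rw [real_inner_self_eq_norm_sq]; exact hf.conf_y (t, θ) hp

lemma inner_xy (hf : DiskConfWillmore f u U) (hp : (t, θ) ∈ U) :
    ⟪pt f t θ, pth f t θ⟫_ℝ = 0 := hf.conf_orth (t, θ) hp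

lemma inner_yx (hf : DiskConfWillmore f u U) (hp : (t, θ) ∈ U) :
    ⟪pth f t θ, pt f t θ⟫_ℝ = 0 := by rw [real_inner_comm]; exact hf.conf_orth (t, θ) hp

/-- The second fundamental form is normal. -/
lemma inner_first_A (hf : DiskConfWillmore f u U) (hU : IsOpen U) (hp : (t, θ) ∈ U) :
    ⟪pt f t θ, Att f u t θ⟫_ℝ = 0 ∧ ⟪pt f t θ, Atth f u t θ⟫_ℝ = 0 ∧
    ⟪pt f t θ, Athth f u t θ⟫_ℝ = 0 ∧ ⟪pth f t θ, Att f u t θ⟫_ℝ = 0 ∧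
    ⟪pth f t θ, Atth f u t θ⟫_ℝ = 0 ∧ ⟪pth f t θ, Athth f u t θ⟫_ℝ = 0 := by
  obtain ⟨h1, h2, h3, h4, h5, h6⟩ := hf.inner_first_second hU hp
  simp only [Att, Atth, Athth, inner_add_right, inner_sub_right, real_inner_smul_right,
    hf.inner_self_x hp, hf.inner_self_y hp, hf.inner_xy hp, hf.inner_yx hp,
    h1, h2, h3, h4, h5, h6]
  refine ⟨by ring, by ring, by ring, by ring, by ring, by ring⟩

end DiskConfWillmore

lemma exp_smul_Hmc (f : ℝ → ℝ → EuclideanSpace ℝ (Fin n)) (u : ℝ → ℝ → ℝ) (t θ : ℝ) :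
    Real.exp (2 * u t θ) • Hmc f u t θ = pt (pt f) t θ + pth (pth f) t θ := by
  rw [Hmc, smul_smul, ← Real.exp_add]; simp

lemma exp_smul_Hmc_eq_A (f : ℝ → ℝ → EuclideanSpace ℝ (Fin n)) (u : ℝ → ℝ → ℝ) (t θ : ℝ) :
    Real.exp (2 * u t θ) • Hmc f u t θ = Att f u t θ + Athth f u t θ := by
  rw [exp_smul_Hmc, Att, Athth]; abel

lemma Hmc_eq (f : ℝ → ℝ → EuclideanSpace ℝ (Fin n)) (u : ℝ → ℝ → ℝ) (t θ : ℝ) :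
    Hmc f u t θ = Real.exp (-(2 * u t θ)) • (Att f u t θ + Athth f u t θ) := by
  rw [← exp_smul_Hmc_eq_A, smul_smul, ← Real.exp_add]; simp

namespace DiskConfWillmore

lemma inner_first_H (hf : DiskConfWillmore f u U) (hU : IsOpen U) (hp : (t, θ) ∈ U) :
    ⟪pt f t θ, Hmc f u t θ⟫_ℝ = 0 ∧ ⟪pth f t θ, Hmc f u t θ⟫_ℝ = 0 := by
  obtain ⟨h1, h2, h3, h4, h5, h6⟩ := hf.inner_first_A hU hp
  simp [Hmc_eq, inner_add_right, real_inner_smul_right, h1, h3, h4, h6]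

/-- The flat Laplacian of the conformal factor. -/
lemma codazzi (hf : DiskConfWillmore f u U) (hU : IsOpen U) (hp : (t, θ) ∈ U) :
    pth (Att f u) t θ - pt (Atth f u) t θ =
      pth u t θ • (pt (pt f) t θ + pth (pth f) t θ)
        + (pt (pt u) t θ + pth (pth u) t θ) • pth f t θ ∧
    pt (Athth f u) t θ - pth (Atth f u) t θ =
      pt u t θ • (pt (pt f) t θ + pth (pth f) t θ)
        + (pt (pt u) t θ + pth (pth u) t θ) • pt f t θ := by
  have sf := hf.sm_f
  have su := hf.sm_u
  have f1 := sf.pt hU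
  have f2 := sf.pth hU
  have u1 := su.pt hU
  have u2 := su.pth hU
  have f11 := f1.pt hU
  have f12 := f2.pt hU
  have f22 := f2.pth hU
  have e1 : pth (Att f u) t θ = pth (pt (pt f)) t θ
      - (pt u t θ • pth (pt f) t θ + pth (pt u) t θ • pt f t θ)
      + (pth u t θ • pth (pth f) t θ + pth (pth u) t θ • pth f t θ) := by
    unfold Att
    rw [pth_add hU (f11.sub (u1.smul f1)) (u2.smul f2) hp, pth_sub hU f11 (u1.smul f1) hp,
      pth_smul hU u1 f1 hp, pth_smul hU u2 f2 hp]
  have e2 : pt (Atth f u) t θ = pt (pt (pth f)) t θ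
      - (pth u t θ • pt (pt f) t θ + pt (pth u) t θ • pt f t θ)
      - (pt u t θ • pt (pth f) t θ + pt (pt u) t θ • pth f t θ) := by
    unfold Atth
    rw [pt_sub hU (f12.sub (u2.smul f1)) (u1.smul f2) hp, pt_sub hU f12 (u2.smul f1) hp,
      pt_smul hU u2 f1 hp, pt_smul hU u1 f2 hp]
  have e3 : pth (Atth f u) t θ = pth (pt (pth f)) t θ
      - (pth u t θ • pth (pt f) t θ + pth (pth u) t θ • pt f t θ)
      - (pt u t θ • pth (pth f) t θ + pth (pt u) t θ • pth f t θ) := by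
    unfold Atth
    rw [pth_sub hU (f12.sub (u2.smul f1)) (u1.smul f2) hp, pth_sub hU f12 (u2.smul f1) hp,
      pth_smul hU u2 f1 hp, pth_smul hU u1 f2 hp]
  have e4 : pt (Athth f u) t θ = pt (pth (pth f)) t θ
      + (pt u t θ • pt (pt f) t θ + pt (pt u) t θ • pt f t θ)
      - (pth u t θ • pt (pth f) t θ + pt (pth u) t θ • pth f t θ) := by
    unfold Athth
    rw [pt_sub hU (f22.add (u1.smul f1)) (u2.smul f2) hp, pt_add hU f22 (u1.smul f1) hp,
      pt_smul hU u1 f1 hp, pt_smul hU u2 f2 hp]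
  have cf := pt_pth_comm sf hU hp
  have cu := pt_pth_comm su hU hp
  have c1 : pth (pt (pt f)) t θ = pt (pt (pth f)) t θ := by
    rw [pt_pth_comm f1 hU hp]
    exact pt_congr hU (fun p hp => pt_pth_comm sf hU hp) hp
  have c2 : pth (pt (pth f)) t θ = pt (pth (pth f)) t θ := pt_pth_comm f2 hU hp
  rw [e1, e2, e3, e4, cf, cu, c1, c2]
  constructor <;> module

/-- Gauss equation. -/
lemma gauss (hf : DiskConfWillmore f u U) (hU : IsOpen U) (hp : (t, θ) ∈ U) :
    Real.exp (2 * u t θ) * (pt (pt u) t θ + pth (pth u) t θ) =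
      ‖Atth f u t θ‖ ^ 2 - ⟪Att f u t θ, Athth f u t θ⟫_ℝ := by
  have h := congrArg (fun v => ⟪pth f t θ, v⟫_ℝ) (hf.codazzi hU hp).1
  simp only [inner_sub_right, inner_add_right, real_inner_smul_right] at h
  obtain ⟨i1, i2, i3, i4, i5, i6⟩ := hf.inner_first_A hU hp
  obtain ⟨h1, h2, h3, h4, h5, h6⟩ := hf.inner_first_second hU hp
  have n1 := pth_congr hU (φ := fun a b => ⟪pth f a b, Att f u a b⟫_ℝ)
    (ψ := fun _ _ => (0 : ℝ)) (fun p hp => (hf.inner_first_A hU hp).2.2.2.1) hp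
  have n2 := pt_congr hU (φ := fun a b => ⟪pth f a b, Atth f u a b⟫_ℝ)
    (ψ := fun _ _ => (0 : ℝ)) (fun p hp => (hf.inner_first_A hU hp).2.2.2.2.1) hp
  have z1 : pt (fun _ _ => (0 : ℝ)) t θ = 0 := by simp [pt]
  have z2 : pth (fun _ _ => (0 : ℝ)) t θ = 0 := by simp [pth]
  rw [pth_inner hU (hf.sm_f.pth hU) (hf.sm_Att hU) hp, z2] at n1
  rw [pt_inner hU (hf.sm_f.pth hU) (hf.sm_Atth hU) hp, z1] at n2
  have k1 : ⟪pth (pth f) t θ, Att f u t θ⟫_ℝ = ⟪Att f u t θ, Athth f u t θ⟫_ℝ := by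
    rw [real_inner_comm, Athth]
    simp only [inner_sub_right, inner_add_right, real_inner_smul_right]
    rw [real_inner_comm (pt f t θ), real_inner_comm (pth f t θ), i1, i4]; ring
  have k2 : ⟪pt (pth f) t θ, Atth f u t θ⟫_ℝ = ‖Atth f u t θ‖ ^ 2 := by
    rw [← real_inner_self_eq_norm_sq]
    nth_rw 2 [Atth]
    simp only [inner_sub_left, real_inner_smul_left]
    rw [i2, i5]; ring
  rw [hf.inner_self_y hp, h4, h6] at h
  linarith

end DiskConfWillmore

end Structure

section Willmore

variable {f : ℝ → ℝ → EuclideanSpace ℝ (Fin n)} {u : ℝ → ℝ → ℝ} {U : Set (ℝ × ℝ)} {t θ : ℝ}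

lemma sm_exp_neg_two (hu : Sm U u) : Sm U (fun a b => Real.exp (-(2 * u a b))) :=
  ((sm_const (2 : ℝ)).mul hu).neg.exp

lemma pt_exp_neg_two (hU : IsOpen U) (hu : Sm U u) (hp : (t, θ) ∈ U) :
    pt (fun a b => Real.exp (-(2 * u a b))) t θ
      = Real.exp (-(2 * u t θ)) * (-(2 * pt u t θ)) := by
  rw [pt_exp hU ((sm_const (2 : ℝ)).mul hu).neg hp]
  congr 1
  exact (((hu.hasDerivAt_pt hU hp).const_mul 2).neg).deriv

lemma pth_exp_neg_two (hU : IsOpen U) (hu : Sm U u) (hp : (t, θ) ∈ U) :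
    pth (fun a b => Real.exp (-(2 * u a b))) t θ
      = Real.exp (-(2 * u t θ)) * (-(2 * pth u t θ)) := by
  rw [pth_exp hU ((sm_const (2 : ℝ)).mul hu).neg hp]
  congr 1
  exact (((hu.hasDerivAt_pth hU hp).const_mul 2).neg).deriv

lemma pt_exp_two (hU : IsOpen U) (hu : Sm U u) (hp : (t, θ) ∈ U) :
    pt (fun a b => Real.exp (2 * u a b)) t θ
      = Real.exp (2 * u t θ) * (2 * pt u t θ) := by
  rw [pt_exp hU ((sm_const (2 : ℝ)).mul hu) hp]
  congr 1
  exact ((hu.hasDerivAt_pt hU hp).const_mul 2).deriv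

lemma pth_exp_two (hU : IsOpen U) (hu : Sm U u) (hp : (t, θ) ∈ U) :
    pth (fun a b => Real.exp (2 * u a b)) t θ
      = Real.exp (2 * u t θ) * (2 * pth u t θ) := by
  rw [pth_exp hU ((sm_const (2 : ℝ)).mul hu) hp]
  congr 1
  exact ((hu.hasDerivAt_pth hU hp).const_mul 2).deriv

namespace DiskConfWillmore

lemma pt_trace (hf : DiskConfWillmore f u U) (hU : IsOpen U) (hp : (t, θ) ∈ U) :
    pt (Att f u) t θ + pt (Athth f u) t θ =
      Real.exp (2 * u t θ) • (pt (Hmc f u) t θ + (2 * pt u t θ) • Hmc f u t θ) := by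
  rw [← pt_add hU (hf.sm_Att hU) (hf.sm_Athth hU) hp]
  simp only [← exp_smul_Hmc_eq_A]
  rw [pt_smul hU ((sm_const (2 : ℝ)).mul hf.sm_u).exp (hf.sm_Hmc hU) hp,
    pt_exp_two hU hf.sm_u hp]
  module

lemma pth_trace (hf : DiskConfWillmore f u U) (hU : IsOpen U) (hp : (t, θ) ∈ U) :
    pth (Att f u) t θ + pth (Athth f u) t θ =
      Real.exp (2 * u t θ) • (pth (Hmc f u) t θ + (2 * pth u t θ) • Hmc f u t θ) := by
  rw [← pth_add hU (hf.sm_Att hU) (hf.sm_Athth hU) hp]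
  simp only [← exp_smul_Hmc_eq_A]
  rw [pth_smul hU ((sm_const (2 : ℝ)).mul hf.sm_u).exp (hf.sm_Hmc hU) hp,
    pth_exp_two hU hf.sm_u hp]
  module

/-- Divergence of the rows of the second fundamental form. -/
lemma div_A (hf : DiskConfWillmore f u U) (hU : IsOpen U) (hp : (t, θ) ∈ U) :
    pt (Att f u) t θ + pth (Atth f u) t θ =
      Real.exp (2 * u t θ) • (pt (Hmc f u) t θ + pt u t θ • Hmc f u t θ)
        - (pt (pt u) t θ + pth (pth u) t θ) • pt f t θ ∧
    pt (Atth f u) t θ + pth (Athth f u) t θ =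
      Real.exp (2 * u t θ) • (pth (Hmc f u) t θ + pth u t θ • Hmc f u t θ)
        - (pt (pt u) t θ + pth (pth u) t θ) • pth f t θ := by
  obtain ⟨c1, c2⟩ := hf.codazzi hU hp
  rw [← exp_smul_Hmc] at c1 c2
  have t1 := hf.pt_trace hU hp
  have t2 := hf.pth_trace hU hp
  constructor
  · have : pt (Att f u) t θ + pth (Atth f u) t θ = (pt (Att f u) t θ + pt (Athth f u) t θ)
      - (pt (Athth f u) t θ - pth (Atth f u) t θ) := by abel
    rw [this, t1, c2]; module
  · have : pt (Atth f u) t θ + pth (Athth f u) t θ = (pth (Att f u) t θ + pth (Athth f u) t θ)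
      - (pth (Att f u) t θ - pt (Atth f u) t θ) := by abel
    rw [this, t2, c1]; module

lemma second_derivs (f : ℝ → ℝ → EuclideanSpace ℝ (Fin n)) (u : ℝ → ℝ → ℝ) (t θ : ℝ) :
    pt (pt f) t θ = Att f u t θ + pt u t θ • pt f t θ - pth u t θ • pth f t θ ∧
    pt (pth f) t θ = Atth f u t θ + pth u t θ • pt f t θ + pt u t θ • pth f t θ ∧
    pth (pth f) t θ = Athth f u t θ - pt u t θ • pt f t θ + pth u t θ • pth f t θ := by
  refine ⟨?_, ?_, ?_⟩ <;> simp only [Att, Atth, Athth] <;> abel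

/-- The Willmore equation, solved for the Laplacian of the mean curvature vector. -/
lemma laplace_H (hf : DiskConfWillmore f u U) (hU : IsOpen U) (hp : (t, θ) ∈ U) :
    pt (pt (Hmc f u)) t θ + pth (pth (Hmc f u)) t θ =
      (-(2 * Real.exp (-(2 * u t θ)))) •
        (⟪Hmc f u t θ, Att f u t θ⟫_ℝ • Att f u t θ
          + (2 * ⟪Hmc f u t θ, Atth f u t θ⟫_ℝ) • Atth f u t θ
          + ⟪Hmc f u t θ, Athth f u t θ⟫_ℝ • Athth f u t θ
          + (⟪pt (Hmc f u) t θ, Att f u t θ⟫_ℝ + ⟪pth (Hmc f u) t θ, Atth f u t θ⟫_ℝ) • pt f t θ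
          + (⟪pt (Hmc f u) t θ, Atth f u t θ⟫_ℝ + ⟪pth (Hmc f u) t θ, Athth f u t θ⟫_ℝ)
            • pth f t θ)
      - ⟪Hmc f u t θ, pt (Hmc f u) t θ⟫_ℝ • pt f t θ
      - ⟪Hmc f u t θ, pth (Hmc f u) t θ⟫_ℝ • pth f t θ
      + (1 / 2 * (Real.exp (2 * u t θ) * ‖Hmc f u t θ‖ ^ 2)) • Hmc f u t θ := by
  have hw := hf.willmore (t, θ) hp
  have sH := hf.sm_Hmc hU
  have s11 := hf.sm_Att hU
  have s12 := hf.sm_Atth hU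
  have s22 := hf.sm_Athth hU
  have f1 := hf.sm_f.pt hU
  have f2 := hf.sm_f.pth hU
  have se := sm_exp_neg_two hf.sm_u
  have b11 := sH.inner s11
  have b12 := sH.inner s12
  have b22 := sH.inner s22
  obtain ⟨d1, d2⟩ := hf.div_A hU hp
  obtain ⟨n1, n2⟩ := hf.inner_first_H hU hp
  obtain ⟨q1, q2, q3⟩ := second_derivs f u t θ
  have d1' := congrArg (fun v => ⟪Hmc f u t θ, v⟫_ℝ) d1
  have d2' := congrArg (fun v => ⟪Hmc f u t θ, v⟫_ℝ) d2
  have tr := congrArg (fun v => ⟪Hmc f u t θ, v⟫_ℝ) (exp_smul_Hmc_eq_A f u t θ)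
  rw [real_inner_comm] at n1 n2
  simp only [inner_add_right, inner_sub_right, real_inner_smul_right, n1, n2,
    real_inner_self_eq_norm_sq] at d1' d2' tr
  simp only [willmoreOp] at hw
  rw [pt_smul hU se ((b11.smul f1).add (b12.smul f2)) hp,
    pth_smul hU se ((b12.smul f1).add (b22.smul f2)) hp,
    pt_add hU (b11.smul f1) (b12.smul f2) hp, pth_add hU (b12.smul f1) (b22.smul f2) hp,
    pt_smul hU b11 f1 hp, pt_smul hU b12 f2 hp, pth_smul hU b12 f1 hp, pth_smul hU b22 f2 hp,
    pt_smul hU sH.norm_sq f1 hp, pth_smul hU sH.norm_sq f2 hp,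
    pt_norm_sq hU sH hp, pth_norm_sq hU sH hp,
    pt_inner hU sH s11 hp, pt_inner hU sH s12 hp, pth_inner hU sH s12 hp, pth_inner hU sH s22 hp,
    pt_exp_neg_two hU hf.sm_u hp, pth_exp_neg_two hU hf.sm_u hp,
    pt_pth_comm hf.sm_f hU hp, q2] at hw
  have trv := exp_smul_Hmc_eq_A f u t θ
  have hE : Real.exp (-(2 * u t θ)) * Real.exp (2 * u t θ) = 1 := by
    rw [← Real.exp_add]; simp
  rw [q1, q3] at hw
  set ei := Real.exp (-(2 * u t θ))
  set E := Real.exp (2 * u t θ)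
  linear_combination (norm := module) (1 / 2 : ℝ) • hw - (2 * ei * d1') • pt f t θ
    - (2 * ei * d2') • pth f t θ - (2 * ei * pt u t θ * tr) • pt f t θ
    - (2 * ei * pth u t θ * tr) • pth f t θ
    - (2 * ⟪Hmc f u t θ, pt (Hmc f u) t θ⟫_ℝ * hE) • pt f t θ
    - (2 * ⟪Hmc f u t θ, pth (Hmc f u) t θ⟫_ℝ * hE) • pth f t θ
    - (1 / 2 * ‖Hmc f u t θ‖ ^ 2 : ℝ) • trv

end DiskConfWillmore

end Willmore

/-- The Cauchy–Riemann operator `∂₁ + i ∂₂`. -/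
def dbar (φ : ℝ → ℝ → ℂ) (t θ : ℝ) : ℂ := pt φ t θ + Complex.I * pth φ t θ

/-- A coordinate of the complex vector `a - i b`. -/
def cx (a b : ℝ → ℝ → EuclideanSpace ℝ (Fin n)) (j : Fin n) (t θ : ℝ) : ℂ :=
  (a t θ j : ℂ) - Complex.I * (b t θ j : ℂ)

/-- The mean curvature vector scaled by the conformal factor, `e^u H`. -/
def vh (f : ℝ → ℝ → EuclideanSpace ℝ (Fin n)) (u : ℝ → ℝ → ℝ) (t θ : ℝ) :
    EuclideanSpace ℝ (Fin n) := Real.exp (u t θ) • Hmc f u t θ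

/-- The scaled derivative `e^u ∂₁H`. -/
def vy1 (f : ℝ → ℝ → EuclideanSpace ℝ (Fin n)) (u : ℝ → ℝ → ℝ) (t θ : ℝ) :
    EuclideanSpace ℝ (Fin n) := Real.exp (u t θ) • pt (Hmc f u) t θ

/-- The scaled derivative `e^u ∂₂H`. -/
def vy2 (f : ℝ → ℝ → EuclideanSpace ℝ (Fin n)) (u : ℝ → ℝ → ℝ) (t θ : ℝ) :
    EuclideanSpace ℝ (Fin n) := Real.exp (u t θ) • pth (Hmc f u) t θ

/-- The scaled trace-free second fundamental form, diagonal part. -/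
def vp (f : ℝ → ℝ → EuclideanSpace ℝ (Fin n)) (u : ℝ → ℝ → ℝ) (t θ : ℝ) :
    EuclideanSpace ℝ (Fin n) :=
  Real.exp (-u t θ) • ((1 / 2 : ℝ) • (Att f u t θ - Athth f u t θ))

/-- The scaled trace-free second fundamental form, off-diagonal part. -/
def vq (f : ℝ → ℝ → EuclideanSpace ℝ (Fin n)) (u : ℝ → ℝ → ℝ) (t θ : ℝ) :
    EuclideanSpace ℝ (Fin n) := Real.exp (-u t θ) • Atth f u t θ

/-- The scale invariant length of the second fundamental form. -/
def aa (f : ℝ → ℝ → EuclideanSpace ℝ (Fin n)) (u : ℝ → ℝ → ℝ) (t θ : ℝ) : ℝ :=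
  Real.sqrt (Adens f u t θ)

/-- The length of `e^u ∇H`. -/
def yy (f : ℝ → ℝ → EuclideanSpace ℝ (Fin n)) (u : ℝ → ℝ → ℝ) (t θ : ℝ) : ℝ :=
  ‖vy1 f u t θ‖ + ‖vy2 f u t θ‖

/-- Complex gradient `∂₁u - i ∂₂u`. -/
def gc (u : ℝ → ℝ → ℝ) (t θ : ℝ) : ℂ := ((pt u t θ : ℝ) : ℂ) - Complex.I * ((pth u t θ : ℝ) : ℂ)

section Cx

variable {a b : ℝ → ℝ → EuclideanSpace ℝ (Fin n)} {U : Set (ℝ × ℝ)} {t θ : ℝ}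

lemma abs_apply_le (v : EuclideanSpace ℝ (Fin n)) (j : Fin n) : |v j| ≤ ‖v‖ :=
  PiLp.norm_apply_le v j

lemma norm_mk_le (v w : EuclideanSpace ℝ (Fin n)) (j : Fin n) :
    ‖((v j : ℝ) : ℂ) + Complex.I * ((w j : ℝ) : ℂ)‖ ≤ ‖v‖ + ‖w‖ := by
  refine (norm_add_le _ _).trans ?_
  simp only [norm_mul, Complex.norm_I, one_mul, Complex.norm_real, Real.norm_eq_abs]
  exact add_le_add (abs_apply_le v j) (abs_apply_le w j)

lemma sm_coord (ha : Sm U a) (j : Fin n) : Sm U (fun t θ => a t θ j) :=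
  (EuclideanSpace.proj (𝕜 := ℝ) j).contDiff.comp_contDiffOn ha

lemma sm_ofReal {c : ℝ → ℝ → ℝ} (hc : Sm U c) : Sm U (fun t θ => (c t θ : ℂ)) :=
  Complex.ofRealCLM.contDiff.comp_contDiffOn hc

lemma Sm.cx (ha : Sm U a) (hb : Sm U b) (j : Fin n) : Sm U (cx a b j) :=
  (sm_ofReal (sm_coord ha j)).sub
    (contDiffOn_const.mul (sm_ofReal (sm_coord hb j)))

lemma pt_coord (hU : IsOpen U) (ha : Sm U a) (hp : (t, θ) ∈ U) (j : Fin n) :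
    HasDerivAt (fun s => ((a s θ j : ℝ) : ℂ)) ((pt a t θ j : ℝ) : ℂ) t :=
  ((EuclideanSpace.proj (𝕜 := ℝ) j).hasFDerivAt.comp_hasDerivAt t
    (ha.hasDerivAt_pt hU hp)).ofReal_comp

lemma pth_coord (hU : IsOpen U) (ha : Sm U a) (hp : (t, θ) ∈ U) (j : Fin n) :
    HasDerivAt (fun s => ((a t s j : ℝ) : ℂ)) ((pth a t θ j : ℝ) : ℂ) θ :=
  ((EuclideanSpace.proj (𝕜 := ℝ) j).hasFDerivAt.comp_hasDerivAt θ
    (ha.hasDerivAt_pth hU hp)).ofReal_comp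

lemma pt_cx (hU : IsOpen U) (ha : Sm U a) (hb : Sm U b) (hp : (t, θ) ∈ U) (j : Fin n) :
    pt (cx a b j) t θ = cx (pt a) (pt b) j t θ :=
  ((pt_coord hU ha hp j).sub ((pt_coord hU hb hp j).const_mul Complex.I)).deriv

lemma pth_cx (hU : IsOpen U) (ha : Sm U a) (hb : Sm U b) (hp : (t, θ) ∈ U) (j : Fin n) :
    pth (cx a b j) t θ = cx (pth a) (pth b) j t θ :=
  ((pth_coord hU ha hp j).sub ((pth_coord hU hb hp j).const_mul Complex.I)).deriv

lemma dbar_cx (hU : IsOpen U) (ha : Sm U a) (hb : Sm U b) (hp : (t, θ) ∈ U) (j : Fin n) :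
    dbar (cx a b j) t θ = (((pt a t θ + pth b t θ) j : ℝ) : ℂ)
      + Complex.I * (((pth a t θ - pt b t θ) j : ℝ) : ℂ) := by
  rw [dbar, pt_cx hU ha hb hp, pth_cx hU ha hb hp]
  simp only [cx, PiLp.add_apply, PiLp.sub_apply, Complex.ofReal_add, Complex.ofReal_sub]
  linear_combination (-(pth b t θ j : ℂ)) * Complex.I_mul_I

lemma sum_norm_sq_cx : ∑ j, ‖cx a b j t θ‖ ^ 2 = ‖a t θ‖ ^ 2 + ‖b t θ‖ ^ 2 := by
  rw [EuclideanSpace.norm_sq_eq, EuclideanSpace.norm_sq_eq, ← Finset.sum_add_distrib]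
  refine Finset.sum_congr rfl fun j _ => ?_
  rw [← Complex.normSq_eq_norm_sq, cx, Complex.normSq_apply]
  simp [sq]

lemma norm_cx_le (j : Fin n) : ‖cx a b j t θ‖ ≤ ‖a t θ‖ + ‖b t θ‖ := by
  rw [cx]
  refine (norm_sub_le _ _).trans ?_
  simp only [norm_mul, Complex.norm_I, one_mul, Complex.norm_real, Real.norm_eq_abs]
  exact add_le_add (abs_apply_le _ j) (abs_apply_le _ j)

end Cx

section System

variable {f : ℝ → ℝ → EuclideanSpace ℝ (Fin n)} {u : ℝ → ℝ → ℝ} {U : Set (ℝ × ℝ)} {t θ : ℝ}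

lemma Adens_eq (f : ℝ → ℝ → EuclideanSpace ℝ (Fin n)) (u : ℝ → ℝ → ℝ) (t θ : ℝ) :
    Adens f u t θ = Real.exp (-(2 * u t θ)) *
      (‖Att f u t θ‖ ^ 2 + 2 * ‖Atth f u t θ‖ ^ 2 + ‖Athth f u t θ‖ ^ 2) := by
  have : Real.exp (-(2 * u t θ)) = Real.exp (-(4 * u t θ)) * Real.exp (2 * u t θ) := by
    rw [← Real.exp_add]; ring_nf
  rw [Adens, Asq, this]; ring

lemma Adens_nonneg (f : ℝ → ℝ → EuclideanSpace ℝ (Fin n)) (u : ℝ → ℝ → ℝ) (t θ : ℝ) :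
    0 ≤ Adens f u t θ := by rw [Adens_eq]; positivity

lemma aa_nonneg (f : ℝ → ℝ → EuclideanSpace ℝ (Fin n)) (u : ℝ → ℝ → ℝ) (t θ : ℝ) :
    0 ≤ aa f u t θ := Real.sqrt_nonneg _

lemma aa_sq (f : ℝ → ℝ → EuclideanSpace ℝ (Fin n)) (u : ℝ → ℝ → ℝ) (t θ : ℝ) :
    aa f u t θ ^ 2 = Adens f u t θ := Real.sq_sqrt (Adens_nonneg f u t θ)

lemma yy_nonneg (f : ℝ → ℝ → EuclideanSpace ℝ (Fin n)) (u : ℝ → ℝ → ℝ) (t θ : ℝ) :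
    0 ≤ yy f u t θ := by unfold yy; positivity

lemma sum_A_sq (f : ℝ → ℝ → EuclideanSpace ℝ (Fin n)) (u : ℝ → ℝ → ℝ) (t θ : ℝ) :
    ‖Att f u t θ‖ ^ 2 + 2 * ‖Atth f u t θ‖ ^ 2 + ‖Athth f u t θ‖ ^ 2 =
      (Real.exp (u t θ) * aa f u t θ) ^ 2 := by
  rw [mul_pow, aa_sq, Adens_eq, ← mul_assoc, ← Real.exp_nat_mul, ← Real.exp_add]
  simp

lemma norm_A_le (f : ℝ → ℝ → EuclideanSpace ℝ (Fin n)) (u : ℝ → ℝ → ℝ) (t θ : ℝ) :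
    ‖Att f u t θ‖ ≤ Real.exp (u t θ) * aa f u t θ ∧
    ‖Atth f u t θ‖ ≤ Real.exp (u t θ) * aa f u t θ ∧
    ‖Athth f u t θ‖ ≤ Real.exp (u t θ) * aa f u t θ := by
  have h := sum_A_sq f u t θ
  have h0 : 0 ≤ Real.exp (u t θ) * aa f u t θ := mul_nonneg (Real.exp_pos _).le (aa_nonneg _ _ _ _)
  refine ⟨?_, ?_, ?_⟩ <;> refine abs_le_of_sq_le_sq' ?_ h0 |>.2 <;>
    nlinarith [sq_nonneg ‖Att f u t θ‖, sq_nonneg ‖Atth f u t θ‖, sq_nonneg ‖Athth f u t θ‖]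

lemma aa_sq_eq (f : ℝ → ℝ → EuclideanSpace ℝ (Fin n)) (u : ℝ → ℝ → ℝ) (t θ : ℝ) :
    aa f u t θ ^ 2 = 1 / 2 * ‖vh f u t θ‖ ^ 2 + 2 * ‖vp f u t θ‖ ^ 2 + 2 * ‖vq f u t θ‖ ^ 2 := by
  have e1 : vh f u t θ = Real.exp (-u t θ) • (Att f u t θ + Athth f u t θ) := by
    rw [vh, Hmc_eq, smul_smul, ← Real.exp_add]; ring_nf
  have e2 : Real.exp (-(2 * u t θ)) = Real.exp (-u t θ) ^ 2 := by
    rw [← Real.exp_nat_mul]; ring_nf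
  rw [e1, vp, vq, aa_sq, Adens_eq, e2]
  simp only [norm_smul, mul_pow, Real.norm_eq_abs, sq_abs]
  have := parallelogram_law_with_norm ℝ (Att f u t θ) (Athth f u t θ)
  linear_combination (- (1 / 2) * Real.exp (-u t θ) ^ 2) * this

lemma norm_vh_le (f : ℝ → ℝ → EuclideanSpace ℝ (Fin n)) (u : ℝ → ℝ → ℝ) (t θ : ℝ) :
    ‖vh f u t θ‖ ≤ 2 * aa f u t θ := by
  have h := aa_sq_eq f u t θ
  refine (abs_le_of_sq_le_sq' ?_ (by linarith [aa_nonneg f u t θ])).2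
  nlinarith [sq_nonneg ‖vp f u t θ‖, sq_nonneg ‖vq f u t θ‖]

lemma norm_vp_le (f : ℝ → ℝ → EuclideanSpace ℝ (Fin n)) (u : ℝ → ℝ → ℝ) (t θ : ℝ) :
    ‖vp f u t θ‖ ≤ aa f u t θ := by
  have h := aa_sq_eq f u t θ
  refine (abs_le_of_sq_le_sq' ?_ (aa_nonneg f u t θ)).2
  nlinarith [sq_nonneg ‖vp f u t θ‖, sq_nonneg ‖vq f u t θ‖, sq_nonneg ‖vh f u t θ‖]

lemma norm_vq_le (f : ℝ → ℝ → EuclideanSpace ℝ (Fin n)) (u : ℝ → ℝ → ℝ) (t θ : ℝ) :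
    ‖vq f u t θ‖ ≤ aa f u t θ := by
  have h := aa_sq_eq f u t θ
  refine (abs_le_of_sq_le_sq' ?_ (aa_nonneg f u t θ)).2
  nlinarith [sq_nonneg ‖vp f u t θ‖, sq_nonneg ‖vq f u t θ‖, sq_nonneg ‖vh f u t θ‖]

lemma norm_Hmc (f : ℝ → ℝ → EuclideanSpace ℝ (Fin n)) (u : ℝ → ℝ → ℝ) (t θ : ℝ) :
    Real.exp (u t θ) * ‖Hmc f u t θ‖ ≤ 2 * aa f u t θ := by
  have := norm_vh_le f u t θ
  rwa [vh, norm_smul, Real.norm_eq_abs, Real.abs_exp] at this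

lemma norm_cubic_le {V : Type*} [NormedAddCommGroup V] [InnerProductSpace ℝ V]
    {e ei a : ℝ} {H H1 H2 A B D f1 f2 : V} (he : 0 < e) (hei : 0 < ei) (ha : 0 ≤ a)
    (hEi : ei * e ^ 2 = 1) (nf1 : ‖f1‖ = e) (nf2 : ‖f2‖ = e)
    (n1 : ‖A‖ ≤ e * a) (n2 : ‖B‖ ≤ e * a) (n3 : ‖D‖ ≤ e * a) (nH : e * ‖H‖ ≤ 2 * a)
    (sq' : ‖A‖ ^ 2 + 2 * ‖B‖ ^ 2 + ‖D‖ ^ 2 = (e * a) ^ 2) :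
    e * ‖(-(2 * ei)) • (⟪H, A⟫_ℝ • A + (2 * ⟪H, B⟫_ℝ) • B + ⟪H, D⟫_ℝ • D
        + (⟪H1, A⟫_ℝ + ⟪H2, B⟫_ℝ) • f1 + (⟪H1, B⟫_ℝ + ⟪H2, D⟫_ℝ) • f2)
      - ⟪H, H1⟫_ℝ • f1 - ⟪H, H2⟫_ℝ • f2 + (1 / 2 * (e ^ 2 * ‖H‖ ^ 2)) • H‖ ≤
      8 * a * (e * (‖H1‖ + ‖H2‖) + a ^ 2) := by
  have i1 := abs_real_inner_le_norm H A
  have i2 := abs_real_inner_le_norm H B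
  have i3 := abs_real_inner_le_norm H D
  have i4 := abs_real_inner_le_norm H1 A
  have i5 := abs_real_inner_le_norm H2 B
  have i6 := abs_real_inner_le_norm H1 B
  have i7 := abs_real_inner_le_norm H2 D
  have i8 := abs_real_inner_le_norm H H1
  have i9 := abs_real_inner_le_norm H H2
  have v1 : ‖⟪H, A⟫_ℝ • A + (2 * ⟪H, B⟫_ℝ) • B + ⟪H, D⟫_ℝ • D‖ ≤ ‖H‖ * (e * a) ^ 2 := by
    refine (norm_add₃_le).trans ?_
    simp only [norm_smul, Real.norm_eq_abs, abs_mul, abs_two]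
    rw [← sq']
    linarith [mul_le_mul_of_nonneg_right i1 (norm_nonneg A),
      mul_le_mul_of_nonneg_right i2 (norm_nonneg B), mul_le_mul_of_nonneg_right i3 (norm_nonneg D)]
  have v4 : ‖(⟪H1, A⟫_ℝ + ⟪H2, B⟫_ℝ) • f1‖ ≤ (‖H1‖ + ‖H2‖) * (e * a) * e := by
    rw [norm_smul, nf1, Real.norm_eq_abs]
    refine mul_le_mul_of_nonneg_right ((abs_add_le _ _).trans ?_) he.le
    linarith [mul_le_mul_of_nonneg_left n1 (norm_nonneg H1),
      mul_le_mul_of_nonneg_left n2 (norm_nonneg H2)]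
  have v5 : ‖(⟪H1, B⟫_ℝ + ⟪H2, D⟫_ℝ) • f2‖ ≤ (‖H1‖ + ‖H2‖) * (e * a) * e := by
    rw [norm_smul, nf2, Real.norm_eq_abs]
    refine mul_le_mul_of_nonneg_right ((abs_add_le _ _).trans ?_) he.le
    linarith [mul_le_mul_of_nonneg_left n2 (norm_nonneg H1),
      mul_le_mul_of_nonneg_left n3 (norm_nonneg H2)]
  have w1 : ‖⟪H, H1⟫_ℝ • f1‖ ≤ ‖H‖ * ‖H1‖ * e := by
    rw [norm_smul, nf1, Real.norm_eq_abs]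
    exact mul_le_mul_of_nonneg_right i8 he.le
  have w2 : ‖⟪H, H2⟫_ℝ • f2‖ ≤ ‖H‖ * ‖H2‖ * e := by
    rw [norm_smul, nf2, Real.norm_eq_abs]
    exact mul_le_mul_of_nonneg_right i9 he.le
  have w3 : ‖(1 / 2 * (e ^ 2 * ‖H‖ ^ 2)) • H‖ = 1 / 2 * (e ^ 2 * ‖H‖ ^ 2) * ‖H‖ := by
    rw [norm_smul, Real.norm_eq_abs, abs_of_nonneg (by positivity)]
  have tot : ‖(-(2 * ei)) • (⟪H, A⟫_ℝ • A + (2 * ⟪H, B⟫_ℝ) • B + ⟪H, D⟫_ℝ • D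
        + (⟪H1, A⟫_ℝ + ⟪H2, B⟫_ℝ) • f1 + (⟪H1, B⟫_ℝ + ⟪H2, D⟫_ℝ) • f2)
      - ⟪H, H1⟫_ℝ • f1 - ⟪H, H2⟫_ℝ • f2 + (1 / 2 * (e ^ 2 * ‖H‖ ^ 2)) • H‖ ≤
      2 * ei * (‖H‖ * (e * a) ^ 2 + 2 * ((‖H1‖ + ‖H2‖) * (e * a) * e))
        + ‖H‖ * ‖H1‖ * e + ‖H‖ * ‖H2‖ * e + 1 / 2 * (e ^ 2 * ‖H‖ ^ 2) * ‖H‖ := by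
    refine (norm_add_le _ _).trans (add_le_add ?_ w3.le)
    refine (norm_sub_le _ _).trans (add_le_add ?_ w2)
    refine (norm_sub_le _ _).trans (add_le_add ?_ w1)
    rw [norm_smul, norm_neg, Real.norm_eq_abs, abs_of_pos (by positivity)]
    refine mul_le_mul_of_nonneg_left ?_ (by positivity)
    refine norm_add₃_le.trans ?_
    linarith
  refine (mul_le_mul_of_nonneg_left tot he.le).trans ?_
  have hHn := norm_nonneg H
  have h1n := norm_nonneg H1
  have h2n := norm_nonneg H2
  have k1 : e * (2 * ei * (‖H‖ * (e * a) ^ 2 + 2 * ((‖H1‖ + ‖H2‖) * (e * a) * e))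
        + ‖H‖ * ‖H1‖ * e + ‖H‖ * ‖H2‖ * e + 1 / 2 * (e ^ 2 * ‖H‖ ^ 2) * ‖H‖)
      = 2 * (e * ‖H‖) * a ^ 2 + 4 * a * (e * (‖H1‖ + ‖H2‖))
        + (e * ‖H‖) * (e * (‖H1‖ + ‖H2‖)) + 1 / 2 * (e * ‖H‖) ^ 3 := by
    linear_combination (2 * e * ‖H‖ * a ^ 2 + 4 * a * (e * (‖H1‖ + ‖H2‖))) * hEi
  rw [k1]
  have k2 : (e * ‖H‖) ^ 3 ≤ (2 * a) ^ 3 := pow_le_pow_left₀ (by positivity) nH 3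
  have k3 := mul_le_mul_of_nonneg_right nH (sq_nonneg a)
  have hY : 0 ≤ e * (‖H1‖ + ‖H2‖) := by positivity
  have k4 := mul_le_mul_of_nonneg_right nH hY
  linarith [mul_nonneg ha hY]

namespace DiskConfWillmore

lemma abs_laplace_u_le (hf : DiskConfWillmore f u U) (hU : IsOpen U) (hp : (t, θ) ∈ U) :
    |pt (pt u) t θ + pth (pth u) t θ| ≤ aa f u t θ ^ 2 / 2 := by
  have h := hf.gauss hU hp
  have h2 := sum_A_sq f u t θ
  have h3 := abs_real_inner_le_norm (Att f u t θ) (Athth f u t θ)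
  have hE : Real.exp (2 * u t θ) = Real.exp (u t θ) ^ 2 := by rw [← Real.exp_nat_mul]; norm_num
  have hpos : 0 < Real.exp (u t θ) ^ 2 := by positivity
  have key : Real.exp (u t θ) ^ 2 * |pt (pt u) t θ + pth (pth u) t θ| ≤
      Real.exp (u t θ) ^ 2 * (aa f u t θ ^ 2 / 2) := by
    rw [hE] at h
    rw [← abs_of_pos hpos, ← abs_mul, h, abs_of_pos hpos]
    refine (abs_sub _ _).trans ?_
    rw [abs_of_nonneg (sq_nonneg _)]
    nlinarith [sq_nonneg (‖Att f u t θ‖ - ‖Athth f u t θ‖)]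
  exact le_of_mul_le_mul_left key hpos

lemma norm_pt_f (hf : DiskConfWillmore f u U) (hp : (t, θ) ∈ U) :
    ‖pt f t θ‖ = Real.exp (u t θ) := by
  have := hf.conf_x (t, θ) hp
  rw [two_mul, Real.exp_add, ← sq] at this
  exact (pow_left_inj₀ (norm_nonneg _) (Real.exp_pos _).le two_ne_zero).1 this

lemma norm_pth_f (hf : DiskConfWillmore f u U) (hp : (t, θ) ∈ U) :
    ‖pth f t θ‖ = Real.exp (u t θ) := by
  have := hf.conf_y (t, θ) hp
  rw [two_mul, Real.exp_add, ← sq] at this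
  exact (pow_left_inj₀ (norm_nonneg _) (Real.exp_pos _).le two_ne_zero).1 this

lemma norm_laplace_H_le (hf : DiskConfWillmore f u U) (hU : IsOpen U) (hp : (t, θ) ∈ U) :
    Real.exp (u t θ) * ‖pt (pt (Hmc f u)) t θ + pth (pth (Hmc f u)) t θ‖ ≤
      8 * aa f u t θ * (yy f u t θ + aa f u t θ ^ 2) := by
  rw [hf.laplace_H hU hp]
  obtain ⟨n1, n2, n3⟩ := norm_A_le f u t θ
  have nH := norm_Hmc f u t θ
  have sq' := sum_A_sq f u t θ
  have nf1 := hf.norm_pt_f hp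
  have nf2 := hf.norm_pth_f hp
  have ha := aa_nonneg f u t θ
  have hy : yy f u t θ = Real.exp (u t θ) * (‖pt (Hmc f u) t θ‖ + ‖pth (Hmc f u) t θ‖) := by
    simp only [yy, vy1, vy2, norm_smul, Real.norm_eq_abs, Real.abs_exp]; ring
  have hE : Real.exp (2 * u t θ) = Real.exp (u t θ) ^ 2 := by rw [← Real.exp_nat_mul]; norm_num
  have hEi : Real.exp (-(2 * u t θ)) * Real.exp (u t θ) ^ 2 = 1 := by
    rw [← hE, ← Real.exp_add]; simp
  have he := Real.exp_pos (u t θ)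
  have hei := Real.exp_pos (-(2 * u t θ))
  rw [hy, hE]
  exact norm_cubic_le he hei ha hEi nf1 nf2 n1 n2 n3 nH sq'

lemma sm_vh (hf : DiskConfWillmore f u U) (hU : IsOpen U) : Sm U (vh f u) :=
  hf.sm_u.exp.smul (hf.sm_Hmc hU)

lemma sm_vy1 (hf : DiskConfWillmore f u U) (hU : IsOpen U) : Sm U (vy1 f u) :=
  hf.sm_u.exp.smul ((hf.sm_Hmc hU).pt hU)

lemma sm_vy2 (hf : DiskConfWillmore f u U) (hU : IsOpen U) : Sm U (vy2 f u) :=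
  hf.sm_u.exp.smul ((hf.sm_Hmc hU).pth hU)

lemma sm_vp (hf : DiskConfWillmore f u U) (hU : IsOpen U) : Sm U (vp f u) :=
  hf.sm_u.neg.exp.smul ((sm_const (1 / 2 : ℝ)).smul ((hf.sm_Att hU).sub (hf.sm_Athth hU)))

lemma sm_vq (hf : DiskConfWillmore f u U) (hU : IsOpen U) : Sm U (vq f u) :=
  hf.sm_u.neg.exp.smul (hf.sm_Atth hU)

lemma sm_gc (hf : DiskConfWillmore f u U) (hU : IsOpen U) : Sm U (gc u) :=
  (sm_ofReal (hf.sm_u.pt hU)).sub (contDiffOn_const.mul (sm_ofReal (hf.sm_u.pth hU)))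

lemma pt_vh (hf : DiskConfWillmore f u U) (hU : IsOpen U) (hp : (t, θ) ∈ U) :
    pt (vh f u) t θ = vy1 f u t θ + pt u t θ • vh f u t θ := by
  unfold vh
  rw [pt_smul hU hf.sm_u.exp (hf.sm_Hmc hU) hp, pt_exp hU hf.sm_u hp, vy1]; module

lemma pth_vh (hf : DiskConfWillmore f u U) (hU : IsOpen U) (hp : (t, θ) ∈ U) :
    pth (vh f u) t θ = vy2 f u t θ + pth u t θ • vh f u t θ := by
  unfold vh
  rw [pth_smul hU hf.sm_u.exp (hf.sm_Hmc hU) hp, pth_exp hU hf.sm_u hp, vy2]; module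

lemma div_vy (hf : DiskConfWillmore f u U) (hU : IsOpen U) (hp : (t, θ) ∈ U) :
    pt (vy1 f u) t θ + pth (vy2 f u) t θ = pt u t θ • vy1 f u t θ + pth u t θ • vy2 f u t θ
      + Real.exp (u t θ) • (pt (pt (Hmc f u)) t θ + pth (pth (Hmc f u)) t θ) ∧
    pth (vy1 f u) t θ - pt (vy2 f u) t θ = pth u t θ • vy1 f u t θ - pt u t θ • vy2 f u t θ := by
  have e := hf.sm_u.exp
  have h1 := (hf.sm_Hmc hU).pt hU
  have h2 := (hf.sm_Hmc hU).pth hU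
  unfold vy1 vy2
  rw [pt_smul hU e h1 hp, pt_smul hU e h2 hp, pth_smul hU e h1 hp, pth_smul hU e h2 hp,
    pt_exp hU hf.sm_u hp, pth_exp hU hf.sm_u hp, pt_pth_comm (hf.sm_Hmc hU) hU hp]
  constructor <;> module

lemma div_vpq (hf : DiskConfWillmore f u U) (hU : IsOpen U) (hp : (t, θ) ∈ U) :
    pt (vp f u) t θ + pth (vq f u) t θ = (1 / 2 : ℝ) • vy1 f u t θ
      - pt u t θ • vp f u t θ - pth u t θ • vq f u t θ
      - (Real.exp (-u t θ) * (pt (pt u) t θ + pth (pth u) t θ)) • pt f t θ ∧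
    pth (vp f u) t θ - pt (vq f u) t θ = -(1 / 2 : ℝ) • vy2 f u t θ
      - pth u t θ • vp f u t θ + pt u t θ • vq f u t θ
      + (Real.exp (-u t θ) * (pt (pt u) t θ + pth (pth u) t θ)) • pth f t θ := by
  have e := hf.sm_u.neg.exp
  have s11 := hf.sm_Att hU
  have s12 := hf.sm_Atth hU
  have s22 := hf.sm_Athth hU
  have sP := (sm_const (1 / 2 : ℝ) (U := U)).smul (s11.sub s22)
  have d1 : pt (fun a b => -u a b) t θ = - pt u t θ := (hf.sm_u.hasDerivAt_pt hU hp).neg.deriv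
  have d2 : pth (fun a b => -u a b) t θ = - pth u t θ := (hf.sm_u.hasDerivAt_pth hU hp).neg.deriv
  obtain ⟨c1, c2⟩ := hf.codazzi hU hp
  rw [← exp_smul_Hmc] at c1 c2
  have t1 := hf.pt_trace hU hp
  have t2 := hf.pth_trace hU hp
  have hE : Real.exp (u t θ) = Real.exp (-u t θ) * Real.exp (2 * u t θ) := by
    rw [← Real.exp_add]; ring_nf
  unfold vp vq vy1 vy2
  rw [pt_smul hU e sP hp, pth_smul hU e sP hp, pt_smul hU e s12 hp, pth_smul hU e s12 hp,
    pt_const_smul _ hU (s11.sub s22) hp, pth_const_smul _ hU (s11.sub s22) hp,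
    pt_sub hU s11 s22 hp, pth_sub hU s11 s22 hp, pt_exp hU hf.sm_u.neg hp,
    pth_exp hU hf.sm_u.neg hp, d1, d2, hE]
  constructor
  · linear_combination (norm := module) (1 / 2 * Real.exp (-u t θ)) • t1
      - (Real.exp (-u t θ)) • c2
  · linear_combination (norm := module) -(1 / 2 * Real.exp (-u t θ)) • t2
      + (Real.exp (-u t θ)) • c1

/-- The first order system for `e^u H`. -/
lemma dbar_h (hf : DiskConfWillmore f u U) (hU : IsOpen U) (hp : (t, θ) ∈ U) (j : Fin n) :
    dbar (cx (vh f u) (fun _ _ => 0) j) t θ =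
      (starRingEnd ℂ) (gc u t θ) * cx (vh f u) (fun _ _ => 0) j t θ
        + (starRingEnd ℂ) (cx (vy1 f u) (vy2 f u) j t θ) := by
  have z1 : pt (fun _ _ => (0 : EuclideanSpace ℝ (Fin n))) t θ = 0 := by simp [pt]
  have z2 : pth (fun _ _ => (0 : EuclideanSpace ℝ (Fin n))) t θ = 0 := by simp [pth]
  rw [dbar_cx hU (hf.sm_vh hU) (sm_const 0) hp, z1, z2, hf.pt_vh hU hp, hf.pth_vh hU hp]
  simp only [cx, gc, map_sub, map_mul, Complex.conj_I, Complex.conj_ofReal, PiLp.add_apply,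
    PiLp.sub_apply, PiLp.smul_apply, PiLp.zero_apply, smul_eq_mul]
  push_cast
  ring

/-- The first order equation for `e^u ∇H`. -/
lemma dbar_y (hf : DiskConfWillmore f u U) (hU : IsOpen U) (hp : (t, θ) ∈ U) (j : Fin n) :
    ‖dbar (cx (vy1 f u) (vy2 f u) j) t θ
      - (starRingEnd ℂ) (gc u t θ) * cx (vy1 f u) (vy2 f u) j t θ‖
      ≤ 8 * aa f u t θ * (yy f u t θ + aa f u t θ ^ 2) := by
  refine le_trans ?_ (hf.norm_laplace_H_le hU hp)
  have key : dbar (cx (vy1 f u) (vy2 f u) j) t θ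
      - (starRingEnd ℂ) (gc u t θ) * cx (vy1 f u) (vy2 f u) j t θ =
      (((Real.exp (u t θ) • (pt (pt (Hmc f u)) t θ + pth (pth (Hmc f u)) t θ)) j : ℝ) : ℂ) := by
    rw [dbar_cx hU (hf.sm_vy1 hU) (hf.sm_vy2 hU) hp, (hf.div_vy hU hp).1, (hf.div_vy hU hp).2]
    simp only [cx, gc, map_sub, map_mul, Complex.conj_I, Complex.conj_ofReal, PiLp.add_apply,
      PiLp.sub_apply, PiLp.smul_apply, smul_eq_mul]
    push_cast
    linear_combination ((pth u t θ : ℝ) : ℂ) * (vy2 f u t θ j : ℂ) * Complex.I_mul_I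
  rw [key, Complex.norm_real, Real.norm_eq_abs]
  refine (abs_apply_le _ j).trans ?_
  rw [norm_smul, Real.norm_eq_abs, Real.abs_exp]

/-- The first order equation for the trace-free second fundamental form. -/
lemma dbar_om (hf : DiskConfWillmore f u U) (hU : IsOpen U) (hp : (t, θ) ∈ U) (j : Fin n) :
    ‖dbar (cx (vp f u) (vq f u) j) t θ
      - (-(starRingEnd ℂ) (gc u t θ) * cx (vp f u) (vq f u) j t θ
        + 1 / 2 * cx (vy1 f u) (vy2 f u) j t θ)‖
      ≤ aa f u t θ ^ 2 := by
  set L := pt (pt u) t θ + pth (pth u) t θ with hL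
  have key : dbar (cx (vp f u) (vq f u) j) t θ
      - (-(starRingEnd ℂ) (gc u t θ) * cx (vp f u) (vq f u) j t θ
        + 1 / 2 * cx (vy1 f u) (vy2 f u) j t θ) =
      (((-(Real.exp (-u t θ) * L) • pt f t θ) j : ℝ) : ℂ)
        + Complex.I * ((((Real.exp (-u t θ) * L) • pth f t θ) j : ℝ) : ℂ) := by
    rw [dbar_cx hU (hf.sm_vp hU) (hf.sm_vq hU) hp, (hf.div_vpq hU hp).1, (hf.div_vpq hU hp).2,
      ← hL]
    simp only [cx, gc, map_sub, map_mul, Complex.conj_I, Complex.conj_ofReal, PiLp.add_apply,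
      PiLp.sub_apply, PiLp.smul_apply, PiLp.neg_apply, neg_smul, smul_eq_mul]
    push_cast
    linear_combination (-((pth u t θ : ℝ) : ℂ) * (vq f u t θ j : ℂ)) * Complex.I_mul_I
  rw [key]
  refine (norm_mk_le _ _ j).trans ?_
  rw [norm_smul, norm_smul, hf.norm_pt_f hp, hf.norm_pth_f hp, norm_neg, norm_mul,
    Real.norm_eq_abs, Real.norm_eq_abs, Real.abs_exp]
  have h1 : Real.exp (-u t θ) * |L| * Real.exp (u t θ) = |L| := by
    rw [mul_right_comm, ← Real.exp_add]; simp
  rw [h1]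
  linarith [hf.abs_laplace_u_le hU hp]

/-- The conformal factor satisfies a Poisson equation. -/
lemma dbar_gc (hf : DiskConfWillmore f u U) (hU : IsOpen U) (hp : (t, θ) ∈ U) :
    dbar (gc u) t θ = ((pt (pt u) t θ + pth (pth u) t θ : ℝ) : ℂ) := by
  have a1 : pt (gc u) t θ = ((pt (pt u) t θ : ℝ) : ℂ) - Complex.I * ((pt (pth u) t θ : ℝ) : ℂ) :=
    (((hf.sm_u.pt hU).hasDerivAt_pt hU hp).ofReal_comp.sub
      ((((hf.sm_u.pth hU).hasDerivAt_pt hU hp).ofReal_comp).const_mul Complex.I)).deriv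
  have a2 : pth (gc u) t θ
      = ((pth (pt u) t θ : ℝ) : ℂ) - Complex.I * ((pth (pth u) t θ : ℝ) : ℂ) :=
    (((hf.sm_u.pt hU).hasDerivAt_pth hU hp).ofReal_comp.sub
      ((((hf.sm_u.pth hU).hasDerivAt_pth hU hp).ofReal_comp).const_mul Complex.I)).deriv
  rw [dbar, a1, a2, pt_pth_comm hf.sm_u hU hp]
  push_cast
  linear_combination (-((pth (pth u) t θ : ℝ) : ℂ)) * Complex.I_mul_I

end DiskConfWillmore

end System

/-- The half plane `t > 0`, the universal cover of the half-infinite cylinder. -/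
def halfPlane : Set (ℝ × ℝ) := {p : ℝ × ℝ | 0 < p.1}

lemma isOpen_halfPlane : IsOpen halfPlane := isOpen_lt continuous_const continuous_fst

lemma isOpen_puncturedDisk : IsOpen puncturedDisk :=
  IsOpen.inter (s := {p : ℝ × ℝ | 0 < p.1 ^ 2 + p.2 ^ 2}) (t := {p : ℝ × ℝ | p.1 ^ 2 + p.2 ^ 2 < 1})
    (isOpen_lt continuous_const (by fun_prop)) (isOpen_lt (by fun_prop) continuous_const)

/-- The flux whose divergence is the Willmore operator, first component. -/
def flux1 (f : ℝ → ℝ → EuclideanSpace ℝ (Fin n)) (u : ℝ → ℝ → ℝ) (a b : ℝ) :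
    EuclideanSpace ℝ (Fin n) :=
  (2 : ℝ) • pt (Hmc f u) a b + (4 : ℝ) • (Real.exp (-(2 * u a b)) •
        (⟪Hmc f u a b, Att f u a b⟫_ℝ • pt f a b + ⟪Hmc f u a b, Atth f u a b⟫_ℝ • pth f a b))
    - ‖Hmc f u a b‖ ^ 2 • pt f a b

/-- The flux whose divergence is the Willmore operator, second component. -/
def flux2 (f : ℝ → ℝ → EuclideanSpace ℝ (Fin n)) (u : ℝ → ℝ → ℝ) (a b : ℝ) :
    EuclideanSpace ℝ (Fin n) :=
  (2 : ℝ) • pth (Hmc f u) a b + (4 : ℝ) • (Real.exp (-(2 * u a b)) •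
        (⟪Hmc f u a b, Atth f u a b⟫_ℝ • pt f a b + ⟪Hmc f u a b, Athth f u a b⟫_ℝ • pth f a b))
    - ‖Hmc f u a b‖ ^ 2 • pth f a b

section Flux

variable {f : ℝ → ℝ → EuclideanSpace ℝ (Fin n)} {u : ℝ → ℝ → ℝ} {U : Set (ℝ × ℝ)} {t θ : ℝ}

lemma Sm.Hmc (hf : Sm U f) (hu : Sm U u) (hU : IsOpen U) : Sm U (Hmc f u) :=
  (sm_exp_neg_two hu).smul (((hf.pt hU).pt hU).add ((hf.pth hU).pth hU))

lemma Sm.Att (hf : Sm U f) (hu : Sm U u) (hU : IsOpen U) : Sm U (Att f u) :=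
  (((hf.pt hU).pt hU).sub ((hu.pt hU).smul (hf.pt hU))).add
    ((hu.pth hU).smul (hf.pth hU))

lemma Sm.Atth (hf : Sm U f) (hu : Sm U u) (hU : IsOpen U) : Sm U (Atth f u) :=
  (((hf.pth hU).pt hU).sub ((hu.pth hU).smul (hf.pt hU))).sub
    ((hu.pt hU).smul (hf.pth hU))

lemma Sm.Athth (hf : Sm U f) (hu : Sm U u) (hU : IsOpen U) : Sm U (Athth f u) :=
  (((hf.pth hU).pth hU).add ((hu.pt hU).smul (hf.pt hU))).sub
    ((hu.pth hU).smul (hf.pth hU))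

lemma sm_flux1 (hf : Sm U f) (hu : Sm U u) (hU : IsOpen U) : Sm U (flux1 f u) := by
  have H := hf.Hmc hu hU
  exact (((sm_const (2 : ℝ)).smul (H.pt hU)).add ((sm_const (4 : ℝ)).smul
    ((sm_exp_neg_two hu).smul (((H.inner (hf.Att hu hU)).smul (hf.pt hU)).add
      ((H.inner (hf.Atth hu hU)).smul (hf.pth hU)))))).sub (H.norm_sq.smul (hf.pt hU))

lemma sm_flux2 (hf : Sm U f) (hu : Sm U u) (hU : IsOpen U) : Sm U (flux2 f u) := by
  have H := hf.Hmc hu hU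
  exact (((sm_const (2 : ℝ)).smul (H.pth hU)).add ((sm_const (4 : ℝ)).smul
    ((sm_exp_neg_two hu).smul (((H.inner (hf.Atth hu hU)).smul (hf.pt hU)).add
      ((H.inner (hf.Athth hu hU)).smul (hf.pth hU)))))).sub (H.norm_sq.smul (hf.pth hU))

lemma willmoreOp_eq_div (hf : Sm U f) (hu : Sm U u) (hU : IsOpen U) (hp : (t, θ) ∈ U) :
    willmoreOp f u t θ = pt (flux1 f u) t θ + pth (flux2 f u) t θ := by
  have H := hf.Hmc hu hU
  have w1 := (sm_exp_neg_two hu).smul (((H.inner (hf.Att hu hU)).smul (hf.pt hU)).add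
      ((H.inner (hf.Atth hu hU)).smul (hf.pth hU)))
  have w2 := (sm_exp_neg_two hu).smul (((H.inner (hf.Atth hu hU)).smul (hf.pt hU)).add
      ((H.inner (hf.Athth hu hU)).smul (hf.pth hU)))
  have e1 : pt (flux1 f u) t θ = _ :=
    pt_sub hU (((sm_const (2 : ℝ)).smul (H.pt hU)).add ((sm_const (4 : ℝ)).smul w1))
      (H.norm_sq.smul (hf.pt hU)) hp
  have e2 : pth (flux2 f u) t θ = _ :=
    pth_sub hU (((sm_const (2 : ℝ)).smul (H.pth hU)).add ((sm_const (4 : ℝ)).smul w2))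
      (H.norm_sq.smul (hf.pth hU)) hp
  rw [e1, e2, pt_add hU ((sm_const (2 : ℝ)).smul (H.pt hU)) ((sm_const (4 : ℝ)).smul w1) hp,
    pth_add hU ((sm_const (2 : ℝ)).smul (H.pth hU)) ((sm_const (4 : ℝ)).smul w2) hp,
    pt_const_smul _ hU (H.pt hU) hp, pth_const_smul _ hU (H.pth hU) hp,
    pt_const_smul _ hU w1 hp, pth_const_smul _ hU w2 hp, willmoreOp]
  module

end Flux

section Pull

variable {F : Type*} [NormedAddCommGroup F] [NormedSpace ℝ F]

/-- First Cartesian coordinate in terms of the cylindrical coordinates. -/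
def cX (t θ : ℝ) : ℝ := Real.exp (-t) * Real.cos θ

/-- Second Cartesian coordinate in terms of the cylindrical coordinates. -/
def cY (t θ : ℝ) : ℝ := Real.exp (-t) * Real.sin θ

/-- Pull-back to the cylinder of a function on the disk. -/
def pull (φ : ℝ → ℝ → F) (t θ : ℝ) : F := φ (cX t θ) (cY t θ)

variable {φ : ℝ → ℝ → F} {t θ : ℝ}

lemma cX_sq_add_cY_sq (t θ : ℝ) : cX t θ ^ 2 + cY t θ ^ 2 = Real.exp (-(2 * t)) := by
  have : Real.exp (-(2 * t)) = Real.exp (-t) ^ 2 := by rw [← Real.exp_nat_mul]; ring_nf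
  rw [this, cX, cY]
  linear_combination Real.exp (-t) ^ 2 * Real.cos_sq_add_sin_sq θ

lemma mem_puncturedDisk (hp : 0 < t) : (cX t θ, cY t θ) ∈ puncturedDisk := by
  simp only [puncturedDisk, Set.mem_ofPred_eq, cX_sq_add_cY_sq]
  exact ⟨Real.exp_pos _, by rw [Real.exp_lt_one_iff]; linarith⟩

lemma contDiff_cXY : ContDiff ℝ (⊤ : ℕ∞) (fun p : ℝ × ℝ => (cX p.1 p.2, cY p.1 p.2)) := by
  unfold cX cY
  fun_prop

lemma sm_pull (hφ : Sm puncturedDisk φ) : Sm halfPlane (pull φ) :=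
  ContDiffOn.comp (g := fun p : ℝ × ℝ => φ p.1 p.2) hφ contDiff_cXY.contDiffOn
    fun _ hp => mem_puncturedDisk hp

lemma hasDerivAt_cX_fst (t θ : ℝ) : HasDerivAt (fun s => cX s θ) (-cX t θ) t := by
  have := ((hasDerivAt_id t).neg.exp).mul_const (Real.cos θ)
  simpa [cX] using this

lemma hasDerivAt_cY_fst (t θ : ℝ) : HasDerivAt (fun s => cY s θ) (-cY t θ) t := by
  have := ((hasDerivAt_id t).neg.exp).mul_const (Real.sin θ)
  simpa [cY] using this

lemma hasDerivAt_cX_snd (t θ : ℝ) : HasDerivAt (fun s => cX t s) (-cY t θ) θ := by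
  have := (Real.hasDerivAt_cos θ).const_mul (Real.exp (-t))
  simpa [cX, cY] using this

lemma hasDerivAt_cY_snd (t θ : ℝ) : HasDerivAt (fun s => cY t s) (cX t θ) θ :=
  (Real.hasDerivAt_sin θ).const_mul (Real.exp (-t))

lemma pt_pull (hφ : Sm puncturedDisk φ) (hp : 0 < t) :
    pt (pull φ) t θ = -(cX t θ • pull (pt φ) t θ + cY t θ • pull (pth φ) t θ) := by
  have h := (hφ.hasFDerivAt isOpen_puncturedDisk (mem_puncturedDisk (θ := θ) hp)).comp_hasDerivAt
    (f := fun s => (cX s θ, cY s θ)) t ((hasDerivAt_cX_fst t θ).prodMk (hasDerivAt_cY_fst t θ))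
  rw [hφ.fderiv_apply isOpen_puncturedDisk (mem_puncturedDisk hp)] at h
  refine h.deriv.trans ?_
  simp only [pull]
  module

lemma pth_pull (hφ : Sm puncturedDisk φ) (hp : 0 < t) :
    pth (pull φ) t θ = -(cY t θ • pull (pt φ) t θ) + cX t θ • pull (pth φ) t θ := by
  have h := (hφ.hasFDerivAt isOpen_puncturedDisk (mem_puncturedDisk (θ := θ) hp)).comp_hasDerivAt
    (f := fun s => (cX t s, cY t s)) θ ((hasDerivAt_cX_snd t θ).prodMk (hasDerivAt_cY_snd t θ))
  rw [hφ.fderiv_apply isOpen_puncturedDisk (mem_puncturedDisk hp)] at h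
  refine h.deriv.trans ?_
  simp only [pull]
  module

/-- First component of the pull-back of a covector field to the cylinder. -/
def pull1 (φ ψ : ℝ → ℝ → F) (t θ : ℝ) : F :=
  -(cX t θ • pull φ t θ + cY t θ • pull ψ t θ)

/-- Second component of the pull-back of a covector field to the cylinder. -/
def pull2 (φ ψ : ℝ → ℝ → F) (t θ : ℝ) : F :=
  -(cY t θ • pull φ t θ) + cX t θ • pull ψ t θ

lemma pull_derivs {ψ : ℝ → ℝ → F} (hφ : Sm puncturedDisk φ) (hψ : Sm puncturedDisk ψ)
    (hp : 0 < t) :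
    pt (pull1 φ ψ) t θ = cX t θ • pull φ t θ + cY t θ • pull ψ t θ
      + (cX t θ ^ 2) • pull (pt φ) t θ + (cX t θ * cY t θ) • pull (pth φ) t θ
      + (cX t θ * cY t θ) • pull (pt ψ) t θ + (cY t θ ^ 2) • pull (pth ψ) t θ ∧
    pt (pull2 φ ψ) t θ = cY t θ • pull φ t θ - cX t θ • pull ψ t θ
      + (cX t θ * cY t θ) • pull (pt φ) t θ + (cY t θ ^ 2) • pull (pth φ) t θ
      - (cX t θ ^ 2) • pull (pt ψ) t θ - (cX t θ * cY t θ) • pull (pth ψ) t θ ∧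
    pth (pull2 φ ψ) t θ = -(cX t θ • pull φ t θ) - cY t θ • pull ψ t θ
      + (cY t θ ^ 2) • pull (pt φ) t θ - (cX t θ * cY t θ) • pull (pth φ) t θ
      - (cX t θ * cY t θ) • pull (pt ψ) t θ + (cX t θ ^ 2) • pull (pth ψ) t θ := by
  have hU := isOpen_halfPlane
  have p1 := (sm_pull hφ).hasDerivAt_pt hU (show (t, θ) ∈ halfPlane from hp)
  have p2 := (sm_pull hψ).hasDerivAt_pt hU (show (t, θ) ∈ halfPlane from hp)
  have q1 := (sm_pull hφ).hasDerivAt_pth hU (show (t, θ) ∈ halfPlane from hp)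
  have q2 := (sm_pull hψ).hasDerivAt_pth hU (show (t, θ) ∈ halfPlane from hp)
  rw [pt_pull hφ hp] at p1
  rw [pt_pull hψ hp] at p2
  rw [pth_pull hφ hp] at q1
  rw [pth_pull hψ hp] at q2
  refine ⟨?_, ?_, ?_⟩
  · refine (((hasDerivAt_cX_fst t θ).smul p1).add
      ((hasDerivAt_cY_fst t θ).smul p2)).neg.deriv.trans ?_
    module
  · refine (((hasDerivAt_cY_fst t θ).smul p1).neg.add
      ((hasDerivAt_cX_fst t θ).smul p2)).deriv.trans ?_
    module
  · refine (((hasDerivAt_cY_snd t θ).smul q1).neg.add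
      ((hasDerivAt_cX_snd t θ).smul q2)).deriv.trans ?_
    module

end Pull

section Transfer

variable {f : ℝ → ℝ → EuclideanSpace ℝ (Fin n)} {w : ℝ → ℝ → ℝ} {t θ : ℝ}

lemma cylOf_eq_pull (f : ℝ → ℝ → EuclideanSpace ℝ (Fin n)) : cylOf f = pull f := rfl

lemma cylFactor_eq (w : ℝ → ℝ → ℝ) : cylFactor w = fun t θ => pull w t θ - t := rfl

lemma sm_cylFactor (hw : Sm puncturedDisk w) : Sm halfPlane (cylFactor w) :=
  (sm_pull hw).sub contDiff_fst.contDiffOn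

lemma pt_cylFactor (hw : Sm puncturedDisk w) (hp : 0 < t) :
    pt (cylFactor w) t θ = pull1 (pt w) (pth w) t θ - 1 := by
  have h := (sm_pull hw).hasDerivAt_pt isOpen_halfPlane (show (t, θ) ∈ halfPlane from hp)
  rw [pt_pull hw hp] at h
  exact (h.sub (hasDerivAt_id t)).deriv

lemma pth_cylFactor (hw : Sm puncturedDisk w) (hp : 0 < t) :
    pth (cylFactor w) t θ = pull2 (pt w) (pth w) t θ := by
  have h := (sm_pull hw).hasDerivAt_pth isOpen_halfPlane (show (t, θ) ∈ halfPlane from hp)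
  rw [pth_pull hw hp] at h
  exact (h.sub_const t).deriv

lemma second_derivs_cylOf (hf : Sm puncturedDisk f) (hp : 0 < t) :
    pt (pt (cylOf f)) t θ = pt (pull1 (pt f) (pth f)) t θ ∧
    pt (pth (cylOf f)) t θ = pt (pull2 (pt f) (pth f)) t θ ∧
    pth (pth (cylOf f)) t θ = pth (pull2 (pt f) (pth f)) t θ := by
  have hp' : (t, θ) ∈ halfPlane := hp
  exact ⟨pt_congr isOpen_halfPlane (fun p hp => pt_pull hf hp) hp',
    pt_congr isOpen_halfPlane (fun p hp => pth_pull hf hp) hp',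
    pth_congr isOpen_halfPlane (fun p hp => pth_pull hf hp) hp'⟩

lemma A_cylOf (hf : Sm puncturedDisk f) (hw : Sm puncturedDisk w) (hp : 0 < t) :
    Att (cylOf f) (cylFactor w) t θ = (cX t θ ^ 2) • pull (Att f w) t θ
      + (2 * cX t θ * cY t θ) • pull (Atth f w) t θ + (cY t θ ^ 2) • pull (Athth f w) t θ ∧
    Atth (cylOf f) (cylFactor w) t θ = (cX t θ * cY t θ) • pull (Att f w) t θ
      + (cY t θ ^ 2 - cX t θ ^ 2) • pull (Atth f w) t θ
      - (cX t θ * cY t θ) • pull (Athth f w) t θ ∧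
    Athth (cylOf f) (cylFactor w) t θ = (cY t θ ^ 2) • pull (Att f w) t θ
      - (2 * cX t θ * cY t θ) • pull (Atth f w) t θ + (cX t θ ^ 2) • pull (Athth f w) t θ := by
  have hD := isOpen_puncturedDisk
  obtain ⟨a1, a2, a3⟩ := second_derivs_cylOf (θ := θ) hf hp
  obtain ⟨d1, d2, d3⟩ := pull_derivs (θ := θ) (hf.pt hD) (hf.pth hD) hp
  have hc : pull (pth (pt f)) t θ = pull (pt (pth f)) t θ :=
    pt_pth_comm hf hD (mem_puncturedDisk hp)
  have u1 := pt_cylFactor (θ := θ) hw hp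
  have u2 := pth_cylFactor (θ := θ) hw hp
  have f1 : pt (cylOf f) t θ = pull1 (pt f) (pth f) t θ := pt_pull hf hp
  have f2 : pth (cylOf f) t θ = pull2 (pt f) (pth f) t θ := pth_pull hf hp
  have e1 : pull (Att f w) t θ = pull (pt (pt f)) t θ - pull (pt w) t θ • pull (pt f) t θ
    + pull (pth w) t θ • pull (pth f) t θ := rfl
  have e2 : pull (Atth f w) t θ = pull (pt (pth f)) t θ - pull (pth w) t θ • pull (pt f) t θ
    - pull (pt w) t θ • pull (pth f) t θ := rfl
  have e3 : pull (Athth f w) t θ = pull (pth (pth f)) t θ + pull (pt w) t θ • pull (pt f) t θ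
    - pull (pth w) t θ • pull (pth f) t θ := rfl
  rw [e1, e2, e3, Att, Atth, Athth, a1, a2, a3, d1, d2, d3, u1, u2, f1, f2, hc]
  simp only [pull1, pull2, smul_eq_mul]
  refine ⟨?_, ?_, ?_⟩ <;> module

lemma exp_cylFactor (w : ℝ → ℝ → ℝ) (t θ : ℝ) : Real.exp (2 * cylFactor w t θ) =
    Real.exp (-(2 * t)) * pull (fun a b => Real.exp (2 * w a b)) t θ := by
  simp only [cylFactor_eq, pull, ← Real.exp_add]; ring_nf

lemma exp_neg_cylFactor (w : ℝ → ℝ → ℝ) (t θ : ℝ) :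
    Real.exp (-(2 * cylFactor w t θ)) * (cX t θ ^ 2 + cY t θ ^ 2) =
      pull (fun a b => Real.exp (-(2 * w a b))) t θ := by
  simp only [cylFactor_eq, pull, cX_sq_add_cY_sq, ← Real.exp_add]; ring_nf

lemma Hmc_cylOf (hf : Sm puncturedDisk f) (hw : Sm puncturedDisk w) (hp : 0 < t) :
    Hmc (cylOf f) (cylFactor w) t θ = pull (Hmc f w) t θ := by
  obtain ⟨a1, a2, a3⟩ := A_cylOf (θ := θ) hf hw hp
  have h : pull (Hmc f w) t θ = pull (fun a b => Real.exp (-(2 * w a b))) t θ •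
      (pull (Att f w) t θ + pull (Athth f w) t θ) := Hmc_eq f w _ _
  rw [Hmc_eq, a1, a3, h, ← exp_neg_cylFactor]
  module

lemma rotate_flux {E : Type*} [NormedAddCommGroup E] [InnerProductSpace ℝ E] (x y k : ℝ)
    (H H₁ H₂ A₁ A₂ A₃ f₁ f₂ : E) :
    (2 : ℝ) • -(x • H₁ + y • H₂) + (4 : ℝ) • (k •
        (⟪H, x ^ 2 • A₁ + (2 * x * y) • A₂ + y ^ 2 • A₃⟫_ℝ • -(x • f₁ + y • f₂)
        + ⟪H, (x * y) • A₁ + (y ^ 2 - x ^ 2) • A₂ - (x * y) • A₃⟫_ℝ • (-(y • f₁) + x • f₂)))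
      - ‖H‖ ^ 2 • -(x • f₁ + y • f₂)
    = -(x • ((2 : ℝ) • H₁ + (4 : ℝ) • ((k * (x ^ 2 + y ^ 2)) • (⟪H, A₁⟫_ℝ • f₁ + ⟪H, A₂⟫_ℝ • f₂))
        - ‖H‖ ^ 2 • f₁)
      + y • ((2 : ℝ) • H₂ + (4 : ℝ) • ((k * (x ^ 2 + y ^ 2)) • (⟪H, A₂⟫_ℝ • f₁ + ⟪H, A₃⟫_ℝ • f₂))
        - ‖H‖ ^ 2 • f₂)) ∧
    (2 : ℝ) • (-(y • H₁) + x • H₂) + (4 : ℝ) • (k •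
        (⟪H, (x * y) • A₁ + (y ^ 2 - x ^ 2) • A₂ - (x * y) • A₃⟫_ℝ • -(x • f₁ + y • f₂)
        + ⟪H, y ^ 2 • A₁ - (2 * x * y) • A₂ + x ^ 2 • A₃⟫_ℝ • (-(y • f₁) + x • f₂)))
      - ‖H‖ ^ 2 • (-(y • f₁) + x • f₂)
    = -(y • ((2 : ℝ) • H₁ + (4 : ℝ) • ((k * (x ^ 2 + y ^ 2)) • (⟪H, A₁⟫_ℝ • f₁ + ⟪H, A₂⟫_ℝ • f₂))
        - ‖H‖ ^ 2 • f₁))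
      + x • ((2 : ℝ) • H₂ + (4 : ℝ) • ((k * (x ^ 2 + y ^ 2)) • (⟪H, A₂⟫_ℝ • f₁ + ⟪H, A₃⟫_ℝ • f₂))
        - ‖H‖ ^ 2 • f₂) := by
  simp only [inner_add_right, inner_sub_right, real_inner_smul_right]
  generalize ⟪H, A₁⟫_ℝ = p
  generalize ⟪H, A₂⟫_ℝ = q
  generalize ⟪H, A₃⟫_ℝ = r
  generalize ‖H‖ ^ 2 = h
  constructor <;> module

lemma flux_cylOf (hf : Sm puncturedDisk f) (hw : Sm puncturedDisk w) (hp : 0 < t) :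
    flux1 (cylOf f) (cylFactor w) t θ = pull1 (flux1 f w) (flux2 f w) t θ ∧
    flux2 (cylOf f) (cylFactor w) t θ = pull2 (flux1 f w) (flux2 f w) t θ := by
  have hD := isOpen_puncturedDisk
  have hp' : (t, θ) ∈ halfPlane := hp
  obtain ⟨a1, a2, a3⟩ := A_cylOf (θ := θ) hf hw hp
  have hH := hf.Hmc hw hD
  have H0 := Hmc_cylOf (θ := θ) hf hw hp
  have H1 : pt (Hmc (cylOf f) (cylFactor w)) t θ =
      -(cX t θ • pull (pt (Hmc f w)) t θ + cY t θ • pull (pth (Hmc f w)) t θ) :=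
    (pt_congr isOpen_halfPlane (fun p hp => Hmc_cylOf hf hw hp) hp').trans (pt_pull hH hp)
  have H2 : pth (Hmc (cylOf f) (cylFactor w)) t θ =
      -(cY t θ • pull (pt (Hmc f w)) t θ) + cX t θ • pull (pth (Hmc f w)) t θ :=
    (pth_congr isOpen_halfPlane (fun p hp => Hmc_cylOf hf hw hp) hp').trans (pth_pull hH hp)
  have f1 : pt (cylOf f) t θ = -(cX t θ • pull (pt f) t θ + cY t θ • pull (pth f) t θ) :=
    pt_pull hf hp
  have f2 : pth (cylOf f) t θ = -(cY t θ • pull (pt f) t θ) + cX t θ • pull (pth f) t θ :=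
    pth_pull hf hp
  have k := exp_neg_cylFactor w t θ
  obtain ⟨r1, r2⟩ := rotate_flux (cX t θ) (cY t θ) (Real.exp (-(2 * cylFactor w t θ)))
    (pull (Hmc f w) t θ) (pull (pt (Hmc f w)) t θ) (pull (pth (Hmc f w)) t θ)
    (pull (Att f w) t θ) (pull (Atth f w) t θ) (pull (Athth f w) t θ) (pull (pt f) t θ)
    (pull (pth f) t θ)
  rw [k] at r1 r2
  constructor
  · rw [flux1, H0, H1, a1, a2, f1, f2, r1]
    simp only [pull1, pull, flux1, flux2]
  · rw [flux2, H0, H2, a2, a3, f1, f2, r2]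
    simp only [pull2, pull, flux1, flux2]

lemma DiskConfWillmore.conformal_cylOf (hf : DiskConfWillmore f w puncturedDisk) (hp : 0 < t) :
    ‖pt (cylOf f) t θ‖ ^ 2 = Real.exp (2 * cylFactor w t θ) ∧
    ‖pth (cylOf f) t θ‖ ^ 2 = Real.exp (2 * cylFactor w t θ) ∧
    ⟪pt (cylOf f) t θ, pth (cylOf f) t θ⟫_ℝ = 0 := by
  have hm := mem_puncturedDisk (θ := θ) hp
  have e : Real.exp (2 * cylFactor w t θ) =
      (cX t θ ^ 2 + cY t θ ^ 2) * Real.exp (2 * w (cX t θ) (cY t θ)) := by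
    rw [exp_cylFactor, cX_sq_add_cY_sq]; rfl
  have k1 : ‖pull (pt f) t θ‖ ^ 2 = Real.exp (2 * w (cX t θ) (cY t θ)) := hf.conf_x (cX t θ, cY t θ) hm
  have k2 : ‖pull (pth f) t θ‖ ^ 2 = Real.exp (2 * w (cX t θ) (cY t θ)) := hf.conf_y (cX t θ, cY t θ) hm
  have k3 : ⟪pull (pt f) t θ, pull (pth f) t θ⟫_ℝ = 0 := hf.conf_orth (cX t θ, cY t θ) hm
  have k4 : ⟪pull (pth f) t θ, pull (pt f) t θ⟫_ℝ = 0 := by rw [real_inner_comm, k3]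
  rw [e, cylOf_eq_pull, pt_pull hf.smooth_f hp, pth_pull hf.smooth_f hp]
  generalize pull (pt f) t θ = v₁ at *
  generalize pull (pth f) t θ = v₂ at *
  simp only [← real_inner_self_eq_norm_sq, inner_neg_left, inner_neg_right,
    inner_add_left, inner_add_right, real_inner_smul_left, real_inner_smul_right] at *
  simp only [k1, k2, k3, k4]
  refine ⟨by ring, by ring, by ring⟩

lemma DiskConfWillmore.willmore_cylOf (hf : DiskConfWillmore f w puncturedDisk) (hp : 0 < t) :
    willmoreOp (cylOf f) (cylFactor w) t θ = 0 := by
  have sf : Sm puncturedDisk f := hf.smooth_f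
  have sw : Sm puncturedDisk w := hf.smooth_w
  have hD := isOpen_puncturedDisk
  have hp' : (t, θ) ∈ halfPlane := hp
  have h := hf.willmore (cX t θ, cY t θ) (mem_puncturedDisk (θ := θ) hp)
  rw [willmoreOp_eq_div sf sw hD (mem_puncturedDisk hp)] at h
  have h' : pull (pt (flux1 f w)) t θ + pull (pth (flux2 f w)) t θ = 0 := h
  obtain ⟨d1, d2, d3⟩ := pull_derivs (θ := θ) (sm_flux1 sf sw hD) (sm_flux2 sf sw hD) hp
  rw [willmoreOp_eq_div (show Sm halfPlane (cylOf f) from sm_pull sf) (sm_cylFactor sw)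
    isOpen_halfPlane hp',
    pt_congr isOpen_halfPlane (fun p hp => (flux_cylOf sf sw hp).1) hp',
    pth_congr isOpen_halfPlane (fun p hp => (flux_cylOf sf sw hp).2) hp', d1, d3]
  linear_combination (norm := module) (cX t θ ^ 2 + cY t θ ^ 2) • h'

theorem DiskConfWillmore.transfer (hf : DiskConfWillmore f w puncturedDisk) :
    DiskConfWillmore (cylOf f) (cylFactor w) halfPlane where
  smooth_f := sm_pull hf.smooth_f
  smooth_w := sm_cylFactor hf.smooth_w
  conf_x _ hp := (hf.conformal_cylOf hp).1
  conf_y _ hp := (hf.conformal_cylOf hp).2.1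
  conf_orth _ hp := (hf.conformal_cylOf hp).2.2
  willmore _ hp := hf.willmore_cylOf hp

lemma Adens_cylOf (hf : Sm puncturedDisk f) (hw : Sm puncturedDisk w) (hp : 0 < t) :
    Adens (cylOf f) (cylFactor w) t θ = Real.exp (-(2 * t)) * pull (Adens f w) t θ := by
  obtain ⟨a1, a2, a3⟩ := A_cylOf (θ := θ) hf hw hp
  have h : pull (Adens f w) t θ = pull (fun a b => Real.exp (-(2 * w a b))) t θ *
      (‖pull (Att f w) t θ‖ ^ 2 + 2 * ‖pull (Atth f w) t θ‖ ^ 2 + ‖pull (Athth f w) t θ‖ ^ 2) :=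
    Adens_eq f w _ _
  rw [Adens_eq, h, ← exp_neg_cylFactor, ← cX_sq_add_cY_sq t θ, a1, a2, a3]
  simp only [← real_inner_self_eq_norm_sq, inner_add_left, inner_add_right, inner_sub_left,
    inner_sub_right, real_inner_smul_left, real_inner_smul_right,
    real_inner_comm (pull (Att f w) t θ) (pull (Atth f w) t θ),
    real_inner_comm (pull (Att f w) t θ) (pull (Athth f w) t θ),
    real_inner_comm (pull (Atth f w) t θ) (pull (Athth f w) t θ)]
  ring

end Transfer

section ChangeOfVariables

lemma cXY_eq_polarCoord_symm (p : ℝ × ℝ) :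
    (cX p.1 p.2, cY p.1 p.2) = polarCoord.symm (Real.exp (-p.1), p.2) := rfl

lemma integrableOn_cyl {g : ℝ × ℝ → ℝ} (hg : IntegrableOn g puncturedDisk) :
    IntegrableOn (fun p : ℝ × ℝ => Real.exp (-(2 * p.1)) * g (cX p.1 p.2, cY p.1 p.2))
      (Ioi 0 ×ˢ Ioo (-π) π) := by
  have hd : ∀ p ∈ Ioi (0 : ℝ) ×ˢ Ioo (-π) π, HasFDerivWithinAt
      (fun p : ℝ × ℝ => (cX p.1 p.2, cY p.1 p.2))
      ((fderivPolarCoordSymm (Real.exp (-p.1), p.2)).comp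
        (((-Real.exp (-p.1)) • ContinuousLinearMap.id ℝ ℝ).prodMap (ContinuousLinearMap.id ℝ ℝ)))
      (Ioi (0 : ℝ) ×ˢ Ioo (-π) π) p := by
    intro p _
    refine HasFDerivAt.hasFDerivWithinAt ?_
    have h1 : HasFDerivAt (fun s : ℝ => Real.exp (-s))
        ((-Real.exp (-p.1)) • ContinuousLinearMap.id ℝ ℝ) p.1 := by
      have := ((hasDerivAt_id p.1).neg.exp).hasFDerivAt
      refine this.congr_fderiv ?_
      ext
      simp
    have h2 := HasFDerivAt.prodMap (p := p) h1 (hasFDerivAt_id p.2)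
    exact (hasFDerivAt_polarCoord_symm (Real.exp (-p.1), p.2)).comp p h2
  have hinj : InjOn (fun p : ℝ × ℝ => (cX p.1 p.2, cY p.1 p.2)) (Ioi (0 : ℝ) ×ˢ Ioo (-π) π) := by
    intro p hp p' hp' h
    simp only [cXY_eq_polarCoord_symm] at h
    have := polarCoord.symm.injOn (x₁ := (Real.exp (-p.1), p.2)) (x₂ := (Real.exp (-p'.1), p'.2))
      ⟨mem_Ioi.2 (Real.exp_pos _), hp.2⟩ ⟨mem_Ioi.2 (Real.exp_pos _), hp'.2⟩ h
    rw [Prod.mk.injEq, Real.exp_eq_exp, neg_inj] at this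
    exact Prod.ext this.1 this.2
  have him : (fun p : ℝ × ℝ => (cX p.1 p.2, cY p.1 p.2)) '' (Ioi (0 : ℝ) ×ˢ Ioo (-π) π)
      ⊆ puncturedDisk := by
    rintro _ ⟨p, hp, rfl⟩
    exact mem_puncturedDisk hp.1
  have h := (integrableOn_image_iff_integrableOn_abs_det_fderiv_smul volume
    (measurableSet_Ioi.prod measurableSet_Ioo) hd hinj g).1 (hg.mono_set him)
  refine h.congr_fun (fun p _ => ?_) (measurableSet_Ioi.prod measurableSet_Ioo)
  have hdet : ((fderivPolarCoordSymm (Real.exp (-p.1), p.2)).comp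
      (((-Real.exp (-p.1)) • ContinuousLinearMap.id ℝ ℝ).prodMap
        (ContinuousLinearMap.id ℝ ℝ))).det = -Real.exp (-(2 * p.1)) := by
    have h1 := det_fderivPolarCoordSymm (Real.exp (-p.1), p.2)
    rw [ContinuousLinearMap.det] at h1
    rw [ContinuousLinearMap.det, ContinuousLinearMap.toLinearMap_comp, LinearMap.det_comp, h1]
    have h2 : LinearMap.det ((((-Real.exp (-p.1)) • ContinuousLinearMap.id ℝ ℝ).prodMap
        (ContinuousLinearMap.id ℝ ℝ) : ℝ × ℝ →L[ℝ] ℝ × ℝ) : ℝ × ℝ →ₗ[ℝ] ℝ × ℝ)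
        = -Real.exp (-p.1) := by
      rw [ContinuousLinearMap.coe_prodMap, LinearMap.det_prodMap]
      simp
    rw [h2]
    have : Real.exp (-(2 * p.1)) = Real.exp (-p.1) * Real.exp (-p.1) := by
      rw [← Real.exp_add]; ring_nf
    rw [this]; ring
  simp only [hdet, abs_neg, abs_of_pos (Real.exp_pos _), smul_eq_mul]

end ChangeOfVariables

/-- Integral over a full circle of a function on the cylinder. -/
def circ {F : Type*} [NormedAddCommGroup F] [NormedSpace ℝ F] (φ : ℝ → ℝ → F) (t : ℝ) : F :=
  ∫ θ in (-π)..π, φ t θ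

/-- A conformal Willmore immersion of the half-infinite cylinder with finite energy and area. -/
structure FiniteCyl (f : ℝ → ℝ → EuclideanSpace ℝ (Fin n)) (u : ℝ → ℝ → ℝ) : Prop where
  conf : DiskConfWillmore f u halfPlane
  per_f : ∀ t θ, f t (θ + 2 * π) = f t θ
  per_u : ∀ t θ, u t (θ + 2 * π) = u t θ
  int_A : IntegrableOn (circ (Adens f u)) (Ioi 0)
  int_u : IntegrableOn (circ fun t θ => Real.exp (2 * u t θ)) (Ioi 0)

lemma integrableOn_circ {g : ℝ × ℝ → ℝ} {φ : ℝ → ℝ → ℝ} (hg : IntegrableOn g puncturedDisk)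
    (h : ∀ t θ, 0 < t → φ t θ = Real.exp (-(2 * t)) * g (cX t θ, cY t θ)) :
    IntegrableOn (circ φ) (Ioi 0) := by
  have h1 := integrableOn_cyl hg
  rw [IntegrableOn, Measure.volume_eq_prod, ← Measure.prod_restrict] at h1
  have h2 : IntegrableOn (fun t => ∫ θ in Ioo (-π) π,
      Real.exp (-(2 * t)) * g (cX t θ, cY t θ)) (Ioi 0) := h1.integral_prod_left
  refine h2.congr_fun (fun t ht => ?_) measurableSet_Ioi
  show (∫ θ in Ioo (-π) π, Real.exp (-(2 * t)) * g (cX t θ, cY t θ)) = circ φ t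
  rw [circ, intervalIntegral.integral_of_le (by linarith [pi_pos]), ← integral_Ioc_eq_integral_Ioo]
  exact integral_congr_ae (Eventually.of_forall fun θ => (h t θ ht).symm)

theorem DiskConfWillmore.finiteCyl {f : ℝ → ℝ → EuclideanSpace ℝ (Fin n)} {w : ℝ → ℝ → ℝ}
    (hf : DiskConfWillmore f w puncturedDisk)
    (hA : IntegrableOn (fun p : ℝ × ℝ => Asq f w p.1 p.2 * Real.exp (2 * w p.1 p.2)) puncturedDisk)
    (harea : IntegrableOn (fun p : ℝ × ℝ => Real.exp (2 * w p.1 p.2)) puncturedDisk) :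
    FiniteCyl (cylOf f) (cylFactor w) where
  conf := hf.transfer
  per_f t θ := by simp [cylOf]
  per_u t θ := by simp [cylFactor]
  int_A := integrableOn_circ hA fun t θ ht => Adens_cylOf hf.smooth_f hf.smooth_w ht
  int_u := integrableOn_circ harea fun t θ _ => exp_cylFactor w t θ

/-- The product of a set of parameters with the universal cover of the circle. -/
def strip (I : Set ℝ) : Set (ℝ × ℝ) := {p : ℝ × ℝ | p.1 ∈ I}

lemma isOpen_strip {I : Set ℝ} (hI : IsOpen I) : IsOpen (strip I) := hI.preimage continuous_fst

section Circle

variable {F : Type*} [NormedAddCommGroup F] [NormedSpace ℝ F] {φ ψ : ℝ → ℝ → F} {I : Set ℝ} {t : ℝ}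

lemma continuous_slice (hφ : Sm (strip I) φ) (ht : t ∈ I) : Continuous (φ t) := by
  have h : ContinuousOn (fun p : ℝ × ℝ => φ p.1 p.2) (strip I) := ContDiffOn.continuousOn hφ
  exact h.comp_continuous (f := fun θ : ℝ => (t, θ)) (by fun_prop) fun θ => ht

lemma hasDerivAt_circ (hφ : Sm (strip I) φ) (hI : IsOpen I) (ht : t ∈ I) :
    HasDerivAt (circ φ) (circ (pt φ) t) t := by
  obtain ⟨δ, hδ, hsub⟩ := Metric.isOpen_iff.1 hI t ht
  have hpt := hφ.pt (isOpen_strip hI)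
  have hc : ContinuousOn (fun p : ℝ × ℝ => pt φ p.1 p.2) (strip I) := ContDiffOn.continuousOn hpt
  have hK : IsCompact (Metric.closedBall t (δ / 2) ×ˢ uIcc (-π) π) :=
    (isCompact_closedBall t _).prod isCompact_uIcc
  have hKs : Metric.closedBall t (δ / 2) ⊆ I := fun s hs =>
    hsub (Metric.closedBall_subset_ball (by linarith) hs)
  obtain ⟨C, hC⟩ := hK.exists_bound_of_continuousOn
    (hc.mono fun p hp => show p.1 ∈ I from hKs hp.1)
  refine (intervalIntegral.hasDerivAt_integral_of_dominated_loc_of_deriv_le (F := φ) (F' := pt φ)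
    (bound := fun _ => C) (Metric.ball_mem_nhds t (half_pos hδ)) ?_ ?_ ?_ ?_ ?_ ?_).2
  · filter_upwards [hI.mem_nhds ht] with s hs
    exact (continuous_slice hφ hs).aestronglyMeasurable
  · exact (continuous_slice hφ ht).intervalIntegrable _ _
  · exact (continuous_slice hpt ht).aestronglyMeasurable
  · refine Eventually.of_forall fun θ hθ s hs => ?_
    exact hC (s, θ) ⟨Metric.ball_subset_closedBall hs, uIoc_subset_uIcc hθ⟩
  · exact intervalIntegrable_const
  · refine Eventually.of_forall fun θ _ s hs => ?_
    exact hφ.hasDerivAt_pt (isOpen_strip hI) (hKs (Metric.ball_subset_closedBall hs))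

lemma continuousOn_circ (hφ : Sm (strip I) φ) (hI : IsOpen I) : ContinuousOn (circ φ) I :=
  fun _ ht => (hasDerivAt_circ hφ hI ht).continuousAt.continuousWithinAt

lemma circ_congr (h : ∀ θ, φ t θ = ψ t θ) : circ φ t = circ ψ t := by
  simp only [circ, h]

lemma circ_pth [CompleteSpace F] (hφ : Sm (strip I) φ) (hI : IsOpen I) (ht : t ∈ I)
    (hper : ∀ θ, φ t (θ + 2 * π) = φ t θ) : circ (pth φ) t = 0 := by
  rw [circ, intervalIntegral.integral_eq_sub_of_hasDerivAt
    (fun θ _ => hφ.hasDerivAt_pth (isOpen_strip hI) ht)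
    ((continuous_slice (hφ.pth (isOpen_strip hI)) ht).intervalIntegrable _ _)]
  have := hper (-π)
  rw [show -π + 2 * π = π by ring] at this
  rw [this, sub_self]

lemma norm_circ_le : ‖circ φ t‖ ≤ circ (fun a b => ‖φ a b‖) t :=
  intervalIntegral.norm_integral_le_integral_norm (by linarith [pi_pos])

lemma norm_circ_le_of_le {C : ℝ} (h : ∀ θ, ‖φ t θ‖ ≤ C) : ‖circ φ t‖ ≤ 2 * π * C := by
  have := intervalIntegral.norm_integral_le_of_norm_le_const (a := -π) (b := π) (f := φ t)
    (fun θ _ => h θ)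
  rw [abs_of_pos (by linarith [pi_pos])] at this
  calc ‖circ φ t‖ ≤ C * (π - -π) := this
    _ = 2 * π * C := by ring

lemma circ_mono {a b : ℝ → ℝ → ℝ} (ha : Continuous (a t)) (hb : Continuous (b t))
    (h : ∀ θ, a t θ ≤ b t θ) : circ a t ≤ circ b t :=
  intervalIntegral.integral_mono_on (by linarith [pi_pos]) (ha.intervalIntegrable _ _)
    (hb.intervalIntegrable _ _) fun θ _ => h θ

lemma circ_nonneg {a : ℝ → ℝ → ℝ} (h : ∀ θ, 0 ≤ a t θ) : 0 ≤ circ a t :=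
  intervalIntegral.integral_nonneg (by linarith [pi_pos]) fun θ _ => h θ

lemma circ_const [CompleteSpace F] (x : F) : circ (fun _ _ => x) t = (2 * π) • x := by
  rw [circ, intervalIntegral.integral_const]; ring_nf

lemma circ_eq_integral (hper : ∀ θ, φ t (θ + 2 * π) = φ t θ) (θ₀ : ℝ) :
    circ φ t = ∫ θ in θ₀..(θ₀ + 2 * π), φ t θ := by
  have := Function.Periodic.intervalIntegral_add_eq (f := φ t) (T := 2 * π) hper (-π) θ₀
  rw [← this, circ]
  ring_nf

end Circle

section Fourier

/-- The `k`-th Fourier coefficient (times `2π`) on the circle with parameter `t`. -/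
def fc (k : ℤ) (φ : ℝ → ℝ → ℂ) (t : ℝ) : ℂ :=
  circ (fun a b => Complex.exp (-(k * b * Complex.I)) * φ a b) t

variable {φ ψ e : ℝ → ℝ → ℂ} {I : Set ℝ} {t : ℝ} (k : ℤ)

lemma sm_expI (U : Set (ℝ × ℝ)) : Sm U fun _ b => Complex.exp (-(k * b * Complex.I)) := by
  refine ContDiff.contDiffOn ?_
  have : ContDiff ℝ (⊤ : ℕ∞) (fun p : ℝ × ℝ => (p.2 : ℂ)) :=
    Complex.ofRealCLM.contDiff.comp contDiff_snd
  fun_prop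

lemma norm_expI (θ : ℝ) : ‖Complex.exp (-(k * θ * Complex.I))‖ = 1 := by
  rw [show -((k : ℂ) * θ * Complex.I) = ((-(k * θ) : ℝ) : ℂ) * Complex.I by push_cast; ring]
  exact Complex.norm_exp_ofReal_mul_I _

lemma expI_periodic (θ : ℝ) : Complex.exp (-(k * (θ + 2 * π : ℝ) * Complex.I)) =
    Complex.exp (-(k * θ * Complex.I)) := by
  rw [Complex.exp_eq_exp_iff_exists_int]
  exact ⟨-k, by push_cast; ring⟩

lemma Sm.mulC {U : Set (ℝ × ℝ)} (hφ : Sm U φ) (hψ : Sm U ψ) : Sm U (fun a b => φ a b * ψ a b) :=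
  ContDiffOn.mul hφ hψ

lemma fc_add (hφ : Continuous (φ t)) (hψ : Continuous (ψ t)) :
    fc k (fun a b => φ a b + ψ a b) t = fc k φ t + fc k ψ t := by
  have hc : Continuous fun b : ℝ => Complex.exp (-(k * b * Complex.I)) := by fun_prop
  simp only [fc, circ, mul_add]
  exact intervalIntegral.integral_add ((hc.mul hφ).intervalIntegrable _ _)
    ((hc.mul hψ).intervalIntegrable _ _)

lemma fc_mul_left (c : ℂ) : fc k (fun a b => c * φ a b) t = c * fc k φ t := by
  simp only [fc, circ]
  rw [← intervalIntegral.integral_const_mul]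
  congr 1; ext θ; ring

lemma fc_congr (h : ∀ θ, φ t θ = ψ t θ) : fc k φ t = fc k ψ t := by
  simp only [fc, circ, h]

lemma norm_fc_le : ‖fc k φ t‖ ≤ circ (fun a b => ‖φ a b‖) t := by
  refine (norm_circ_le).trans (le_of_eq ?_)
  simp only [norm_mul, norm_expI, one_mul]

lemma hasDerivAt_fc (hφ : Sm (strip I) φ) (hI : IsOpen I) (ht : t ∈ I) :
    HasDerivAt (fc k φ) (fc k (pt φ) t) t := by
  have h := hasDerivAt_circ ((sm_expI k (strip I)).mulC hφ) hI ht
  have e : circ (pt fun a b => Complex.exp (-(k * b * Complex.I)) * φ a b) t = fc k (pt φ) t :=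
    circ_congr fun θ => ((hφ.hasDerivAt_pt (isOpen_strip hI) (θ := θ) ht).const_mul _).deriv
  rw [e] at h
  exact h

lemma fc_pth (hφ : Sm (strip I) φ) (hI : IsOpen I) (ht : t ∈ I)
    (hper : ∀ θ, φ t (θ + 2 * π) = φ t θ) : fc k (pth φ) t = k * Complex.I * fc k φ t := by
  have hs := (sm_expI k (strip I)).mulC hφ
  have h := circ_pth hs hI ht (fun θ => by rw [expI_periodic, hper])
  have e : ∀ θ, pth (fun a b => Complex.exp (-(k * b * Complex.I)) * φ a b) t θ =
      (-(k * Complex.I)) * (Complex.exp (-(k * θ * Complex.I)) * φ t θ)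
        + Complex.exp (-(k * θ * Complex.I)) * pth φ t θ := by
    intro θ
    have h1 : HasDerivAt (fun b : ℝ => Complex.exp (-(k * b * Complex.I)))
        (Complex.exp (-(k * θ * Complex.I)) * (-(k * Complex.I))) θ := by
      have h2 : HasDerivAt (fun b : ℝ => -((k : ℂ) * b * Complex.I)) (-(k * Complex.I)) θ := by
        have := (((hasDerivAt_id θ).ofReal_comp.const_mul (k : ℂ)).mul_const Complex.I).neg
        rw [Complex.ofReal_one, mul_one] at this
        exact this
      exact h2.cexp
    refine (h1.mul (hφ.hasDerivAt_pth (isOpen_strip hI) ht)).deriv.trans ?_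
    ring
  have c1 : Continuous fun θ : ℝ => Complex.exp (-(k * θ * Complex.I)) * φ t θ :=
    continuous_slice hs ht
  have c2 : Continuous fun θ : ℝ => Complex.exp (-(k * θ * Complex.I)) * pth φ t θ :=
    continuous_slice ((sm_expI k (strip I)).mulC (hφ.pth (isOpen_strip hI))) ht
  simp only [circ, e] at h
  rw [intervalIntegral.integral_add ((c1.const_mul _).intervalIntegrable _ _)
    (c2.intervalIntegrable _ _), intervalIntegral.integral_const_mul] at h
  have h' : -(k * Complex.I) * fc k φ t + fc k (pth φ) t = 0 := h
  linear_combination h'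

lemma hasDerivAt_fc_of_dbar (hφ : Sm (strip I) φ) (hI : IsOpen I) (ht : t ∈ I)
    (hper : ∀ θ, φ t (θ + 2 * π) = φ t θ) (l : ℤ) (hd : ∀ θ, dbar φ t θ = l * φ t θ + e t θ) :
    HasDerivAt (fc k φ) ((k + l) * fc k φ t + fc k e t) t := by
  have hU := isOpen_strip hI
  have c0 := continuous_slice hφ ht
  have c1 := continuous_slice (hφ.pt hU) ht
  have c2 := continuous_slice (hφ.pth hU) ht
  have h := hasDerivAt_fc k hφ hI ht
  have he : fc k e t = fc k (pt φ) t + (Complex.I * fc k (pth φ) t + (-l) * fc k φ t) := by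
    rw [← fc_mul_left, ← fc_mul_left, ← fc_add k (c2.const_mul _) (c0.const_mul _),
      ← fc_add k c1 ((c2.const_mul _).add (c0.const_mul _))]
    refine fc_congr k fun θ => ?_
    have := hd θ
    rw [dbar] at this
    linear_combination -this
  rw [fc_pth k hφ hI ht hper] at he
  convert h using 1
  rw [he]
  linear_combination (k * fc k φ t) * Complex.I_sq

lemma hasSum_norm_sq_fc (hφ : Continuous (φ t)) :
    HasSum (fun k => ‖fc k φ t‖ ^ 2) (2 * π * circ (fun a b => ‖φ a b‖ ^ 2) t) := by
  have hab : -π < π := by linarith [pi_pos]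
  have hL : MemLp (φ t) 2 (volume.restrict (Ioc (-π) π)) := by
    refine MemLp.mono_measure (Measure.restrict_mono Ioc_subset_Icc_self le_rfl) ?_
    obtain ⟨C, hC⟩ := isCompact_Icc.exists_bound_of_continuousOn (s := Icc (-π) π) hφ.continuousOn
    have : IsFiniteMeasure (volume.restrict (Icc (-π) π)) := ⟨by simp⟩
    exact MemLp.of_bound hφ.aestronglyMeasurable C
      ((ae_restrict_iff' measurableSet_Icc).2 (Eventually.of_forall hC))
  have h := (hasSum_sq_fourierCoeffOn hab hL).mul_left ((2 * π) ^ 2)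
  have hp := pi_pos
  have e1 : (fun k => ‖fc k φ t‖ ^ 2) =
      fun k => (2 * π) ^ 2 * ‖fourierCoeffOn hab (φ t) k‖ ^ 2 := by
    funext k
    rw [fourierCoeffOn_eq_integral, norm_smul, mul_pow]
    have : fc k φ t = ∫ x in (-π)..π, fourier (-k) (x : AddCircle (π - -π)) • φ t x := by
      simp only [fc, circ]
      congr 1
      ext θ
      rw [fourier_coe_apply, smul_eq_mul]
      congr 2
      push_cast
      have : (π : ℂ) ≠ 0 := by exact_mod_cast hp.ne'
      field_simp
      ring
    rw [← this, norm_div, norm_one, Real.norm_of_nonneg (by linarith)]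
    field_simp
    ring
  have e2 : 2 * π * circ (fun a b => ‖φ a b‖ ^ 2) t =
      (2 * π) ^ 2 * (π - -π)⁻¹ • ∫ x in (-π)..π, ‖φ t x‖ ^ 2 := by
    rw [smul_eq_mul, circ]
    field_simp
    ring
  rw [e1, e2]
  exact h

end Fourier

/-- The open Euclidean disc in the plane. -/
def disc (p : ℝ × ℝ) (R : ℝ) : Set (ℝ × ℝ) :=
  {q : ℝ × ℝ | (q.1 - p.1) ^ 2 + (q.2 - p.2) ^ 2 < R ^ 2}

/-- A function on the plane in polar coordinates centred at `p`. -/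
def polar {F : Type*} (φ : ℝ → ℝ → F) (p : ℝ × ℝ) (r α : ℝ) : F :=
  φ (p.1 + r * Real.cos α) (p.2 + r * Real.sin α)

/-- The integral of a function over the disc of radius `ρ` centred at `p`. -/
def discInt (F : ℝ → ℝ → ℝ) (p : ℝ × ℝ) (ρ : ℝ) : ℝ := ∫ r in (0 : ℝ)..ρ, r * circ (polar F p) r

section Polar

variable {U : Set (ℝ × ℝ)} {p : ℝ × ℝ} {R r α : ℝ}

lemma polar_dist (p : ℝ × ℝ) (r α : ℝ) :
    (p.1 + r * Real.cos α - p.1) ^ 2 + (p.2 + r * Real.sin α - p.2) ^ 2 = r ^ 2 := by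
  linear_combination r ^ 2 * Real.cos_sq_add_sin_sq α

lemma polar_mem_disc (hr : r ∈ Ioo (-R) R) :
    (p.1 + r * Real.cos α, p.2 + r * Real.sin α) ∈ disc p R := by
  have : r ^ 2 < R ^ 2 := sq_lt_sq' hr.1 hr.2
  simpa only [disc, Set.mem_ofPred_eq, polar_dist] using this

lemma polar_mem_disc' (hr : 0 ≤ r) (hR : r < R) :
    (p.1 + r * Real.cos α, p.2 + r * Real.sin α) ∈ disc p R :=
  polar_mem_disc ⟨by linarith, hR⟩

lemma disc_mono {R' : ℝ} (h0 : 0 ≤ R) (h : R ≤ R') : disc p R ⊆ disc p R' := fun q hq => by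
  have : R ^ 2 ≤ R' ^ 2 := by gcongr
  exact lt_of_lt_of_le hq this

lemma continuous_polarMap (p : ℝ × ℝ) :
    ContDiff ℝ (⊤ : ℕ∞) (fun q : ℝ × ℝ => (p.1 + q.1 * Real.cos q.2, p.2 + q.1 * Real.sin q.2)) := by
  fun_prop

lemma polar_periodic {F : Type*} (φ : ℝ → ℝ → F) (p : ℝ × ℝ) (r α : ℝ) :
    polar φ p r (α + 2 * π) = polar φ p r α := by simp [polar]

section

variable {F : Type*} [NormedAddCommGroup F] [NormedSpace ℝ F] {φ : ℝ → ℝ → F}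

lemma sm_polar (hφ : Sm U φ) (hd : disc p R ⊆ U) : Sm (strip (Ioo (-R) R)) (polar φ p) :=
  ContDiffOn.comp (g := fun p : ℝ × ℝ => φ p.1 p.2) hφ (continuous_polarMap p).contDiffOn
    fun _ hq => hd (polar_mem_disc hq)

lemma continuousOn_polar (hφ : ContinuousOn (fun p : ℝ × ℝ => φ p.1 p.2) U) (hd : disc p R ⊆ U) :
    ContinuousOn (fun q : ℝ × ℝ => polar φ p q.1 q.2) (strip (Ioo (-R) R)) :=
  ContinuousOn.comp (g := fun p : ℝ × ℝ => φ p.1 p.2) hφ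
    (continuous_polarMap p).continuous.continuousOn fun _ hq => hd (polar_mem_disc hq)

lemma continuousOn_circ_of_continuousOn {I : Set ℝ} (hI : IsOpen I)
    (h : ContinuousOn (fun q : ℝ × ℝ => φ q.1 q.2) (strip I)) : ContinuousOn (circ φ) I := by
  intro t ht
  refine ContinuousAt.continuousWithinAt ?_
  obtain ⟨δ, hδ, hsub⟩ := Metric.isOpen_iff.1 hI t ht
  have hK : IsCompact (Metric.closedBall t (δ / 2) ×ˢ uIcc (-π) π) :=
    (isCompact_closedBall t _).prod isCompact_uIcc
  have hKs : Metric.closedBall t (δ / 2) ⊆ I := fun s hs =>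
    hsub (Metric.closedBall_subset_ball (by linarith) hs)
  obtain ⟨C, hC⟩ := hK.exists_bound_of_continuousOn
    (h.mono fun p hp => show p.1 ∈ I from hKs hp.1)
  refine intervalIntegral.continuousAt_of_dominated_interval (bound := fun _ => C) ?_ ?_ ?_ ?_
  · filter_upwards [hI.mem_nhds ht] with s hs
    exact (h.comp_continuous (f := fun θ : ℝ => (s, θ)) (by fun_prop)
      fun θ => hs).aestronglyMeasurable
  · filter_upwards [Metric.closedBall_mem_nhds t (half_pos hδ)] with s hs
    exact Eventually.of_forall fun θ hθ => hC (s, θ) ⟨hs, uIoc_subset_uIcc hθ⟩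
  · exact intervalIntegrable_const
  · refine Eventually.of_forall fun θ _ => ?_
    have := h.continuousAt ((isOpen_strip hI).mem_nhds (show (t, θ) ∈ strip I from ht))
    exact this.comp (f := fun s : ℝ => (s, θ)) (by fun_prop)

end

variable {ψ : ℝ → ℝ → ℂ}

lemma polar_dbar (hψ : Sm U ψ) (hU : IsOpen U) (hd : disc p R ⊆ U) (hr : r ∈ Ioo (-R) R) :
    r * (Complex.exp (-((1 : ℤ) * α * Complex.I)) * polar (dbar ψ) p r α) =
      r * pt (polar ψ p) r α + Complex.I * pth (polar ψ p) r α := by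
  have hm : (p.1 + r * Real.cos α, p.2 + r * Real.sin α) ∈ U := hd (polar_mem_disc hr)
  have hx : HasDerivAt (fun s : ℝ => p.1 + s * Real.cos α) (Real.cos α) r := by
    simpa using ((hasDerivAt_id r).mul_const (Real.cos α)).const_add p.1
  have hy : HasDerivAt (fun s : ℝ => p.2 + s * Real.sin α) (Real.sin α) r := by
    simpa using ((hasDerivAt_id r).mul_const (Real.sin α)).const_add p.2
  have hx' : HasDerivAt (fun s : ℝ => p.1 + r * Real.cos s) (r * -Real.sin α) α :=
    ((Real.hasDerivAt_cos α).const_mul r).const_add p.1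
  have hy' : HasDerivAt (fun s : ℝ => p.2 + r * Real.sin s) (r * Real.cos α) α :=
    ((Real.hasDerivAt_sin α).const_mul r).const_add p.2
  have h1 := (hψ.hasFDerivAt hU hm).comp_hasDerivAt
    (f := fun s => (p.1 + s * Real.cos α, p.2 + s * Real.sin α)) r (hx.prodMk hy)
  have h2 := (hψ.hasFDerivAt hU hm).comp_hasDerivAt
    (f := fun s => (p.1 + r * Real.cos s, p.2 + r * Real.sin s)) α (hx'.prodMk hy')
  rw [hψ.fderiv_apply hU hm] at h1 h2
  have e1 : pt (polar ψ p) r α = _ := h1.deriv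
  have e2 : pth (polar ψ p) r α = _ := h2.deriv
  have e3 : Complex.exp (-((1 : ℤ) * α * Complex.I)) = Real.cos α - Real.sin α * Complex.I := by
    rw [show -(((1 : ℤ) : ℂ) * α * Complex.I) = ((-α : ℝ) : ℂ) * Complex.I by push_cast; ring,
      Complex.exp_mul_I, ← Complex.ofReal_cos, ← Complex.ofReal_sin, Real.cos_neg, Real.sin_neg]
    push_cast; ring
  rw [e1, e2, e3]
  simp only [polar, dbar, Complex.real_smul, Complex.ofReal_mul, Complex.ofReal_neg]
  linear_combination (-r * (Real.sin α : ℂ) * pth ψ (p.1 + r * Real.cos α) (p.2 + r * Real.sin α)) *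
    Complex.I_sq

lemma hasDerivAt_circ_polar (hψ : Sm U ψ) (hU : IsOpen U) (hd : disc p R ⊆ U)
    (hr : r ∈ Ioo (-R) R) (hr0 : r ≠ 0) :
    HasDerivAt (circ (polar ψ p)) (fc 1 (polar (dbar ψ) p) r) r := by
  have hs := sm_polar hψ hd
  have h := hasDerivAt_circ hs isOpen_Ioo hr
  have h0 := circ_pth hs isOpen_Ioo hr (polar_periodic ψ p r)
  refine h.congr_deriv ?_
  have hc : (r : ℂ) ≠ 0 := by exact_mod_cast hr0
  have c1 := continuous_slice (hs.pt (isOpen_strip isOpen_Ioo)) hr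
  have c2 := continuous_slice (hs.pth (isOpen_strip isOpen_Ioo)) hr
  have key : (r : ℂ) * fc 1 (polar (dbar ψ) p) r = r * circ (pt (polar ψ p)) r
      + Complex.I * circ (pth (polar ψ p)) r := by
    simp only [fc, circ]
    rw [← intervalIntegral.integral_const_mul, ← intervalIntegral.integral_const_mul,
      ← intervalIntegral.integral_const_mul, ← intervalIntegral.integral_add
      ((c1.const_mul _).intervalIntegrable _ _) ((c2.const_mul _).intervalIntegrable _ _)]
    congr 1
    ext α
    exact polar_dbar hψ hU hd hr
  rw [h0, mul_zero, add_zero] at key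
  exact (mul_left_cancel₀ hc key).symm

lemma hasDerivAt_mul_fc_polar (hψ : Sm U ψ) (hU : IsOpen U) (hd : disc p R ⊆ U)
    (hr : r ∈ Ioo (-R) R) :
    HasDerivAt (fun r : ℝ => (r : ℂ) * fc (-1) (polar ψ p) r)
      (r * circ (polar (dbar ψ) p) r) r := by
  have hs := sm_polar hψ hd
  have h := (hasDerivAt_id r).ofReal_comp.mul (hasDerivAt_fc (-1) hs isOpen_Ioo hr)
  have h0 := fc_pth (-1) hs isOpen_Ioo hr (polar_periodic ψ p r)
  refine HasDerivAt.congr_deriv (f := fun r : ℝ => (r : ℂ) * fc (-1) (polar ψ p) r) h ?_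
  have c1 := continuous_slice (hs.pt (isOpen_strip isOpen_Ioo)) hr
  have c2 := continuous_slice (hs.pth (isOpen_strip isOpen_Ioo)) hr
  have key : (r : ℂ) * circ (polar (dbar ψ) p) r = r * fc (-1) (pt (polar ψ p)) r
      + Complex.I * fc (-1) (pth (polar ψ p)) r := by
    rw [← fc_mul_left, ← fc_mul_left, ← fc_add (-1) (c1.const_mul _) (c2.const_mul _)]
    simp only [fc, circ]
    rw [← intervalIntegral.integral_const_mul]
    congr 1
    ext α
    rw [← polar_dbar hψ hU hd hr, mul_left_comm, ← mul_assoc (Complex.exp _), ← Complex.exp_add]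
    simp
  rw [key, h0]
  simp only [id, Complex.ofReal_one]
  push_cast
  linear_combination (fc (-1) (polar ψ p) r) * Complex.I_sq

end Polar

section PolarBounds

variable {U : Set (ℝ × ℝ)} {p : ℝ × ℝ} {R r ρ s : ℝ} {ψ : ℝ → ℝ → ℂ}

lemma continuousOn_fc_of_continuousOn {φ : ℝ → ℝ → ℂ} {I : Set ℝ} (k : ℤ) (hI : IsOpen I)
    (h : ContinuousOn (fun q : ℝ × ℝ => φ q.1 q.2) (strip I)) : ContinuousOn (fc k φ) I := by
  refine continuousOn_circ_of_continuousOn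
    (φ := fun a b => Complex.exp (-(k * b * Complex.I)) * φ a b) hI ?_
  have h1 := (sm_expI k (strip I)).continuousOn
  exact ContinuousOn.mul h1 h

lemma Sm.dbar {U : Set (ℝ × ℝ)} (hψ : Sm U ψ) (hU : IsOpen U) : Sm U (dbar ψ) := by
  have h1 := hψ.pt hU
  have h2 := hψ.pth hU
  exact ContDiffOn.add h1 (ContDiffOn.mul contDiffOn_const h2)

lemma continuousOn_circ_norm_polar {φ : ℝ → ℝ → ℂ} (hφ : Sm U φ) (hd : disc p R ⊆ U) :
    ContinuousOn (circ (polar (fun a b => ‖φ a b‖) p)) (Ioo (-R) R) := by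
  refine continuousOn_circ_of_continuousOn isOpen_Ioo ?_
  exact (continuousOn_polar hφ.continuousOn hd).norm

lemma integral_fc_polar (hψ : Sm U ψ) (hU : IsOpen U) (hd : disc p R ⊆ U) (hs : 0 ≤ s)
    (hsr : s ≤ r) (hr : r < R) :
    ∫ x in s..r, fc 1 (polar (dbar ψ) p) x = circ (polar ψ p) r - circ (polar ψ p) s := by
  have hsub : Icc s r ⊆ Ioo (-R) R := fun x hx => ⟨by linarith [hx.1, hx.2], by linarith [hx.2]⟩
  have hc := continuousOn_circ (sm_polar hψ hd) isOpen_Ioo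
  have hc' := continuousOn_fc_of_continuousOn 1 isOpen_Ioo
    (continuousOn_polar (hψ.dbar hU).continuousOn hd)
  refine intervalIntegral.integral_eq_sub_of_hasDerivAt_of_le hsr (hc.mono hsub) ?_ ?_
  · intro x hx
    exact hasDerivAt_circ_polar hψ hU hd (hsub (Ioo_subset_Icc_self hx)) (by linarith [hx.1])
  · refine ContinuousOn.intervalIntegrable ?_
    rw [uIcc_of_le hsr]
    exact hc'.mono hsub

lemma circ_polar_zero (ψ : ℝ → ℝ → ℂ) (p : ℝ × ℝ) :
    circ (polar ψ p) 0 = (2 * π : ℝ) * ψ p.1 p.2 := by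
  have := circ_const (t := 0) (ψ p.1 p.2)
  rw [Complex.real_smul] at this
  rw [← this]
  exact circ_congr fun θ => by simp [polar]

lemma norm_integral_fc_polar_le {Λ : ℝ} (hs : 0 ≤ s) (hsr : s ≤ r) (hr : r < R)
    (hΛ : ∀ q ∈ disc p R, ‖dbar ψ q.1 q.2‖ ≤ Λ) :
    ‖∫ x in s..r, fc 1 (polar (dbar ψ) p) x‖ ≤ 2 * π * Λ * (r - s) := by
  have := intervalIntegral.norm_integral_le_of_norm_le_const (a := s) (b := r)
    (f := fc 1 (polar (dbar ψ) p)) (C := 2 * π * Λ) ?_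
  · rwa [abs_of_nonneg (by linarith)] at this
  · intro x hx
    rw [uIoc_of_le hsr] at hx
    refine norm_circ_le_of_le fun θ => ?_
    rw [norm_mul, norm_expI, one_mul]
    exact hΛ _ (polar_mem_disc' (by linarith [hx.1]) (by linarith [hx.2]))

lemma discInt_nonneg {F : ℝ → ℝ → ℝ} (hF : ∀ a b, 0 ≤ F a b) (hρ : 0 ≤ ρ) :
    0 ≤ discInt F p ρ :=
  intervalIntegral.integral_nonneg hρ fun _ hr =>
    mul_nonneg hr.1 (circ_nonneg fun _ => hF _ _)

lemma norm_integral_fc_polar_le_discInt (hψ : Sm U ψ) (hU : IsOpen U) (hd : disc p R ⊆ U)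
    (hs : 0 < s) (hsr : s ≤ r) (hrρ : r ≤ ρ) (hρ : ρ < R) :
    ‖∫ x in s..r, fc 1 (polar (dbar ψ) p) x‖ ≤
      discInt (fun a b => ‖dbar ψ a b‖) p ρ / s := by
  have hsub : Icc 0 ρ ⊆ Ioo (-R) R := fun x hx => ⟨by linarith [hx.1, hx.2], by linarith [hx.2]⟩
  have hsub' : Icc s r ⊆ Icc 0 ρ := Icc_subset_Icc hs.le hrρ
  have hc := (continuousOn_circ_norm_polar (hψ.dbar hU) hd).mono hsub
  have hc' : ContinuousOn (fun x => x * circ (polar (fun a b => ‖dbar ψ a b‖) p) x) (Icc 0 ρ) :=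
    continuousOn_id.mul hc
  have hnn : ∀ x, 0 ≤ circ (polar (fun a b => ‖dbar ψ a b‖) p) x := fun x =>
    circ_nonneg fun θ => norm_nonneg _
  have h1 : ‖∫ x in s..r, fc 1 (polar (dbar ψ) p) x‖ ≤
      ∫ x in s..r, (x * circ (polar (fun a b => ‖dbar ψ a b‖) p) x) / s := by
    refine intervalIntegral.norm_integral_le_of_norm_le hsr ?_ ?_
    · refine Eventually.of_forall fun x hx => ?_
      refine (norm_fc_le (φ := polar (dbar ψ) p) 1).trans ?_
      rw [le_div_iff₀ hs, mul_comm]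
      exact mul_le_mul_of_nonneg_right hx.1.le (hnn x)
    · refine ContinuousOn.intervalIntegrable ?_
      rw [uIcc_of_le hsr]
      exact (hc'.mono hsub').div_const s
  refine h1.trans ?_
  rw [intervalIntegral.integral_div]
  refine div_le_div_of_nonneg_right ?_ hs.le
  refine intervalIntegral.integral_mono_interval hs.le hsr hrρ ?_ ?_
  · refine (ae_restrict_iff' measurableSet_Ioc).2 (Eventually.of_forall fun x hx => ?_)
    exact mul_nonneg hx.1.le (hnn x)
  · refine ContinuousOn.intervalIntegrable ?_
    rwa [uIcc_of_le (by linarith)]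

lemma norm_circ_polar_sub_le {Λ : ℝ} (hψ : Sm U ψ) (hU : IsOpen U) (hd : disc p R ⊆ U)
    (hs : 0 < s) (hρ : ρ < R) (hΛ : ∀ q ∈ disc p s, ‖dbar ψ q.1 q.2‖ ≤ Λ) (hr0 : 0 < r)
    (hr : r ≤ ρ) :
    ‖circ (polar ψ p) r - circ (polar ψ p) 0‖ ≤
      2 * π * Λ * s + discInt (fun a b => ‖dbar ψ a b‖) p ρ / s := by
  set D := discInt (fun a b => ‖dbar ψ a b‖) p ρ with hD
  have hD0 : 0 ≤ D := discInt_nonneg (fun a b => norm_nonneg _) (by linarith)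
  have hΛ0 : 0 ≤ Λ := (norm_nonneg _).trans (hΛ p (by simp [disc]; positivity))
  have hpi := pi_pos
  have hDs : 0 ≤ D / s := div_nonneg hD0 hs.le
  have inner : ∀ r, 0 < r → r < s → r < R →
      ‖circ (polar ψ p) r - circ (polar ψ p) 0‖ ≤ 2 * π * Λ * s := by
    intro r h0 hrs hrR
    rw [← integral_fc_polar hψ hU hd le_rfl h0.le hrR]
    refine (norm_integral_fc_polar_le (R := s) le_rfl h0.le hrs hΛ).trans ?_
    rw [sub_zero]
    gcongr
  rcases lt_or_ge r s with h | h
  · exact (inner r hr0 h (by linarith)).trans (by linarith)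
  have inner_s : ‖circ (polar ψ p) s - circ (polar ψ p) 0‖ ≤ 2 * π * Λ * s := by
    have hcs : ContinuousAt (circ (polar ψ p)) s :=
      (hasDerivAt_circ (sm_polar hψ hd) isOpen_Ioo (t := s)
        ⟨by linarith, by linarith⟩).continuousAt
    have ht : Tendsto (fun x => ‖circ (polar ψ p) x - circ (polar ψ p) 0‖)
      (nhdsWithin s (Iio s)) (nhds ‖circ (polar ψ p) s - circ (polar ψ p) 0‖) :=
      ((hcs.sub continuousAt_const).norm).tendsto.mono_left nhdsWithin_le_nhds
    refine le_of_tendsto ht ?_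
    filter_upwards [Ioo_mem_nhdsLT hs] with x hx
    exact inner x hx.1 hx.2 (by linarith [hx.2])
  have := norm_integral_fc_polar_le_discInt hψ hU hd hs h hr hρ
  rw [integral_fc_polar hψ hU hd hs.le h (by linarith)] at this
  calc ‖circ (polar ψ p) r - circ (polar ψ p) 0‖
      = ‖(circ (polar ψ p) s - circ (polar ψ p) 0)
        + (circ (polar ψ p) r - circ (polar ψ p) s)‖ := by congr 1; abel
    _ ≤ _ := (norm_add_le _ _).trans (add_le_add inner_s this)

lemma mul_norm_le_discInt {Λ : ℝ} (hψ : Sm U ψ) (hU : IsOpen U) (hd : disc p R ⊆ U)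
    (hs : 0 < s) (hsρ : s ≤ ρ) (hρ : ρ < R) (hΛ : ∀ q ∈ disc p s, ‖dbar ψ q.1 q.2‖ ≤ Λ) :
    π * ρ ^ 2 * ‖ψ p.1 p.2‖ ≤ discInt (fun a b => ‖ψ a b‖) p ρ + π * ρ ^ 2 * s * Λ +
      ρ ^ 2 / (2 * s) * discInt (fun a b => ‖dbar ψ a b‖) p ρ := by
  set D := discInt (fun a b => ‖dbar ψ a b‖) p ρ with hD
  have hD0 : 0 ≤ D := discInt_nonneg (fun a b => norm_nonneg _) (by linarith)
  have hΛ0 : 0 ≤ Λ := (norm_nonneg _).trans (hΛ p (by simp [disc]; positivity))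
  set K := 2 * π * Λ * s + D / s with hK
  have hpi := pi_pos
  have hsub : Icc 0 ρ ⊆ Ioo (-R) R := fun x hx => ⟨by linarith [hx.1, hx.2], by linarith [hx.2]⟩
  have main : ∀ r ∈ Ioc 0 ρ, ‖circ (polar ψ p) 0‖ ≤ circ (polar (fun a b => ‖ψ a b‖) p) r + K := by
    intro r hr
    have h1 : ‖circ (polar ψ p) r‖ ≤ circ (polar (fun a b => ‖ψ a b‖) p) r := norm_circ_le
    have h2 := norm_circ_polar_sub_le hψ hU hd hs hρ hΛ hr.1 hr.2
    calc ‖circ (polar ψ p) 0‖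
        = ‖circ (polar ψ p) r - (circ (polar ψ p) r - circ (polar ψ p) 0)‖ := by congr 1; abel
      _ ≤ _ := (norm_sub_le _ _).trans (add_le_add h1 h2)
  have hcn := (continuousOn_circ_norm_polar hψ hd).mono hsub
  have hρ0 : 0 ≤ ρ := by linarith
  have i1 : IntervalIntegrable (fun r => r * circ (polar (fun a b => ‖ψ a b‖) p) r) volume 0 ρ := by
    refine ContinuousOn.intervalIntegrable ?_
    rw [uIcc_of_le hρ0]
    exact continuousOn_id.mul hcn
  have i2 : IntervalIntegrable (fun r => r * K) volume 0 ρ :=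
    (by fun_prop : Continuous fun r => r * K).intervalIntegrable _ _
  have h_int := intervalIntegral.integral_mono_on (a := 0) (b := ρ) (μ := volume)
    (f := fun r => r * ‖circ (polar ψ p) 0‖)
    (g := fun r => r * circ (polar (fun a b => ‖ψ a b‖) p) r + r * K) hρ0
    ((by fun_prop : Continuous fun r => r * ‖circ (polar ψ p) 0‖).intervalIntegrable _ _)
    (i1.add i2) ?_
  · rw [intervalIntegral.integral_add i1 i2, intervalIntegral.integral_mul_const,
      intervalIntegral.integral_mul_const, integral_id, circ_polar_zero, norm_mul,
      Complex.norm_real, Real.norm_of_nonneg (by linarith)] at h_int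
    have e : (ρ ^ 2 - 0 ^ 2) / 2 * K = π * ρ ^ 2 * s * Λ + ρ ^ 2 / (2 * s) * D := by
      rw [hK]; field_simp; ring
    rw [e] at h_int
    have e2 : (ρ ^ 2 - 0 ^ 2) / 2 * (2 * π * ‖ψ p.1 p.2‖) = π * ρ ^ 2 * ‖ψ p.1 p.2‖ := by ring
    rw [e2] at h_int
    have e3 : discInt (fun a b => ‖ψ a b‖) p ρ =
      ∫ r in (0 : ℝ)..ρ, r * circ (polar (fun a b => ‖ψ a b‖) p) r := rfl
    linarith
  · intro x hx
    rcases eq_or_lt_of_le hx.1 with h | h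
    · simp [← h]
    · rw [← mul_add]
      exact mul_le_mul_of_nonneg_left (main x ⟨h, hx.2⟩) hx.1

lemma circ_conj (φ : ℝ → ℝ → ℂ) (t : ℝ) :
    circ (fun a b => (starRingEnd ℂ) (φ a b)) t = (starRingEnd ℂ) (circ φ t) := by
  simp only [circ, intervalIntegral.integral_of_le (show -π ≤ π by linarith [pi_pos])]
  exact integral_conj

lemma norm_le_of_dbar_pair {h y : ℝ → ℝ → ℂ} {Λ μ δ : ℝ} (hh : Sm U h) (hy : Sm U y)
    (hU : IsOpen U) (hd : disc p R ⊆ U) (hρ0 : 0 < ρ) (hρ : ρ < R)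
    (hΛ : ∀ q ∈ disc p R, ‖dbar y q.1 q.2‖ ≤ Λ)
    (hμ : ∀ q ∈ disc p R, ‖dbar h q.1 q.2 - (starRingEnd ℂ) (y q.1 q.2)‖ ≤ μ)
    (hδ : ∀ q ∈ disc p R, ‖h q.1 q.2‖ ≤ δ) :
    ‖y p.1 p.2‖ ≤ 2 * Λ * ρ + 2 * μ + 2 * δ / ρ := by
  have hpi := pi_pos
  have hp : p ∈ disc p R := by simp only [disc, Set.mem_ofPred_eq, sub_self]; nlinarith
  have hΛ0 : 0 ≤ Λ := (norm_nonneg _).trans (hΛ p hp)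
  have hμ0 : 0 ≤ μ := (norm_nonneg _).trans (hμ p hp)
  have hsub : Icc 0 ρ ⊆ Ioo (-R) R := fun x hx => ⟨by linarith [hx.1, hx.2], by linarith [hx.2]⟩
  have hdh := hh.dbar hU
  have hcd : ContinuousOn (circ (polar (dbar h) p)) (Icc 0 ρ) :=
    (continuousOn_circ (sm_polar hdh hd) isOpen_Ioo).mono hsub
  have i1 : IntervalIntegrable (fun r : ℝ => (r : ℂ) * circ (polar (dbar h) p) r) volume 0 ρ := by
    refine ContinuousOn.intervalIntegrable ?_
    rw [uIcc_of_le hρ0.le]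
    exact (Complex.continuous_ofReal.continuousOn).mul hcd
  have e1 : ∫ r in (0 : ℝ)..ρ, (r : ℂ) * circ (polar (dbar h) p) r = ρ * fc (-1) (polar h p) ρ := by
    have := intervalIntegral.integral_eq_sub_of_hasDerivAt (a := 0) (b := ρ)
      (f := fun r : ℝ => (r : ℂ) * fc (-1) (polar h p) r)
      (fun x hx => hasDerivAt_mul_fc_polar hh hU hd
        (hsub (by rwa [uIcc_of_le hρ0.le] at hx))) i1
    simpa using this
  have b1 : ‖(ρ : ℂ) * fc (-1) (polar h p) ρ‖ ≤ ρ * (2 * π * δ) := by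
    rw [norm_mul, Complex.norm_real, Real.norm_of_nonneg hρ0.le]
    refine mul_le_mul_of_nonneg_left (norm_circ_le_of_le fun θ => ?_) hρ0.le
    rw [norm_mul, norm_expI, one_mul]
    exact hδ _ (polar_mem_disc' hρ0.le hρ)
  set Y : ℂ := (starRingEnd ℂ) (circ (polar y p) 0) with hY
  have b2 : ∀ r ∈ Icc 0 ρ, ‖circ (polar (dbar h) p) r - Y‖ ≤ 2 * π * μ + 2 * π * Λ * ρ := by
    intro r hr
    have cy := continuous_slice (sm_polar hy hd) (hsub hr)
    have ch := continuous_slice (sm_polar hdh hd) (hsub hr)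
    have s1 : ‖circ (polar (dbar h) p) r - (starRingEnd ℂ) (circ (polar y p) r)‖ ≤ 2 * π * μ := by
      have e : circ (polar (dbar h) p) r - (starRingEnd ℂ) (circ (polar y p) r) =
          circ (fun a b => polar (dbar h) p a b - (starRingEnd ℂ) (polar y p a b)) r := by
        rw [← circ_conj]
        exact (intervalIntegral.integral_sub (ch.intervalIntegrable _ _)
          ((Complex.continuous_conj.comp cy).intervalIntegrable _ _)).symm
      rw [e]
      exact norm_circ_le_of_le fun θ => hμ _ (polar_mem_disc' hr.1 (by linarith [hr.2]))
    have s2 : ‖(starRingEnd ℂ) (circ (polar y p) r) - Y‖ ≤ 2 * π * Λ * ρ := by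
      rw [hY, ← map_sub, RCLike.norm_conj, ← integral_fc_polar hy hU hd le_rfl hr.1
        (by linarith [hr.2])]
      refine (norm_integral_fc_polar_le (R := R) le_rfl hr.1 (by linarith [hr.2]) hΛ).trans ?_
      rw [sub_zero]
      have := hr.2
      gcongr
    calc _ = ‖(circ (polar (dbar h) p) r - (starRingEnd ℂ) (circ (polar y p) r))
          + ((starRingEnd ℂ) (circ (polar y p) r) - Y)‖ := by congr 1; abel
      _ ≤ _ := (norm_add_le _ _).trans (add_le_add s1 s2)
  have b3 : ‖∫ r in (0 : ℝ)..ρ, ((r : ℂ) * circ (polar (dbar h) p) r - r * Y)‖ ≤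
      ρ * (2 * π * μ + 2 * π * Λ * ρ) * |ρ - 0| := by
    refine intervalIntegral.norm_integral_le_of_norm_le_const fun r hr => ?_
    rw [uIoc_of_le hρ0.le] at hr
    rw [← mul_sub, norm_mul, Complex.norm_real, Real.norm_of_nonneg hr.1.le]
    exact mul_le_mul hr.2 (b2 r ⟨hr.1.le, hr.2⟩) (norm_nonneg _) hρ0.le
  have i2 : IntervalIntegrable (fun r : ℝ => (r : ℂ) * Y) volume 0 ρ :=
    (by fun_prop : Continuous fun r : ℝ => (r : ℂ) * Y).intervalIntegrable _ _
  have e2 : ∫ r in (0 : ℝ)..ρ, (r : ℂ) * Y = ((ρ ^ 2 / 2 : ℝ) : ℂ) * Y := by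
    rw [intervalIntegral.integral_mul_const, intervalIntegral.integral_ofReal, integral_id]
    norm_num
  rw [intervalIntegral.integral_sub i1 i2, e1, e2, sub_zero, abs_of_pos hρ0] at b3
  have b4 : ‖((ρ ^ 2 / 2 : ℝ) : ℂ) * Y‖ ≤
      ρ * (2 * π * μ + 2 * π * Λ * ρ) * ρ + ρ * (2 * π * δ) := by
    calc ‖((ρ ^ 2 / 2 : ℝ) : ℂ) * Y‖ = ‖(ρ : ℂ) * fc (-1) (polar h p) ρ
          - (ρ * fc (-1) (polar h p) ρ - ((ρ ^ 2 / 2 : ℝ) : ℂ) * Y)‖ := by congr 1; ring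
      _ ≤ _ := (norm_sub_le _ _).trans (by linarith)
  have nY : ‖Y‖ = 2 * π * ‖y p.1 p.2‖ := by
    rw [hY, RCLike.norm_conj, circ_polar_zero, norm_mul, Complex.norm_real,
      Real.norm_of_nonneg (by linarith)]
  rw [norm_mul, Complex.norm_real, Real.norm_of_nonneg (by positivity), nY] at b4
  have e5 : 2 * Λ * ρ + 2 * μ + 2 * δ / ρ =
      (ρ * (2 * π * μ + 2 * π * Λ * ρ) * ρ + ρ * (2 * π * δ)) / (π * ρ ^ 2) := by
    field_simp; ring
  rw [e5, le_div_iff₀ (by positivity)]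
  linarith

/-- If `h` is a potential of `ψ`, then `ψ` is controlled by the mean of `h` on a disc. -/
lemma norm_le_of_dbar_eq_conj {h : ℝ → ℝ → ℂ} {Λ : ℝ} (hh : Sm U h) (hψ : Sm U ψ)
    (hU : IsOpen U) (hd : disc p R ⊆ U) (hs : 0 < s) (hρ0 : 0 < ρ) (hρ : ρ < R)
    (hΛ : ∀ q ∈ disc p s, ‖dbar ψ q.1 q.2‖ ≤ Λ)
    (he : ∀ q ∈ disc p R, dbar h q.1 q.2 = (starRingEnd ℂ) (ψ q.1 q.2)) :
    ‖ψ p.1 p.2‖ ≤ 3 / (π * ρ ^ 3) * discInt (fun a b => ‖h a b‖) p ρ + Λ * s +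
      discInt (fun a b => ‖dbar ψ a b‖) p ρ / (2 * π * s) := by
  have hpi := pi_pos
  set K := 2 * π * Λ * s + discInt (fun a b => ‖dbar ψ a b‖) p ρ / s with hK
  have hsub : Icc 0 ρ ⊆ Ioo (-R) R := fun x hx => ⟨by linarith [hx.1, hx.2], by linarith [hx.2]⟩
  have hdh := hh.dbar hU
  have hcd : ContinuousOn (circ (polar (dbar h) p)) (Icc 0 ρ) :=
    (continuousOn_circ (sm_polar hdh hd) isOpen_Ioo).mono hsub
  set Y : ℂ := (starRingEnd ℂ) (circ (polar ψ p) 0) with hY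
  have nY : ‖Y‖ = 2 * π * ‖ψ p.1 p.2‖ := by
    rw [hY, RCLike.norm_conj, circ_polar_zero, norm_mul, Complex.norm_real,
      Real.norm_of_nonneg (by linarith)]
  have main : ∀ τ ∈ Ioc 0 ρ, τ ^ 2 / 2 * ‖Y‖ ≤
      τ * circ (polar (fun a b => ‖h a b‖) p) τ + τ ^ 2 / 2 * K := by
    intro τ hτ
    have hsubτ : Icc 0 τ ⊆ Icc 0 ρ := Icc_subset_Icc_right hτ.2
    have i1 : IntervalIntegrable (fun r : ℝ => (r : ℂ) * circ (polar (dbar h) p) r) volume 0 τ := by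
      refine ContinuousOn.intervalIntegrable ?_
      rw [uIcc_of_le hτ.1.le]
      exact (Complex.continuous_ofReal.continuousOn).mul (hcd.mono hsubτ)
    have e1 : ∫ r in (0 : ℝ)..τ, (r : ℂ) * circ (polar (dbar h) p) r =
        τ * fc (-1) (polar h p) τ := by
      have := intervalIntegral.integral_eq_sub_of_hasDerivAt (a := 0) (b := τ)
        (f := fun r : ℝ => (r : ℂ) * fc (-1) (polar h p) r)
        (fun x hx => hasDerivAt_mul_fc_polar hh hU hd
          (hsub (hsubτ (by rwa [uIcc_of_le hτ.1.le] at hx)))) i1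
      simpa using this
    have b1 : ‖(τ : ℂ) * fc (-1) (polar h p) τ‖ ≤
        τ * circ (polar (fun a b => ‖h a b‖) p) τ := by
      rw [norm_mul, Complex.norm_real, Real.norm_of_nonneg hτ.1.le]
      exact mul_le_mul_of_nonneg_left (norm_fc_le (φ := polar h p) _) hτ.1.le
    have i2 : IntervalIntegrable (fun r : ℝ => (r : ℂ) * Y) volume 0 τ :=
      (by fun_prop : Continuous fun r : ℝ => (r : ℂ) * Y).intervalIntegrable _ _
    have e2 : ∫ r in (0 : ℝ)..τ, (r : ℂ) * Y = ((τ ^ 2 / 2 : ℝ) : ℂ) * Y := by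
      rw [intervalIntegral.integral_mul_const, intervalIntegral.integral_ofReal, integral_id]
      norm_num
    have b3 : ‖∫ r in (0 : ℝ)..τ, ((r : ℂ) * circ (polar (dbar h) p) r - r * Y)‖ ≤
        ∫ r in (0 : ℝ)..τ, r * K := by
      refine intervalIntegral.norm_integral_le_of_norm_le hτ.1.le ?_
        ((by fun_prop : Continuous fun r : ℝ => r * K).intervalIntegrable _ _)
      refine Eventually.of_forall fun r hr => ?_
      rw [← mul_sub, norm_mul, Complex.norm_real, Real.norm_of_nonneg hr.1.le]
      refine mul_le_mul_of_nonneg_left ?_ hr.1.le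
      have e3 : circ (polar (dbar h) p) r = (starRingEnd ℂ) (circ (polar ψ p) r) := by
        rw [← circ_conj]
        exact circ_congr fun θ => he _ (polar_mem_disc' hr.1.le (by linarith [hr.2, hτ.2]))
      rw [e3, hY, ← map_sub, RCLike.norm_conj]
      exact norm_circ_polar_sub_le hψ hU hd hs hρ hΛ hr.1 (hr.2.trans hτ.2)
    rw [intervalIntegral.integral_sub i1 i2, e1, e2, intervalIntegral.integral_mul_const,
      integral_id] at b3
    calc τ ^ 2 / 2 * ‖Y‖ = ‖((τ ^ 2 / 2 : ℝ) : ℂ) * Y‖ := by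
          rw [norm_mul, Complex.norm_real, Real.norm_of_nonneg (by positivity)]
      _ = ‖(τ : ℂ) * fc (-1) (polar h p) τ
          - (τ * fc (-1) (polar h p) τ - ((τ ^ 2 / 2 : ℝ) : ℂ) * Y)‖ := by congr 1; ring
      _ ≤ _ := (norm_sub_le _ _).trans (by linarith)
  have hcn := (continuousOn_circ_norm_polar hh hd).mono hsub
  have i1 : IntervalIntegrable (fun r => r * circ (polar (fun a b => ‖h a b‖) p) r) volume 0 ρ := by
    refine ContinuousOn.intervalIntegrable ?_
    rw [uIcc_of_le hρ0.le]
    exact continuousOn_id.mul hcn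
  have i2 : IntervalIntegrable (fun r => r ^ 2 / 2 * K) volume 0 ρ :=
    (by fun_prop : Continuous fun r => r ^ 2 / 2 * K).intervalIntegrable _ _
  have h_int := intervalIntegral.integral_mono_on (a := 0) (b := ρ) (μ := volume)
    (f := fun r => r ^ 2 / 2 * ‖Y‖)
    (g := fun r => r * circ (polar (fun a b => ‖h a b‖) p) r + r ^ 2 / 2 * K) hρ0.le
    ((by fun_prop : Continuous fun r => r ^ 2 / 2 * ‖Y‖).intervalIntegrable _ _)
    (i1.add i2) fun x hx => by
      rcases eq_or_lt_of_le hx.1 with h0 | h0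
      · simp [← h0]
      · exact main x ⟨h0, hx.2⟩
  rw [intervalIntegral.integral_add i1 i2, intervalIntegral.integral_mul_const,
    intervalIntegral.integral_mul_const, intervalIntegral.integral_div, integral_pow, nY] at h_int
  have e3 : discInt (fun a b => ‖h a b‖) p ρ =
    ∫ r in (0 : ℝ)..ρ, r * circ (polar (fun a b => ‖h a b‖) p) r := rfl
  rw [← e3] at h_int
  have e5 : 3 / (π * ρ ^ 3) * discInt (fun a b => ‖h a b‖) p ρ + Λ * s +
      discInt (fun a b => ‖dbar ψ a b‖) p ρ / (2 * π * s) =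
      (discInt (fun a b => ‖h a b‖) p ρ + ρ ^ 3 / 6 * K) / (π * ρ ^ 3 / 3) := by
    rw [hK]; field_simp; ring
  rw [e5, le_div_iff₀ (by positivity)]
  norm_num at h_int
  linarith

end PolarBounds

lemma discInt_le_integral_circ {F : ℝ → ℝ → ℝ} {p : ℝ × ℝ} {ρ : ℝ}
    (hF : ContinuousOn (fun q : ℝ × ℝ => F q.1 q.2) halfPlane) (hF0 : ∀ a b, 0 ≤ F a b)
    (hper : ∀ t, 0 < t → ∀ θ, F t (θ + 2 * π) = F t θ) (hρ : 0 < ρ) (hρπ : ρ ≤ π) (hp : ρ < p.1) :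
    discInt F p ρ ≤ ∫ s in (p.1 - ρ)..(p.1 + ρ), circ F s := by
  have hpi := pi_pos
  set G : ℝ × ℝ → ℝ := fun q => F (p.1 + q.1) (p.2 + q.2) with hG
  have hGc : ContinuousOn G (Icc (-ρ) ρ ×ˢ Icc (-π) π) := by
    refine ContinuousOn.comp (g := fun q : ℝ × ℝ => F q.1 q.2) hF
      (f := fun q : ℝ × ℝ => (p.1 + q.1, p.2 + q.2)) (by fun_prop) ?_
    intro q hq
    show 0 < p.1 + q.1
    linarith [hq.1.1]
  have hGi : IntegrableOn G (Icc (-ρ) ρ ×ˢ Icc (-π) π) :=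
    hGc.integrableOn_compact (isCompact_Icc.prod isCompact_Icc)
  set B : Set (ℝ × ℝ) := {q | q.1 ^ 2 + q.2 ^ 2 ≤ ρ ^ 2} with hB
  have hBm : MeasurableSet B := (isClosed_le (by fun_prop) continuous_const).measurableSet
  have hBs : B ⊆ Icc (-ρ) ρ ×ˢ Icc (-π) π := by
    intro q hq
    have hq' : q.1 ^ 2 + q.2 ^ 2 ≤ ρ ^ 2 := hq
    have h1 := abs_le_of_sq_le_sq' (show q.1 ^ 2 ≤ ρ ^ 2 by nlinarith [sq_nonneg q.2]) hρ.le
    have h2 := abs_le_of_sq_le_sq' (show q.2 ^ 2 ≤ ρ ^ 2 by nlinarith [sq_nonneg q.1]) hρ.le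
    exact ⟨⟨h1.1, h1.2⟩, ⟨by linarith [h2.1], by linarith [h2.2]⟩⟩
  have e1 : discInt F p ρ = ∫ q in B, G q := by
    rw [← integral_indicator hBm, ← integral_comp_polarCoord_symm]
    have e2 : ∀ q ∈ polarCoord.target, q.1 • B.indicator G (polarCoord.symm q) =
        (Iic ρ ×ˢ (univ : Set ℝ)).indicator (fun q => q.1 * polar F p q.1 q.2) q := by
      intro q hq
      have h0 : 0 < q.1 := hq.1
      have hmem : polarCoord.symm q ∈ B ↔ q ∈ Iic ρ ×ˢ (univ : Set ℝ) := by
        simp only [hB, polarCoord_symm_apply, Set.mem_ofPred_eq, mem_prod, mem_Iic, mem_univ,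
          and_true]
        rw [show (q.1 * Real.cos q.2) ^ 2 + (q.1 * Real.sin q.2) ^ 2 = q.1 ^ 2 by
          linear_combination q.1 ^ 2 * Real.cos_sq_add_sin_sq q.2]
        exact sq_le_sq₀ h0.le hρ.le
      by_cases h : q ∈ Iic ρ ×ˢ (univ : Set ℝ)
      · rw [indicator_of_mem h, indicator_of_mem (hmem.2 h)]
        simp only [hG, polarCoord_symm_apply, polar, smul_eq_mul]
      · rw [indicator_of_notMem h, indicator_of_notMem (fun h' => h (hmem.1 h')), smul_zero]
    rw [setIntegral_congr_fun polarCoord.open_target.measurableSet e2,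
      setIntegral_indicator (measurableSet_Iic.prod MeasurableSet.univ)]
    have e3 : polarCoord.target ∩ Iic ρ ×ˢ (univ : Set ℝ) = Ioc 0 ρ ×ˢ Ioo (-π) π := by
      ext q
      simp only [polarCoord_target, mem_inter_iff, mem_prod, mem_Ioi, mem_Iic, mem_univ, mem_Ioc]
      tauto
    rw [e3, Measure.volume_eq_prod, setIntegral_prod]
    · rw [discInt, intervalIntegral.integral_of_le hρ.le]
      refine setIntegral_congr_fun measurableSet_Ioc fun r _ => ?_
      simp only [circ]
      rw [intervalIntegral.integral_of_le (by linarith), integral_Ioc_eq_integral_Ioo,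
        ← integral_const_mul]
    · have hc : ContinuousOn (fun q : ℝ × ℝ => q.1 * polar F p q.1 q.2)
          (Icc 0 ρ ×ˢ Icc (-π) π) := by
        refine continuousOn_fst.mul ?_
        have hd : disc p p.1 ⊆ halfPlane := by
          intro q hq
          have hq' : (q.1 - p.1) ^ 2 + (q.2 - p.2) ^ 2 < p.1 ^ 2 := hq
          have h1 := abs_lt_of_sq_lt_sq' (show (q.1 - p.1) ^ 2 < p.1 ^ 2 by
            nlinarith [sq_nonneg (q.2 - p.2)]) (by linarith)
          show 0 < q.1
          linarith [h1.1]
        refine (continuousOn_polar hF hd).mono fun q hq => ?_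
        exact ⟨by linarith [hq.1.1], by linarith [hq.1.2]⟩
      exact (hc.integrableOn_compact (isCompact_Icc.prod isCompact_Icc)).mono_set
        (prod_mono Ioc_subset_Icc_self Ioo_subset_Icc_self)
  have e4 : ∫ q in Icc (-ρ) ρ ×ˢ Icc (-π) π, G q = ∫ s in (p.1 - ρ)..(p.1 + ρ), circ F s := by
    rw [Measure.volume_eq_prod, setIntegral_prod]
    · rw [integral_Icc_eq_integral_Ioc, ← intervalIntegral.integral_of_le (by linarith)]
      have h1 := intervalIntegral.integral_comp_add_left (a := -ρ) (b := ρ) (circ F) p.1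
      rw [← sub_eq_add_neg] at h1
      rw [← h1]
      refine intervalIntegral.integral_congr fun x hx => ?_
      rw [uIcc_of_le (by linarith)] at hx
      simp only [hG]
      rw [integral_Icc_eq_integral_Ioc, ← intervalIntegral.integral_of_le (by linarith),
        circ_eq_integral (hper _ (by linarith [hx.1])) (p.2 - π),
        intervalIntegral.integral_comp_add_left (fun y => F (p.1 + x) y) p.2]
      congr 1 <;> ring
    · rwa [Measure.volume_eq_prod] at hGi
  rw [e1, ← e4]
  exact setIntegral_mono_set hGi (Eventually.of_forall fun q => hF0 _ _)
    (Eventually.of_forall hBs)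

section ModeODE

variable {x e : ℝ → ℂ} {b : ℝ → ℝ} {a t c : ℝ}

lemma norm_exp_mul_sub_le (hat : a ≤ t)
    (hx : ∀ s ∈ Icc a t, HasDerivAt x (c * x s + e s) s) (he : ContinuousOn e (Icc a t))
    (hb : ContinuousOn b (Icc a t)) (heb : ∀ s ∈ Icc a t, ‖e s‖ ≤ b s) :
    ‖(Real.exp (-(c * t)) : ℂ) * x t - (Real.exp (-(c * a)) : ℂ) * x a‖ ≤
      ∫ s in a..t, Real.exp (-(c * s)) * b s := by
  have hd : ∀ s ∈ uIcc a t, HasDerivAt (fun s : ℝ => (Real.exp (-(c * s)) : ℂ) * x s)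
      ((Real.exp (-(c * s)) : ℂ) * e s) s := by
    intro s hs
    rw [uIcc_of_le hat] at hs
    have h1 : HasDerivAt (fun s : ℝ => Real.exp (-(c * s))) (Real.exp (-(c * s)) * -(c * 1)) s :=
      (((hasDerivAt_id s).const_mul c).neg).exp
    refine (h1.ofReal_comp.mul (hx s hs)).congr_deriv ?_
    push_cast
    ring
  have hcont : ContinuousOn (fun s : ℝ => (Real.exp (-(c * s)) : ℂ) * e s) (Icc a t) :=
    (by fun_prop : Continuous fun s : ℝ => (Real.exp (-(c * s)) : ℂ)).continuousOn.mul he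
  have hcb : ContinuousOn (fun s : ℝ => Real.exp (-(c * s)) * b s) (Icc a t) :=
    (by fun_prop : Continuous fun s : ℝ => Real.exp (-(c * s))).continuousOn.mul hb
  rw [← intervalIntegral.integral_eq_sub_of_hasDerivAt hd
    (ContinuousOn.intervalIntegrable (by rwa [uIcc_of_le hat]))]
  refine intervalIntegral.norm_integral_le_of_norm_le hat (Eventually.of_forall fun s hs => ?_)
    (ContinuousOn.intervalIntegrable (by rwa [uIcc_of_le hat]))
  rw [norm_mul, Complex.norm_real, Real.norm_of_nonneg (Real.exp_pos _).le]
  exact mul_le_mul_of_nonneg_left (heb s (Ioc_subset_Icc_self hs)) (Real.exp_pos _).le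

lemma norm_le_exp_mul_add (hat : a ≤ t)
    (hx : ∀ s ∈ Icc a t, HasDerivAt x (c * x s + e s) s) (he : ContinuousOn e (Icc a t))
    (hb : ContinuousOn b (Icc a t)) (heb : ∀ s ∈ Icc a t, ‖e s‖ ≤ b s) :
    ‖x t‖ ≤ Real.exp (c * (t - a)) * ‖x a‖ + ∫ s in a..t, Real.exp (c * (t - s)) * b s := by
  have h := norm_exp_mul_sub_le hat hx he hb heb
  have h1 : ‖(Real.exp (-(c * t)) : ℂ) * x t‖ ≤ ‖(Real.exp (-(c * a)) : ℂ) * x a‖ +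
      ∫ s in a..t, Real.exp (-(c * s)) * b s := by
    calc _ = ‖((Real.exp (-(c * t)) : ℂ) * x t - (Real.exp (-(c * a)) : ℂ) * x a)
          + (Real.exp (-(c * a)) : ℂ) * x a‖ := by congr 1; abel
      _ ≤ _ := (norm_add_le _ _).trans (by linarith)
  rw [norm_mul, norm_mul, Complex.norm_real, Complex.norm_real,
    Real.norm_of_nonneg (Real.exp_pos _).le, Real.norm_of_nonneg (Real.exp_pos _).le] at h1
  have h2 := mul_le_mul_of_nonneg_left h1 (Real.exp_pos (c * t)).le
  rw [mul_add, ← mul_assoc, ← mul_assoc, ← Real.exp_add, ← Real.exp_add,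
    ← intervalIntegral.integral_const_mul] at h2
  simp only [← mul_assoc, ← Real.exp_add] at h2
  rw [show c * t + -(c * t) = 0 by ring, Real.exp_zero, one_mul] at h2
  refine h2.trans (le_of_eq ?_)
  congr 2
  · congr 1; ring
  · ext s; congr 2; ring

lemma norm_le_exp_mul_add' (hat : a ≤ t)
    (hx : ∀ s ∈ Icc a t, HasDerivAt x (c * x s + e s) s) (he : ContinuousOn e (Icc a t))
    (hb : ContinuousOn b (Icc a t)) (heb : ∀ s ∈ Icc a t, ‖e s‖ ≤ b s) :
    ‖x a‖ ≤ Real.exp (-(c * (t - a))) * ‖x t‖ +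
      ∫ s in a..t, Real.exp (-(c * (s - a))) * b s := by
  have h := norm_exp_mul_sub_le hat hx he hb heb
  have h1 : ‖(Real.exp (-(c * a)) : ℂ) * x a‖ ≤ ‖(Real.exp (-(c * t)) : ℂ) * x t‖ +
      ∫ s in a..t, Real.exp (-(c * s)) * b s := by
    calc _ = ‖(Real.exp (-(c * t)) : ℂ) * x t - ((Real.exp (-(c * t)) : ℂ) * x t
          - (Real.exp (-(c * a)) : ℂ) * x a)‖ := by congr 1; abel
      _ ≤ _ := (norm_sub_le _ _).trans (by linarith)
  rw [norm_mul, norm_mul, Complex.norm_real, Complex.norm_real,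
    Real.norm_of_nonneg (Real.exp_pos _).le, Real.norm_of_nonneg (Real.exp_pos _).le] at h1
  have h2 := mul_le_mul_of_nonneg_left h1 (Real.exp_pos (c * a)).le
  rw [mul_add, ← mul_assoc, ← mul_assoc, ← Real.exp_add, ← Real.exp_add,
    ← intervalIntegral.integral_const_mul] at h2
  simp only [← mul_assoc, ← Real.exp_add] at h2
  rw [show c * a + -(c * a) = 0 by ring, Real.exp_zero, one_mul] at h2
  refine h2.trans (le_of_eq ?_)
  congr 2
  · congr 1; ring
  · ext s; congr 2; ring

lemma exists_lt_of_integrableOn_Ioi {h : ℝ → ℝ} {T₀ : ℝ} (hi : IntegrableOn h (Ioi T₀)) {ε : ℝ}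
    (hε : 0 < ε) (T : ℝ) : ∃ t, T < t ∧ h t < ε := by
  by_contra! hcon
  set S := max T T₀ with hS
  have h1 : IntegrableOn h (Ioi S) := hi.mono_set (Ioi_subset_Ioi (le_max_right _ _))
  have h2 : IntegrableOn (fun _ : ℝ => ε) (Ioi S) := by
    refine Integrable.mono' h1 aestronglyMeasurable_const ?_
    refine (ae_restrict_iff' measurableSet_Ioi).2 (Eventually.of_forall fun t ht => ?_)
    rw [Real.norm_of_nonneg hε.le]
    exact hcon t (lt_of_le_of_lt (le_max_left _ _) ht)
  rw [integrableOn_const_iff] at h2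
  simp [hε.ne'] at h2

end ModeODE

section GradientModes

variable {f : ℝ → ℝ → EuclideanSpace ℝ (Fin n)} {u : ℝ → ℝ → ℝ}

lemma periodic_pt {F : Type*} [NormedAddCommGroup F] [NormedSpace ℝ F] {φ : ℝ → ℝ → F}
    (h : ∀ t, 0 < t → ∀ θ, φ t (θ + 2 * π) = φ t θ) {t : ℝ} (ht : 0 < t) (θ : ℝ) :
    pt φ t (θ + 2 * π) = pt φ t θ := by
  refine Filter.EventuallyEq.deriv_eq ?_
  filter_upwards [Ioi_mem_nhds ht] with s hs
  exact h s hs θ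

lemma periodic_pth {F : Type*} [NormedAddCommGroup F] [NormedSpace ℝ F] {φ : ℝ → ℝ → F}
    (h : ∀ t, 0 < t → ∀ θ, φ t (θ + 2 * π) = φ t θ) {t : ℝ} (ht : 0 < t) (θ : ℝ) :
    pth φ t (θ + 2 * π) = pth φ t θ := by
  have : φ t = fun s => φ t (s + 2 * π) := funext fun s => (h t ht s).symm
  conv_rhs => rw [pth, this, deriv_comp_add_const]
  rfl

end GradientModes

section CircAlgebra

variable {F : Type*} [NormedAddCommGroup F] [NormedSpace ℝ F] {φ ψ : ℝ → ℝ → F} {t : ℝ}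

lemma circ_add (hφ : Continuous (φ t)) (hψ : Continuous (ψ t)) :
    circ (fun a b => φ a b + ψ a b) t = circ φ t + circ ψ t :=
  intervalIntegral.integral_add (hφ.intervalIntegrable _ _) (hψ.intervalIntegrable _ _)

lemma circ_sub (hφ : Continuous (φ t)) (hψ : Continuous (ψ t)) :
    circ (fun a b => φ a b - ψ a b) t = circ φ t - circ ψ t :=
  intervalIntegral.integral_sub (hφ.intervalIntegrable _ _) (hψ.intervalIntegrable _ _)

lemma circ_const_mul {𝕜 : Type*} [RCLike 𝕜] (c : 𝕜) (φ : ℝ → ℝ → 𝕜) (t : ℝ) :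
    circ (fun a b => c * φ a b) t = c * circ φ t :=
  intervalIntegral.integral_const_mul _ _

lemma circ_ofReal (φ : ℝ → ℝ → ℝ) (t : ℝ) :
    circ (fun a b => (φ a b : ℂ)) t = ((circ φ t : ℝ) : ℂ) :=
  intervalIntegral.integral_ofReal

end CircAlgebra

section GradientModes

variable {f : ℝ → ℝ → EuclideanSpace ℝ (Fin n)} {u : ℝ → ℝ → ℝ} {t θ a : ℝ} {k : ℤ}

lemma sm_Adens {U : Set (ℝ × ℝ)} (hf : DiskConfWillmore f u U) (hU : IsOpen U) :
    Sm U (Adens f u) := by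
  have h1 := (hf.sm_Att hU).norm_sq
  have h2 := (hf.sm_Atth hU).norm_sq
  have h3 := (hf.sm_Athth hU).norm_sq
  refine Sm.congr (φ := fun t θ => Real.exp (-2 * u t θ) *
      ((‖Att f u t θ‖ ^ 2 + 2 * ‖Atth f u t θ‖ ^ 2) + ‖Athth f u t θ‖ ^ 2)) ?_ fun p _ => ?_
  · exact (((sm_const (-2)).mul hf.sm_u).exp).mul ((h1.add ((sm_const 2).mul h2)).add h3)
  · rw [Adens_eq]
    ring_nf

lemma mem_halfPlane (ht : 0 < t) : (t, θ) ∈ halfPlane := ht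

lemma continuousOn_circ_Adens (hF : FiniteCyl f u) : ContinuousOn (circ (Adens f u)) (Ioi 0) :=
  continuousOn_circ (sm_Adens hF.conf isOpen_halfPlane) isOpen_Ioi

lemma circ_Adens_nonneg (f : ℝ → ℝ → EuclideanSpace ℝ (Fin n)) (u : ℝ → ℝ → ℝ) (t : ℝ) :
    0 ≤ circ (Adens f u) t := circ_nonneg fun _ => Adens_nonneg _ _ _ _

lemma periodic_gc (hF : FiniteCyl f u) (ht : 0 < t) (θ : ℝ) :
    gc u t (θ + 2 * π) = gc u t θ := by
  rw [gc, gc, periodic_pt (fun t _ => hF.per_u t) ht, periodic_pth (fun t _ => hF.per_u t) ht]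

lemma norm_dbar_gc_le (hF : FiniteCyl f u) (ht : 0 < t) :
    ‖dbar (gc u) t θ‖ ≤ Adens f u t θ := by
  rw [hF.conf.dbar_gc isOpen_halfPlane (mem_halfPlane ht), Complex.norm_real, Real.norm_eq_abs]
  have := hF.conf.abs_laplace_u_le isOpen_halfPlane (mem_halfPlane (θ := θ) ht)
  rw [aa_sq] at this
  linarith [Adens_nonneg f u t θ]

lemma sm_gc' (hF : FiniteCyl f u) : Sm (strip (Ioi 0)) (gc u) := hF.conf.sm_gc isOpen_halfPlane

lemma sm_dbar_gc (hF : FiniteCyl f u) : Sm (strip (Ioi 0)) (dbar (gc u)) :=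
  (sm_gc' hF).dbar isOpen_halfPlane

lemma circ_norm_dbar_gc_le (hF : FiniteCyl f u) (ht : 0 < t) :
    circ (fun a b => ‖dbar (gc u) a b‖) t ≤ circ (Adens f u) t :=
  circ_mono (continuous_slice (sm_dbar_gc hF) ht).norm
    (continuous_slice (sm_Adens hF.conf isOpen_halfPlane) ht) fun _ => norm_dbar_gc_le hF ht

lemma norm_fc_dbar_gc_le (hF : FiniteCyl f u) (k : ℤ) (ht : 0 < t) :
    ‖fc k (dbar (gc u)) t‖ ≤ circ (Adens f u) t :=
  (norm_fc_le k).trans (circ_norm_dbar_gc_le hF ht)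

lemma hasDerivAt_fc_gc (hF : FiniteCyl f u) (k : ℤ) (ht : 0 < t) :
    HasDerivAt (fc k (gc u)) (((k : ℝ) : ℂ) * fc k (gc u) t + fc k (dbar (gc u)) t) t := by
  refine (hasDerivAt_fc_of_dbar k (sm_gc' hF) isOpen_Ioi ht (periodic_gc hF ht) 0
    (e := dbar (gc u)) fun θ => ?_).congr_deriv ?_ <;> simp

lemma norm_fc_gc_le_fwd (hF : FiniteCyl f u) (k : ℤ) (ha : 0 < a) (hat : a ≤ t) :
    ‖fc k (gc u) t‖ ≤ Real.exp (k * (t - a)) * ‖fc k (gc u) a‖ +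
      ∫ s in a..t, Real.exp (k * (t - s)) * circ (Adens f u) s := by
  have hsub : Icc a t ⊆ Ioi 0 := fun s hs => lt_of_lt_of_le ha hs.1
  refine norm_le_exp_mul_add hat (fun s hs => hasDerivAt_fc_gc hF k (hsub hs)) ?_
    ((continuousOn_circ_Adens hF).mono hsub) fun s hs => norm_fc_dbar_gc_le hF k (hsub hs)
  exact (continuousOn_fc_of_continuousOn k isOpen_Ioi (sm_dbar_gc hF).continuousOn).mono hsub

lemma norm_fc_gc_le_bwd (hF : FiniteCyl f u) (k : ℤ) (ha : 0 < a) (hat : a ≤ t) :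
    ‖fc k (gc u) a‖ ≤ Real.exp (-(k * (t - a))) * ‖fc k (gc u) t‖ +
      ∫ s in a..t, Real.exp (-(k * (s - a))) * circ (Adens f u) s := by
  have hsub : Icc a t ⊆ Ioi 0 := fun s hs => lt_of_lt_of_le ha hs.1
  refine norm_le_exp_mul_add' hat (fun s hs => hasDerivAt_fc_gc hF k (hsub hs)) ?_
    ((continuousOn_circ_Adens hF).mono hsub) fun s hs => norm_fc_dbar_gc_le hF k (hsub hs)
  exact (continuousOn_fc_of_continuousOn k isOpen_Ioi (sm_dbar_gc hF).continuousOn).mono hsub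

lemma integral_weight_circ_le (hF : FiniteCyl f u) {w : ℝ → ℝ} (hw : Continuous w)
    (ha : 0 < a) (hat : a ≤ t) (h1 : ∀ s ∈ Icc a t, w s ≤ 1) :
    ∫ s in a..t, w s * circ (Adens f u) s ≤ ∫ s in Ioi a, circ (Adens f u) s := by
  have hsub : Icc a t ⊆ Ioi 0 := fun s hs => lt_of_lt_of_le ha hs.1
  have hc : ContinuousOn (circ (Adens f u)) (uIcc a t) := by
    rw [uIcc_of_le hat]; exact (continuousOn_circ_Adens hF).mono hsub
  have hi := hF.int_A.mono_set (Ioi_subset_Ioi ha.le)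
  calc ∫ s in a..t, w s * circ (Adens f u) s ≤ ∫ s in a..t, circ (Adens f u) s := by
        refine intervalIntegral.integral_mono_on hat
          (hw.continuousOn.mul hc).intervalIntegrable hc.intervalIntegrable fun s hs => ?_
        have := mul_le_mul_of_nonneg_right (h1 s hs) (circ_Adens_nonneg f u s)
        rwa [one_mul] at this
    _ = ∫ s in Ioc a t, circ (Adens f u) s := intervalIntegral.integral_of_le hat
    _ ≤ _ := setIntegral_mono_set hi (Eventually.of_forall fun s => circ_Adens_nonneg f u s)
        (Eventually.of_forall fun s hs => hs.1)

/-- A bound for the negative Fourier modes of the complex gradient of `u`. -/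
lemma norm_fc_gc_neg_le (hF : FiniteCyl f u) (hk : k ≤ 0) (ht : 1 ≤ t) :
    ‖fc k (gc u) t‖ ≤ circ (fun a b => ‖gc u a b‖) 1 + ∫ s in Ioi 1, circ (Adens f u) s := by
  have hk' : (k : ℝ) ≤ 0 := by exact_mod_cast hk
  refine (norm_fc_gc_le_fwd hF k one_pos ht).trans (add_le_add ?_ ?_)
  · have h1 : Real.exp (k * (t - 1)) ≤ 1 :=
      Real.exp_le_one_iff.2 (mul_nonpos_of_nonpos_of_nonneg hk' (by linarith))
    calc _ ≤ 1 * ‖fc k (gc u) 1‖ := mul_le_mul_of_nonneg_right h1 (norm_nonneg _)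
      _ = ‖fc k (gc u) 1‖ := one_mul _
      _ ≤ _ := norm_fc_le k
  · refine integral_weight_circ_le hF (by fun_prop) one_pos ht fun s hs => ?_
    exact Real.exp_le_one_iff.2 (mul_nonpos_of_nonpos_of_nonneg hk' (by linarith [hs.2]))

lemma fc_zero_gc (hF : FiniteCyl f u) (ht : 0 < t) :
    fc 0 (gc u) t = ((circ (pt u) t : ℝ) : ℂ) := by
  have hsu : Sm (strip (Ioi 0)) u := hF.conf.sm_u
  have c1 := continuous_slice (hsu.pt isOpen_halfPlane) ht
  have c2 := continuous_slice (hsu.pth isOpen_halfPlane) ht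
  have e := circ_pth hsu isOpen_Ioi ht (hF.per_u t)
  have e2 : fc 0 (gc u) t = circ (gc u) t := circ_congr fun θ => by simp
  rw [e2, show gc u = fun a b => ((pt u a b : ℝ) : ℂ) - Complex.I * ((pth u a b : ℝ) : ℂ)
    from rfl, circ_sub (φ := fun a b => ((pt u a b : ℝ) : ℂ))
    (ψ := fun a b => Complex.I * ((pth u a b : ℝ) : ℂ))
    (Complex.continuous_ofReal.comp c1)
    (continuous_const.mul (Complex.continuous_ofReal.comp c2)), circ_const_mul, circ_ofReal,
    circ_ofReal, e]
  simp

lemma circ_u_lower (hF : FiniteCyl f u) : ∃ C, ∀ t, 1 ≤ t → |circ u t| ≤ C * t := by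
  set B := circ (fun a b => ‖gc u a b‖) 1 + ∫ s in Ioi 1, circ (Adens f u) s with hB
  have hsu : Sm (strip (Ioi 0)) u := hF.conf.sm_u
  have hd : ∀ t ∈ Ici (1 : ℝ), |circ (pt u) t| ≤ B := by
    intro t ht
    have ht0 : 0 < t := lt_of_lt_of_le one_pos ht
    have h1 := norm_fc_gc_neg_le hF le_rfl ht
    rw [fc_zero_gc hF ht0, Complex.norm_real, Real.norm_eq_abs] at h1
    exact h1
  have hB0 : 0 ≤ B := (abs_nonneg _).trans (hd 1 self_mem_Ici)
  refine ⟨|circ u 1| + B, fun t ht => ?_⟩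
  have h3 := norm_image_sub_le_of_norm_deriv_le_segment' (f := circ u)
    (f' := circ (pt u)) (a := 1) (b := t) (C := B)
    (fun s hs => (hasDerivAt_circ hsu isOpen_Ioi
      (lt_of_lt_of_le one_pos hs.1)).hasDerivWithinAt)
    (fun s hs => hd s hs.1) t (right_mem_Icc.2 ht)
  rw [Real.norm_eq_abs] at h3
  have h4 := abs_sub_abs_le_abs_sub (circ u t) (circ u 1)
  nlinarith [abs_nonneg (circ u 1)]

/-- The Fourier modes of `u` grow slower than exponentially along a sequence. -/
lemma exists_fc_u_small (hF : FiniteCyl f u) (hk : 0 < k) {ε : ℝ} (hε : 0 < ε) (T : ℝ) :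
    ∃ t, T < t ∧ Real.exp (-(k * t)) * ‖fc k (fun a b => (u a b : ℂ)) t‖ < ε := by
  obtain ⟨C, hC⟩ := circ_u_lower hF
  have hk' : (1 : ℝ) ≤ k := by exact_mod_cast hk
  have hsu : Sm (strip (Ioi 0)) u := hF.conf.sm_u
  have h_int : IntegrableOn (fun t => circ (fun t θ => Real.exp (2 * u t θ)) t +
      C * (t * Real.exp (-t))) (Ioi 0) := by
    refine hF.int_u.add (Integrable.const_mul ?_ C)
    have := Real.GammaIntegral_convergent (show (0 : ℝ) < 2 by norm_num)
    refine this.congr_fun (fun t ht => ?_) measurableSet_Ioi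
    simp only
    rw [show (2 : ℝ) - 1 = 1 by norm_num, Real.rpow_one, mul_comm]
  obtain ⟨t, ht, hlt⟩ := exists_lt_of_integrableOn_Ioi h_int hε (max T 1)
  have ht1 : 1 < t := lt_of_le_of_lt (le_max_right _ _) ht
  have ht0 : 0 < t := by linarith
  refine ⟨t, lt_of_le_of_lt (le_max_left _ _) ht, lt_of_le_of_lt ?_ hlt⟩
  have cu := continuous_slice hsu ht0
  have h1 : ‖fc k (fun a b => (u a b : ℂ)) t‖ ≤
      circ (fun t θ => Real.exp (2 * u t θ)) t + C * t := by
    refine (norm_fc_le k).trans ?_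
    have h2 : circ (fun a b => ‖((u a b : ℝ) : ℂ)‖) t ≤
        circ (fun a b => Real.exp (2 * u a b) + -u a b) t := by
      refine circ_mono (Complex.continuous_ofReal.comp cu).norm (by fun_prop) fun θ => ?_
      rw [Complex.norm_real, Real.norm_eq_abs]
      have := Real.add_one_le_exp (2 * u t θ)
      have h0 := Real.exp_pos (2 * u t θ)
      rcases abs_cases (u t θ) with h | h <;> linarith
    refine h2.trans ?_
    have e : circ (fun a b => Real.exp (2 * u a b) + -u a b) t =
        circ (fun a b => Real.exp (2 * u a b)) t + -circ u t := by
      rw [circ_add (φ := fun a b => Real.exp (2 * u a b)) (ψ := fun a b => -u a b)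
        (by fun_prop) cu.neg]
      congr 1
      exact intervalIntegral.integral_neg
    rw [e]
    have := hC t ht1.le
    linarith [neg_abs_le (circ u t)]
  have hE : 0 ≤ circ (fun t θ => Real.exp (2 * u t θ)) t := circ_nonneg fun θ => (Real.exp_pos _).le
  have hCt : 0 ≤ C * t := (abs_nonneg _).trans (hC t ht1.le)
  have h5 : Real.exp (-(k * t)) ≤ Real.exp (-t) := by
    apply Real.exp_le_exp.2; nlinarith
  have h6 : Real.exp (-t) ≤ 1 := Real.exp_le_one_iff.2 (by linarith)
  have h7 := Real.exp_pos (-t)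
  calc _ ≤ Real.exp (-t) * (circ (fun t θ => Real.exp (2 * u t θ)) t + C * t) :=
        mul_le_mul h5 h1 (norm_nonneg _) h7.le
    _ ≤ _ := by nlinarith

lemma fc_gc_sub_conj (hF : FiniteCyl f u) (k : ℤ) (ht : 0 < t) :
    fc k (gc u) t = (starRingEnd ℂ) (fc (-k) (gc u) t) + 2 * k * fc k (fun a b => (u a b : ℂ)) t := by
  have hsu : Sm (strip (Ioi 0)) u := hF.conf.sm_u
  have hsg := sm_gc' hF
  have e1 : (starRingEnd ℂ) (fc (-k) (gc u) t) = fc k (fun a b => (starRingEnd ℂ) (gc u a b)) t := by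
    rw [fc, ← circ_conj]
    refine circ_congr fun θ => ?_
    rw [map_mul, ← Complex.exp_conj]
    congr 2
    simp
  have e2 : 2 * k * fc k (fun a b => (u a b : ℂ)) t =
      fc k (fun a b => (-2 * Complex.I) * pth (fun a b => (u a b : ℂ)) a b) t := by
    rw [fc_mul_left, fc_pth k (sm_ofReal hsu) isOpen_Ioi ht (fun θ => by rw [hF.per_u])]
    linear_combination (2 * k * fc k (fun a b => (u a b : ℂ)) t) * Complex.I_mul_I
  have c2 := continuous_slice ((sm_ofReal hsu).pth isOpen_halfPlane) ht
  have c1 := continuous_slice hsg ht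
  rw [e1, e2, ← fc_add k (Complex.continuous_conj.comp c1) (continuous_const.mul c2)]
  refine fc_congr k fun θ => ?_
  have e3 : pth (fun a b => (u a b : ℂ)) t θ = ((pth u t θ : ℝ) : ℂ) :=
    (hsu.hasDerivAt_pth isOpen_halfPlane (mem_halfPlane ht)).ofReal_comp.deriv
  rw [e3, gc, map_sub, map_mul, Complex.conj_I, Complex.conj_ofReal, Complex.conj_ofReal]
  ring

end GradientModes

section GradientLimit

variable {f : ℝ → ℝ → EuclideanSpace ℝ (Fin n)} {u : ℝ → ℝ → ℝ} {t : ℝ} {k : ℤ}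

/-- The total curvature of the end `(t, ∞) × S¹`. -/
def tail (f : ℝ → ℝ → EuclideanSpace ℝ (Fin n)) (u : ℝ → ℝ → ℝ) (t : ℝ) : ℝ :=
  ∫ s in Ioi t, circ (Adens f u) s

lemma tail_anti (hF : FiniteCyl f u) {a : ℝ} (ha : 0 ≤ a) (hat : a ≤ t) :
    tail f u t ≤ tail f u a :=
  setIntegral_mono_set (hF.int_A.mono_set (Ioi_subset_Ioi ha))
    (Eventually.of_forall fun _ => circ_Adens_nonneg f u _)
    (Ioi_subset_Ioi hat).eventuallyLE

lemma exists_tail_le (hF : FiniteCyl f u) {ε : ℝ} (hε : 0 < ε) :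
    ∃ a, 1 ≤ a ∧ ∀ t, a ≤ t → tail f u t ≤ ε := by
  have h1 := intervalIntegral_tendsto_integral_Ioi 0 hF.int_A tendsto_id
  have h2 : ∀ᶠ a in atTop, (∫ s in Ioi 0, circ (Adens f u) s) - ε <
      ∫ s in (0 : ℝ)..(id a), circ (Adens f u) s := h1.eventually_const_lt (by linarith)
  obtain ⟨a, ha, h1a⟩ := (h2.and (eventually_ge_atTop 1)).exists
  refine ⟨a, h1a, fun t hat => (tail_anti hF (by linarith) hat).trans ?_⟩
  have ha0 : 0 ≤ a := by linarith
  have h3 := intervalIntegral.integral_Ioi_sub_Ioi hF.int_A ha0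
  simp only [id] at ha
  rw [tail]
  linarith

lemma integral_circ_Adens_le_tail (hF : FiniteCyl f u) {a : ℝ} (ha : 0 < a) (hat : a ≤ t) :
    ∫ s in a..t, circ (Adens f u) s ≤ tail f u a := by
  have := integral_weight_circ_le hF (w := fun _ => 1) continuous_const ha hat fun _ _ => le_rfl
  simpa only [one_mul, tail] using this

lemma tail_nonneg (f : ℝ → ℝ → EuclideanSpace ℝ (Fin n)) (u : ℝ → ℝ → ℝ) (t : ℝ) :
    0 ≤ tail f u t :=
  setIntegral_nonneg measurableSet_Ioi fun _ _ => circ_Adens_nonneg f u _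

lemma exists_norm_fc_gc_neg_le (hF : FiniteCyl f u) {ε : ℝ} (hε : 0 < ε) :
    ∃ T, 1 ≤ T ∧ ∀ t, T ≤ t → ∀ k : ℤ, k ≤ -1 → ‖fc k (gc u) t‖ ≤ ε := by
  obtain ⟨a, ha, hta⟩ := exists_tail_le hF (half_pos hε)
  set C := circ (fun x b => ‖gc u x b‖) a with hC
  have hC0 : 0 ≤ C := circ_nonneg fun θ => norm_nonneg _
  have hlim : Tendsto (fun t : ℝ => Real.exp (-(t - a)) * C) atTop (nhds (0 * C)) := by
    refine Tendsto.mul_const _ (Real.tendsto_exp_neg_atTop_nhds_zero.comp ?_)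
    exact tendsto_atTop_add_const_right _ _ tendsto_id
  rw [zero_mul] at hlim
  obtain ⟨T, hT⟩ := eventually_atTop.1 (hlim.eventually_lt_const (half_pos hε))
  refine ⟨max T a, ha.trans (le_max_right _ _), fun t ht k hk => ?_⟩
  have hat : a ≤ t := (le_max_right _ _).trans ht
  have hk' : (k : ℝ) ≤ -1 := by exact_mod_cast hk
  have h1 := norm_fc_gc_le_fwd hF k (by linarith) hat
  have h2 := integral_weight_circ_le hF (w := fun s => Real.exp (k * (t - s))) (by fun_prop)
    (by linarith) hat fun s hs => Real.exp_le_one_iff.2 (by nlinarith [hs.2])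
  have h3 := hta a le_rfl
  have h4 : Real.exp (k * (t - a)) * ‖fc k (gc u) a‖ ≤ Real.exp (-(t - a)) * C :=
    mul_le_mul (Real.exp_le_exp.2 (by nlinarith)) (norm_fc_le k) (norm_nonneg _)
      (Real.exp_pos _).le
  have h5 := hT t ((le_max_left _ _).trans ht)
  rw [tail] at h3
  linarith

lemma norm_fc_gc_pos_le (hF : FiniteCyl f u) (hk : 0 < k) (ht : 0 < t) :
    ‖fc k (gc u) t‖ ≤ tail f u t := by
  refine le_of_forall_pos_le_add fun ε hε => ?_
  have hk' : (1 : ℝ) ≤ k := by exact_mod_cast hk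
  set C := circ (fun x b => ‖gc u x b‖) 1 + ∫ s in Ioi 1, circ (Adens f u) s with hC
  set E := Real.exp (k * t) with hE
  have hE0 : 0 < E := Real.exp_pos _
  have hC0 : 0 ≤ C := add_nonneg (circ_nonneg fun θ => norm_nonneg _) (tail_nonneg f u 1)
  have hlim : Tendsto (fun x : ℝ => E * (Real.exp (-x) * C)) atTop (nhds (E * (0 * C))) :=
    (Real.tendsto_exp_neg_atTop_nhds_zero.mul_const C).const_mul E
  rw [zero_mul, mul_zero] at hlim
  obtain ⟨T₀, hT₀⟩ := eventually_atTop.1 (hlim.eventually_lt_const (half_pos hε))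
  obtain ⟨T, hT, hTs⟩ := exists_fc_u_small hF hk (ε := ε / (4 * k * E)) (by positivity)
    (max T₀ (max 1 t))
  have hT1 : 1 ≤ T := ((le_max_left _ _).trans (le_max_right _ _)).trans hT.le
  have hTt : t ≤ T := ((le_max_right _ _).trans (le_max_right _ _)).trans hT.le
  have h1 := norm_fc_gc_le_bwd hF k ht hTt
  have h2 := integral_weight_circ_le hF (w := fun s => Real.exp (-(k * (s - t)))) (by fun_prop)
    ht hTt fun s hs => Real.exp_le_one_iff.2 (by nlinarith [hs.1])
  have h3 := hT₀ T ((le_max_left _ _).trans hT.le)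
  have h4 : ‖fc k (gc u) T‖ ≤ C + 2 * k * ‖fc k (fun a b => (u a b : ℂ)) T‖ := by
    rw [fc_gc_sub_conj hF k (by linarith)]
    refine (norm_add_le _ _).trans (add_le_add ?_ ?_)
    · rw [RCLike.norm_conj]
      exact norm_fc_gc_neg_le hF (by omega) hT1
    · rw [norm_mul, norm_mul, Complex.norm_intCast, Complex.norm_ofNat, abs_of_pos (by linarith)]
  have h5 : Real.exp (-(k * (T - t))) = E * Real.exp (-(k * T)) := by
    rw [hE, ← Real.exp_add]; ring_nf
  have h6 : Real.exp (-(k * T)) ≤ Real.exp (-T) := Real.exp_le_exp.2 (by nlinarith)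
  rw [h5] at h1
  have h7 : E * Real.exp (-(k * T)) * ‖fc k (gc u) T‖ ≤ ε := by
    have h8 := Real.exp_pos (-(k * T))
    have h9 : E * (Real.exp (-(k * T)) * C) ≤ E * (Real.exp (-T) * C) := by gcongr
    have h10 : 2 * k * E * (Real.exp (-(k * T)) * ‖fc k (fun a b => (u a b : ℂ)) T‖) ≤
        2 * k * E * (ε / (4 * k * E)) := by gcongr
    have h11 : 2 * k * E * (ε / (4 * k * E)) = ε / 2 := by field_simp; norm_num
    calc _ ≤ E * Real.exp (-(k * T)) * (C + 2 * k * ‖fc k (fun a b => (u a b : ℂ)) T‖) := by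
          gcongr
      _ = E * (Real.exp (-(k * T)) * C) +
          2 * k * E * (Real.exp (-(k * T)) * ‖fc k (fun a b => (u a b : ℂ)) T‖) := by ring
      _ ≤ ε := by linarith
  rw [tail]
  linarith

lemma exists_tendsto_circ_pt_u (hF : FiniteCyl f u) :
    ∃ m : ℝ, Tendsto (circ (pt u)) atTop (nhds (-(2 * π * m))) := by
  have hd : ∀ t ∈ Ioi (1 : ℝ), HasDerivAt (fc 0 (gc u)) (fc 0 (dbar (gc u)) t) t := by
    intro t ht
    refine (hasDerivAt_fc_gc hF 0 (lt_trans one_pos ht)).congr_deriv (by simp)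
  have hi : IntegrableOn (fc 0 (dbar (gc u))) (Ioi 1) := by
    refine Integrable.mono' (hF.int_A.mono_set (Ioi_subset_Ioi zero_le_one)) ?_ ?_
    · refine ContinuousOn.aestronglyMeasurable ?_ measurableSet_Ioi
      exact (continuousOn_fc_of_continuousOn 0 isOpen_Ioi (sm_dbar_gc hF).continuousOn).mono
        (Ioi_subset_Ioi zero_le_one)
    · refine (ae_restrict_iff' measurableSet_Ioi).2 (Eventually.of_forall fun t ht => ?_)
      exact norm_fc_dbar_gc_le hF 0 (lt_trans one_pos ht)
  have h1 := tendsto_limUnder_of_hasDerivAt_of_integrableOn_Ioi hd hi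
  set L := limUnder atTop (fc 0 (gc u))
  refine ⟨-(L.re / (2 * π)), ?_⟩
  have h2 : Tendsto (fun t => (fc 0 (gc u) t).re) atTop (nhds L.re) :=
    (Complex.continuous_re.tendsto L).comp h1
  have e : -(2 * π * -(L.re / (2 * π))) = L.re := by field_simp [pi_ne_zero]; 
  rw [e]
  refine h2.congr' ?_
  filter_upwards [eventually_gt_atTop 0] with t ht
  rw [fc_zero_gc hF ht, Complex.ofReal_re]

lemma fc_const (hk : k ≠ 0) (c : ℂ) (t : ℝ) : fc k (fun _ _ => c) t = 0 := by
  have h := fc_pth k (φ := fun _ _ => c) (I := univ) (t := t) contDiffOn_const isOpen_univ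
    (mem_univ _) fun θ => rfl
  have h0 : fc k (pth fun _ _ => c) t = 0 := by
    simp [fc, circ, pth]
  rw [h0] at h
  have : (k : ℂ) * Complex.I ≠ 0 := mul_ne_zero (by exact_mod_cast hk) Complex.I_ne_zero
  exact (mul_eq_zero.1 h.symm).resolve_left this

lemma exists_circ_u_sub_mean_le (hF : FiniteCyl f u) {ε : ℝ} (hε : 0 < ε) :
    ∃ T, 1 ≤ T ∧ ∀ t, T ≤ t → circ (fun a b => |u a b - circ u a / (2 * π)|) t ≤ ε := by
  set S := ∑' k : ℤ, 1 / (k : ℝ) ^ 2 with hS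
  have hsum : Summable fun k : ℤ => 1 / (k : ℝ) ^ 2 :=
    Real.summable_one_div_int_pow.2 one_lt_two
  have hS0 : 0 ≤ S := tsum_nonneg fun k => by positivity
  obtain ⟨η, hη0, hη⟩ : ∃ η, 0 < η ∧ η ^ 2 * S ≤ ε ^ 2 := by
    refine ⟨ε / (1 + S), by positivity, ?_⟩
    have h1 : S ≤ (1 + S) ^ 2 := by nlinarith
    rw [div_pow, div_mul_eq_mul_div, div_le_iff₀ (by positivity)]
    nlinarith [sq_nonneg ε]
  obtain ⟨T₁, hT₁, hneg⟩ := exists_norm_fc_gc_neg_le hF hη0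
  obtain ⟨T₂, hT₂, htail⟩ := exists_tail_le hF hη0
  refine ⟨max T₁ T₂, hT₁.trans (le_max_left _ _), fun t ht => ?_⟩
  have ht1 : T₁ ≤ t := (le_max_left _ _).trans ht
  have ht2 : T₂ ≤ t := (le_max_right _ _).trans ht
  have ht0 : 0 < t := by linarith
  have hsu : Sm (strip (Ioi 0)) u := hF.conf.sm_u
  have cu := continuous_slice hsu ht0
  have hpi := pi_pos
  set c : ℝ := circ u t / (2 * π) with hc
  have cφ : Continuous fun b => ((u t b : ℝ) : ℂ) + ((-c : ℝ) : ℂ) := by fun_prop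
  have hmode : ∀ k : ℤ, ‖fc k (fun a b => ((u a b : ℝ) : ℂ) + ((-c : ℝ) : ℂ)) t‖ ^ 2 ≤
      η ^ 2 * (1 / (k : ℝ) ^ 2) := by
    intro k
    rw [fc_add (φ := fun a b => ((u a b : ℝ) : ℂ)) (ψ := fun _ _ => ((-c : ℝ) : ℂ)) k
      (Complex.continuous_ofReal.comp cu) continuous_const]
    rcases eq_or_ne k 0 with rfl | hk
    · have e1 : fc 0 (fun a b => ((u a b : ℝ) : ℂ)) t = ((circ u t : ℝ) : ℂ) := by
        rw [← circ_ofReal]; exact circ_congr fun θ => by simp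
      have e2 : fc 0 (fun _ _ => ((-c : ℝ) : ℂ)) t = ((2 * π * (-c) : ℝ) : ℂ) := by
        rw [show fc 0 (fun _ _ => ((-c : ℝ) : ℂ)) t = circ (fun _ _ => ((-c : ℝ) : ℂ)) t from
          circ_congr fun θ => by simp, circ_const]
        simp
      rw [e1, e2, ← Complex.ofReal_add, hc]
      have : circ u t + 2 * π * (-(circ u t / (2 * π))) = 0 := by field_simp; ring
      rw [this]; simp
    rw [fc_const hk, add_zero]
    have hall : ∀ j : ℤ, j ≠ 0 → ‖fc j (gc u) t‖ ≤ η := fun j hj => by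
      rcases lt_or_gt_of_ne hj with h | h
      · exact hneg t ht1 j (by omega)
      · exact (norm_fc_gc_pos_le hF h ht0).trans (htail t ht2)
    have h1 := fc_gc_sub_conj hF k ht0
    have h2 : 2 * |(k : ℝ)| * ‖fc k (fun a b => ((u a b : ℝ) : ℂ)) t‖ ≤ 2 * η := by
      have : ‖2 * (k : ℂ) * fc k (fun a b => ((u a b : ℝ) : ℂ)) t‖ =
          2 * |(k : ℝ)| * ‖fc k (fun a b => ((u a b : ℝ) : ℂ)) t‖ := by
        rw [norm_mul, norm_mul, Complex.norm_intCast, Complex.norm_ofNat]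
      rw [← this, show 2 * (k : ℂ) * fc k (fun a b => ((u a b : ℝ) : ℂ)) t =
        fc k (gc u) t - (starRingEnd ℂ) (fc (-k) (gc u) t) by rw [h1]; ring]
      refine (norm_sub_le _ _).trans ?_
      rw [RCLike.norm_conj]
      linarith [hall k hk, hall (-k) (by omega)]
    have hk0 : (k : ℝ) ≠ 0 := by exact_mod_cast hk
    rw [← sq_abs (k : ℝ), mul_one_div, ← div_pow]
    refine pow_le_pow_left₀ (norm_nonneg _) ?_ 2
    rw [le_div_iff₀ (abs_pos.2 hk0)]
    linarith
  have hP := hasSum_norm_sq_fc (φ := fun a b => ((u a b : ℝ) : ℂ) + ((-c : ℝ) : ℂ)) (t := t) cφ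
  have h3 := hasSum_le hmode hP (hsum.hasSum.mul_left (η ^ 2))
  have h4 : circ (fun a b => |u a b - circ u a / (2 * π)|) t ≤
      circ (fun a b => (π / ε) * ‖((u a b : ℝ) : ℂ) + ((-c : ℝ) : ℂ)‖ ^ 2 + ε / (4 * π)) t := by
    refine circ_mono (by fun_prop) (by fun_prop) fun θ => ?_
    have e : ‖((u t θ : ℝ) : ℂ) + ((-c : ℝ) : ℂ)‖ = |u t θ - circ u t / (2 * π)| := by
      rw [← Complex.ofReal_add, Complex.norm_real, Real.norm_eq_abs, hc]; ring_nf
    rw [e]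
    set x := |u t θ - circ u t / (2 * π)|
    have : (π / ε) * x ^ 2 + ε / (4 * π) - x = (2 * π * x - ε) ^ 2 / (4 * π * ε) := by
      field_simp; ring
    have h5 : 0 ≤ (2 * π * x - ε) ^ 2 / (4 * π * ε) := by positivity
    linarith
  rw [circ_add (φ := fun a b => (π / ε) * ‖((u a b : ℝ) : ℂ) + ((-c : ℝ) : ℂ)‖ ^ 2)
    (ψ := fun _ _ => ε / (4 * π)) (by fun_prop) continuous_const, circ_const_mul, circ_const] at h4
  have h6 : 2 * π * circ (fun a b => ‖((u a b : ℝ) : ℂ) + ((-c : ℝ) : ℂ)‖ ^ 2) t ≤ ε ^ 2 :=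
    h3.trans hη
  refine h4.trans ?_
  rw [smul_eq_mul]
  have e : 2 * π * (ε / (4 * π)) = ε / 2 := by field_simp; norm_num
  have e2 : π / ε * circ (fun a b => ‖((u a b : ℝ) : ℂ) + ((-c : ℝ) : ℂ)‖ ^ 2) t ≤ ε / 2 := by
    rw [div_mul_eq_mul_div, div_le_iff₀ hε]
    nlinarith
  linarith

end GradientLimit

section GradientBound

variable {f : ℝ → ℝ → EuclideanSpace ℝ (Fin n)} {u : ℝ → ℝ → ℝ}

lemma disc_subset_halfPlane {p : ℝ × ℝ} {R : ℝ} (hR : 0 ≤ R) (hp : R ≤ p.1) :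
    disc p R ⊆ halfPlane := by
  intro q hq
  have h1 : (q.1 - p.1) ^ 2 < R ^ 2 := by
    have : (q.1 - p.1) ^ 2 + (q.2 - p.2) ^ 2 < R ^ 2 := hq
    nlinarith [sq_nonneg (q.2 - p.2)]
  have h2 := abs_lt_of_sq_lt_sq h1 hR
  have h3 : 0 < q.1 := by linarith [(abs_lt.1 h2).1]
  exact h3

lemma exists_circ_affine_le {m : ℝ} (hF : FiniteCyl f u)
    (hm : Tendsto (circ (pt u)) atTop (nhds (-(2 * π * m)))) {ε : ℝ} (hε : 0 < ε) :
    ∃ T, 2 ≤ T ∧ ∀ t₀, T ≤ t₀ → ∃ c : ℝ, ∀ t ∈ Icc (t₀ - 1) (t₀ + 1),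
      circ (fun a b => |u a b + m * a - c|) t ≤ ε := by
  obtain ⟨T₁, hT₁, h1⟩ := exists_circ_u_sub_mean_le hF (half_pos hε)
  have hm' : Tendsto (fun t => |circ (pt u) t + 2 * π * m|) atTop (nhds 0) := by
    have := (hm.add_const (2 * π * m)).abs
    simpa using this
  obtain ⟨T₂, hT₂⟩ := eventually_atTop.1 (hm'.eventually_lt_const (half_pos hε))
  refine ⟨max T₁ T₂ + 1, by linarith [le_max_left T₁ T₂], fun t₀ ht₀ => ?_⟩
  refine ⟨circ u t₀ / (2 * π) + m * t₀, fun t ht => ?_⟩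
  have hpi := pi_pos
  have hsu : Sm (strip (Ioi 0)) u := hF.conf.sm_u
  have hl := le_max_left T₁ T₂
  have hr := le_max_right T₁ T₂
  have htT : T₁ ≤ t := by linarith [ht.1]
  have ht0 : 0 < t := by linarith
  have cu := continuous_slice hsu ht0
  have hmv := Convex.norm_image_sub_le_of_norm_hasDerivWithin_le (s := Icc (t₀ - 1) (t₀ + 1))
    (f := fun t => circ u t + 2 * π * m * t) (f' := fun t => circ (pt u) t + 2 * π * m)
    (C := ε / 2) (x := t₀) (y := t)
    (fun s hs => by
      have hs0 : 0 < s := by linarith [hs.1]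
      refine ((hasDerivAt_circ hsu isOpen_Ioi hs0).add
        ((hasDerivAt_id s).const_mul (2 * π * m))).hasDerivWithinAt.congr_deriv (by simp))
    (fun s hs => (hT₂ s (by linarith [hs.1])).le) (convex_Icc _ _)
    ⟨by linarith, by linarith⟩ ht
  have habs : ‖t - t₀‖ ≤ 1 := by
    rw [Real.norm_eq_abs, abs_le]; constructor <;> linarith [ht.1, ht.2]
  have hmv2 : |circ u t + 2 * π * m * t - (circ u t₀ + 2 * π * m * t₀)| ≤ ε / 2 := by
    refine hmv.trans ?_
    nlinarith [norm_nonneg (t - t₀)]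
  set d := circ u t / (2 * π) + m * t - (circ u t₀ / (2 * π) + m * t₀) with hd
  have hd2 : 2 * π * |d| ≤ ε / 2 := by
    rw [show circ u t + 2 * π * m * t - (circ u t₀ + 2 * π * m * t₀) = 2 * π * d by
      rw [hd]; field_simp, abs_mul, abs_of_pos (by linarith)] at hmv2
    exact hmv2
  have h2 : circ (fun a b => |u a b + m * a - (circ u t₀ / (2 * π) + m * t₀)|) t ≤
      circ (fun a b => |u a b - circ u a / (2 * π)| + |d|) t := by
    refine circ_mono (by fun_prop) (by fun_prop) fun θ => ?_
    rw [show u t θ + m * t - (circ u t₀ / (2 * π) + m * t₀) =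
      (u t θ - circ u t / (2 * π)) + d by rw [hd]; ring]
    exact abs_add_le _ _
  rw [circ_add (φ := fun a b => |u a b - circ u a / (2 * π)|) (ψ := fun _ _ => |d|)
    (by fun_prop) continuous_const, circ_const, smul_eq_mul] at h2
  linarith [h1 t htT]

lemma discInt_norm_dbar_gc_le (hF : FiniteCyl f u) {p : ℝ × ℝ} {ρ : ℝ} (hρ : 0 < ρ) (hρ1 : ρ ≤ 3)
    (hp : ρ < p.1) : discInt (fun a b => ‖dbar (gc u) a b‖) p ρ ≤ tail f u (p.1 - ρ) := by
  have hc : ContinuousOn (fun q : ℝ × ℝ => ‖dbar (gc u) q.1 q.2‖) halfPlane :=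
    (sm_dbar_gc hF).continuousOn.norm
  have hper : ∀ t, 0 < t → ∀ θ, dbar (gc u) t (θ + 2 * π) = dbar (gc u) t θ := fun t ht θ => by
    rw [dbar, dbar, periodic_pt (fun t ht => periodic_gc hF ht) ht,
      periodic_pth (fun t ht => periodic_gc hF ht) ht]
  have h1 := discInt_le_integral_circ (F := fun a b => ‖dbar (gc u) a b‖) hc
    (fun a b => norm_nonneg _) (fun t ht θ => by rw [hper t ht]) hρ
    (hρ1.trans pi_gt_three.le) hp
  refine h1.trans (le_trans ?_ (integral_circ_Adens_le_tail hF (by linarith)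
    (show p.1 - ρ ≤ p.1 + ρ by linarith)))
  have hsub : Icc (p.1 - ρ) (p.1 + ρ) ⊆ Ioi 0 := fun x hx => lt_of_lt_of_le (by linarith) hx.1
  have hle : p.1 - ρ ≤ p.1 + ρ := by linarith
  refine intervalIntegral.integral_mono_on hle ?_ ?_ fun s hs =>
    circ_norm_dbar_gc_le hF (hsub hs)
  · refine ContinuousOn.intervalIntegrable ?_
    rw [uIcc_of_le hle]
    exact (continuousOn_circ_of_continuousOn isOpen_Ioi hc).mono hsub
  · refine ContinuousOn.intervalIntegrable ?_
    rw [uIcc_of_le hle]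
    exact (continuousOn_circ_Adens hF).mono hsub

/-- The gradient of `u + m t` is small far out, up to local curvature terms. -/
lemma exists_norm_gc_add_le {m : ℝ} (hF : FiniteCyl f u)
    (hm : Tendsto (circ (pt u)) atTop (nhds (-(2 * π * m)))) {ε : ℝ} (hε : 0 < ε) :
    ∃ T, 2 ≤ T ∧ ∀ p : ℝ × ℝ, T ≤ p.1 → ∀ s Λ : ℝ, 0 < s →
      (∀ q ∈ disc p s, ‖dbar (gc u) q.1 q.2‖ ≤ Λ) →
      ‖gc u p.1 p.2 + m‖ ≤ ε + Λ * s + ε / s := by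
  have hpi := pi_gt_three
  obtain ⟨T₁, hT₁, h1⟩ := exists_circ_affine_le hF hm (show 0 < ε / 8 by linarith)
  obtain ⟨T₂, hT₂, h2⟩ := exists_tail_le hF hε
  refine ⟨max T₁ (T₂ + 1), hT₁.trans (le_max_left _ _), fun p hp s Λ hs hΛ => ?_⟩
  have hp1 : T₁ ≤ p.1 := (le_max_left _ _).trans hp
  have hp2 : T₂ + 1 ≤ p.1 := (le_max_right _ _).trans hp
  obtain ⟨c, hc⟩ := h1 p.1 hp1
  have hsu : Sm halfPlane u := hF.conf.sm_u
  set v : ℝ → ℝ → ℝ := fun a b => u a b + m * a - c with hv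
  have hsv : Sm halfPlane v := by
    have hl : Sm halfPlane fun a _ => m * a - c := by
      refine ContDiff.contDiffOn ?_
      fun_prop
    refine (hsu.add hl).congr fun q _ => ?_
    simp only [hv]; ring
  have hg := sm_gc' hF
  have hψ : Sm halfPlane fun a b => gc u a b + (m : ℂ) := Sm.add hg (sm_const _)
  have hd : disc p 1 ⊆ halfPlane := disc_subset_halfPlane zero_le_one (by linarith)
  have hdb : ∀ q : ℝ × ℝ, dbar (fun a b => gc u a b + (m : ℂ)) q.1 q.2 = dbar (gc u) q.1 q.2 := by
    intro q
    simp only [dbar, pt, pth, deriv_add_const]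
  have e1 := norm_le_of_dbar_eq_conj (h := fun a b => ((v a b : ℝ) : ℂ)) (R := 1) (ρ := 1 / 2)
    (Λ := Λ) (sm_ofReal hsv) hψ isOpen_halfPlane hd hs (by norm_num) (by norm_num)
    (fun q hq => by rw [hdb]; exact hΛ q hq)
    (fun q hq => by
      have hm' := hd hq
      have d1 : HasDerivAt (fun a : ℝ => u a q.2 + m * a - c) (pt u q.1 q.2 + m * 1) q.1 :=
        ((hsu.hasDerivAt_pt isOpen_halfPlane hm').add ((hasDerivAt_id q.1).const_mul m)).sub_const c
      have d2 : HasDerivAt (fun b : ℝ => u q.1 b + m * q.1 - c) (pth u q.1 q.2) q.2 :=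
        ((hsu.hasDerivAt_pth isOpen_halfPlane hm').add_const _).sub_const c
      have e2 : pt (fun a b => ((v a b : ℝ) : ℂ)) q.1 q.2 = ((pt u q.1 q.2 + m * 1 : ℝ) : ℂ) :=
        d1.ofReal_comp.deriv
      have e3 : pth (fun a b => ((v a b : ℝ) : ℂ)) q.1 q.2 = ((pth u q.1 q.2 : ℝ) : ℂ) :=
        d2.ofReal_comp.deriv
      rw [dbar, e2, e3, gc]
      simp only [map_add, map_sub, map_mul, Complex.conj_I, Complex.conj_ofReal,
        Complex.ofReal_add, Complex.ofReal_mul, Complex.ofReal_one]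
      ring)
  have b1 : discInt (fun a b => ‖((v a b : ℝ) : ℂ)‖) p (1 / 2) ≤ ε / 8 := by
    have hcont : ContinuousOn (fun q : ℝ × ℝ => ‖((v q.1 q.2 : ℝ) : ℂ)‖) halfPlane :=
      (sm_ofReal hsv).continuousOn.norm
    refine (discInt_le_integral_circ (F := fun a b => ‖((v a b : ℝ) : ℂ)‖) hcont
      (fun _ _ => norm_nonneg _) (fun t _ θ => by simp only [hv, hF.per_u]) (by norm_num)
      (by linarith) (by linarith)).trans ?_
    have hle : p.1 - 1 / 2 ≤ p.1 + 1 / 2 := by linarith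
    have hsub : Icc (p.1 - 1 / 2) (p.1 + 1 / 2) ⊆ Ioi 0 :=
      fun x hx => lt_of_lt_of_le (by linarith) hx.1
    have := intervalIntegral.integral_mono_on (μ := volume) (a := p.1 - 1 / 2) (b := p.1 + 1 / 2)
      (f := circ fun a b => ‖((v a b : ℝ) : ℂ)‖) (g := fun _ => ε / 8) hle
      (by
        refine ContinuousOn.intervalIntegrable ?_
        rw [uIcc_of_le hle]
        exact (continuousOn_circ_of_continuousOn isOpen_Ioi hcont).mono hsub)
      (continuous_const.intervalIntegrable _ _)
      (fun t ht => by
        have h := hc t ⟨by linarith [ht.1], by linarith [ht.2]⟩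
        refine le_trans (le_of_eq (circ_congr fun θ => ?_)) h
        rw [Complex.norm_real, Real.norm_eq_abs])
    refine this.trans (le_of_eq ?_)
    rw [intervalIntegral.integral_const, smul_eq_mul]; ring
  have b2 : discInt (fun a b => ‖dbar (fun a b => gc u a b + (m : ℂ)) a b‖) p (1 / 2) ≤ ε := by
    have e : (fun a b => ‖dbar (fun a b => gc u a b + (m : ℂ)) a b‖) =
        fun a b => ‖dbar (gc u) a b‖ := by
      funext a b; rw [hdb (a, b)]
    rw [e]
    refine (discInt_norm_dbar_gc_le hF (by norm_num) (by norm_num) (by linarith)).trans ?_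
    exact h2 _ (by linarith)
  refine e1.trans ?_
  have c1 : 3 / (π * (1 / 2 : ℝ) ^ 3) * discInt (fun a b => ‖((v a b : ℝ) : ℂ)‖) p (1 / 2) ≤ ε := by
    rw [div_mul_eq_mul_div, div_le_iff₀ (by positivity)]
    nlinarith
  have c2 : discInt (fun a b => ‖dbar (fun a b => gc u a b + (m : ℂ)) a b‖) p (1 / 2) /
      (2 * π * s) ≤ ε / s := by
    rw [div_le_div_iff₀ (by positivity) hs]
    have h5 : 0 < ε * s := by positivity
    have h6 : discInt (fun a b => ‖dbar (fun a b => gc u a b + (m : ℂ)) a b‖) p (1 / 2) * s ≤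
      ε * s := mul_le_mul_of_nonneg_right b2 hs.le
    nlinarith
  linarith

end GradientBound

section LocalRegularity

variable {f : ℝ → ℝ → EuclideanSpace ℝ (Fin n)} {u : ℝ → ℝ → ℝ} {U : Set (ℝ × ℝ)}
  {p : ℝ × ℝ} {R ρ : ℝ}

lemma discInt_le_affine {F G : ℝ → ℝ → ℝ} {l c : ℝ}
    (hF : ContinuousOn (fun q : ℝ × ℝ => F q.1 q.2) U)
    (hG : ContinuousOn (fun q : ℝ × ℝ => G q.1 q.2) U) (hd : disc p R ⊆ U) (hρ0 : 0 < ρ)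
    (hρ : ρ < R) (h : ∀ q ∈ disc p R, F q.1 q.2 ≤ l * G q.1 q.2 + c) :
    discInt F p ρ ≤ l * discInt G p ρ + c * (π * ρ ^ 2) := by
  have hsub : Icc 0 ρ ⊆ Ioo (-R) R := fun x hx => ⟨by linarith [hx.1, hx.2], by linarith [hx.2]⟩
  have cF := continuousOn_polar hF hd
  have cG := continuousOn_polar hG hd
  have dF := (continuousOn_circ_of_continuousOn isOpen_Ioo cF).mono hsub
  have dG := (continuousOn_circ_of_continuousOn isOpen_Ioo cG).mono hsub
  have sl : ∀ {φ : ℝ → ℝ → ℝ}, ContinuousOn (fun q : ℝ × ℝ => φ q.1 q.2) (strip (Ioo (-R) R)) →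
      ∀ r ∈ Ioo (-R) R, Continuous (φ r) := fun {φ} hφ r hr =>
    hφ.comp_continuous (f := fun θ : ℝ => (r, θ)) (by fun_prop) fun θ => hr
  have iF : IntervalIntegrable (fun r => r * circ (polar F p) r) volume 0 ρ :=
    ContinuousOn.intervalIntegrable (by rw [uIcc_of_le hρ0.le]; exact continuousOn_id.mul dF)
  have iG : IntervalIntegrable (fun r => r * circ (polar G p) r) volume 0 ρ :=
    ContinuousOn.intervalIntegrable (by rw [uIcc_of_le hρ0.le]; exact continuousOn_id.mul dG)
  have i2 : IntervalIntegrable (fun r : ℝ => r * (2 * π * c)) volume 0 ρ :=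
    (by fun_prop : Continuous fun r : ℝ => r * (2 * π * c)).intervalIntegrable _ _
  have e : l * discInt G p ρ + c * (π * ρ ^ 2) =
      ∫ r in (0 : ℝ)..ρ, (l * (r * circ (polar G p) r) + r * (2 * π * c)) := by
    rw [intervalIntegral.integral_add (iG.const_mul l) i2, intervalIntegral.integral_const_mul,
      intervalIntegral.integral_mul_const, integral_id, discInt]
    ring
  rw [e, discInt]
  refine intervalIntegral.integral_mono_on hρ0.le iF ((iG.const_mul l).add i2) fun r hr => ?_
  have hr' := hsub hr
  have c1 : circ (polar F p) r ≤ circ (fun a b => l * polar G p a b + c) r :=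
    circ_mono (sl cF r hr') ((continuous_const.mul (sl cG r hr')).add continuous_const)
      fun θ => h _ (polar_mem_disc hr')
  have c2 : circ (fun a b => l * polar G p a b + c) r = l * circ (polar G p) r + 2 * π * c := by
    have := circ_add (φ := fun a b => l * polar G p a b) (ψ := fun _ _ => c) (t := r)
      (continuous_const.mul (sl cG r hr')) continuous_const
    rw [this, circ_const, circ, intervalIntegral.integral_const_mul, smul_eq_mul, circ]
  rw [c2] at c1
  nlinarith [mul_le_mul_of_nonneg_left c1 hr.1]

lemma norm_le_of_affine {ψ : ℝ → ℝ → ℂ} {G : ℝ → ℝ → ℝ} {l c Λ : ℝ} (hψ : Sm U ψ) (hU : IsOpen U)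
    (hG : ContinuousOn (fun q : ℝ × ℝ => G q.1 q.2) U) (hd : disc p R ⊆ U) (hρ0 : 0 < ρ)
    (hρ : ρ < R) (h : ∀ q ∈ disc p R, ‖ψ q.1 q.2‖ ≤ l * G q.1 q.2 + c)
    (hΛ : ∀ q ∈ disc p R, ‖dbar ψ q.1 q.2‖ ≤ Λ) :
    ‖ψ p.1 p.2‖ ≤ l * discInt G p ρ / (π * ρ ^ 2) + c + 2 * Λ * ρ := by
  have hp : p ∈ disc p R := by
    simp only [disc, Set.mem_ofPred_eq, sub_self]; nlinarith
  have hΛ0 : 0 ≤ Λ := (norm_nonneg _).trans (hΛ p hp)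
  have hpi := pi_pos
  have h1 := mul_norm_le_discInt hψ hU hd hρ0 le_rfl hρ fun q hq =>
    hΛ q (disc_mono hρ0.le hρ.le hq)
  have h2 := discInt_le_affine (F := fun a b => ‖ψ a b‖) hψ.continuousOn.norm hG hd hρ0 hρ h
  have h3 := discInt_le_affine (F := fun a b => ‖dbar ψ a b‖) (G := fun _ _ => (0 : ℝ)) (l := 0)
    (hψ.dbar hU).continuousOn.norm continuousOn_const hd hρ0 hρ
    (fun q hq => by simpa using hΛ q hq)
  have e : l * discInt G p ρ / (π * ρ ^ 2) + c + 2 * Λ * ρ =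
      (l * discInt G p ρ + (c + 2 * Λ * ρ) * (π * ρ ^ 2)) / (π * ρ ^ 2) := by
    field_simp
    ring
  rw [e, le_div_iff₀ (by positivity)]
  have h4 : ρ ^ 2 / (2 * ρ) * discInt (fun a b => ‖dbar ψ a b‖) p ρ ≤
      ρ ^ 2 / (2 * ρ) * (Λ * (π * ρ ^ 2)) := by
    refine mul_le_mul_of_nonneg_left (by linarith) (by positivity)
  have h5 : ρ ^ 2 / (2 * ρ) * (Λ * (π * ρ ^ 2)) = Λ * ρ * (π * ρ ^ 2) / 2 := by
    field_simp
  have h6 : 0 ≤ Λ * ρ * (π * ρ ^ 2) := by positivity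
  nlinarith

lemma discInt_Adens_le (hF : FiniteCyl f u) (hρ : 0 < ρ) (hρ1 : ρ ≤ 3) (hp : ρ < p.1) :
    discInt (Adens f u) p ρ ≤ tail f u (p.1 - ρ) := by
  have hper : ∀ t, 0 < t → ∀ θ, Adens f u t (θ + 2 * π) = Adens f u t θ := by
    intro t ht θ
    have hp' := fun t ht => periodic_pt (fun t _ => hF.per_f t) (t := t) ht
    have hq' := fun t ht => periodic_pth (fun t _ => hF.per_f t) (t := t) ht
    have a1 : ∀ θ, pt u t (θ + 2 * π) = pt u t θ := periodic_pt (fun t _ => hF.per_u t) ht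
    have a2 : ∀ θ, pth u t (θ + 2 * π) = pth u t θ := periodic_pth (fun t _ => hF.per_u t) ht
    simp only [Adens, Asq, Att, Atth, Athth, a1, a2, hF.per_u, hp' t ht, hq' t ht,
      periodic_pt hp' ht, periodic_pth hq' ht, periodic_pt hq' ht]
  refine (discInt_le_integral_circ (sm_Adens hF.conf isOpen_halfPlane).continuousOn
    (Adens_nonneg f u) hper hρ (hρ1.trans pi_gt_three.le) hp).trans ?_
  exact integral_circ_Adens_le_tail hF (by linarith) (by linarith)

lemma norm_sq_add_le_of_cx {a b : ℝ → ℝ → EuclideanSpace ℝ (Fin n)} {t θ B : ℝ}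
    (h : ∀ j, ‖cx a b j t θ‖ ≤ B) : ‖a t θ‖ ^ 2 + ‖b t θ‖ ^ 2 ≤ n * B ^ 2 := by
  rw [← sum_norm_sq_cx]
  refine (Finset.sum_le_card_nsmul _ _ (B ^ 2) fun j _ => ?_).trans (by simp)
  exact pow_le_pow_left₀ (norm_nonneg _) (h j) 2

lemma aa_le_of_cx {t θ B : ℝ} (hB : 0 ≤ B) (h1 : ∀ j, ‖cx (vh f u) (fun _ _ => 0) j t θ‖ ≤ B)
    (h2 : ∀ j, ‖cx (vp f u) (vq f u) j t θ‖ ≤ B) : aa f u t θ ≤ 2 * (n + 1) * B := by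
  have e1 := norm_sq_add_le_of_cx h1
  have e2 := norm_sq_add_le_of_cx h2
  simp only [norm_zero] at e1
  have := aa_sq_eq f u t θ
  refine abs_le_of_sq_le_sq' ?_ (by positivity) |>.2
  have hn : (0 : ℝ) ≤ n := by positivity
  have hB2 := sq_nonneg B
  have h3 : 0 ≤ (n : ℝ) * B ^ 2 := by positivity
  have h4 : 0 ≤ (n : ℝ) * ((n : ℝ) * B ^ 2) := by positivity
  have h5 : (2 * (n + 1) * B) ^ 2 = 4 * (n * (n * B ^ 2)) + 8 * (n * B ^ 2) + 4 * B ^ 2 := by ring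
  linarith

lemma yy_le_of_cx {t θ B : ℝ} (hB : 0 ≤ B)
    (h : ∀ j, ‖cx (vy1 f u) (vy2 f u) j t θ‖ ≤ B) : yy f u t θ ≤ 2 * (n + 1) * B := by
  have e1 := norm_sq_add_le_of_cx h
  refine abs_le_of_sq_le_sq' ?_ (by positivity) |>.2
  have hn : (0 : ℝ) ≤ n := by positivity
  have hB2 := sq_nonneg B
  have h3 : 0 ≤ (n : ℝ) * B ^ 2 := by positivity
  have h4 : 0 ≤ (n : ℝ) * ((n : ℝ) * B ^ 2) := by positivity
  have h5 : (2 * (n + 1) * B) ^ 2 = 4 * (n * (n * B ^ 2)) + 8 * (n * B ^ 2) + 4 * B ^ 2 := by ring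
  have h6 : yy f u t θ ^ 2 ≤ 2 * (‖vy1 f u t θ‖ ^ 2 + ‖vy2 f u t θ‖ ^ 2) := by
    rw [yy]; nlinarith [sq_nonneg (‖vy1 f u t θ‖ - ‖vy2 f u t θ‖)]
  linarith

lemma disc_subset_disc {q : ℝ × ℝ} {r s : ℝ} (hr : 0 ≤ r) (hs : 0 ≤ s) (hq : q ∈ disc p s) :
    disc q r ⊆ disc p (s + r) := by
  intro x hx
  have h1 : (q.1 - p.1) ^ 2 + (q.2 - p.2) ^ 2 < s ^ 2 := hq
  have h2 : (x.1 - q.1) ^ 2 + (x.2 - q.2) ^ 2 < r ^ 2 := hx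
  show (x.1 - p.1) ^ 2 + (x.2 - p.2) ^ 2 < (s + r) ^ 2
  have h3 : ((q.1 - p.1) * (x.1 - q.1) + (q.2 - p.2) * (x.2 - q.2)) ^ 2 ≤ (s * r) ^ 2 := by
    have : ((q.1 - p.1) * (x.1 - q.1) + (q.2 - p.2) * (x.2 - q.2)) ^ 2 ≤
        ((q.1 - p.1) ^ 2 + (q.2 - p.2) ^ 2) * ((x.1 - q.1) ^ 2 + (x.2 - q.2) ^ 2) := by
      nlinarith [sq_nonneg ((q.1 - p.1) * (x.2 - q.2) - (q.2 - p.2) * (x.1 - q.1))]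
    refine this.trans ?_
    rw [mul_pow]
    exact mul_le_mul h1.le h2.le (by positivity) (by positivity)
  have h4 := (abs_le_of_sq_le_sq' h3 (by positivity)).2
  nlinarith

lemma norm_h_om_le (hF : FiniteCyl f u) {K κ r : ℝ} (hκ : 0 < κ) (hκ1 : κ < 1 / 4)
    (hr : 0 < r) (hr1 : r ≤ 1) (hp : 2 ≤ p.1)
    (ha : ∀ q ∈ disc p r, aa f u q.1 q.2 ≤ 1 / r)
    (hy : ∀ q ∈ disc p r, yy f u q.1 q.2 ≤ 1 / r ^ 2)
    (hg : ∀ q ∈ disc p (r / 2), ‖gc u q.1 q.2‖ ≤ K / r)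
    (ht : tail f u (p.1 - r) ≤ κ ^ 4) (j : Fin n) {q : ℝ × ℝ} (hq : q ∈ disc p (r / 4)) :
    ‖cx (vh f u) (fun _ _ => 0) j q.1 q.2‖ ≤ (4 * K + 6) * κ / r ∧
    ‖cx (vp f u) (vq f u) j q.1 q.2‖ ≤ (4 * K + 6) * κ / r := by
  have hU := isOpen_halfPlane
  have hf := hF.conf
  have hpi := pi_gt_three
  have hdr : disc p r ⊆ halfPlane := disc_subset_halfPlane hr.le (by linarith)
  have hd2 : disc q (r / 4) ⊆ disc p (r / 2) := by
    have := disc_subset_disc (r := r / 4) (by linarith) (by linarith) hq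
    rwa [show r / 4 + r / 4 = r / 2 by ring] at this
  have hd1 : disc q (r / 4) ⊆ disc p r := hd2.trans (disc_mono (by linarith) (by linarith))
  have hd : disc q (r / 4) ⊆ halfPlane := hd1.trans hdr
  have hK : 0 ≤ K := by
    have hpp : p ∈ disc p (r / 2) := by
      simp only [disc, Set.mem_ofPred_eq, sub_self]; nlinarith
    have := (norm_nonneg _).trans (hg p hpp)
    by_contra hK
    have := div_neg_of_neg_of_pos (not_le.1 hK) hr
    linarith
  have hyj : ∀ z ∈ disc q (r / 4), ‖cx (vy1 f u) (vy2 f u) j z.1 z.2‖ ≤ 1 / r ^ 2 := fun z hz =>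
    (norm_cx_le j).trans (hy z (hd1 hz))
  have hhj : ∀ z : ℝ × ℝ, ‖cx (vh f u) (fun _ _ => 0) j z.1 z.2‖ ≤ 2 * aa f u z.1 z.2 := fun z =>
    (norm_cx_le j).trans (by rw [norm_zero, add_zero]; exact norm_vh_le f u z.1 z.2)
  have hoj : ∀ z : ℝ × ℝ, ‖cx (vp f u) (vq f u) j z.1 z.2‖ ≤ 2 * aa f u z.1 z.2 := fun z =>
    (norm_cx_le j).trans (by
      have := norm_vp_le f u z.1 z.2
      have := norm_vq_le f u z.1 z.2
      linarith)
  have hgm : ∀ {x : ℂ} (z : ℝ × ℝ), z ∈ disc q (r / 4) → ‖x‖ ≤ 2 * aa f u z.1 z.2 →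
      ‖(starRingEnd ℂ) (gc u z.1 z.2) * x‖ ≤ 2 * K / r ^ 2 := fun {x} z hz hx => by
    rw [norm_mul, RCLike.norm_conj]
    have h1 := hg z (hd2 hz)
    have h2 : ‖x‖ ≤ 2 * (1 / r) := hx.trans (by linarith [ha z (hd1 hz)])
    calc ‖gc u z.1 z.2‖ * ‖x‖ ≤ (K / r) * (2 * (1 / r)) :=
          mul_le_mul h1 h2 (norm_nonneg _) (by positivity)
      _ = 2 * K / r ^ 2 := by field_simp
  have dh : ∀ z ∈ disc q (r / 4), ‖dbar (cx (vh f u) (fun _ _ => 0) j) z.1 z.2‖ ≤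
      (2 * K + 2) / r ^ 2 := fun z hz => by
    rw [hf.dbar_h hU (hd hz)]
    refine (norm_add_le _ _).trans ?_
    rw [RCLike.norm_conj]
    have h1 := hgm z hz (hhj z)
    have h2 := hyj z hz
    have h3 : 0 < 1 / r ^ 2 := by positivity
    rw [show (2 * K + 2) / r ^ 2 = 2 * K / r ^ 2 + 1 / r ^ 2 + 1 / r ^ 2 by ring]
    linarith
  have dom : ∀ z ∈ disc q (r / 4), ‖dbar (cx (vp f u) (vq f u) j) z.1 z.2‖ ≤
      (2 * K + 2) / r ^ 2 := fun z hz => by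
    have h0 := hf.dbar_om hU (hd hz) j
    have h1 := hgm z hz (hoj z)
    have h2 := hyj z hz
    have h3 : 0 < 1 / r ^ 2 := by positivity
    have h4 : aa f u z.1 z.2 ^ 2 ≤ 1 / r ^ 2 := by
      have := pow_le_pow_left₀ (aa_nonneg f u _ _) (ha z (hd1 hz)) 2
      rwa [div_pow, one_pow] at this
    have h5 := norm_le_insert' (dbar (cx (vp f u) (vq f u) j) z.1 z.2)
      (-(starRingEnd ℂ) (gc u z.1 z.2) * cx (vp f u) (vq f u) j z.1 z.2
        + 1 / 2 * cx (vy1 f u) (vy2 f u) j z.1 z.2)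
    have h6 := norm_add_le (-(starRingEnd ℂ) (gc u z.1 z.2) * cx (vp f u) (vq f u) j z.1 z.2)
      (1 / 2 * cx (vy1 f u) (vy2 f u) j z.1 z.2)
    rw [neg_mul, norm_neg] at h6
    have h7 : ‖1 / 2 * cx (vy1 f u) (vy2 f u) j z.1 z.2‖ ≤ 1 / r ^ 2 := by
      rw [norm_mul]; norm_num; norm_num at h2; linarith [norm_nonneg (cx (vy1 f u) (vy2 f u) j z.1 z.2)]
    rw [show (2 * K + 2) / r ^ 2 = 2 * K / r ^ 2 + 1 / r ^ 2 + 1 / r ^ 2 by ring]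
    rw [neg_mul] at h5 h0
    linarith
  have hq1 : p.1 - r / 4 ≤ q.1 := by
    have h1 : (q.1 - p.1) ^ 2 < (r / 4) ^ 2 := by
      have : (q.1 - p.1) ^ 2 + (q.2 - p.2) ^ 2 < (r / 4) ^ 2 := hq
      nlinarith [sq_nonneg (q.2 - p.2)]
    linarith [(abs_lt.1 (abs_lt_of_sq_lt_sq h1 (by linarith))).1]
  have hκr : κ * r < r / 4 := by nlinarith
  have hκr0 : 0 < κ * r := by positivity
  have hD : discInt (Adens f u) q (κ * r) ≤ κ ^ 4 :=
    (discInt_Adens_le hF hκr0 (by linarith) (by linarith)).trans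
      ((tail_anti hF (by linarith) (by linarith)).trans ht)
  have haff : ∀ {x : ℂ} (z : ℝ × ℝ), ‖x‖ ≤ 2 * aa f u z.1 z.2 →
      ‖x‖ ≤ r / κ * Adens f u z.1 z.2 + κ / r := fun {x} z hx => by
    rw [← aa_sq]
    refine hx.trans ?_
    have : 0 ≤ r / κ * (aa f u z.1 z.2 - κ / r) ^ 2 := by positivity
    have e : r / κ * (aa f u z.1 z.2 - κ / r) ^ 2 =
      r / κ * aa f u z.1 z.2 ^ 2 + κ / r - 2 * aa f u z.1 z.2 := by field_simp; ring
    linarith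
  have fin : ∀ {ψ : ℝ → ℝ → ℂ}, Sm halfPlane ψ → (∀ z : ℝ × ℝ, ‖ψ z.1 z.2‖ ≤ 2 * aa f u z.1 z.2) →
      (∀ z ∈ disc q (r / 4), ‖dbar ψ z.1 z.2‖ ≤ (2 * K + 2) / r ^ 2) →
      ‖ψ q.1 q.2‖ ≤ (4 * K + 6) * κ / r := fun {ψ} hψ h1 h2 => by
    refine (norm_le_of_affine hψ hU (sm_Adens hf hU).continuousOn hd hκr0 hκr
      (fun z _ => haff z (h1 z)) h2).trans ?_
    have e1 : r / κ * discInt (Adens f u) q (κ * r) / (π * (κ * r) ^ 2) ≤ κ / r := by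
      rw [div_le_div_iff₀ (by positivity) hr]
      have : r / κ * discInt (Adens f u) q (κ * r) * r ≤ r / κ * κ ^ 4 * r := by gcongr
      refine this.trans ?_
      have e : r / κ * κ ^ 4 * r = κ ^ 3 * r ^ 2 := by field_simp
      rw [e]
      have : 0 < κ ^ 3 * r ^ 2 := by positivity
      nlinarith
    have e2 : 2 * ((2 * K + 2) / r ^ 2) * (κ * r) = (4 * K + 4) * κ / r := by
      field_simp; ring
    rw [e2]
    have e3 : (4 * K + 6) * κ / r = κ / r + κ / r + (4 * K + 4) * κ / r := by ring
    linarith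
  exact ⟨fin ((hf.sm_vh hU).cx (sm_const 0) j) hhj dh,
    fin ((hf.sm_vp hU).cx (hf.sm_vq hU) j) hoj dom⟩

lemma norm_y_le (hF : FiniteCyl f u) {K τ r : ℝ} (hτ : 0 < τ) (hτ1 : τ < 1 / 4)
    (hr : 0 < r) (hr1 : r ≤ 1) (hp : 2 ≤ p.1)
    (ha : ∀ q ∈ disc p r, aa f u q.1 q.2 ≤ 1 / r)
    (hy : ∀ q ∈ disc p r, yy f u q.1 q.2 ≤ 1 / r ^ 2)
    (hg : ∀ q ∈ disc p (r / 2), ‖gc u q.1 q.2‖ ≤ K / r)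
    (ht : tail f u (p.1 - r) ≤ τ ^ 8) (j : Fin n) :
    ‖cx (vy1 f u) (vy2 f u) j p.1 p.2‖ ≤
      (2 * K + 32 + 2 * K * (4 * K + 6) + 2 * (4 * K + 6)) * τ / r ^ 2 := by
  have hU := isOpen_halfPlane
  have hf := hF.conf
  have hK : 0 ≤ K := by
    have hpp : p ∈ disc p (r / 2) := by
      simp only [disc, Set.mem_ofPred_eq, sub_self]; nlinarith
    have := (norm_nonneg _).trans (hg p hpp)
    by_contra hK
    have := div_neg_of_neg_of_pos (not_le.1 hK) hr
    linarith
  have hκ1 : τ ^ 2 < 1 / 4 := by nlinarith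
  have ht' : tail f u (p.1 - r) ≤ (τ ^ 2) ^ 4 := by rwa [← pow_mul]
  have hsm : ∀ q ∈ disc p (r / 4), ‖cx (vh f u) (fun _ _ => 0) j q.1 q.2‖ ≤
      (4 * K + 6) * τ ^ 2 / r := fun q hq =>
    (norm_h_om_le hF (by positivity) hκ1 hr hr1 hp ha hy hg ht' j hq).1
  have hd1 : disc p (r / 4) ⊆ disc p r := disc_mono (by linarith) (by linarith)
  have hd2 : disc p (r / 4) ⊆ disc p (r / 2) := disc_mono (by linarith) (by linarith)
  have hd : disc p (r / 4) ⊆ halfPlane := disc_subset_halfPlane (by linarith) (by linarith)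
  have main := norm_le_of_dbar_pair (p := p) (R := r / 4) (ρ := τ * r) (Λ := (K + 16) / r ^ 3)
    (μ := K / r * ((4 * K + 6) * τ ^ 2 / r)) (δ := (4 * K + 6) * τ ^ 2 / r)
    ((hf.sm_vh hU).cx (sm_const 0) j) ((hf.sm_vy1 hU).cx (hf.sm_vy2 hU) j) hU hd (by positivity)
    (by nlinarith)
    (fun z hz => by
      have h0 := hf.dbar_y hU (hd hz) j
      have h1 := norm_le_insert' (dbar (cx (vy1 f u) (vy2 f u) j) z.1 z.2)
        ((starRingEnd ℂ) (gc u z.1 z.2) * cx (vy1 f u) (vy2 f u) j z.1 z.2)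
      have h2 : ‖(starRingEnd ℂ) (gc u z.1 z.2) * cx (vy1 f u) (vy2 f u) j z.1 z.2‖ ≤
          K / r * (1 / r ^ 2) := by
        rw [norm_mul, RCLike.norm_conj]
        exact mul_le_mul (hg z (hd2 hz)) ((norm_cx_le j).trans (hy z (hd1 hz))) (norm_nonneg _)
          (by positivity)
      have a1 := ha z (hd1 hz)
      have a0 := aa_nonneg f u z.1 z.2
      have h4 : aa f u z.1 z.2 ^ 2 ≤ 1 / r ^ 2 := by
        have := pow_le_pow_left₀ a0 a1 2
        rwa [div_pow, one_pow] at this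
      have h3 : 8 * aa f u z.1 z.2 * (yy f u z.1 z.2 + aa f u z.1 z.2 ^ 2) ≤
          8 * (1 / r) * (1 / r ^ 2 + 1 / r ^ 2) := by
        refine mul_le_mul (by linarith) (add_le_add (hy z (hd1 hz)) h4) ?_ (by positivity)
        have := yy_nonneg f u z.1 z.2
        positivity
      have e : (K + 16) / r ^ 3 = K / r * (1 / r ^ 2) + 8 * (1 / r) * (1 / r ^ 2 + 1 / r ^ 2) := by
        field_simp; ring
      rw [e]
      linarith)
    (fun z hz => by
      rw [hf.dbar_h hU (hd hz), add_sub_cancel_right, norm_mul, RCLike.norm_conj]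
      exact mul_le_mul (hg z (hd2 hz)) (hsm z hz) (norm_nonneg _) (by positivity))
    (fun z hz => hsm z hz)
  refine main.trans ?_
  have e : 2 * ((K + 16) / r ^ 3) * (τ * r) + 2 * (K / r * ((4 * K + 6) * τ ^ 2 / r)) +
      2 * ((4 * K + 6) * τ ^ 2 / r) / (τ * r) =
      ((2 * K + 32) * τ + 2 * K * (4 * K + 6) * τ ^ 2 + 2 * (4 * K + 6) * τ) / r ^ 2 := by
    field_simp; ring
  rw [e]
  refine div_le_div_of_nonneg_right ?_ (by positivity)
  have h1 : τ ^ 2 ≤ τ := by nlinarith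
  have h2 : 0 ≤ 2 * K * (4 * K + 6) := by positivity
  nlinarith [mul_le_mul_of_nonneg_left h1 h2]

lemma exists_local_regularity (n : ℕ) {K δ : ℝ} (hK : 0 ≤ K) (hδ : 0 < δ) :
    ∃ η > 0, ∀ (f : ℝ → ℝ → EuclideanSpace ℝ (Fin n)) (u : ℝ → ℝ → ℝ), FiniteCyl f u →
      ∀ (p : ℝ × ℝ) (r : ℝ), 0 < r → r ≤ 1 → 2 ≤ p.1 →
      (∀ q ∈ disc p r, aa f u q.1 q.2 ≤ 1 / r) →
      (∀ q ∈ disc p r, yy f u q.1 q.2 ≤ 1 / r ^ 2) →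
      (∀ q ∈ disc p (r / 2), ‖gc u q.1 q.2‖ ≤ K / r) → tail f u (p.1 - r) ≤ η →
      aa f u p.1 p.2 ≤ δ / r ∧ yy f u p.1 p.2 ≤ (δ / r) ^ 2 := by
  set C₁ := 2 * ((n : ℝ) + 1) * (4 * K + 6) with hC₁
  set C₂ := 2 * ((n : ℝ) + 1) * (2 * K + 32 + 2 * K * (4 * K + 6) + 2 * (4 * K + 6)) with hC₂
  have p1 : 0 < C₁ := by positivity
  have p2 : 0 < C₂ := by positivity
  obtain ⟨τ, hτ, hτ1⟩ : ∃ τ : ℝ, 0 < τ ∧ τ ≤ min (1 / 8) (min (δ / C₁) (δ ^ 2 / C₂)) :=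
    ⟨_, by positivity, le_rfl⟩
  have t1 : τ ≤ 1 / 8 := hτ1.trans (min_le_left _ _)
  have t2 : τ * C₁ ≤ δ := (le_div_iff₀ p1).1 (hτ1.trans ((min_le_right _ _).trans (min_le_left _ _)))
  have t3 : τ * C₂ ≤ δ ^ 2 :=
    (le_div_iff₀ p2).1 (hτ1.trans ((min_le_right _ _).trans (min_le_right _ _)))
  refine ⟨τ ^ 8, by positivity, fun f u hF p r hr hr1 hp ha hy hg ht => ⟨?_, ?_⟩⟩
  · have hp0 : p ∈ disc p (r / 4) := by
      simp only [disc, Set.mem_ofPred_eq, sub_self]; nlinarith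
    have h := fun j => norm_h_om_le hF (κ := τ ^ 2) (by positivity) (by nlinarith) hr hr1 hp ha hy
      hg (by rwa [← pow_mul]) j hp0
    refine (aa_le_of_cx (by positivity) (fun j => (h j).1) fun j => (h j).2).trans ?_
    have e : 2 * ((n : ℝ) + 1) * ((4 * K + 6) * τ ^ 2 / r) = τ * C₁ * τ / r := by
      rw [hC₁]; ring
    rw [e]
    refine div_le_div_of_nonneg_right ?_ hr.le
    nlinarith [mul_pos hτ p1]
  · have h := norm_y_le hF hτ (by linarith) hr hr1 hp ha hy hg ht
    refine (yy_le_of_cx (by positivity) h).trans ?_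
    have e : 2 * ((n : ℝ) + 1) * ((2 * K + 32 + 2 * K * (4 * K + 6) + 2 * (4 * K + 6)) * τ / r ^ 2)
      = τ * C₂ / r ^ 2 := by
      rw [hC₂]; ring
    rw [e, div_pow]
    exact div_le_div_of_nonneg_right t3 (by positivity)

end LocalRegularity

section PointPicking

variable {f : ℝ → ℝ → EuclideanSpace ℝ (Fin n)} {u : ℝ → ℝ → ℝ}

lemma mem_disc_iff {p q : ℝ × ℝ} {r : ℝ} (hr : 0 ≤ r) :
    q ∈ disc p r ↔ ‖(⟨q.1, q.2⟩ : ℂ) - ⟨p.1, p.2⟩‖ < r := by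
  rw [← sq_lt_sq₀ (norm_nonneg _) hr, ← Complex.normSq_eq_norm_sq, Complex.normSq_apply, disc]
  simp only [Set.mem_ofPred_eq, Complex.sub_re, Complex.sub_im, sq]

lemma abs_fst_sub_le (p q : ℝ × ℝ) : |q.1 - p.1| ≤ ‖(⟨q.1, q.2⟩ : ℂ) - ⟨p.1, p.2⟩‖ := by
  have := Complex.abs_re_le_norm ((⟨q.1, q.2⟩ : ℂ) - ⟨p.1, p.2⟩)
  simpa using this

lemma continuousOn_aa (hF : FiniteCyl f u) :
    ContinuousOn (fun q : ℝ × ℝ => aa f u q.1 q.2) halfPlane :=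
  (sm_Adens hF.conf isOpen_halfPlane).continuousOn.sqrt

lemma continuousOn_yy (hF : FiniteCyl f u) :
    ContinuousOn (fun q : ℝ × ℝ => yy f u q.1 q.2) halfPlane :=
  (hF.conf.sm_vy1 isOpen_halfPlane).continuousOn.norm.add
    (hF.conf.sm_vy2 isOpen_halfPlane).continuousOn.norm

lemma exists_aa_yy_le {m : ℝ} (hF : FiniteCyl f u)
    (hm : Tendsto (circ (pt u)) atTop (nhds (-(2 * π * m)))) {ε : ℝ} (hε : 0 < ε) :
    ∃ T, 2 ≤ T ∧ ∀ p : ℝ × ℝ, T ≤ p.1 → aa f u p.1 p.2 ≤ ε ∧ yy f u p.1 p.2 ≤ ε ^ 2 := by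
  obtain ⟨δ, hδ, hδ1⟩ : ∃ δ : ℝ, 0 < δ ∧ δ ≤ min (1 / 8) (ε / 4) := ⟨_, by positivity, le_rfl⟩
  have d1 := hδ1.trans (min_le_left _ _)
  have d2 := hδ1.trans (min_le_right _ _)
  obtain ⟨η, hη, hreg⟩ := exists_local_regularity n (K := |m| + 4) (δ := δ) (by positivity) hδ
  obtain ⟨T₁, hT₁, h1⟩ := exists_norm_gc_add_le hF hm one_pos
  obtain ⟨T₂, hT₂, h2⟩ := exists_tail_le hF hη
  refine ⟨max (T₁ + 2) (T₂ + 2), by linarith [le_max_left (T₁ + 2) (T₂ + 2)], fun p hp => ?_⟩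
  have hp1 : T₁ + 2 ≤ p.1 := (le_max_left _ _).trans hp
  have hp2 : T₂ + 2 ≤ p.1 := (le_max_right _ _).trans hp
  set N : ℝ × ℝ → ℝ := fun q => aa f u q.1 q.2 + Real.sqrt (yy f u q.1 q.2) with hN
  have hN0 : ∀ q, 0 ≤ N q := fun q => add_nonneg (aa_nonneg f u q.1 q.2) (Real.sqrt_nonneg _)
  set d : ℝ × ℝ → ℝ := fun q => ‖(⟨q.1, q.2⟩ : ℂ) - ⟨p.1, p.2⟩‖ with hd
  have hdc : Continuous d := by
    have : Continuous fun q : ℝ × ℝ => (⟨q.1, q.2⟩ : ℂ) := Complex.equivRealProdCLM.symm.continuous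
    exact (this.sub continuous_const).norm
  have hfst : ∀ q, d q ≤ 1 → p.1 - 1 ≤ q.1 := fun q hq => by
    have := (abs_le.1 ((abs_fst_sub_le p q).trans hq)).1
    linarith
  have hcomp : IsCompact {q | d q ≤ 1} := by
    have e : {q | d q ≤ 1} = Complex.equivRealProdCLM.symm ⁻¹'
        Metric.closedBall (⟨p.1, p.2⟩ : ℂ) 1 := by
      ext q
      simp only [Set.mem_ofPred_eq, Set.mem_preimage, Metric.mem_closedBall, dist_eq_norm, hd]
      rfl
    rw [e]
    exact Complex.equivRealProdCLM.symm.toHomeomorph.isCompact_preimage.2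
      (isCompact_closedBall _ _)
  have hsub : {q | d q ≤ 1} ⊆ halfPlane := fun q hq => by
    have := hfst q hq
    have h : 0 < q.1 := by linarith
    exact h
  have hp0 : d p = 0 := by simp [hd]
  have hNc : ContinuousOn N halfPlane := (continuousOn_aa hF).add (continuousOn_yy hF).sqrt
  obtain ⟨p₁, hm1, hmax⟩ := hcomp.exists_isMaxOn (f := fun q => (1 - d q) * N q)
    ⟨p, by rw [Set.mem_ofPred_eq, hp0]; exact zero_le_one⟩
    ((continuous_const.sub hdc).continuousOn.mul (hNc.mono hsub))
  have hmax' : ∀ q, d q ≤ 1 → (1 - d q) * N q ≤ (1 - d p₁) * N p₁ := fun q hq => hmax hq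
  have hp1' : d p₁ ≤ 1 := hm1
  have key : N p ≤ 4 * δ := by
    have h0 := hmax' p (by rw [hp0]; exact zero_le_one)
    rw [hp0, sub_zero, one_mul] at h0
    by_contra hcon
    have hpos : 0 < N p := lt_trans (by linarith) (not_le.1 hcon)
    have hN1 : 0 < N p₁ := by
      rcases (hN0 p₁).lt_or_eq with h | h
      · exact h
      · rw [← h, mul_zero] at h0; linarith
    have hdpos : 0 < 1 - d p₁ := by
      rcases (sub_nonneg.2 hp1').lt_or_eq with h | h
      · exact h
      · rw [← h, zero_mul] at h0; linarith
    obtain ⟨r, hr⟩ : ∃ r, r = min ((1 - d p₁) / 2) (1 / (2 * N p₁)) := ⟨_, rfl⟩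
    have hr0 : 0 < r := by rw [hr]; positivity
    have r1 : r ≤ (1 - d p₁) / 2 := hr ▸ min_le_left _ _
    have r2 : r ≤ 1 / (2 * N p₁) := hr ▸ min_le_right _ _
    have hdp : 0 ≤ d p₁ := norm_nonneg _
    have hr12 : r ≤ 1 / 2 := by linarith
    have hNr : 2 * N p₁ ≤ 1 / r := by
      rw [le_div_iff₀ hr0]
      rw [le_div_iff₀ (by positivity)] at r2
      linarith
    have hNq : ∀ q ∈ disc p₁ r, N q ≤ 1 / r := fun q hq => by
      rw [mem_disc_iff hr0.le] at hq
      have e1 : d q ≤ d p₁ + r := by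
        have := norm_sub_le_norm_sub_add_norm_sub (⟨q.1, q.2⟩ : ℂ) ⟨p₁.1, p₁.2⟩ ⟨p.1, p.2⟩
        simp only [hd]; linarith
      have e2 := hmax' q (by linarith)
      refine le_trans ?_ hNr
      have e3 : (1 - d p₁) / 2 * N q ≤ (1 - d q) * N q :=
        mul_le_mul_of_nonneg_right (by linarith) (hN0 q)
      have e4 : (1 - d p₁) * N q ≤ (1 - d p₁) * (2 * N p₁) := by linarith
      exact le_of_mul_le_mul_left e4 hdpos
    have ha : ∀ q ∈ disc p₁ r, aa f u q.1 q.2 ≤ 1 / r := fun q hq =>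
      le_trans (le_add_of_nonneg_right (Real.sqrt_nonneg _)) (hNq q hq)
    have hy : ∀ q ∈ disc p₁ r, yy f u q.1 q.2 ≤ 1 / r ^ 2 := fun q hq => by
      have : Real.sqrt (yy f u q.1 q.2) ≤ 1 / r :=
        le_trans (le_add_of_nonneg_left (aa_nonneg _ _ _ _)) (hNq q hq)
      rw [Real.sqrt_le_left (by positivity), div_pow, one_pow] at this
      exact this
    have hf1 := hfst p₁ hp1'
    have hg : ∀ q ∈ disc p₁ (r / 2), ‖gc u q.1 q.2‖ ≤ (|m| + 4) / r := fun q hq => by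
      have hdq : disc q (r / 2) ⊆ disc p₁ r := by
        have := disc_subset_disc (r := r / 2) (by linarith) (by linarith) hq
        rwa [add_halves] at this
      have hq1 : p₁.1 - 1 ≤ q.1 := by
        rw [mem_disc_iff (by linarith)] at hq
        have := (abs_le.1 ((abs_fst_sub_le p₁ q).trans hq.le)).1
        linarith
      have hdr : disc p₁ r ⊆ halfPlane := disc_subset_halfPlane hr0.le (by linarith)
      have e1 := h1 q (by linarith) (r / 2) (1 / r ^ 2) (by linarith) fun z hz => by
        have hz' := hdq hz
        refine (norm_dbar_gc_le hF (hdr hz')).trans ?_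
        rw [← aa_sq]
        have := pow_le_pow_left₀ (aa_nonneg f u z.1 z.2) (ha z hz') 2
        rwa [div_pow, one_pow] at this
      have e2 : ‖gc u q.1 q.2‖ ≤ ‖gc u q.1 q.2 + m‖ + |m| := by
        have := norm_sub_le (gc u q.1 q.2 + m) (m : ℂ)
        rwa [add_sub_cancel_right, Complex.norm_real, Real.norm_eq_abs] at this
      have e3 : 1 ≤ 1 / r := by rw [le_div_iff₀ hr0]; linarith
      have e4 : 1 / r ^ 2 * (r / 2) = 1 / 2 * (1 / r) := by field_simp
      have e5 : 1 / (r / 2) = 2 * (1 / r) := by field_simp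
      have e6 : (|m| + 4) / r = |m| * (1 / r) + 4 * (1 / r) := by ring
      have e7 : |m| * 1 ≤ |m| * (1 / r) := mul_le_mul_of_nonneg_left e3 (abs_nonneg _)
      rw [e4, e5] at e1
      rw [e6]
      linarith
    have hres := hreg f u hF p₁ r hr0 (by linarith) (by linarith) ha hy hg (h2 _ (by linarith))
    have hs : Real.sqrt (yy f u p₁.1 p₁.2) ≤ δ / r :=
      (Real.sqrt_le_left (by positivity)).2 hres.2
    have hrN : N p₁ * r ≤ 2 * δ := by
      have : N p₁ ≤ δ / r + δ / r := add_le_add hres.1 hs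
      rw [← add_div, le_div_iff₀ hr0] at this
      linarith
    rcases min_choice ((1 - d p₁) / 2) (1 / (2 * N p₁)) with h | h
    · rw [h] at hr
      rw [hr] at hrN
      exact hcon (by linarith)
    · rw [h] at hr
      have : N p₁ * r = 1 / 2 := by rw [hr]; field_simp
      linarith
  have hk : N p ≤ ε := by linarith
  refine ⟨le_trans (le_add_of_nonneg_right (Real.sqrt_nonneg _)) hk, ?_⟩
  have : Real.sqrt (yy f u p.1 p.2) ≤ ε := le_trans (le_add_of_nonneg_left (aa_nonneg _ _ _ _)) hk
  exact (Real.sqrt_le_left hε.le).1 this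

lemma exists_forall_small {m : ℝ} (hF : FiniteCyl f u)
    (hm : Tendsto (circ (pt u)) atTop (nhds (-(2 * π * m)))) {ε : ℝ} (hε : 0 < ε) :
    ∃ T, 2 ≤ T ∧ ∀ t θ, T ≤ t → aa f u t θ ≤ ε ∧ yy f u t θ ≤ ε ∧ ‖gc u t θ + m‖ ≤ ε := by
  obtain ⟨δ, hδ, hδ1⟩ : ∃ δ : ℝ, 0 < δ ∧ δ ≤ min 1 (ε / 4) := ⟨_, by positivity, le_rfl⟩
  have d1 := hδ1.trans (min_le_left _ _)
  have d2 := hδ1.trans (min_le_right _ _)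
  obtain ⟨T₁, hT₁, h1⟩ := exists_norm_gc_add_le hF hm hδ
  obtain ⟨T₂, hT₂, h2⟩ := exists_aa_yy_le hF hm hδ
  refine ⟨max T₁ (T₂ + 1), hT₁.trans (le_max_left _ _), fun t θ ht => ?_⟩
  have t1 : T₁ ≤ t := (le_max_left _ _).trans ht
  have t2 : T₂ + 1 ≤ t := (le_max_right _ _).trans ht
  have h3 := h2 (t, θ) (by show T₂ ≤ t; linarith)
  have h4 := h1 (t, θ) t1 1 δ one_pos fun q hq => by
    rw [mem_disc_iff zero_le_one] at hq
    have hq1 := (abs_le.1 ((abs_fst_sub_le (t, θ) q).trans hq.le)).1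
    have hq2 : T₂ ≤ q.1 := by simp only at hq1; linarith
    refine (norm_dbar_gc_le hF (by linarith)).trans ?_
    rw [← aa_sq]
    have := pow_le_pow_left₀ (aa_nonneg f u q.1 q.2) (h2 q hq2).1 2
    nlinarith
  simp only [mul_one, div_one] at h4
  refine ⟨by linarith [h3.1], ?_, by linarith⟩
  nlinarith [h3.2]

end PointPicking

section Rotation

variable {V : Type*} [NormedAddCommGroup V] [NormedSpace ℝ V] [CompleteSpace V]

lemma norm_sub_le_integral_of_hasDerivAt {P P' : ℝ → V} {b : ℝ → ℝ} {θ : ℝ}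
    (hP : ∀ s, HasDerivAt P (P' s) s) (hc : Continuous P') (hb : Continuous b)
    (h : ∀ s, ‖P' s‖ ≤ b s) (hθ : θ ∈ Icc (-π) π) :
    ‖P θ - P 0‖ ≤ ∫ s in (-π)..π, b s := by
  have hb0 : ∀ s, 0 ≤ b s := fun s => (norm_nonneg _).trans (h s)
  rw [← intervalIntegral.integral_eq_sub_of_hasDerivAt (fun s _ => hP s)
    (hc.intervalIntegrable _ _)]
  refine (intervalIntegral.norm_integral_le_abs_integral_norm).trans ?_
  have hπ : (-π : ℝ) ≤ π := by linarith [pi_pos]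
  have h1 : |∫ s in (0 : ℝ)..θ, ‖P' s‖| ≤ |∫ s in (-π)..π, ‖P' s‖| := by
    refine intervalIntegral.abs_integral_mono_interval ?_ ?_ (hc.norm.intervalIntegrable _ _)
    · rw [Set.uIoc_of_le hπ]
      exact Set.Ioc_subset_Ioc (le_min (by linarith [pi_pos]) hθ.1)
        (max_le (by linarith [pi_pos]) hθ.2)
    · exact Filter.Eventually.of_forall fun s => norm_nonneg _
  rw [abs_of_nonneg (intervalIntegral.integral_nonneg hπ fun s _ => norm_nonneg (P' s))] at h1
  exact h1.trans (intervalIntegral.integral_mono_on hπ (hc.norm.intervalIntegrable _ _)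
    (hb.intervalIntegrable _ _) fun s _ => h s)

/-- A pair `(F, G)` almost solving `F' = -m G`, `G' = m F` is almost a rotation. -/
lemma norm_sub_rotation_le {F G F' G' : ℝ → V} {m θ : ℝ} {b : ℝ → ℝ}
    (hF : ∀ s, HasDerivAt F (F' s) s) (hG : ∀ s, HasDerivAt G (G' s) s)
    (hF' : Continuous F') (hG' : Continuous G') (hb : Continuous b)
    (h1 : ∀ s, ‖F' s + m • G s‖ ≤ b s) (h2 : ∀ s, ‖G' s - m • F s‖ ≤ b s)
    (hθ : θ ∈ Icc (-π) π) :
    ‖F θ - (Real.cos (m * θ) • F 0 - Real.sin (m * θ) • G 0)‖ ≤ 4 * ∫ s in (-π)..π, b s ∧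
    ‖G θ - (Real.cos (m * θ) • G 0 + Real.sin (m * θ) • F 0)‖ ≤ 4 * ∫ s in (-π)..π, b s := by
  have hFc : Continuous F := continuous_iff_continuousAt.2 fun s => (hF s).continuousAt
  have hGc : Continuous G := continuous_iff_continuousAt.2 fun s => (hG s).continuousAt
  have hm : ∀ s : ℝ, HasDerivAt (fun s => m * s) m s := fun s => by
    simpa using (hasDerivAt_id s).const_mul m
  have hcos : ∀ s, HasDerivAt (fun s => Real.cos (m * s)) (-Real.sin (m * s) * m) s := fun s =>
    (hm s).cos
  have hsin : ∀ s, HasDerivAt (fun s => Real.sin (m * s)) (Real.cos (m * s) * m) s := fun s =>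
    (hm s).sin
  set P : ℝ → V := fun s => Real.cos (m * s) • F s + Real.sin (m * s) • G s with hPdef
  set Q : ℝ → V := fun s => Real.cos (m * s) • G s - Real.sin (m * s) • F s with hQdef
  have hP : ∀ s, HasDerivAt P (Real.cos (m * s) • (F' s + m • G s)
      + Real.sin (m * s) • (G' s - m • F s)) s := fun s =>
    (((hcos s).smul (hF s)).add ((hsin s).smul (hG s))).congr_deriv (by module)
  have hQ : ∀ s, HasDerivAt Q (Real.cos (m * s) • (G' s - m • F s)
      - Real.sin (m * s) • (F' s + m • G s)) s := fun s =>
    (((hcos s).smul (hG s)).sub ((hsin s).smul (hF s))).congr_deriv (by module)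
  have key : ∀ (x y : V) (B α : ℝ), ‖x‖ ≤ B → ‖y‖ ≤ B →
      ‖Real.cos α • x + Real.sin α • y‖ ≤ 2 * B ∧ ‖Real.cos α • y - Real.sin α • x‖ ≤ 2 * B := by
    intro x y B α hx hy
    have c : ‖Real.cos α • x‖ ≤ B ∧ ‖Real.sin α • y‖ ≤ B ∧ ‖Real.cos α • y‖ ≤ B ∧
        ‖Real.sin α • x‖ ≤ B := by
      have hc := Real.abs_cos_le_one α
      have hs := Real.abs_sin_le_one α
      simp only [norm_smul, Real.norm_eq_abs]
      refine ⟨?_, ?_, ?_, ?_⟩ <;> nlinarith [norm_nonneg x, norm_nonneg y]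
    exact ⟨(norm_add_le _ _).trans (by linarith), (norm_sub_le _ _).trans (by linarith)⟩
  have eP := norm_sub_le_integral_of_hasDerivAt hP (by fun_prop) (by fun_prop)
    (b := fun s => 2 * b s) (fun s => (key _ _ _ _ (h1 s) (h2 s)).1) hθ
  have eQ := norm_sub_le_integral_of_hasDerivAt hQ (by fun_prop) (by fun_prop)
    (b := fun s => 2 * b s) (fun s => (key _ _ _ _ (h1 s) (h2 s)).2) hθ
  rw [intervalIntegral.integral_const_mul] at eP eQ
  have hP0 : P 0 = F 0 := by simp [hPdef]
  have hQ0 : Q 0 = G 0 := by simp [hQdef]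
  rw [hP0] at eP
  rw [hQ0] at eQ
  have hcs := Real.cos_sq_add_sin_sq (m * θ)
  have r1 : F θ - (Real.cos (m * θ) • F 0 - Real.sin (m * θ) • G 0) =
      Real.cos (-(m * θ)) • (P θ - F 0) + Real.sin (-(m * θ)) • (Q θ - G 0) := by
    simp only [hPdef, hQdef, Real.cos_neg, Real.sin_neg]
    linear_combination (norm := module) (-hcs) • F θ
  have r2 : G θ - (Real.cos (m * θ) • G 0 + Real.sin (m * θ) • F 0) =
      Real.cos (-(m * θ)) • (Q θ - G 0) - Real.sin (-(m * θ)) • (P θ - F 0) := by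
    simp only [hPdef, hQdef, Real.cos_neg, Real.sin_neg]
    linear_combination (norm := module) (-hcs) • G θ
  have k := key _ _ _ (-(m * θ)) eP eQ
  rw [r1, r2]
  exact ⟨k.1.trans (by linarith), k.2.trans (by linarith)⟩

end Rotation

/-- The first unit tangent vector. -/
def vF (f : ℝ → ℝ → EuclideanSpace ℝ (Fin n)) (u : ℝ → ℝ → ℝ) (t θ : ℝ) :
    EuclideanSpace ℝ (Fin n) := Real.exp (-u t θ) • pt f t θ

/-- The second unit tangent vector. -/
def vG (f : ℝ → ℝ → EuclideanSpace ℝ (Fin n)) (u : ℝ → ℝ → ℝ) (t θ : ℝ) :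
    EuclideanSpace ℝ (Fin n) := Real.exp (-u t θ) • pth f t θ

/-- A cylinder whose scale invariant geometry is `ε`-close to a cone of slope `-m` beyond `T`. -/
structure AsympCyl (f : ℝ → ℝ → EuclideanSpace ℝ (Fin n)) (u : ℝ → ℝ → ℝ) (m ε T : ℝ) :
    Prop where
  cyl : FiniteCyl f u
  pos : 0 < T
  aa_le : ∀ t θ, T ≤ t → aa f u t θ ≤ ε
  yy_le : ∀ t θ, T ≤ t → yy f u t θ ≤ ε
  gc_le : ∀ t θ, T ≤ t → ‖gc u t θ + m‖ ≤ ε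

section Frame

variable {f : ℝ → ℝ → EuclideanSpace ℝ (Fin n)} {u : ℝ → ℝ → ℝ} {U : Set (ℝ × ℝ)} {t θ : ℝ}

lemma DiskConfWillmore.sm_vF (hf : DiskConfWillmore f u U) (hU : IsOpen U) : Sm U (vF f u) :=
  hf.sm_u.neg.exp.smul (hf.sm_f.pt hU)

lemma DiskConfWillmore.sm_vG (hf : DiskConfWillmore f u U) (hU : IsOpen U) : Sm U (vG f u) :=
  hf.sm_u.neg.exp.smul (hf.sm_f.pth hU)

lemma norm_vF (hf : DiskConfWillmore f u U) (hp : (t, θ) ∈ U) : ‖vF f u t θ‖ = 1 := by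
  rw [vF, norm_smul, hf.norm_pt_f hp, Real.norm_eq_abs, Real.abs_exp, ← Real.exp_add]; simp

lemma norm_vG (hf : DiskConfWillmore f u U) (hp : (t, θ) ∈ U) : ‖vG f u t θ‖ = 1 := by
  rw [vG, norm_smul, hf.norm_pth_f hp, Real.norm_eq_abs, Real.abs_exp, ← Real.exp_add]; simp

lemma inner_vF_vG (hf : DiskConfWillmore f u U) (hp : (t, θ) ∈ U) :
    ⟪vF f u t θ, vG f u t θ⟫_ℝ = 0 := by
  rw [vF, vG, real_inner_smul_left, real_inner_smul_right, hf.inner_xy hp]; simp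

lemma pth_exp_neg (hU : IsOpen U) (hu : Sm U u) (hp : (t, θ) ∈ U) :
    pth (fun a b => Real.exp (-u a b)) t θ = Real.exp (-u t θ) * (-pth u t θ) := by
  rw [pth_exp hU hu.neg hp]
  congr 1
  exact (hu.hasDerivAt_pth hU hp).neg.deriv

lemma pth_vF (hf : DiskConfWillmore f u U) (hU : IsOpen U) (hp : (t, θ) ∈ U) :
    pth (vF f u) t θ = Real.exp (-u t θ) • Atth f u t θ + pt u t θ • vG f u t θ := by
  have h := DiskConfWillmore.second_derivs f u t θ
  have e : pth (vF f u) t θ = _ := pth_smul hU hf.sm_u.neg.exp (hf.sm_f.pt hU) hp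
  rw [e, pth_exp_neg hU hf.sm_u hp, pt_pth_comm hf.sm_f hU hp, h.2.1, vG]
  module

lemma pth_vG (hf : DiskConfWillmore f u U) (hU : IsOpen U) (hp : (t, θ) ∈ U) :
    pth (vG f u) t θ = Real.exp (-u t θ) • Athth f u t θ - pt u t θ • vF f u t θ := by
  have h := DiskConfWillmore.second_derivs f u t θ
  have e : pth (vG f u) t θ = _ := pth_smul hU hf.sm_u.neg.exp (hf.sm_f.pth hU) hp
  rw [e, pth_exp_neg hU hf.sm_u hp, h.2.2, vF]
  module

lemma norm_exp_neg_smul_le {x : EuclideanSpace ℝ (Fin n)} {v a : ℝ} (h : ‖x‖ ≤ Real.exp v * a) :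
    ‖Real.exp (-v) • x‖ ≤ a := by
  rw [norm_smul, Real.norm_eq_abs, Real.abs_exp]
  calc Real.exp (-v) * ‖x‖ ≤ Real.exp (-v) * (Real.exp v * a) := by gcongr
    _ = a := by rw [← mul_assoc, ← Real.exp_add]; simp

lemma abs_pt_add_le_of_gc {m : ℝ} : |pt u t θ + m| ≤ ‖gc u t θ + m‖ := by
  have := Complex.abs_re_le_norm (gc u t θ + m)
  simpa [gc] using this

lemma abs_pth_le_of_gc {m : ℝ} : |pth u t θ| ≤ ‖gc u t θ + m‖ := by
  have := Complex.abs_im_le_norm (gc u t θ + m)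
  simpa [gc] using this

variable {m ε T : ℝ}

namespace AsympCyl

lemma mem (h : AsympCyl f u m ε T) (ht : T ≤ t) (θ : ℝ) : (t, θ) ∈ halfPlane :=
  mem_halfPlane (h.pos.trans_le ht)

lemma eps_nonneg (h : AsympCyl f u m ε T) : 0 ≤ ε := (aa_nonneg f u T 0).trans (h.aa_le T 0 le_rfl)

lemma abs_u1 (h : AsympCyl f u m ε T) (ht : T ≤ t) (θ : ℝ) : |pt u t θ + m| ≤ ε :=
  abs_pt_add_le_of_gc.trans (h.gc_le t θ ht)

lemma abs_u2 (h : AsympCyl f u m ε T) (ht : T ≤ t) (θ : ℝ) : |pth u t θ| ≤ ε :=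
  abs_pth_le_of_gc.trans (h.gc_le t θ ht)

lemma hasDerivAt_frame (h : AsympCyl f u m ε T) (ht : T ≤ t) (θ : ℝ) :
    HasDerivAt (vF f u t) (pth (vF f u) t θ) θ ∧ HasDerivAt (vG f u t) (pth (vG f u) t θ) θ :=
  ⟨(h.cyl.conf.sm_vF isOpen_halfPlane).hasDerivAt_pth isOpen_halfPlane (h.mem ht θ),
    (h.cyl.conf.sm_vG isOpen_halfPlane).hasDerivAt_pth isOpen_halfPlane (h.mem ht θ)⟩

lemma continuous_frame (h : AsympCyl f u m ε T) (ht : T ≤ t) :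
    Continuous (pth (vF f u) t) ∧ Continuous (pth (vG f u) t) :=
  ⟨continuous_slice (I := Ioi 0) ((h.cyl.conf.sm_vF isOpen_halfPlane).pth isOpen_halfPlane)
      (h.pos.trans_le ht),
    continuous_slice (I := Ioi 0) ((h.cyl.conf.sm_vG isOpen_halfPlane).pth isOpen_halfPlane)
      (h.pos.trans_le ht)⟩

/-- The tangent frame rotates almost uniformly. -/
lemma norm_frame_sub_le (h : AsympCyl f u m ε T) (ht : T ≤ t) (hθ : θ ∈ Icc (-π) π) :
    ‖vF f u t θ - (Real.cos (m * θ) • vF f u t 0 - Real.sin (m * θ) • vG f u t 0)‖ ≤ 64 * ε ∧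
    ‖vG f u t θ - (Real.cos (m * θ) • vG f u t 0 + Real.sin (m * θ) • vF f u t 0)‖ ≤ 64 * ε := by
  have hA := fun s => norm_A_le f u t s
  have key := norm_sub_rotation_le (m := m) (fun s => (h.hasDerivAt_frame ht s).1)
    (fun s => (h.hasDerivAt_frame ht s).2) (h.continuous_frame ht).1 (h.continuous_frame ht).2
    (b := fun _ => 2 * ε) continuous_const (fun s => ?_) (fun s => ?_) hθ
  · rw [intervalIntegral.integral_const, smul_eq_mul] at key
    have := pi_lt_four
    have := h.eps_nonneg
    have e : 4 * ((π - -π) * (2 * ε)) ≤ 64 * ε := by nlinarith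
    exact ⟨key.1.trans e, key.2.trans e⟩
  · have e : pth (vF f u) t s + m • vG f u t s =
        Real.exp (-u t s) • Atth f u t s + (pt u t s + m) • vG f u t s := by
      rw [pth_vF h.cyl.conf isOpen_halfPlane (h.mem ht s)]; module
    rw [e]
    refine (norm_add_le _ _).trans ?_
    have e1 := (norm_exp_neg_smul_le (hA s).2.1).trans (h.aa_le t s ht)
    have e2 := h.abs_u1 ht s
    rw [norm_smul (pt u t s + m), norm_vG h.cyl.conf (h.mem ht s), Real.norm_eq_abs]
    linarith
  · have e : pth (vG f u) t s - m • vF f u t s =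
        Real.exp (-u t s) • Athth f u t s - (pt u t s + m) • vF f u t s := by
      rw [pth_vG h.cyl.conf isOpen_halfPlane (h.mem ht s)]; module
    rw [e]
    refine (norm_sub_le _ _).trans ?_
    have e1 := (norm_exp_neg_smul_le (hA s).2.2).trans (h.aa_le t s ht)
    have e2 := h.abs_u1 ht s
    rw [norm_smul (pt u t s + m), norm_vF h.cyl.conf (h.mem ht s), Real.norm_eq_abs]
    linarith

end AsympCyl

end Frame

section Limit

variable {f : ℝ → ℝ → EuclideanSpace ℝ (Fin n)} {u : ℝ → ℝ → ℝ} {t θ : ℝ} {m ε T : ℝ}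

lemma exists_asympCyl (hF : FiniteCyl f u)
    (hm : Tendsto (circ (pt u)) atTop (nhds (-(2 * π * m)))) (hε : 0 < ε) :
    ∃ T, 2 ≤ T ∧ AsympCyl f u m ε T := by
  obtain ⟨T, hT, h⟩ := exists_forall_small hF hm hε
  exact ⟨T, hT, hF, by linarith, fun t θ ht => (h t θ ht).1, fun t θ ht => (h t θ ht).2.1,
    fun t θ ht => (h t θ ht).2.2⟩

lemma periodic_vF (hF : FiniteCyl f u) (ht : 0 < t) (θ : ℝ) :
    vF f u t (θ + 2 * π) = vF f u t θ := by
  rw [vF, vF, hF.per_u, periodic_pt (fun t _ θ => hF.per_f t θ) ht]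

lemma periodic_vG (hF : FiniteCyl f u) (ht : 0 < t) (θ : ℝ) :
    vG f u t (θ + 2 * π) = vG f u t θ := by
  rw [vG, vG, hF.per_u, periodic_pth (fun t _ θ => hF.per_f t θ) ht]

namespace AsympCyl

lemma abs_sin_mul_pi_le (h : AsympCyl f u m ε T) : |Real.sin (m * π)| ≤ 64 * ε := by
  have hp : (-π : ℝ) ≤ π := by linarith [pi_pos]
  have h1 := (h.norm_frame_sub_le le_rfl (θ := π) ⟨hp, le_rfl⟩).1
  have h2 := (h.norm_frame_sub_le le_rfl (θ := -π) ⟨le_rfl, hp⟩).1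
  have hper := periodic_vF h.cyl h.pos (-π)
  rw [show -π + 2 * π = π by ring] at hper
  rw [mul_neg, Real.cos_neg, Real.sin_neg] at h2
  rw [hper] at h1
  have e : (2 * Real.sin (m * π)) • vG f u T 0 =
      (vF f u T (-π) - (Real.cos (m * π) • vF f u T 0 - Real.sin (m * π) • vG f u T 0))
      - (vF f u T (-π) - (Real.cos (m * π) • vF f u T 0 - (-Real.sin (m * π)) • vG f u T 0)) := by
    module
  have e1 := norm_sub_le_of_le h1 h2
  rw [← e, norm_smul, norm_vG h.cyl.conf (h.mem le_rfl 0), Real.norm_eq_abs, abs_mul,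
    abs_of_pos (two_pos : (0 : ℝ) < 2)] at e1
  linarith

lemma hasDerivAt_u (h : AsympCyl f u m ε T) (ht : T ≤ t) (θ : ℝ) :
    HasDerivAt (fun s => u s θ) (pt u t θ) t :=
  h.cyl.conf.sm_u.hasDerivAt_pt isOpen_halfPlane (h.mem ht θ)

lemma slope_ne_zero (h : AsympCyl f u m ε T) (hε : ε < 1 / 64) : m ≠ 0 := by
  intro h0
  have hp : (-π : ℝ) < π := by linarith [pi_pos]
  have hd : ∀ s, HasDerivAt (fun s => ⟪f T s, vG f u T 0⟫_ℝ) ⟪pth f T s, vG f u T 0⟫_ℝ s :=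
    fun s => ((h.cyl.conf.sm_f.hasDerivAt_pth isOpen_halfPlane (h.mem le_rfl s)).inner ℝ
      (hasDerivAt_const s (vG f u T 0))).congr_deriv (by simp)
  obtain ⟨c, hc, hc0⟩ := exists_hasDerivAt_eq_zero hp
    (continuous_iff_continuousAt.2 fun s => (hd s).continuousAt).continuousOn
    (by have := h.cyl.per_f T (-π)
        rw [show -π + 2 * π = π by ring] at this
        simp only [this]) fun s _ => hd s
  have h1 := (h.norm_frame_sub_le le_rfl (Set.Ioo_subset_Icc_self hc)).2
  simp only [h0, zero_mul, Real.cos_zero, Real.sin_zero, one_smul, zero_smul, add_zero] at h1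
  have h2 : ⟪vG f u T c, vG f u T 0⟫_ℝ = 0 := by
    rw [vG, real_inner_smul_left, hc0, mul_zero]
  have h3 := abs_real_inner_le_norm (vG f u T c - vG f u T 0) (vG f u T 0)
  rw [inner_sub_left, h2, real_inner_self_eq_norm_sq, norm_vG h.cyl.conf (h.mem le_rfl 0)] at h3
  norm_num at h3
  linarith

lemma slope_not_neg (h : AsympCyl f u m ε T) (hε : ε ≤ 1) (hm : m ≤ -1) : False := by
  have hcont : ∀ t, T ≤ t → Continuous fun θ => Real.exp (2 * u t θ) := fun t ht =>
    continuous_slice (I := Ioi 0) (φ := fun t θ => Real.exp (2 * u t θ))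
      ((sm_const (2 : ℝ)).mul h.cyl.conf.sm_u).exp (h.pos.trans_le ht)
  have hmono : ∀ t θ, T ≤ t → u T θ ≤ u t θ := fun t θ ht => by
    refine monotoneOn_of_deriv_nonneg (convex_Ici T)
      (fun s hs => (h.hasDerivAt_u hs θ).continuousAt.continuousWithinAt) (fun s hs => ?_)
      (fun s hs => ?_) Set.self_mem_Ici ht ht
    · exact (h.hasDerivAt_u (interior_subset hs) θ).differentiableAt.differentiableWithinAt
    · rw [(h.hasDerivAt_u (interior_subset hs) θ).deriv]
      have := abs_le.1 (h.abs_u1 (t := s) (interior_subset hs) θ)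
      linarith
  have hpos : 0 < circ (fun t θ => Real.exp (2 * u t θ)) T := by
    refine intervalIntegral.intervalIntegral_pos_of_pos_on ((hcont T le_rfl).intervalIntegrable _ _)
      (fun _ _ => Real.exp_pos _) (by linarith [pi_pos])
  obtain ⟨t, ht, hlt⟩ := exists_lt_of_integrableOn_Ioi h.cyl.int_u hpos T
  refine absurd hlt (not_lt.2 ?_)
  refine intervalIntegral.integral_mono_on (by linarith [pi_pos])
    ((hcont T le_rfl).intervalIntegrable _ _) ((hcont t ht.le).intervalIntegrable _ _)
    fun θ _ => ?_
  exact Real.exp_le_exp.2 (by linarith [hmono t θ ht.le])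

section Decay

variable (h : AsympCyl f u m ε T) (hm : 1 ≤ m) (hε : ε ≤ 1 / 2)
include h hm hε

lemma hasDerivAt_expU (ht : T ≤ t) (θ : ℝ) :
    HasDerivAt (fun s => Real.exp (u s θ)) (Real.exp (u t θ) * pt u t θ) t ∧
      Real.exp (u t θ) ≤ -(2 * (Real.exp (u t θ) * pt u t θ)) := by
  refine ⟨(h.hasDerivAt_u ht θ).exp, ?_⟩
  have := abs_le.1 (h.abs_u1 ht θ)
  nlinarith [Real.exp_pos (u t θ)]

lemma expU_le (ht : T ≤ t) (θ : ℝ) :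
    Real.exp (u t θ) ≤ Real.exp (u T θ) * Real.exp (-((t - T) / 2)) := by
  rw [← Real.exp_add, Real.exp_le_exp]
  have hd : ∀ s, T ≤ s → HasDerivAt (fun s => u s θ + s / 2) (pt u s θ + 1 / 2) s := fun s hs =>
    (h.hasDerivAt_u hs θ).add ((hasDerivAt_id s).div_const 2)
  have := antitoneOn_of_deriv_nonpos (convex_Ici T)
      (fun s hs => (hd s hs).continuousAt.continuousWithinAt)
      (fun s hs => (hd s (interior_subset hs)).differentiableAt.differentiableWithinAt)
      (fun s hs => by
        rw [(hd s (interior_subset hs)).deriv]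
        have := abs_le.1 (h.abs_u1 (t := s) (interior_subset hs) θ)
        linarith) Set.self_mem_Ici ht ht
  simp only at this
  linarith

lemma tendsto_expU (θ : ℝ) : Tendsto (fun t => Real.exp (u t θ)) atTop (nhds 0) := by
  have h1 : Tendsto (fun t : ℝ => Real.exp (u T θ) * Real.exp (-((t - T) / 2))) atTop
      (nhds (Real.exp (u T θ) * 0)) := by
    refine (Real.tendsto_exp_neg_atTop_nhds_zero.comp ?_).const_mul _
    exact (tendsto_atTop_add_const_right _ (-T) tendsto_id).atTop_div_const two_pos
  rw [mul_zero] at h1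
  refine tendsto_of_tendsto_of_tendsto_of_le_of_le' tendsto_const_nhds h1
    (Eventually.of_forall fun _ => (Real.exp_pos _).le) ?_
  filter_upwards [eventually_ge_atTop T] with t ht using h.expU_le hm hε ht θ

/-- Integration of a bound by the conformal factor along a ray. -/
lemma norm_sub_le_expU {V : Type*} [NormedAddCommGroup V] [NormedSpace ℝ V] {W W' : ℝ → V} {K : ℝ}
    (hK : 0 ≤ K) (θ : ℝ) (hW : ∀ s, T ≤ s → HasDerivAt W (W' s) s)
    (hb : ∀ s, T ≤ s → ‖W' s‖ ≤ K * Real.exp (u s θ)) {s : ℝ} (ht : T ≤ t) (hs : t ≤ s) :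
    ‖W s - W t‖ ≤ 2 * K * (Real.exp (u t θ) - Real.exp (u s θ)) := by
  have hB : ∀ r, T ≤ r → HasDerivAt (fun r => 2 * K * (Real.exp (u t θ) - Real.exp (u r θ)))
      (2 * K * -(Real.exp (u r θ) * pt u r θ)) r := fun r hr =>
    (((h.hasDerivAt_expU hm hε hr θ).1).const_sub _).const_mul _
  refine image_norm_le_of_norm_deriv_right_le_deriv_boundary' (f := fun s => W s - W t)
    (f' := W') (a := t) (b := s)
    (B := fun r => 2 * K * (Real.exp (u t θ) - Real.exp (u r θ)))
    (B' := fun r => 2 * K * -(Real.exp (u r θ) * pt u r θ)) ?_ ?_ ?_ ?_ ?_ ?_ ⟨hs, le_rfl⟩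
  · exact fun r hr => ((hW r (ht.trans hr.1)).sub_const _).continuousAt.continuousWithinAt
  · exact fun r hr => ((hW r (ht.trans hr.1)).sub_const _).hasDerivWithinAt
  · simp
  · exact fun r hr => (hB r (ht.trans hr.1)).continuousAt.continuousWithinAt
  · exact fun r hr => (hB r (ht.trans hr.1)).hasDerivWithinAt
  · intro r hr
    refine (hb r (ht.trans hr.1)).trans ?_
    have := (h.hasDerivAt_expU hm hε (ht.trans hr.1) θ).2
    nlinarith

lemma exists_limit : ∃ L, ∀ θ, Tendsto (fun t => f t θ) atTop (nhds L) := by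
  have hd : ∀ s θ, T ≤ s → HasDerivAt (fun s => f s θ) (pt f s θ) s := fun s θ hs =>
    h.cyl.conf.sm_f.hasDerivAt_pt isOpen_halfPlane (h.mem hs θ)
  have hb : ∀ t s, T ≤ t → t ≤ s → ‖f s 0 - f t 0‖ ≤ 2 * Real.exp (u t 0) := fun t s ht hs => by
    refine (h.norm_sub_le_expU hm hε zero_le_one 0 (fun r hr => hd r 0 hr) (fun r hr => ?_)
      ht hs).trans ?_
    · rw [one_mul, h.cyl.conf.norm_pt_f (h.mem hr 0)]
    · linarith [Real.exp_pos (u s 0)]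
  have hc : CauchySeq fun t => f t 0 := by
    refine Metric.cauchySeq_iff'.2 fun δ hδ => ?_
    obtain ⟨t, ht, ht'⟩ := (((h.tendsto_expU hm hε 0).eventually (gt_mem_nhds
      (show (0 : ℝ) < δ / 2 by linarith))).and (eventually_ge_atTop T)).exists
    refine ⟨t, fun s hs => ?_⟩
    rw [dist_eq_norm]
    linarith [hb t s ht' hs]
  obtain ⟨L, hL⟩ := cauchySeq_tendsto_of_complete hc
  refine ⟨L, fun θ => ?_⟩
  have hcont : Continuous fun θ => Real.exp (u T θ) :=
    continuous_slice (I := Ioi 0) (φ := fun t θ => Real.exp (u t θ)) h.cyl.conf.sm_u.exp h.pos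
  obtain ⟨M, hM⟩ := isCompact_uIcc.exists_bound_of_continuousOn (s := Set.uIcc 0 θ)
    hcont.continuousOn
  have hlim : Tendsto (fun t => f t θ - f t 0) atTop (nhds 0) := by
    have h1 : Tendsto (fun t : ℝ => M * |θ - 0| * Real.exp (-((t - T) / 2))) atTop
        (nhds (M * |θ - 0| * 0)) := by
      refine (Real.tendsto_exp_neg_atTop_nhds_zero.comp ?_).const_mul _
      exact (tendsto_atTop_add_const_right _ (-T) tendsto_id).atTop_div_const two_pos
    rw [mul_zero] at h1
    refine squeeze_zero_norm' ?_ h1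
    filter_upwards [eventually_ge_atTop T] with t ht
    have := (convex_uIcc 0 θ).norm_image_sub_le_of_norm_hasDerivWithin_le
      (C := M * Real.exp (-((t - T) / 2)))
      (fun s _ => (h.cyl.conf.sm_f.hasDerivAt_pth isOpen_halfPlane
        (h.mem ht s)).hasDerivWithinAt) (fun s hs => ?_) Set.left_mem_uIcc Set.right_mem_uIcc
    · rw [Real.norm_eq_abs] at this
      linarith
    · rw [h.cyl.conf.norm_pth_f (h.mem ht s)]
      refine (h.expU_le hm hε ht s).trans ?_
      have := hM s hs
      rw [Real.norm_eq_abs, Real.abs_exp] at this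
      gcongr
  simpa using hlim.add hL

lemma norm_position_le {L : EuclideanSpace ℝ (Fin n)}
    (hL : Tendsto (fun t => f t θ) atTop (nhds L)) (ht : T ≤ t) :
    ‖Real.exp (-u t θ) • (f t θ - L) + (1 / m) • vF f u t θ‖ ≤ 6 * ε := by
  have hm0 : 0 < m := by linarith
  have he := h.eps_nonneg
  have hinv : 1 / m ≤ 1 := by rw [div_le_one hm0]; exact hm
  have hinv0 : 0 < 1 / m := by positivity
  have hW : ∀ s, T ≤ s → HasDerivAt (fun s => f s θ + (1 / m) • pt f s θ)
      (pt f s θ + (1 / m) • pt (pt f) s θ) s := fun s hs =>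
    (h.cyl.conf.sm_f.hasDerivAt_pt isOpen_halfPlane (h.mem hs θ)).add
      (((h.cyl.conf.sm_f.pt isOpen_halfPlane).hasDerivAt_pt isOpen_halfPlane
        (h.mem hs θ)).const_smul (1 / m))
  have hW' : ∀ s, T ≤ s → ‖pt f s θ + (1 / m) • pt (pt f) s θ‖ ≤ 3 * ε * Real.exp (u s θ) := by
    intro s hs
    have e : pt f s θ + (1 / m) • pt (pt f) s θ =
        (1 / m) • ((pt u s θ + m) • pt f s θ + Att f u s θ - pth u s θ • pth f s θ) := by
      rw [(DiskConfWillmore.second_derivs f u s θ).1]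
      have : (1 / m) * m = 1 := by field_simp
      linear_combination (norm := module) (-this) • pt f s θ
    have k1 := h.abs_u1 hs θ
    have k2 := h.abs_u2 hs θ
    have k3 := (norm_A_le f u s θ).1
    have k4 := mul_le_mul_of_nonneg_left (h.aa_le s θ hs) (Real.exp_pos (u s θ)).le
    have k5 : ‖(pt u s θ + m) • pt f s θ‖ ≤ ε * Real.exp (u s θ) := by
      rw [norm_smul, h.cyl.conf.norm_pt_f (h.mem hs θ), Real.norm_eq_abs]
      gcongr
    have k6 : ‖pth u s θ • pth f s θ‖ ≤ ε * Real.exp (u s θ) := by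
      rw [norm_smul, h.cyl.conf.norm_pth_f (h.mem hs θ), Real.norm_eq_abs]
      gcongr
    have k7 : ‖(pt u s θ + m) • pt f s θ + Att f u s θ - pth u s θ • pth f s θ‖
        ≤ 3 * ε * Real.exp (u s θ) :=
      (norm_sub_le_of_le (norm_add_le_of_le k5 k3) k6).trans (by linarith)
    rw [e, norm_smul, Real.norm_eq_abs, abs_of_pos hinv0]
    nlinarith [norm_nonneg ((pt u s θ + m) • pt f s θ + Att f u s θ - pth u s θ • pth f s θ)]
  have hlim : Tendsto (fun s => f s θ + (1 / m) • pt f s θ) atTop (nhds L) := by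
    have h1 : Tendsto (fun s => pt f s θ) atTop (nhds 0) := by
      refine squeeze_zero_norm' ?_ (h.tendsto_expU hm hε θ)
      filter_upwards [eventually_ge_atTop T] with s hs
      rw [h.cyl.conf.norm_pt_f (h.mem hs θ)]
    simpa using hL.add (h1.const_smul (1 / m))
  have key : ‖L - (f t θ + (1 / m) • pt f t θ)‖ ≤ 2 * (3 * ε) * Real.exp (u t θ) := by
    refine le_of_tendsto (hlim.sub_const _).norm ?_
    filter_upwards [eventually_ge_atTop t] with s hs
    refine (h.norm_sub_le_expU hm hε (K := 3 * ε) (by positivity) θ hW hW' ht hs).trans ?_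
    have := Real.exp_pos (u s θ)
    gcongr
    linarith
  have e : Real.exp (-u t θ) • (f t θ - L) + (1 / m) • vF f u t θ =
      -(Real.exp (-u t θ) • (L - (f t θ + (1 / m) • pt f t θ))) := by
    rw [vF]; module
  rw [e, norm_neg]
  refine norm_exp_neg_smul_le (key.trans (le_of_eq ?_))
  ring

end Decay

end AsympCyl

/-- The asymptotic slope of the logarithm of the conformal factor is a negative integer. -/
lemma exists_nat_slope (hF : FiniteCyl f u) : ∃ m : ℕ, 1 ≤ m ∧
    Tendsto (circ (pt u)) atTop (nhds (-(2 * π * m))) := by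
  obtain ⟨m, hm⟩ := exists_tendsto_circ_pt_u hF
  have hsin : Real.sin (m * π) = 0 := by
    by_contra hne
    obtain ⟨T, -, h⟩ := exists_asympCyl hF hm (ε := |Real.sin (m * π)| / 128) (by positivity)
    have := h.abs_sin_mul_pi_le
    have := abs_pos.2 hne
    linarith
  obtain ⟨k, hk⟩ := Real.sin_eq_zero_iff.1 hsin
  have hk' : (k : ℝ) = m := mul_right_cancel₀ pi_pos.ne' hk
  obtain ⟨T, -, h⟩ := exists_asympCyl hF hm (ε := 1 / 128) (by norm_num)
  have h0 : k ≠ 0 := by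
    rintro rfl
    exact h.slope_ne_zero (by norm_num) (by rw [← hk']; simp)
  have h1 : 0 < k := by
    by_contra hneg
    have : k ≤ -1 := by omega
    exact h.slope_not_neg (by norm_num) (by rw [← hk']; exact_mod_cast this)
  refine ⟨k.toNat, by omega, ?_⟩
  have : ((k.toNat : ℕ) : ℝ) = m := by
    rw [← hk']; exact_mod_cast Int.toNat_of_nonneg h1.le
  rw [this]; exact hm

end Limit

section Periodic

variable {f : ℝ → ℝ → EuclideanSpace ℝ (Fin n)} {u : ℝ → ℝ → ℝ} {t : ℝ}

lemma periodic_A (hF : FiniteCyl f u) (ht : 0 < t) (θ : ℝ) :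
    Att f u t (θ + 2 * π) = Att f u t θ ∧ Atth f u t (θ + 2 * π) = Atth f u t θ ∧
      Athth f u t (θ + 2 * π) = Athth f u t θ := by
  have hp' := fun t ht => periodic_pt (fun t _ => hF.per_f t) (t := t) ht
  have hq' := fun t ht => periodic_pth (fun t _ => hF.per_f t) (t := t) ht
  have a1 : ∀ θ, pt u t (θ + 2 * π) = pt u t θ := periodic_pt (fun t _ => hF.per_u t) ht
  have a2 : ∀ θ, pth u t (θ + 2 * π) = pth u t θ := periodic_pth (fun t _ => hF.per_u t) ht
  simp only [Att, Atth, Athth, a1, a2, hp' t ht, hq' t ht,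
    periodic_pt hp' ht, periodic_pth hq' ht, periodic_pt hq' ht, and_self]

lemma periodic_Hmc (hF : FiniteCyl f u) (ht : 0 < t) (θ : ℝ) :
    Hmc f u t (θ + 2 * π) = Hmc f u t θ := by
  obtain ⟨h1, -, h2⟩ := periodic_A hF ht θ
  rw [Hmc_eq, Hmc_eq, h1, h2, hF.per_u]

lemma periodic_flux2 (hF : FiniteCyl f u) (ht : 0 < t) (θ : ℝ) :
    flux2 f u t (θ + 2 * π) = flux2 f u t θ := by
  obtain ⟨-, h1, h2⟩ := periodic_A hF ht θ
  have h3 := periodic_pth (fun t ht => periodic_Hmc hF (t := t) ht) ht θ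
  have h4 := periodic_pt (fun t _ => hF.per_f t) ht θ
  have h5 := periodic_pth (fun t _ => hF.per_f t) ht θ
  simp only [flux2, h1, h2, h3, h4, h5, periodic_Hmc hF ht, hF.per_u]

end Periodic

section Wedge

variable {E : Type*} [NormedAddCommGroup E] [InnerProductSpace ℝ E]

/-- The pairing of the bivectors `x ∧ y` and `a ∧ b`. -/
def wd (a b x y : E) : ℝ := ⟪x, a⟫_ℝ * ⟪y, b⟫_ℝ - ⟪x, b⟫_ℝ * ⟪y, a⟫_ℝ

variable {a b : E}

lemma wd_self (x : E) : wd a b x x = 0 := by rw [wd]; ring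

lemma wd_swap (x y : E) : wd a b y x = -wd a b x y := by rw [wd, wd]; ring

lemma wd_add_left (x x' y : E) : wd a b (x + x') y = wd a b x y + wd a b x' y := by
  simp only [wd, inner_add_left]; ring

lemma wd_add_right (x y y' : E) : wd a b x (y + y') = wd a b x y + wd a b x y' := by
  simp only [wd, inner_add_left]; ring

lemma wd_smul_left (r : ℝ) (x y : E) : wd a b (r • x) y = r * wd a b x y := by
  simp only [wd, real_inner_smul_left]; ring

lemma wd_smul_right (r : ℝ) (x y : E) : wd a b x (r • y) = r * wd a b x y := by
  simp only [wd, real_inner_smul_left]; ring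

lemma wd_sub_left (x x' y : E) : wd a b (x - x') y = wd a b x y - wd a b x' y := by
  simp only [wd, inner_sub_left]; ring

lemma abs_wd_le (ha : ‖a‖ ≤ 1) (hb : ‖b‖ ≤ 1) (x y : E) : |wd a b x y| ≤ 2 * (‖x‖ * ‖y‖) := by
  have h : ∀ z c : E, ‖c‖ ≤ 1 → |⟪z, c⟫_ℝ| ≤ ‖z‖ := fun z c hc =>
    (abs_real_inner_le_norm z c).trans (mul_le_of_le_one_right (norm_nonneg _) hc)
  rw [wd]
  refine (abs_sub _ _).trans ?_
  rw [abs_mul, abs_mul]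
  have h1 := mul_le_mul (h x a ha) (h y b hb) (abs_nonneg _) (norm_nonneg _)
  have h2 := mul_le_mul (h x b hb) (h y a ha) (abs_nonneg _) (norm_nonneg _)
  linarith

variable {X Y : ℝ → ℝ → E} {U : Set (ℝ × ℝ)} {t θ : ℝ}

lemma Sm.wd (hX : Sm U X) (hY : Sm U Y) : Sm U fun s r => wd a b (X s r) (Y s r) :=
  ((hX.inner (sm_const a)).mul (hY.inner (sm_const b))).sub
    ((hX.inner (sm_const b)).mul (hY.inner (sm_const a)))

lemma hasDerivAt_wd {x y : ℝ → E} {x' y' : E} {s : ℝ} (hx : HasDerivAt x x' s)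
    (hy : HasDerivAt y y' s) :
    HasDerivAt (fun s => wd a b (x s) (y s)) (wd a b x' (y s) + wd a b (x s) y') s := by
  have hi : ∀ {z : ℝ → E} {z' : E} (c : E), HasDerivAt z z' s →
      HasDerivAt (fun s => ⟪z s, c⟫_ℝ) ⟪z', c⟫_ℝ s := fun c hz =>
    (hz.inner ℝ (hasDerivAt_const s c)).congr_deriv (by simp)
  refine (((hi a hx).mul (hi b hy)).sub ((hi b hx).mul (hi a hy))).congr_deriv ?_
  simp only [wd]
  ring

end Wedge

section Residue

variable {f : ℝ → ℝ → EuclideanSpace ℝ (Fin n)} {u : ℝ → ℝ → ℝ} {t θ : ℝ} {m ε T : ℝ}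

/-- The density of the rotational residue. -/
def res1 (f : ℝ → ℝ → EuclideanSpace ℝ (Fin n)) (u : ℝ → ℝ → ℝ)
    (L a b : EuclideanSpace ℝ (Fin n)) (t θ : ℝ) : ℝ :=
  wd a b (flux1 f u t θ) (f t θ - L) - 2 * wd a b (Hmc f u t θ) (pt f t θ)

/-- The angular flux of the rotational residue. -/
def res2 (f : ℝ → ℝ → EuclideanSpace ℝ (Fin n)) (u : ℝ → ℝ → ℝ)
    (L a b : EuclideanSpace ℝ (Fin n)) (t θ : ℝ) : ℝ :=
  wd a b (flux2 f u t θ) (f t θ - L) - 2 * wd a b (Hmc f u t θ) (pth f t θ)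

variable (L a b : EuclideanSpace ℝ (Fin n))

lemma sm_res (hF : FiniteCyl f u) :
    Sm halfPlane (res1 f u L a b) ∧ Sm halfPlane (res2 f u L a b) := by
  have hf := hF.conf.sm_f
  have hH := hF.conf.sm_Hmc isOpen_halfPlane
  have hs := hf.sub (sm_const L)
  exact ⟨((sm_flux1 hf hF.conf.sm_u isOpen_halfPlane).wd hs).sub
      ((sm_const 2).mul (hH.wd (hf.pt isOpen_halfPlane))),
    ((sm_flux2 hf hF.conf.sm_u isOpen_halfPlane).wd hs).sub
      ((sm_const 2).mul (hH.wd (hf.pth isOpen_halfPlane)))⟩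

lemma div_res (hF : FiniteCyl f u) (hp : (t, θ) ∈ halfPlane) :
    pt (res1 f u L a b) t θ = -pth (res2 f u L a b) t θ := by
  have hU := isOpen_halfPlane
  have hf := hF.conf.sm_f
  have hH := hF.conf.sm_Hmc hU
  have d1 := (hf.hasDerivAt_pt hU hp).sub_const L
  have d2 := (hf.hasDerivAt_pth hU hp).sub_const L
  have h1 := sm_flux1 hf hF.conf.sm_u hU
  have h2 := sm_flux2 hf hF.conf.sm_u hU
  have e1 : pt (res1 f u L a b) t θ = _ :=
    ((hasDerivAt_wd (h1.hasDerivAt_pt hU hp) d1).sub ((hasDerivAt_wd (hH.hasDerivAt_pt hU hp)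
      ((hf.pt hU).hasDerivAt_pt hU hp)).const_mul 2)).deriv
  have e2 : pth (res2 f u L a b) t θ = _ :=
    ((hasDerivAt_wd (h2.hasDerivAt_pth hU hp) d2).sub ((hasDerivAt_wd (hH.hasDerivAt_pth hU hp)
      ((hf.pth hU).hasDerivAt_pth hU hp)).const_mul 2)).deriv
  rw [e1, e2]
  have hw := hF.conf.willmore (t, θ) hp
  rw [willmoreOp_eq_div hf hF.conf.sm_u hU hp] at hw
  have hw' := congrArg (fun x => wd a b x (f t θ - L)) hw
  simp only [wd_add_left] at hw'
  have h0 : wd a b (0 : EuclideanSpace ℝ (Fin n)) (f t θ - L) = 0 := by simp [wd]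
  rw [h0] at hw'
  have hh := congrArg (fun x => wd a b (Hmc f u t θ) x) (exp_smul_Hmc f u t θ)
  simp only [wd_smul_right, wd_self, wd_add_right, mul_zero] at hh
  have f1 : wd a b (flux1 f u t θ) (pt f t θ) = 2 * wd a b (pt (Hmc f u) t θ) (pt f t θ)
      + 4 * (Real.exp (-(2 * u t θ)) * (⟪Hmc f u t θ, Atth f u t θ⟫_ℝ *
        wd a b (pth f t θ) (pt f t θ))) := by
    simp only [flux1, wd_sub_left, wd_add_left, wd_smul_left, wd_self]; ring
  have f2 : wd a b (flux2 f u t θ) (pth f t θ) = 2 * wd a b (pth (Hmc f u) t θ) (pth f t θ)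
      - 4 * (Real.exp (-(2 * u t θ)) * (⟪Hmc f u t θ, Atth f u t θ⟫_ℝ *
        wd a b (pth f t θ) (pt f t θ))) := by
    simp only [flux2, wd_sub_left, wd_add_left, wd_smul_left, wd_self,
      wd_swap (pth f t θ) (pt f t θ)]; ring
  rw [f1, f2]
  linarith

lemma hasDerivAt_circ_res (hF : FiniteCyl f u) (ht : 0 < t) :
    HasDerivAt (circ (res1 f u L a b)) 0 t := by
  refine (hasDerivAt_circ (I := Ioi 0) (sm_res L a b hF).1 isOpen_Ioi ht).congr_deriv ?_
  have h := circ_pth (I := Ioi 0) (sm_res L a b hF).2 isOpen_Ioi ht fun θ => by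
    rw [res2, res2, periodic_flux2 hF ht, periodic_Hmc hF ht, hF.per_f,
      periodic_pth (fun t _ => hF.per_f t) ht]
  rw [circ_congr (ψ := fun s r => -pth (res2 f u L a b) s r) fun θ => div_res L a b hF (mem_halfPlane (θ := θ) ht)]
  rw [circ, intervalIntegral.integral_neg, neg_eq_zero]
  exact h

/-- The rescaled flux. -/
lemma exp_smul_flux1 (f : ℝ → ℝ → EuclideanSpace ℝ (Fin n)) (u : ℝ → ℝ → ℝ) (t θ : ℝ) :
    Real.exp (u t θ) • flux1 f u t θ = (2 : ℝ) • vy1 f u t θ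
      + ((4 : ℝ) • (⟪vh f u t θ, Real.exp (-u t θ) • Att f u t θ⟫_ℝ • vF f u t θ
        + ⟪vh f u t θ, Real.exp (-u t θ) • Atth f u t θ⟫_ℝ • vG f u t θ)
      - ‖vh f u t θ‖ ^ 2 • vF f u t θ) := by
  have e1 : Real.exp (u t θ) * Real.exp (-u t θ) = 1 := by rw [← Real.exp_add]; simp
  have e2 : Real.exp (-(2 * u t θ)) = Real.exp (-u t θ) * Real.exp (-u t θ) := by
    rw [← Real.exp_add]; congr 1; ring
  simp only [flux1, vy1, vh, vF, vG, real_inner_smul_left, real_inner_smul_right, norm_smul,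
    Real.norm_eq_abs, Real.abs_exp, e2, mul_pow]
  set E := Real.exp (u t θ)
  set E' := Real.exp (-u t θ)
  have e3 : E * (E' * E') = E' := by rw [← mul_assoc, e1, one_mul]
  have e4 : E ^ 2 * E' = E := by rw [sq, mul_assoc, e1, mul_one]
  linear_combination (norm := module)
    e3 • ((4 * ⟪Hmc f u t θ, Att f u t θ⟫_ℝ) • pt f t θ
    + (4 * ⟪Hmc f u t θ, Atth f u t θ⟫_ℝ) • pth f t θ) -
    (e1 * E') • ((4 * ⟪Hmc f u t θ, Att f u t θ⟫_ℝ) • pt f t θ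
    + (4 * ⟪Hmc f u t θ, Atth f u t θ⟫_ℝ) • pth f t θ) + e4 • (‖Hmc f u t θ‖ ^ 2 • pt f t θ)

end Residue

lemma norm_circ_le_circ {F : Type*} [NormedAddCommGroup F] [NormedSpace ℝ F] {φ : ℝ → ℝ → F}
    {b : ℝ → ℝ → ℝ} {t : ℝ} (hb : Continuous (b t))
    (h : ∀ θ ∈ Icc (-π) π, ‖φ t θ‖ ≤ b t θ) : ‖circ φ t‖ ≤ circ b t :=
  intervalIntegral.norm_integral_le_of_norm_le (by linarith [pi_pos])
    (Filter.Eventually.of_forall fun θ hθ => h θ ⟨hθ.1.le, hθ.2⟩) (hb.intervalIntegrable _ _)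

section Neutral

variable {f : ℝ → ℝ → EuclideanSpace ℝ (Fin n)} {u : ℝ → ℝ → ℝ} {t θ : ℝ} {m ε T : ℝ}

/-- The quadratic part of the rescaled flux. -/
def fluxRem (f : ℝ → ℝ → EuclideanSpace ℝ (Fin n)) (u : ℝ → ℝ → ℝ) (t θ : ℝ) :
    EuclideanSpace ℝ (Fin n) :=
  (4 : ℝ) • (⟪vh f u t θ, Real.exp (-u t θ) • Att f u t θ⟫_ℝ • vF f u t θ
    + ⟪vh f u t θ, Real.exp (-u t θ) • Atth f u t θ⟫_ℝ • vG f u t θ)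
  - ‖vh f u t θ‖ ^ 2 • vF f u t θ

lemma abs_inner_vh_le (f : ℝ → ℝ → EuclideanSpace ℝ (Fin n)) (u : ℝ → ℝ → ℝ) (t θ : ℝ) :
    |⟪vh f u t θ, Real.exp (-u t θ) • Att f u t θ⟫_ℝ| ≤ 2 * aa f u t θ ^ 2 ∧
      |⟪vh f u t θ, Real.exp (-u t θ) • Atth f u t θ⟫_ℝ| ≤ 2 * aa f u t θ ^ 2 := by
  have hA := norm_A_le f u t θ
  have hh := norm_vh_le f u t θ
  have ha := aa_nonneg f u t θ
  have key : ∀ x : EuclideanSpace ℝ (Fin n), ‖x‖ ≤ Real.exp (u t θ) * aa f u t θ →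
      |⟪vh f u t θ, Real.exp (-u t θ) • x⟫_ℝ| ≤ 2 * aa f u t θ ^ 2 := fun x hx => by
    refine (abs_real_inner_le_norm _ _).trans ?_
    have := mul_le_mul hh (norm_exp_neg_smul_le hx) (norm_nonneg _) (by positivity)
    linarith
  exact ⟨key _ hA.1, key _ hA.2.1⟩

lemma norm_fluxRem_le (hF : FiniteCyl f u) (hp : (t, θ) ∈ halfPlane) :
    ‖fluxRem f u t θ‖ ≤ 20 * aa f u t θ ^ 2 := by
  obtain ⟨h1, h2⟩ := abs_inner_vh_le f u t θ
  have hh := norm_vh_le f u t θ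
  have hF1 := norm_vF hF.conf hp
  have hG1 := norm_vG hF.conf hp
  have ha := aa_nonneg f u t θ
  rw [fluxRem]
  refine (norm_sub_le _ _).trans ?_
  have e1 : ‖(4 : ℝ) • (⟪vh f u t θ, Real.exp (-u t θ) • Att f u t θ⟫_ℝ • vF f u t θ
    + ⟪vh f u t θ, Real.exp (-u t θ) • Atth f u t θ⟫_ℝ • vG f u t θ)‖ ≤
      4 * (2 * aa f u t θ ^ 2 + 2 * aa f u t θ ^ 2) := by
    rw [norm_smul, Real.norm_eq_abs, abs_of_pos (by norm_num : (0:ℝ) < 4)]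
    gcongr
    refine (norm_add_le _ _).trans ?_
    rw [norm_smul, norm_smul, hF1, hG1, mul_one, mul_one, Real.norm_eq_abs, Real.norm_eq_abs]
    exact add_le_add h1 h2
  have e2 : ‖‖vh f u t θ‖ ^ 2 • vF f u t θ‖ ≤ 4 * aa f u t θ ^ 2 := by
    rw [norm_smul, hF1, mul_one, Real.norm_eq_abs, abs_of_nonneg (by positivity)]
    nlinarith [norm_nonneg (vh f u t θ)]
  linarith

/-- The components of `e^u ∂₁H` along the tangent frame are quadratically small. -/
lemma abs_inner_vy1_le (hF : FiniteCyl f u) (hp : (t, θ) ∈ halfPlane) :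
    |⟪vy1 f u t θ, vF f u t θ⟫_ℝ| ≤ 2 * aa f u t θ ^ 2 ∧
      |⟪vy1 f u t θ, vG f u t θ⟫_ℝ| ≤ 2 * aa f u t θ ^ 2 := by
  have hU := isOpen_halfPlane
  have hf := hF.conf.sm_f
  have hH := hF.conf.sm_Hmc hU
  have hs := DiskConfWillmore.second_derivs f u t θ
  have hn := hF.conf.inner_first_H hU hp
  have key : ∀ X : ℝ → ℝ → EuclideanSpace ℝ (Fin n), Sm halfPlane X →
      (∀ q ∈ halfPlane, ⟪X q.1 q.2, Hmc f u q.1 q.2⟫_ℝ = 0) →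
      ⟪pt (Hmc f u) t θ, X t θ⟫_ℝ = -⟪pt X t θ, Hmc f u t θ⟫_ℝ := fun X hX h => by
    have e := pt_inner hU hX hH hp
    rw [pt_congr (ψ := fun _ _ => (0 : ℝ)) hU h hp] at e
    have z : pt (fun _ _ => (0 : ℝ)) t θ = 0 := by simp [pt]
    rw [z] at e
    rw [real_inner_comm]
    linarith
  have k1 := key _ (hf.pt hU) (fun q hq => (hF.conf.inner_first_H hU hq).1)
  have k2 := key _ (hf.pth hU) (fun q hq => (hF.conf.inner_first_H hU hq).2)
  rw [hs.1, inner_sub_left, inner_add_left, real_inner_smul_left, real_inner_smul_left,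
    hn.1, hn.2] at k1
  rw [hs.2.1, inner_add_left, inner_add_left, real_inner_smul_left, real_inner_smul_left,
    hn.1, hn.2] at k2
  obtain ⟨b1, b2⟩ := abs_inner_vh_le f u t θ
  have e0 : Real.exp (u t θ) * Real.exp (-u t θ) = 1 := by rw [← Real.exp_add]; simp
  rw [vh, real_inner_smul_left, real_inner_smul_right, ← mul_assoc, e0, one_mul,
    real_inner_comm] at b1 b2
  rw [vy1, vF, vG, real_inner_smul_left, real_inner_smul_right, real_inner_smul_left,
    real_inner_smul_right, ← mul_assoc, ← mul_assoc, e0, one_mul, one_mul, k1, k2]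
  constructor
  · simpa using b1
  · simpa using b2

/-- The rescaled form of the rotational residue density. -/
lemma res1_eq (L a b : EuclideanSpace ℝ (Fin n)) :
    res1 f u L a b t θ = wd a b ((2 : ℝ) • vy1 f u t θ + fluxRem f u t θ)
      (Real.exp (-u t θ) • (f t θ - L)) - 2 * wd a b (vh f u t θ) (vF f u t θ) := by
  have e0 : Real.exp (-u t θ) * Real.exp (u t θ) = 1 := by rw [← Real.exp_add]; simp
  have e := exp_smul_flux1 f u t θ
  rw [← fluxRem] at e
  rw [← e, vh, vF, wd_smul_left, wd_smul_right, wd_smul_left, wd_smul_right, res1]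
  linear_combination (-(wd a b (flux1 f u t θ) (f t θ - L)) +
    2 * wd a b (Hmc f u t θ) (pt f t θ)) * e0

lemma circ_res_eq_zero (hF : FiniteCyl f u)
    (hm : Tendsto (circ (pt u)) atTop (nhds (-(2 * π * m)))) (hm1 : 1 ≤ m)
    {L a b : EuclideanSpace ℝ (Fin n)} (hL : ∀ θ, Tendsto (fun t => f t θ) atTop (nhds L))
    (ha : ‖a‖ ≤ 1) (hb : ‖b‖ ≤ 1) (ht : 0 < t) : circ (res1 f u L a b) t = 0 := by
  have hconst : ∀ s, t ≤ s → circ (res1 f u L a b) s = circ (res1 f u L a b) t := fun s hs => by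
    refine constant_of_has_deriv_right_zero (a := t) (b := s)
      (fun r hr => (hasDerivAt_circ_res L a b hF
        (ht.trans_le hr.1)).continuousAt.continuousWithinAt)
      (fun r hr => (hasDerivAt_circ_res L a b hF (ht.trans_le hr.1)).hasDerivWithinAt) s
      ⟨hs, le_rfl⟩
  by_contra hne
  have hpos := abs_pos.2 hne
  set c := |circ (res1 f u L a b) t| with hc
  obtain ⟨T, -, h⟩ := exists_asympCyl hF hm (ε := min (1 / 2) (c / 1000)) (by positivity)
  set ε := min (1 / 2) (c / 1000)
  have hε : ε ≤ 1 / 2 := min_le_left _ _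
  have hεc : ε ≤ c / 1000 := min_le_right _ _
  have hε0 := h.eps_nonneg
  have hinv : ‖(1 / m : ℝ)‖ ≤ 1 := by
    rw [Real.norm_eq_abs, abs_of_pos (by positivity), div_le_one (by positivity)]; exact hm1
  have bound : ∀ θ, ‖res1 f u L a b (max t T) θ‖ ≤ 104 * ε := fun θ => by
    have hT : T ≤ max t T := le_max_right _ _
    have ha1 := h.aa_le _ θ hT
    have hy1 := h.yy_le _ θ hT
    have ha0 := aa_nonneg f u (max t T) θ
    have hr := norm_fluxRem_le hF (h.mem hT θ)
    have hp := h.norm_position_le hm1 hε (hL θ) hT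
    have hF1 := norm_vF hF.conf (h.mem hT θ)
    have hh := norm_vh_le f u (max t T) θ
    have hw : ‖Real.exp (-u (max t T) θ) • (f (max t T) θ - L)‖ ≤ 4 := by
      have := norm_sub_le (Real.exp (-u (max t T) θ) • (f (max t T) θ - L) +
        (1 / m : ℝ) • vF f u (max t T) θ) ((1 / m : ℝ) • vF f u (max t T) θ)
      rw [add_sub_cancel_right, norm_smul (1 / m : ℝ), hF1, mul_one] at this
      linarith
    have hy : ‖(2 : ℝ) • vy1 f u (max t T) θ + fluxRem f u (max t T) θ‖ ≤ 12 * ε := by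
      refine (norm_add_le _ _).trans ?_
      rw [norm_smul, Real.norm_eq_abs, abs_of_pos (by norm_num : (0:ℝ) < 2)]
      have : ‖vy1 f u (max t T) θ‖ ≤ ε :=
        (le_add_of_nonneg_right (norm_nonneg _)).trans hy1
      nlinarith
    rw [res1_eq, Real.norm_eq_abs]
    refine (abs_sub _ _).trans ?_
    rw [abs_mul, abs_of_pos (by norm_num : (0:ℝ) < 2)]
    have w1 := abs_wd_le ha hb ((2 : ℝ) • vy1 f u (max t T) θ + fluxRem f u (max t T) θ)
      (Real.exp (-u (max t T) θ) • (f (max t T) θ - L))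
    have w2 := abs_wd_le ha hb (vh f u (max t T) θ) (vF f u (max t T) θ)
    rw [hF1, mul_one] at w2
    have := mul_le_mul hy hw (norm_nonneg _) (by positivity)
    linarith
  have key := norm_circ_le_of_le bound
  rw [hconst _ (le_max_left _ _), Real.norm_eq_abs, ← hc] at key
  nlinarith [pi_lt_four, pi_pos]

end Neutral

section Neutral

variable {f : ℝ → ℝ → EuclideanSpace ℝ (Fin n)} {u : ℝ → ℝ → ℝ} {t θ : ℝ} {m ε T : ℝ}

/-- A direction which is almost normal at `θ` is almost normal to the initial tangent plane. -/
lemma AsympCyl.abs_inner_frame_zero_le (h : AsympCyl f u m ε T) (ht : T ≤ t)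
    (hθ : θ ∈ Icc (-π) π) (x : EuclideanSpace ℝ (Fin n)) :
    |⟪x, vF f u t 0⟫_ℝ| ≤ |⟪x, vF f u t θ⟫_ℝ| + |⟪x, vG f u t θ⟫_ℝ| + 128 * ε * ‖x‖ ∧
    |⟪x, vG f u t 0⟫_ℝ| ≤ |⟪x, vF f u t θ⟫_ℝ| + |⟪x, vG f u t θ⟫_ℝ| + 128 * ε * ‖x‖ := by
  obtain ⟨k1, k2⟩ := h.norm_frame_sub_le ht hθ
  have hc := Real.abs_cos_le_one (m * θ)
  have hs := Real.abs_sin_le_one (m * θ)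
  have hcs := Real.cos_sq_add_sin_sq (m * θ)
  set c := Real.cos (m * θ)
  set s := Real.sin (m * θ)
  set F := vF f u t θ
  set G := vG f u t θ
  set F₀ := vF f u t 0
  set G₀ := vG f u t 0
  have i1 := (abs_real_inner_le_norm x _).trans (mul_le_mul_of_nonneg_left k1 (norm_nonneg x))
  have i2 := (abs_real_inner_le_norm x _).trans (mul_le_mul_of_nonneg_left k2 (norm_nonneg x))
  simp only [inner_sub_right, inner_add_right, real_inner_smul_right] at i1 i2
  set A := ⟪x, F⟫_ℝ - (c * ⟪x, F₀⟫_ℝ - s * ⟪x, G₀⟫_ℝ)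
  set B := ⟪x, G⟫_ℝ - (c * ⟪x, G₀⟫_ℝ + s * ⟪x, F₀⟫_ℝ)
  have e1 : ⟪x, F₀⟫_ℝ = c * ⟪x, F⟫_ℝ + s * ⟪x, G⟫_ℝ + (-(c * A) + -(s * B)) := by
    linear_combination -⟪x, F₀⟫_ℝ * hcs
  have e2 : ⟪x, G₀⟫_ℝ = c * ⟪x, G⟫_ℝ + -(s * ⟪x, F⟫_ℝ) + (-(c * B) + s * A) := by
    linear_combination -⟪x, G₀⟫_ℝ * hcs
  have mul1 : ∀ {r y : ℝ}, |r| ≤ 1 → |r * y| ≤ |y| := fun hr => by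
    rw [abs_mul]; exact mul_le_of_le_one_left (abs_nonneg _) hr
  constructor
  · rw [e1]
    refine (abs_add_le _ _).trans ?_
    have a1 := abs_add_le (c * ⟪x, F⟫_ℝ) (s * ⟪x, G⟫_ℝ)
    have a2 := abs_add_le (-(c * A)) (-(s * B))
    rw [abs_neg, abs_neg] at a2
    linarith [mul1 (y := ⟪x, F⟫_ℝ) hc, mul1 (y := ⟪x, G⟫_ℝ) hs, mul1 (y := A) hc,
      mul1 (y := B) hs]
  · rw [e2]
    refine (abs_add_le _ _).trans ?_
    have a1 := abs_add_le (c * ⟪x, G⟫_ℝ) (-(s * ⟪x, F⟫_ℝ))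
    have a2 := abs_add_le (-(c * B)) (s * A)
    rw [abs_neg] at a1 a2
    linarith [mul1 (y := ⟪x, F⟫_ℝ) hs, mul1 (y := ⟪x, G⟫_ℝ) hc, mul1 (y := A) hs,
      mul1 (y := B) hc]

/-- The combination `e^u ∂₁H + m e^u H`, which vanishes to first order on neutral modes. -/
def vz (f : ℝ → ℝ → EuclideanSpace ℝ (Fin n)) (u : ℝ → ℝ → ℝ) (m t θ : ℝ) :
    EuclideanSpace ℝ (Fin n) := vy1 f u t θ + m • vh f u t θ

lemma norm_vz_le (hm : 1 ≤ m) : ‖vz f u m t θ‖ ≤ 2 * m * (aa f u t θ + yy f u t θ) := by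
  have hh := norm_vh_le f u t θ
  have hy : ‖vy1 f u t θ‖ ≤ yy f u t θ := le_add_of_nonneg_right (norm_nonneg _)
  have hy0 := yy_nonneg f u t θ
  refine (norm_add_le _ _).trans ?_
  rw [norm_smul, Real.norm_eq_abs, abs_of_pos (by linarith)]
  nlinarith

lemma vz_inner_frame_le (hF : FiniteCyl f u) (hp : (t, θ) ∈ halfPlane) :
    |⟪vz f u m t θ, vF f u t θ⟫_ℝ| ≤ 2 * aa f u t θ ^ 2 ∧
      |⟪vz f u m t θ, vG f u t θ⟫_ℝ| ≤ 2 * aa f u t θ ^ 2 := by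
  obtain ⟨h1, h2⟩ := abs_inner_vy1_le hF hp
  have hn := hF.conf.inner_first_H isOpen_halfPlane hp
  have n1 : ⟪vh f u t θ, vF f u t θ⟫_ℝ = 0 := by
    rw [vh, vF, real_inner_smul_left, real_inner_smul_right, real_inner_comm, hn.1]; simp
  have n2 : ⟪vh f u t θ, vG f u t θ⟫_ℝ = 0 := by
    rw [vh, vG, real_inner_smul_left, real_inner_smul_right, real_inner_comm, hn.2]; simp
  rw [vz, inner_add_left, inner_add_left, real_inner_smul_left, real_inner_smul_left, n1, n2,
    mul_zero, add_zero, add_zero]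
  exact ⟨h1, h2⟩

section Decay

variable (h : AsympCyl f u m ε T) (hm : 1 ≤ m) (hε : ε ≤ 1 / 2)
  {L a : EuclideanSpace ℝ (Fin n)}
include h hm hε

lemma abs_residue_le (hL : Tendsto (fun t => f t θ) atTop (nhds L)) (ha : ‖a‖ ≤ 1)
    (ht : T ≤ t) {b : EuclideanSpace ℝ (Fin n)} {γ : ℝ} (hb : ‖b‖ ≤ 1)
    (hγ : |⟪vF f u t θ, b⟫_ℝ - γ| ≤ 64 * ε)
    (hz : |⟪vz f u m t θ, b⟫_ℝ| ≤ 4 * aa f u t θ ^ 2 + 128 * ε * ‖vz f u m t θ‖) :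
    |⟪vz f u m t θ, a⟫_ℝ * γ + m / 2 * res1 f u L a b t θ| ≤
      500 * m * ε * (aa f u t θ + yy f u t θ) := by
  have hm0 : 0 < m := by linarith
  have he := h.eps_nonneg
  have hp := h.norm_position_le hm hε hL ht
  have hF := norm_vF h.cyl.conf (h.mem ht θ)
  have hR := norm_fluxRem_le h.cyl (h.mem ht θ)
  have hzn := norm_vz_le (f := f) (u := u) (t := t) (θ := θ) hm
  have ha0 := aa_nonneg f u t θ
  have hy0 := yy_nonneg f u t θ
  have haε := h.aa_le t θ ht
  have hy : ‖vy1 f u t θ‖ ≤ yy f u t θ := le_add_of_nonneg_right (norm_nonneg _)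
  set z := vz f u m t θ with hz'
  set R := fluxRem f u t θ
  set F := vF f u t θ
  set ρ := Real.exp (-u t θ) • (f t θ - L) + (1 / m : ℝ) • F with hρ
  have e : ⟪z, a⟫_ℝ * γ + m / 2 * res1 f u L a b t θ =
      -(⟪z, a⟫_ℝ * (⟪F, b⟫_ℝ - γ)) + ⟪z, b⟫_ℝ * ⟪F, a⟫_ℝ - 1 / 2 * wd a b R F
        + m / 2 * wd a b ((2 : ℝ) • vy1 f u t θ + R) ρ := by
    have e1 : Real.exp (-u t θ) • (f t θ - L) = ρ + (-(1 / m) : ℝ) • F := by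
      rw [hρ]; module
    have e2 : vy1 f u t θ = z + (-m) • vh f u t θ := by rw [hz', vz]; module
    have e3 : ⟪z, a⟫_ℝ * ⟪F, b⟫_ℝ - ⟪z, b⟫_ℝ * ⟪F, a⟫_ℝ = wd a b z F := rfl
    rw [res1_eq, e1, wd_add_right, wd_smul_right]
    have e4 : wd a b ((2 : ℝ) • vy1 f u t θ + R) F =
        2 * (wd a b z F + (-m) * wd a b (vh f u t θ) F) + wd a b R F := by
      rw [wd_add_left, wd_smul_left, e2, wd_add_left, wd_smul_left]
    rw [e4, ← e3]
    field_simp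
    ring
  have b1 : |⟪z, a⟫_ℝ * (⟪F, b⟫_ℝ - γ)| ≤ ‖z‖ * (64 * ε) := by
    rw [abs_mul]
    refine mul_le_mul ((abs_real_inner_le_norm z a).trans
      (mul_le_of_le_one_right (norm_nonneg _) ha)) hγ (abs_nonneg _) (norm_nonneg _)
  have b2 : |⟪z, b⟫_ℝ * ⟪F, a⟫_ℝ| ≤ 4 * aa f u t θ ^ 2 + 128 * ε * ‖z‖ := by
    rw [abs_mul]
    refine (mul_le_of_le_one_right (abs_nonneg _) ?_).trans hz
    refine (abs_real_inner_le_norm F a).trans ?_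
    rw [hF, one_mul]; exact ha
  have b3 : |1 / 2 * wd a b R F| ≤ 20 * aa f u t θ ^ 2 := by
    have := abs_wd_le ha hb R F
    rw [hF, mul_one] at this
    rw [abs_mul, abs_of_pos (by norm_num : (0:ℝ) < 1 / 2)]
    linarith
  have b4 : |m / 2 * wd a b ((2 : ℝ) • vy1 f u t θ + R) ρ| ≤
      m * ((2 * yy f u t θ + 20 * aa f u t θ ^ 2) * (6 * ε)) := by
    have := abs_wd_le ha hb ((2 : ℝ) • vy1 f u t θ + R) ρ
    have e5 : ‖(2 : ℝ) • vy1 f u t θ + R‖ ≤ 2 * yy f u t θ + 20 * aa f u t θ ^ 2 := by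
      refine (norm_add_le _ _).trans ?_
      rw [norm_smul, Real.norm_eq_abs, abs_of_pos (by norm_num : (0:ℝ) < 2)]
      linarith
    have e6 := mul_le_mul e5 hp (norm_nonneg _) (by positivity)
    rw [abs_mul, abs_of_pos (by positivity : 0 < m / 2)]
    have := mul_le_mul_of_nonneg_left (this.trans (mul_le_mul_of_nonneg_left e6 zero_le_two))
      (by positivity : 0 ≤ m / 2)
    linarith
  rw [e]
  refine (abs_add_le _ _).trans ?_
  have t1 := abs_sub (-(⟪z, a⟫_ℝ * (⟪F, b⟫_ℝ - γ)) + ⟪z, b⟫_ℝ * ⟪F, a⟫_ℝ) (1 / 2 * wd a b R F)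
  have t2 := abs_add_le (-(⟪z, a⟫_ℝ * (⟪F, b⟫_ℝ - γ))) (⟪z, b⟫_ℝ * ⟪F, a⟫_ℝ)
  rw [abs_neg] at t2
  set A := aa f u t θ
  set Y := yy f u t θ
  have q1 : A ^ 2 ≤ ε * A := by nlinarith
  have q2 : ‖z‖ * ε ≤ 2 * m * (A + Y) * ε := by gcongr
  have q3 : ε * A ≤ m * (ε * A) := le_mul_of_one_le_left (by positivity) hm
  have q4 : A ^ 2 * (m * ε) ≤ A * (m * ε) / 2 := by
    have : A ^ 2 ≤ A / 2 := by nlinarith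
    nlinarith [mul_le_mul_of_nonneg_right this (by positivity : 0 ≤ m * ε)]
  have q5 : 0 ≤ m * ε * A := by positivity
  have q6 : 0 ≤ m * ε * Y := by positivity
  nlinarith

/-- The two basic residue inequalities at the rotating frame. -/
lemma abs_residue_frame_le (hL : Tendsto (fun t => f t θ) atTop (nhds L)) (ha : ‖a‖ ≤ 1)
    (ht : T ≤ t) (hθ : θ ∈ Icc (-π) π) :
    |⟪vz f u m t θ, a⟫_ℝ * Real.cos (m * θ) + m / 2 * res1 f u L a (vF f u t 0) t θ| ≤
      500 * m * ε * (aa f u t θ + yy f u t θ) ∧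
    |⟪vz f u m t θ, a⟫_ℝ * -Real.sin (m * θ) + m / 2 * res1 f u L a (vG f u t 0) t θ| ≤
      500 * m * ε * (aa f u t θ + yy f u t θ) := by
  have hF0 := norm_vF h.cyl.conf (h.mem ht 0)
  have hG0 := norm_vG h.cyl.conf (h.mem ht 0)
  have hFG := inner_vF_vG h.cyl.conf (h.mem ht 0)
  obtain ⟨i1, i2⟩ := h.abs_inner_frame_zero_le ht hθ (vz f u m t θ)
  obtain ⟨j1, j2⟩ := vz_inner_frame_le (m := m) h.cyl (h.mem ht θ)
  have k := (h.norm_frame_sub_le ht hθ).1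
  have key : ∀ b : EuclideanSpace ℝ (Fin n), ‖b‖ = 1 → |⟪vF f u t θ, b⟫_ℝ -
      (Real.cos (m * θ) * ⟪vF f u t 0, b⟫_ℝ - Real.sin (m * θ) * ⟪vG f u t 0, b⟫_ℝ)| ≤
      64 * ε := fun b hb => by
    have := abs_real_inner_le_norm (vF f u t θ -
      (Real.cos (m * θ) • vF f u t 0 - Real.sin (m * θ) • vG f u t 0)) b
    rw [hb, mul_one, inner_sub_left, inner_sub_left, real_inner_smul_left,
      real_inner_smul_left] at this
    exact this.trans k
  refine ⟨abs_residue_le h hm hε hL ha ht hF0.le ?_ (by linarith),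
    abs_residue_le h hm hε hL ha ht hG0.le ?_ (by linarith)⟩
  · have := key _ hF0
    rw [real_inner_self_eq_norm_sq, hF0, real_inner_comm (vF f u t 0) (vG f u t 0), hFG] at this
    simpa using this
  · have := key _ hG0
    rw [real_inner_self_eq_norm_sq, hG0, hFG] at this
    simpa using this

end Decay

end Neutral

section Fourier

lemma norm_fc_ofReal_le {φ : ℝ → ℝ → ℝ} {t : ℝ} (k : ℤ) (hφ : Continuous (φ t)) :
    ‖fc k (fun s r => (φ s r : ℂ)) t‖ ≤ |circ (fun s r => φ s r * Real.cos (k * r)) t|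
      + |circ (fun s r => φ s r * -Real.sin (k * r)) t| := by
  have e : fc k (fun s r => (φ s r : ℂ)) t =
      ((circ (fun s r => φ s r * Real.cos (k * r)) t : ℝ) : ℂ) +
      Complex.I * ((circ (fun s r => φ s r * -Real.sin (k * r)) t : ℝ) : ℂ) := by
    rw [← circ_ofReal, ← circ_ofReal, ← circ_const_mul, ← circ_add]
    · refine circ_congr fun θ => ?_
      have : (-(k * θ * Complex.I) : ℂ) = ((-(k * θ) : ℝ) : ℂ) * Complex.I := by push_cast; ring
      rw [this, Complex.exp_mul_I, ← Complex.ofReal_cos, ← Complex.ofReal_sin, Real.cos_neg,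
        Real.sin_neg]
      push_cast
      ring
    · fun_prop
    · fun_prop
  rw [e]
  refine (norm_add_le _ _).trans ?_
  rw [norm_mul, Complex.norm_I, one_mul, Complex.norm_real, Complex.norm_real]
  rfl

end Fourier

section Neutral

variable {f : ℝ → ℝ → EuclideanSpace ℝ (Fin n)} {u : ℝ → ℝ → ℝ} {t : ℝ} {ε T : ℝ} {m : ℕ}

lemma continuous_aa (hF : FiniteCyl f u) (ht : 0 < t) : Continuous (aa f u t) :=
  continuous_iff_continuousAt.2 fun θ =>
    (((continuousOn_aa hF).continuousAt
      (isOpen_halfPlane.mem_nhds (mem_halfPlane (θ := θ) ht)))).comp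
      (f := fun r : ℝ => (t, r)) (by fun_prop)

lemma continuous_yy (hF : FiniteCyl f u) (ht : 0 < t) : Continuous (yy f u t) :=
  continuous_iff_continuousAt.2 fun θ =>
    (((continuousOn_yy hF).continuousAt
      (isOpen_halfPlane.mem_nhds (mem_halfPlane (θ := θ) ht)))).comp
      (f := fun r : ℝ => (t, r)) (by fun_prop)

lemma periodic_vh (hF : FiniteCyl f u) (ht : 0 < t) (θ : ℝ) :
    vh f u t (θ + 2 * π) = vh f u t θ := by
  rw [vh, vh, periodic_Hmc hF ht, hF.per_u]

/-- A cylinder asymptotic to a cone of integer slope whose rotational residues vanish. -/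
structure TameCyl (f : ℝ → ℝ → EuclideanSpace ℝ (Fin n)) (u : ℝ → ℝ → ℝ) (m : ℕ) (ε T : ℝ)
    (L : EuclideanSpace ℝ (Fin n)) : Prop where
  asymp : AsympCyl f u m ε T
  one_le : 1 ≤ m
  eps_le : ε ≤ 1 / 1000
  lim : ∀ θ, Tendsto (fun t => f t θ) atTop (nhds L)
  circ_res : ∀ a b : EuclideanSpace ℝ (Fin n), ‖a‖ ≤ 1 → ‖b‖ ≤ 1 → ∀ t, 0 < t →
    circ (res1 f u L a b) t = 0

variable {L : EuclideanSpace ℝ (Fin n)}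

/-- Abbreviation for the total size on a circle. -/
def sz (f : ℝ → ℝ → EuclideanSpace ℝ (Fin n)) (u : ℝ → ℝ → ℝ) (t : ℝ) : ℝ :=
  circ (fun s r => aa f u s r + yy f u s r) t

namespace TameCyl

variable (h : TameCyl f u m ε T L)
include h

lemma pos (ht : T ≤ t) : 0 < t := h.asymp.pos.trans_le ht

lemma norm_fc_vz_le (ht : T ≤ t) (j : Fin n) :
    ‖fc m (fun s r => (vz f u m s r j : ℂ)) t‖ ≤ 1000 * m * ε * sz f u t := by
  have hm : (1 : ℝ) ≤ m := by exact_mod_cast h.one_le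
  have hε : ε ≤ 1 / 2 := by linarith [h.eps_le]
  have ht0 := h.pos ht
  have hU := isOpen_halfPlane
  have hF := h.asymp.cyl
  set a := EuclideanSpace.single j (1 : ℝ) with ha'
  have ha : ‖a‖ ≤ 1 := by rw [ha', PiLp.norm_single]; simp
  have hz : ∀ x : EuclideanSpace ℝ (Fin n), ⟪x, a⟫_ℝ = x j := fun x => by
    rw [ha', EuclideanSpace.inner_single_right]; simp
  have sz' : Sm halfPlane (vz f u m) :=
    (hF.conf.sm_vy1 hU).add ((sm_const (m : ℝ)).smul (hF.conf.sm_vh hU))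
  have cz : Continuous fun r => vz f u m t r j := by
    simp only [← hz]
    exact (continuous_slice (I := Ioi 0) sz' ht0).inner continuous_const
  have cb : Continuous fun r => aa f u t r + yy f u t r :=
    (continuous_aa hF ht0).add (continuous_yy hF ht0)
  have key : ∀ (b : EuclideanSpace ℝ (Fin n)) (γ : ℝ → ℝ), ‖b‖ ≤ 1 → Continuous γ →
      (∀ θ ∈ Icc (-π) π, |⟪vz f u m t θ, a⟫_ℝ * γ θ + m / 2 * res1 f u L a b t θ| ≤
        500 * m * ε * (aa f u t θ + yy f u t θ)) →
      |circ (fun s r => vz f u m s r j * γ r) t| ≤ 500 * m * ε * sz f u t :=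
    fun b γ hb hγ hb' => by
    have cr : Continuous (res1 f u L a b t) :=
      continuous_slice (I := Ioi 0) (sm_res L a b hF).1 ht0
    have e := norm_circ_le_circ (t := t)
      (φ := fun s r => vz f u m s r j * γ r + m / 2 * res1 f u L a b s r)
      (b := fun s r => 500 * m * ε * (aa f u s r + yy f u s r)) (continuous_const.mul cb)
      (fun θ hθ => by rw [Real.norm_eq_abs, ← hz]; exact hb' θ hθ)
    rw [circ_add (φ := fun s r => vz f u m s r j * γ r)
      (ψ := fun s r => (m / 2 : ℝ) * res1 f u L a b s r) (cz.mul hγ) (continuous_const.mul cr),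
      circ_const_mul, circ_const_mul, h.circ_res a b ha hb t ht0, mul_zero, add_zero] at e
    exact e
  have hres := fun θ hθ => abs_residue_frame_le (θ := θ) h.asymp hm hε (h.lim θ) ha ht hθ
  have k1 := key _ (fun r => Real.cos (m * r)) (norm_vF hF.conf (h.asymp.mem ht 0)).le
    (by fun_prop) fun θ hθ => (hres θ hθ).1
  have k2 := key _ (fun r => -Real.sin (m * r)) (norm_vG hF.conf (h.asymp.mem ht 0)).le
    (by fun_prop) fun θ hθ => (hres θ hθ).2
  have := norm_fc_ofReal_le (φ := fun s r => vz f u m s r j) (m : ℤ) cz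
  push_cast at this
  refine this.trans ?_
  linarith

/-- The neutral Fourier mode of `e^u ∇H` is small. -/
lemma norm_fc_y_le (ht : T ≤ t) (j : Fin n) :
    ‖fc m (cx (vy1 f u) (vy2 f u) j) t‖ ≤ 1002 * m * ε * sz f u t := by
  have hm : (1 : ℝ) ≤ m := by exact_mod_cast h.one_le
  have ht0 := h.pos ht
  have hU := isOpen_halfPlane
  have hF := h.asymp.cyl
  have he := h.asymp.eps_nonneg
  have sh := sm_ofReal (sm_coord (hF.conf.sm_vh hU) j)
  have s1 := sm_ofReal (sm_coord (hF.conf.sm_vy1 hU) j)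
  have c1 : Continuous fun r => (vz f u m t r j : ℂ) := by
    have sz' : Sm halfPlane (vz f u m) :=
      (hF.conf.sm_vy1 hU).add ((sm_const (m : ℝ)).smul (hF.conf.sm_vh hU))
    exact continuous_slice (I := Ioi 0) (sm_ofReal (sm_coord sz' j)) ht0
  have ch : Continuous fun r => (vh f u t r j : ℂ) := continuous_slice (I := Ioi 0) sh ht0
  have cy : Continuous fun r => (vy1 f u t r j : ℂ) := continuous_slice (I := Ioi 0) s1 ht0
  have cp : Continuous (pth (fun s r => (vh f u s r j : ℂ)) t) :=
    continuous_slice (I := Ioi 0) (sh.pth hU) ht0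
  have cu : Continuous (pth u t) := continuous_slice (I := Ioi 0) (hF.conf.sm_u.pth hU) ht0
  have e1 : ∀ θ, cx (vy1 f u) (vy2 f u) j t θ = (vy1 f u t θ j : ℂ) +
      ((-Complex.I) * pth (fun s r => (vh f u s r j : ℂ)) t θ +
        Complex.I * ((pth u t θ * vh f u t θ j : ℝ) : ℂ)) := fun θ => by
    have hp := mem_halfPlane (θ := θ) ht0
    have e : pth (fun s r => (vh f u s r j : ℂ)) t θ = ((pth (vh f u) t θ j : ℝ) : ℂ) :=
      (HasDerivAt.ofReal_comp (f := fun r => vh f u t r j)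
        (hasDerivAt_pi.1 ((PiLp.hasFDerivAt_ofLp 2 _).comp_hasDerivAt θ
          ((hF.conf.sm_vh hU).hasDerivAt_pth hU hp)) j)).deriv
    rw [e, hF.conf.pth_vh hU hp, cx]
    simp only [PiLp.add_apply, PiLp.smul_apply, smul_eq_mul]
    push_cast
    ring
  have e2 : fc m (cx (vy1 f u) (vy2 f u) j) t = fc m (fun s r => (vz f u m s r j : ℂ)) t +
      Complex.I * fc m (fun s r => ((pth u s r * vh f u s r j : ℝ) : ℂ)) t := by
    rw [fc_congr _ (ψ := fun s r => (vy1 f u s r j : ℂ) +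
        ((-Complex.I) * pth (fun s r => (vh f u s r j : ℂ)) s r +
        Complex.I * ((pth u s r * vh f u s r j : ℝ) : ℂ))) e1,
      fc_add _ (φ := fun s r => (vy1 f u s r j : ℂ)) cy
      (ψ := fun s r => (-Complex.I) * pth (fun s r => (vh f u s r j : ℂ)) s r +
        Complex.I * ((pth u s r * vh f u s r j : ℝ) : ℂ))]
    rotate_left
    · refine (continuous_const.mul cp).add (continuous_const.mul ?_)
      push_cast
      exact (Complex.continuous_ofReal.comp cu).mul ch
    rw [fc_add _ (φ := fun s r => (-Complex.I) * pth (fun s r => (vh f u s r j : ℂ)) s r)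
      (ψ := fun s r => Complex.I * ((pth u s r * vh f u s r j : ℝ) : ℂ))
      (continuous_const.mul cp)]
    rotate_left
    · refine continuous_const.mul ?_
      push_cast
      exact (Complex.continuous_ofReal.comp cu).mul ch
    rw [fc_mul_left, fc_mul_left, fc_pth (I := Ioi 0) _ sh isOpen_Ioi ht0
      (fun θ => by rw [periodic_vh hF ht0])]
    have e3 : fc m (fun s r => (vz f u m s r j : ℂ)) t = fc m (fun s r => (vy1 f u s r j : ℂ)) t
        + m * fc m (fun s r => (vh f u s r j : ℂ)) t := by
      rw [← fc_mul_left, ← fc_add _ (φ := fun s r => (vy1 f u s r j : ℂ))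
        (ψ := fun s r => (m : ℂ) * (vh f u s r j : ℂ)) cy (continuous_const.mul ch)]
      refine fc_congr _ fun θ => ?_
      simp [vz]
    rw [e3]
    push_cast
    linear_combination (-(m : ℂ)) * fc m (fun s r => (vh f u s r j : ℂ)) t * Complex.I_mul_I
  rw [e2]
  refine (norm_add_le _ _).trans ?_
  have k1 := h.norm_fc_vz_le ht j
  have k2 : ‖fc m (fun s r => ((pth u s r * vh f u s r j : ℝ) : ℂ)) t‖ ≤ 2 * ε * sz f u t := by
    refine (norm_fc_le _).trans ?_
    rw [sz, ← circ_const_mul]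
    refine circ_mono ?_ (continuous_const.mul ((continuous_aa hF ht0).add
      (continuous_yy hF ht0))) fun θ => ?_
    · push_cast
      exact ((Complex.continuous_ofReal.comp cu).mul ch).norm
    · rw [Complex.norm_real, norm_mul, Real.norm_eq_abs, Real.norm_eq_abs]
      have i1 := h.asymp.abs_u2 ht θ
      have i2 := (abs_apply_le (vh f u t θ) j).trans (norm_vh_le f u t θ)
      have := mul_le_mul i1 i2 (abs_nonneg _) he
      nlinarith [yy_nonneg f u t θ]
  have hs : 0 ≤ sz f u t := circ_nonneg fun θ => add_nonneg (aa_nonneg f u t θ)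
    (yy_nonneg f u t θ)
  rw [norm_mul, Complex.norm_I, one_mul]
  have : ε * sz f u t ≤ m * (ε * sz f u t) := le_mul_of_one_le_left (by positivity) hm
  linarith

/-- The neutral Fourier mode of `e^u H` is controlled by `e^u ∇H`. -/
lemma norm_fc_h_le (ht : T ≤ t) (j : Fin n) :
    ‖fc m (fun s r => (vh f u s r j : ℂ)) t‖ ≤ 1000 * m * ε * sz f u t + circ (yy f u) t := by
  have hm : (1 : ℝ) ≤ m := by exact_mod_cast h.one_le
  have ht0 := h.pos ht
  have hU := isOpen_halfPlane
  have hF := h.asymp.cyl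
  have ch : Continuous fun r => (vh f u t r j : ℂ) :=
    continuous_slice (I := Ioi 0) (sm_ofReal (sm_coord (hF.conf.sm_vh hU) j)) ht0
  have cy : Continuous fun r => (vy1 f u t r j : ℂ) :=
    continuous_slice (I := Ioi 0) (sm_ofReal (sm_coord (hF.conf.sm_vy1 hU) j)) ht0
  have e3 : fc m (fun s r => (vz f u m s r j : ℂ)) t = fc m (fun s r => (vy1 f u s r j : ℂ)) t
      + m * fc m (fun s r => (vh f u s r j : ℂ)) t := by
    rw [← fc_mul_left, ← fc_add _ (φ := fun s r => (vy1 f u s r j : ℂ))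
      (ψ := fun s r => (m : ℂ) * (vh f u s r j : ℂ)) cy (continuous_const.mul ch)]
    refine fc_congr _ fun θ => ?_
    simp [vz]
  have k1 := h.norm_fc_vz_le ht j
  have k2 : ‖fc m (fun s r => (vy1 f u s r j : ℂ)) t‖ ≤ circ (yy f u) t := by
    refine (norm_fc_le _).trans (circ_mono cy.norm (continuous_yy hF ht0) fun θ => ?_)
    rw [Complex.norm_real]
    exact (abs_apply_le (vy1 f u t θ) j).trans (le_add_of_nonneg_right (norm_nonneg _))
  have k3 : ‖(m : ℂ) * fc m (fun s r => (vh f u s r j : ℂ)) t‖ ≤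
      1000 * m * ε * sz f u t + circ (yy f u) t := by
    rw [show (m : ℂ) * fc m (fun s r => (vh f u s r j : ℂ)) t =
      fc m (fun s r => (vz f u m s r j : ℂ)) t - fc m (fun s r => (vy1 f u s r j : ℂ)) t by
        rw [e3]; ring]
    exact (norm_sub_le _ _).trans (add_le_add k1 k2)
  rw [norm_mul, Complex.norm_natCast] at k3
  exact (le_mul_of_one_le_left (norm_nonneg _) hm).trans k3

end TameCyl

end Neutral

section Fourier

lemma norm_fc_neg_ofReal (φ : ℝ → ℝ → ℝ) (t : ℝ) (k : ℤ) :
    ‖fc (-k) (fun s r => (φ s r : ℂ)) t‖ = ‖fc k (fun s r => (φ s r : ℂ)) t‖ := by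
  have : fc (-k) (fun s r => (φ s r : ℂ)) t =
      (starRingEnd ℂ) (fc k (fun s r => (φ s r : ℂ)) t) := by
    rw [fc, fc, ← circ_conj]
    refine circ_congr fun θ => ?_
    rw [map_mul, ← Complex.exp_conj]
    simp
  rw [this, Complex.norm_conj]

end Fourier

section Neutral

variable {f : ℝ → ℝ → EuclideanSpace ℝ (Fin n)} {u : ℝ → ℝ → ℝ} {t : ℝ} {ε T : ℝ} {m : ℕ}
  {L : EuclideanSpace ℝ (Fin n)}

/-- The scaled angular part of the second fundamental form paired with a fixed vector. -/
def angA (f : ℝ → ℝ → EuclideanSpace ℝ (Fin n)) (u : ℝ → ℝ → ℝ) (a : EuclideanSpace ℝ (Fin n))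
    (t θ : ℝ) : ℂ :=
  (⟪Real.exp (-u t θ) • Athth f u t θ, a⟫_ℝ : ℂ) +
    Complex.I * (⟪Real.exp (-u t θ) • Atth f u t θ, a⟫_ℝ : ℂ)

lemma sm_angA (hF : FiniteCyl f u) (a : EuclideanSpace ℝ (Fin n)) : Sm halfPlane (angA f u a) := by
  have hU := isOpen_halfPlane
  exact (sm_ofReal ((hF.conf.sm_u.neg.exp.smul (hF.conf.sm_Athth hU)).inner (sm_const a))).add
    ((sm_const Complex.I).mulC
      (sm_ofReal ((hF.conf.sm_u.neg.exp.smul (hF.conf.sm_Atth hU)).inner (sm_const a))))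

lemma norm_angA_le (a : EuclideanSpace ℝ (Fin n)) (t θ : ℝ) :
    ‖angA f u a t θ‖ ≤ |⟪Real.exp (-u t θ) • Athth f u t θ, a⟫_ℝ| +
      |⟪Real.exp (-u t θ) • Atth f u t θ, a⟫_ℝ| := by
  refine (norm_add_le _ _).trans ?_
  rw [norm_mul, Complex.norm_I, one_mul, Complex.norm_real, Complex.norm_real]
  rfl

lemma fc_angA_add_smul (hF : FiniteCyl f u) (ht : 0 < t) (k : ℤ) (a b : EuclideanSpace ℝ (Fin n))
    (r : ℝ) : fc k (angA f u (a + r • b)) t = fc k (angA f u a) t + r * fc k (angA f u b) t := by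
  rw [← fc_mul_left, ← fc_add _ (φ := angA f u a) (ψ := fun s θ => (r : ℂ) * angA f u b s θ)
    (continuous_slice (I := Ioi 0) (sm_angA hF a) ht)
    (continuous_const.mul (continuous_slice (I := Ioi 0) (sm_angA hF b) ht))]
  refine fc_congr _ fun θ => ?_
  simp only [angA, inner_add_right, real_inner_smul_right]
  push_cast
  ring

namespace TameCyl

variable (h : TameCyl f u m ε T L)
include h

lemma norm_fc_angA_frame_le (ht : T ≤ t) (k : ℤ) :
    ‖fc k (angA f u (vF f u t 0)) t‖ ≤ 256 * ε * circ (aa f u) t ∧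
      ‖fc k (angA f u (vG f u t 0)) t‖ ≤ 256 * ε * circ (aa f u) t := by
  have ht0 := h.pos ht
  have hF := h.asymp.cyl
  have he := h.asymp.eps_nonneg
  have key : ∀ b, (∀ θ ∈ Icc (-π) π, ∀ x : EuclideanSpace ℝ (Fin n),
      |⟪x, b⟫_ℝ| ≤ |⟪x, vF f u t θ⟫_ℝ| + |⟪x, vG f u t θ⟫_ℝ| + 128 * ε * ‖x‖) →
      ‖fc k (angA f u b) t‖ ≤ 256 * ε * circ (aa f u) t := fun b hb => by
    rw [fc, ← circ_const_mul]
    refine norm_circ_le_circ (continuous_const.mul (continuous_aa hF ht0)) fun θ hθ => ?_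
    rw [norm_mul, norm_expI, one_mul]
    refine (norm_angA_le _ _ _).trans ?_
    obtain ⟨-, -, -, i2, i3, i4, i5, i6⟩ : True ∧ True ∧ _ :=
      ⟨trivial, trivial, hF.conf.inner_first_A isOpen_halfPlane (h.asymp.mem ht θ)⟩
    have hA := norm_A_le f u t θ
    have one : ∀ x : EuclideanSpace ℝ (Fin n), ⟪pt f t θ, x⟫_ℝ = 0 → ⟪pth f t θ, x⟫_ℝ = 0 →
        ‖x‖ ≤ Real.exp (u t θ) * aa f u t θ →
        |⟪Real.exp (-u t θ) • x, b⟫_ℝ| ≤ 128 * ε * aa f u t θ := fun x x1 x2 x3 => by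
      have := hb θ hθ (Real.exp (-u t θ) • x)
      have z1 : ⟪Real.exp (-u t θ) • x, vF f u t θ⟫_ℝ = 0 := by
        rw [vF, real_inner_smul_left, real_inner_smul_right, real_inner_comm, x1]; simp
      have z2 : ⟪Real.exp (-u t θ) • x, vG f u t θ⟫_ℝ = 0 := by
        rw [vG, real_inner_smul_left, real_inner_smul_right, real_inner_comm, x2]; simp
      rw [z1, z2, abs_zero, add_zero, zero_add] at this
      exact this.trans (mul_le_mul_of_nonneg_left (norm_exp_neg_smul_le x3) (by positivity))
    have a1 := one _ i3 i6 hA.2.2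
    have a2 := one _ i2 i5 hA.2.1
    linarith
  exact ⟨key _ fun θ hθ x => (h.asymp.abs_inner_frame_zero_le ht hθ x).1,
    key _ fun θ hθ x => (h.asymp.abs_inner_frame_zero_le ht hθ x).2⟩

lemma norm_fc_angA_normal_le (ht : T ≤ t) {a : EuclideanSpace ℝ (Fin n)} (ha : ‖a‖ ≤ 3)
    (h1 : ⟪vF f u t 0, a⟫_ℝ = 0) (h2 : ⟪vG f u t 0, a⟫_ℝ = 0) :
    ‖fc (-m) (angA f u a) t‖ ≤ 384 * ε * circ (aa f u) t := by
  have hU := isOpen_halfPlane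
  have ht0 := h.pos ht
  have hF := h.asymp.cyl
  have he := h.asymp.eps_nonneg
  have sP : Sm halfPlane fun s r => ⟪vF f u s r, a⟫_ℝ := (hF.conf.sm_vF hU).inner (sm_const a)
  have sQ : Sm halfPlane fun s r => ⟪vG f u s r, a⟫_ℝ := (hF.conf.sm_vG hU).inner (sm_const a)
  set P : ℝ → ℝ → ℝ := fun s r => ⟪vF f u s r, a⟫_ℝ with hP
  set Q : ℝ → ℝ → ℝ := fun s r => ⟪vG f u s r, a⟫_ℝ with hQ
  have cP : Continuous (P t) := continuous_slice (I := Ioi 0) sP ht0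
  have cQ : Continuous (Q t) := continuous_slice (I := Ioi 0) sQ ht0
  have cP' : Continuous (pth P t) := continuous_slice (I := Ioi 0) (sP.pth hU) ht0
  have cQ' : Continuous (pth Q t) := continuous_slice (I := Ioi 0) (sQ.pth hU) ht0
  have dP : ∀ θ, pth P t θ = ⟪Real.exp (-u t θ) • Atth f u t θ, a⟫_ℝ + pt u t θ * Q t θ :=
    fun θ => by
    have hp := h.asymp.mem ht θ
    have e : pth P t θ = _ :=
      (((h.asymp.hasDerivAt_frame ht θ).1).inner ℝ (hasDerivAt_const θ a)).deriv
    rw [e, pth_vF hF.conf hU hp]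
    simp [inner_add_left, real_inner_smul_left, hQ]
  have dQ : ∀ θ, pth Q t θ = ⟪Real.exp (-u t θ) • Athth f u t θ, a⟫_ℝ - pt u t θ * P t θ :=
    fun θ => by
    have hp := h.asymp.mem ht θ
    have e : pth Q t θ = _ :=
      (((h.asymp.hasDerivAt_frame ht θ).2).inner ℝ (hasDerivAt_const θ a)).deriv
    rw [e, pth_vG hF.conf hU hp]
    simp [inner_sub_left, real_inner_smul_left, hP]
  have bd : ∀ (x : EuclideanSpace ℝ (Fin n)) (θ : ℝ), ‖x‖ ≤ Real.exp (u t θ) * aa f u t θ →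
      |⟪Real.exp (-u t θ) • x, a⟫_ℝ| ≤ 3 * aa f u t θ := fun x θ hx => by
    refine (abs_real_inner_le_norm _ _).trans ?_
    have := mul_le_mul (norm_exp_neg_smul_le hx) ha (norm_nonneg _) (aa_nonneg f u t θ)
    linarith
  have cS : Continuous fun r => |P t r| + |Q t r| := cP.abs.add cQ.abs
  have cb : Continuous fun r => 3 * aa f u t r + ε * (|P t r| + |Q t r|) :=
    (continuous_const.mul (continuous_aa hF ht0)).add (continuous_const.mul cS)
  have hu : ∀ θ, ∀ x : ℝ, |(pt u t θ + m) * x| ≤ ε * |x| := fun θ x => by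
    rw [abs_mul]; exact mul_le_mul_of_nonneg_right (h.asymp.abs_u1 ht θ) (abs_nonneg _)
  set S := circ (fun s r => |P s r| + |Q s r|) t with hS
  set K := circ (aa f u) t with hK
  have eb : ∫ r in (-π)..π, (3 * aa f u t r + ε * (|P t r| + |Q t r|)) = 3 * K + ε * S := by
    have := circ_add (t := t) (φ := fun s r => 3 * aa f u s r)
      (ψ := fun s r => ε * (|P s r| + |Q s r|)) (continuous_const.mul (continuous_aa hF ht0))
      (continuous_const.mul cS)
    rw [circ_const_mul, circ_const_mul] at this
    exact this
  have rot : ∀ θ ∈ Icc (-π) π, ‖|P t θ| + |Q t θ|‖ ≤ 8 * (3 * K + ε * S) := fun θ hθ => by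
    have key := norm_sub_rotation_le (F := P t) (G := Q t) (F' := pth P t) (G' := pth Q t)
      (m := m) (b := fun r => 3 * aa f u t r + ε * (|P t r| + |Q t r|))
      (fun s => sP.hasDerivAt_pth hU (h.asymp.mem ht s))
      (fun s => sQ.hasDerivAt_pth hU (h.asymp.mem ht s)) cP' cQ' cb (fun s => ?_) (fun s => ?_) hθ
    · rw [eb, show P t 0 = 0 from h1, show Q t 0 = 0 from h2] at key
      simp only [smul_zero, sub_zero, add_zero, Real.norm_eq_abs] at key
      rw [Real.norm_eq_abs, abs_of_nonneg (by positivity)]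
      linarith [key.1, key.2]
    · rw [dP, Real.norm_eq_abs, smul_eq_mul, show ⟪Real.exp (-u t s) • Atth f u t s, a⟫_ℝ +
        pt u t s * Q t s + m * Q t s = ⟪Real.exp (-u t s) • Atth f u t s, a⟫_ℝ +
        (pt u t s + m) * Q t s by ring]
      have p := mul_nonneg he (abs_nonneg (P t s))
      linarith [abs_add_le ⟪Real.exp (-u t s) • Atth f u t s, a⟫_ℝ ((pt u t s + m) * Q t s),
        hu s (Q t s), bd _ s (norm_A_le f u t s).2.1]
    · rw [dQ, Real.norm_eq_abs, smul_eq_mul, show ⟪Real.exp (-u t s) • Athth f u t s, a⟫_ℝ -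
        pt u t s * P t s - m * P t s = ⟪Real.exp (-u t s) • Athth f u t s, a⟫_ℝ -
        (pt u t s + m) * P t s by ring]
      have p := mul_nonneg he (abs_nonneg (Q t s))
      linarith [abs_sub ⟪Real.exp (-u t s) • Athth f u t s, a⟫_ℝ ((pt u t s + m) * P t s),
        hu s (P t s), bd _ s (norm_A_le f u t s).2.2]
  have hS0 : 0 ≤ S := circ_nonneg fun θ => by positivity
  have hK0 : 0 ≤ K := circ_nonneg fun θ => aa_nonneg f u t θ
  have hSle : S ≤ 384 * K := by
    have k := norm_circ_le_circ (φ := fun s r => |P s r| + |Q s r|) (t := t)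
      (b := fun _ _ => 8 * (3 * K + ε * S)) continuous_const rot
    rw [circ_const, ← hS, Real.norm_eq_abs, abs_of_nonneg hS0, smul_eq_mul] at k
    have := h.eps_le
    have := pi_lt_four
    have e1 : ε * S ≤ S / 1000 := by nlinarith
    have : 2 * π * (8 * (3 * K + ε * S)) ≤ 64 * (3 * K + S / 1000) := by
      have := pi_pos
      have e2 : 8 * (3 * K + ε * S) ≤ 8 * (3 * K + S / 1000) := by linarith
      nlinarith [mul_nonneg pi_pos.le hS0, mul_nonneg pi_pos.le hK0]
    linarith
  have sφ : Sm halfPlane fun s r => (P s r : ℂ) - Complex.I * (Q s r : ℂ) :=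
    (sm_ofReal sP).sub ((sm_const Complex.I).mulC (sm_ofReal sQ))
  set φ : ℝ → ℝ → ℂ := fun s r => (P s r : ℂ) - Complex.I * (Q s r : ℂ) with hφ
  have cφ : Continuous (φ t) := continuous_slice (I := Ioi 0) sφ ht0
  have cφ' : Continuous (pth φ t) := continuous_slice (I := Ioi 0) (sφ.pth hU) ht0
  have cu : Continuous (pt u t) := continuous_slice (I := Ioi 0) (hF.conf.sm_u.pt hU) ht0
  have cuφ : Continuous fun r => ((pt u t r : ℝ) : ℂ) * φ t r :=
    (Complex.continuous_ofReal.comp cu).mul cφ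
  have e1 : ∀ θ, angA f u a t θ = Complex.I * pth φ t θ + ((pt u t θ : ℝ) : ℂ) * φ t θ := fun θ => by
    have hp := h.asymp.mem ht θ
    have e : pth φ t θ = ((pth P t θ : ℝ) : ℂ) - Complex.I * ((pth Q t θ : ℝ) : ℂ) :=
      (((sP.hasDerivAt_pth hU hp).ofReal_comp).sub
        ((sQ.hasDerivAt_pth hU hp).ofReal_comp.const_mul Complex.I)).deriv
    rw [e, dP, dQ, angA, hφ]
    push_cast
    linear_combination ((⟪Real.exp (-u t θ) • Athth f u t θ, a⟫_ℝ : ℂ) -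
      ((pt u t θ : ℝ) : ℂ) * P t θ) * Complex.I_sq
  have per : ∀ θ, φ t (θ + 2 * π) = φ t θ := fun θ => by
    simp only [hφ, hP, hQ, periodic_vF hF ht0, periodic_vG hF ht0]
  have e2 : fc (-m) (angA f u a) t = fc (-m) (fun s r => ((pt u s r + m : ℝ) : ℂ) * φ s r) t := by
    rw [fc_congr _ (ψ := fun s r => Complex.I * pth φ s r + ((pt u s r : ℝ) : ℂ) * φ s r) e1,
      fc_add _ (φ := fun s r => Complex.I * pth φ s r) (ψ := fun s r => ((pt u s r : ℝ) : ℂ) * φ s r)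
      (continuous_const.mul cφ') cuφ, fc_mul_left, fc_pth (I := Ioi 0) _ sφ isOpen_Ioi ht0 per,
      fc_congr _ (φ := fun s r => ((pt u s r + m : ℝ) : ℂ) * φ s r)
        (ψ := fun s r => ((pt u s r : ℝ) : ℂ) * φ s r + (m : ℂ) * φ s r)
        (fun θ => by push_cast; ring),
      fc_add _ (φ := fun s r => ((pt u s r : ℝ) : ℂ) * φ s r) (ψ := fun s r => (m : ℂ) * φ s r)
      cuφ (continuous_const.mul cφ), fc_mul_left]
    push_cast
    linear_combination (-(m : ℂ) * fc (-m) φ t) * Complex.I_mul_I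
  rw [e2]
  refine (norm_fc_le _).trans ?_
  have e3 : circ (fun s r => ‖((pt u s r + m : ℝ) : ℂ) * φ s r‖) t ≤ ε * S := by
    rw [hS, ← circ_const_mul]
    refine circ_mono ?_ (continuous_const.mul cS) fun θ => ?_
    · exact ((Complex.continuous_ofReal.comp (cu.add continuous_const)).mul cφ).norm
    · rw [norm_mul, Complex.norm_real, Real.norm_eq_abs]
      refine mul_le_mul (h.asymp.abs_u1 ht θ) ((norm_sub_le _ _).trans ?_) (norm_nonneg _) he
      rw [norm_mul, Complex.norm_I, one_mul, Complex.norm_real, Complex.norm_real]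
      rfl
  refine e3.trans ?_
  nlinarith

/-- The neutral Fourier mode of the Hopf differential is controlled by that of `e^u H`. -/
lemma norm_fc_om_le (ht : T ≤ t) (j : Fin n) :
    ‖fc (-m) (cx (vp f u) (vq f u) j) t‖ ≤
      ‖fc m (fun s r => (vh f u s r j : ℂ)) t‖ + 896 * ε * circ (aa f u) t := by
  have hU := isOpen_halfPlane
  have ht0 := h.pos ht
  have hF := h.asymp.cyl
  have he := h.asymp.eps_nonneg
  set a := EuclideanSpace.single j (1 : ℝ) with ha'
  have ha : ‖a‖ ≤ 1 := by rw [ha', PiLp.norm_single]; simp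
  have hz : ∀ x : EuclideanSpace ℝ (Fin n), ⟪x, a⟫_ℝ = x j := fun x => by
    rw [ha', EuclideanSpace.inner_single_right]; simp
  have hF0 := norm_vF hF.conf (h.asymp.mem ht 0)
  have hG0 := norm_vG hF.conf (h.asymp.mem ht 0)
  have hFG := inner_vF_vG hF.conf (h.asymp.mem ht 0)
  obtain ⟨k1, k2⟩ := h.norm_fc_angA_frame_le ht (-m)
  set F₀ := vF f u t 0
  set G₀ := vG f u t 0
  set α := ⟪F₀, a⟫_ℝ
  set β := ⟪G₀, a⟫_ℝ
  have hα : |α| ≤ 1 := by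
    refine (abs_real_inner_le_norm _ _).trans ?_; rw [hF0, one_mul]; exact ha
  have hβ : |β| ≤ 1 := by
    refine (abs_real_inner_le_norm _ _).trans ?_; rw [hG0, one_mul]; exact ha
  set c := a + (-α) • F₀ + (-β) • G₀ with hc
  have hcn : ‖c‖ ≤ 3 := by
    refine (norm_add₃_le).trans ?_
    rw [norm_smul, norm_smul, hF0, hG0, norm_neg, norm_neg, Real.norm_eq_abs, Real.norm_eq_abs]
    linarith
  have hc1 : ⟪F₀, c⟫_ℝ = 0 := by
    rw [hc, inner_add_right, inner_add_right, real_inner_smul_right, real_inner_smul_right,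
      real_inner_self_eq_norm_sq, hF0, hFG]
    simp [α]
  have hc2 : ⟪G₀, c⟫_ℝ = 0 := by
    rw [hc, inner_add_right, inner_add_right, real_inner_smul_right, real_inner_smul_right,
      real_inner_self_eq_norm_sq, hG0, real_inner_comm F₀ G₀, hFG]
    simp [β]
  have k3 := h.norm_fc_angA_normal_le ht hcn hc1 hc2
  have e1 : fc (-m) (angA f u a) t = fc (-m) (angA f u c) t + (α : ℂ) * fc (-m) (angA f u F₀) t
      + (β : ℂ) * fc (-m) (angA f u G₀) t := by
    rw [← fc_angA_add_smul hF ht0, ← fc_angA_add_smul hF ht0]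
    congr 2
    rw [hc]; module
  have hK0 : 0 ≤ circ (aa f u) t := circ_nonneg fun θ => aa_nonneg f u t θ
  have k4 : ‖fc (-m) (angA f u a) t‖ ≤ 896 * ε * circ (aa f u) t := by
    rw [e1]
    refine norm_add₃_le.trans ?_
    rw [norm_mul, norm_mul, Complex.norm_real, Complex.norm_real, Real.norm_eq_abs,
      Real.norm_eq_abs]
    have l1 := mul_le_of_le_one_left (norm_nonneg (fc (-m) (angA f u F₀) t)) hα
    have l2 := mul_le_of_le_one_left (norm_nonneg (fc (-m) (angA f u G₀) t)) hβ
    linarith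
  have ch : Continuous fun r => (vh f u t r j : ℂ) :=
    continuous_slice (I := Ioi 0) (sm_ofReal (sm_coord (hF.conf.sm_vh hU) j)) ht0
  have ca : Continuous (angA f u a t) := continuous_slice (I := Ioi 0) (sm_angA hF a) ht0
  have e2 : fc (-m) (cx (vp f u) (vq f u) j) t =
      (1 / 2 : ℂ) * fc (-m) (fun s r => (vh f u s r j : ℂ)) t + (-1) * fc (-m) (angA f u a) t := by
    rw [← fc_mul_left, ← fc_mul_left, ← fc_add _ (φ := fun s r => (1 / 2 : ℂ) * (vh f u s r j : ℂ))
      (ψ := fun s r => (-1) * angA f u a s r) (continuous_const.mul ch) (continuous_const.mul ca)]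
    refine fc_congr _ fun θ => ?_
    have e : vh f u t θ = Real.exp (-u t θ) • (Att f u t θ + Athth f u t θ) := by
      have e0 : Real.exp (u t θ) = Real.exp (-u t θ) * Real.exp (2 * u t θ) := by
        rw [← Real.exp_add]; congr 1; ring
      rw [vh, e0, mul_smul, exp_smul_Hmc_eq_A]
    rw [cx, angA, hz, hz, e, vp, vq]
    simp only [PiLp.add_apply, PiLp.smul_apply, PiLp.sub_apply, smul_eq_mul]
    push_cast
    ring
  rw [e2, ← norm_fc_neg_ofReal]
  refine (norm_add_le _ _).trans ?_
  rw [norm_mul, norm_mul]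
  norm_num
  linarith [norm_nonneg (fc (-m) (fun s r => (vh f u s r j : ℂ)) t)]

end TameCyl

end Neutral

section Gronwall

variable {D D' : ℝ → ℝ} {c T t : ℝ}

/-- If `D' ≤ -c D` on `[T, ∞)` and `D T ≤ 0` then `D ≤ 0` there. -/
lemma nonpos_of_deriv_le_neg_mul (hD : ∀ s, T ≤ s → HasDerivAt D (D' s) s)
    (h : ∀ s, T ≤ s → D' s ≤ -c * D s) (h0 : D T ≤ 0) (ht : T ≤ t) : D t ≤ 0 := by
  have hd : ∀ s, T ≤ s → HasDerivAt (fun s => Real.exp (c * s) * D s)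
      (Real.exp (c * s) * (c * D s + D' s)) s := fun s hs => by
    have h1 : HasDerivAt (fun s => Real.exp (c * s)) (Real.exp (c * s) * (c * 1)) s :=
      ((hasDerivAt_id s).const_mul c).exp
    refine (h1.mul (hD s hs)).congr_deriv ?_
    ring
  have hanti : AntitoneOn (fun s => Real.exp (c * s) * D s) (Ici T) := by
    refine antitoneOn_of_deriv_nonpos (convex_Ici T)
      (fun s hs => (hd s hs).continuousAt.continuousWithinAt)
      (fun s hs => (hd s (interior_subset hs)).differentiableAt.differentiableWithinAt)
      fun s hs => ?_
    rw [(hd s (interior_subset hs)).deriv]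
    exact mul_nonpos_of_nonneg_of_nonpos (Real.exp_pos _).le
      (by linarith [h s (interior_subset hs)])
  have h1 : Real.exp (c * t) * D t ≤ Real.exp (c * T) * D T := hanti self_mem_Ici ht ht
  have h2 : Real.exp (c * T) * D T ≤ 0 := mul_nonpos_of_nonneg_of_nonpos (Real.exp_pos _).le h0
  by_contra hc
  exact absurd (mul_pos (Real.exp_pos (c * t)) (not_le.1 hc)) (by linarith)

/-- If `D' ≥ c D` on `[T, ∞)` with `c > 0` and `D` is bounded above then `D ≤ 0` there. -/
lemma nonpos_of_mul_le_deriv {B : ℝ} (hc : 0 < c) (hD : ∀ s, T ≤ s → HasDerivAt D (D' s) s)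
    (h : ∀ s, T ≤ s → c * D s ≤ D' s) (hB : ∀ s, T ≤ s → D s ≤ B) (ht : T ≤ t) : D t ≤ 0 := by
  have hd : ∀ s, T ≤ s → HasDerivAt (fun s => Real.exp (-c * s) * D s)
      (Real.exp (-c * s) * (-c * D s + D' s)) s := fun s hs => by
    have h1 : HasDerivAt (fun s => Real.exp (-c * s)) (Real.exp (-c * s) * (-c * 1)) s :=
      ((hasDerivAt_id s).const_mul (-c)).exp
    refine (h1.mul (hD s hs)).congr_deriv ?_
    ring
  have hmono : MonotoneOn (fun s => Real.exp (-c * s) * D s) (Ici T) := by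
    refine monotoneOn_of_deriv_nonneg (convex_Ici T)
      (fun s hs => (hd s hs).continuousAt.continuousWithinAt)
      (fun s hs => (hd s (interior_subset hs)).differentiableAt.differentiableWithinAt)
      fun s hs => ?_
    rw [(hd s (interior_subset hs)).deriv]
    exact mul_nonneg (Real.exp_pos _).le (by linarith [h s (interior_subset hs)])
  have hlim : Tendsto (fun s => Real.exp (-c * s) * B) atTop (nhds (0 * B)) := by
    refine Tendsto.mul_const B (Real.tendsto_exp_atBot.comp ?_)
    exact (tendsto_id.const_mul_atTop_of_neg (by linarith))
  have h1 : Real.exp (-c * t) * D t ≤ 0 * B := by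
    refine ge_of_tendsto hlim ?_
    filter_upwards [eventually_ge_atTop t] with s hs
    refine (hmono ht (mem_Ici.2 (ht.trans hs)) hs).trans ?_
    exact mul_le_mul_of_nonneg_left (hB s (ht.trans hs)) (Real.exp_pos _).le
  by_contra hcon
  exact absurd (mul_pos (Real.exp_pos (-c * t)) (not_le.1 hcon)) (by linarith)

end Gronwall

section Modes

/-- The comparison weight `e^{-2σ(t-T)} + δ`. -/
def wt (σ δ T t : ℝ) : ℝ := Real.exp (-(2 * σ) * (t - T)) + δ

variable {σ δ T t : ℝ}

lemma hasDerivAt_wt (σ δ T t : ℝ) :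
    HasDerivAt (wt σ δ T) (-(2 * σ) * Real.exp (-(2 * σ) * (t - T))) t := by
  have h1 := ((((hasDerivAt_id t).sub_const T).const_mul (-(2 * σ))).exp).add_const δ
  refine h1.congr_deriv ?_
  simp only [id]
  ring

lemma wt_nonneg (hδ : 0 ≤ δ) : 0 ≤ wt σ δ T t := add_nonneg (Real.exp_pos _).le hδ

lemma one_le_wt_self (hδ : 0 ≤ δ) : 1 ≤ wt σ δ T T := by
  simp [wt, hδ]

variable {φ e : ℝ → ℝ → ℂ} {l : ℤ} {N B : ℝ}

lemma hasDerivAt_norm_sq_fc (hφ : Sm halfPlane φ)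
    (hper : ∀ t, 0 < t → ∀ θ, φ t (θ + 2 * π) = φ t θ)
    (hd : ∀ t, 0 < t → ∀ θ, dbar φ t θ = l * φ t θ + e t θ) (k : ℤ) (ht : 0 < t) :
    HasDerivAt (fun s => ‖fc k φ s‖ ^ 2)
      (2 * (((k + l : ℤ) : ℝ) * ‖fc k φ t‖ ^ 2 + ⟪fc k φ t, fc k e t⟫_ℝ)) t := by
  have h := hasDerivAt_fc_of_dbar (I := Ioi 0) k hφ isOpen_Ioi ht (hper t ht) l (hd t ht)
  refine h.norm_sq.congr_deriv ?_
  have e1 : ((k : ℂ) + l) * fc k φ t = ((k + l : ℤ) : ℝ) • fc k φ t := by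
    rw [Complex.real_smul]; push_cast; ring
  rw [e1, inner_add_right, real_inner_smul_right, real_inner_self_eq_norm_sq]

lemma sum_norm_sq_fc_le {φ : ℝ → ℝ → ℂ} (hφ : Continuous (φ t)) (S : Finset ℤ) :
    ∑ k ∈ S, ‖fc k φ t‖ ^ 2 ≤ 2 * π * circ (fun s r => ‖φ s r‖ ^ 2) t :=
  sum_le_hasSum S (fun _ _ => sq_nonneg _) (hasSum_norm_sq_fc hφ)

lemma two_inner_le (hσ : σ < 1) (x y : ℂ) :
    2 * |⟪x, y⟫_ℝ| ≤ (1 - σ) * ‖x‖ ^ 2 + ‖y‖ ^ 2 / (1 - σ) := by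
  have h0 : 0 < 1 - σ := by linarith
  have h1 := abs_real_inner_le_norm x y
  have h2 : 0 ≤ ((1 - σ) * ‖x‖ - ‖y‖) ^ 2 / (1 - σ) := by positivity
  have h3 : ((1 - σ) * ‖x‖ - ‖y‖) ^ 2 / (1 - σ) =
      (1 - σ) * ‖x‖ ^ 2 - 2 * (‖x‖ * ‖y‖) + ‖y‖ ^ 2 / (1 - σ) := by
    field_simp
    ring
  linarith

lemma sum_norm_sq_fc_le_of_decreasing (hT : 0 < T) (hσ0 : 0 < σ) (hσ : σ < 1) (hδ : 0 ≤ δ)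
    (hN0 : 0 ≤ N) (hφ : Sm halfPlane φ)
    (hper : ∀ t, 0 < t → ∀ θ, φ t (θ + 2 * π) = φ t θ)
    (hd : ∀ t, 0 < t → ∀ θ, dbar φ t θ = l * φ t θ + e t θ)
    (he : ∀ t, 0 < t → Continuous (e t))
    (hN : ∀ t, T ≤ t → 2 * π * circ (fun s r => ‖e s r‖ ^ 2) t ≤ N * wt σ δ T t)
    {S : Finset ℤ} (hS : ∀ k ∈ S, k + l ≤ -1) (ht : T ≤ t) :
    ∑ k ∈ S, ‖fc k φ t‖ ^ 2 ≤
      (∑ k ∈ S, ‖fc k φ T‖ ^ 2 + N / (1 - σ) ^ 2) * wt σ δ T t := by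
  have h1σ : 0 < 1 - σ := by linarith
  set K := ∑ k ∈ S, ‖fc k φ T‖ ^ 2 + N / (1 - σ) ^ 2 with hK
  have hQ0 : 0 ≤ ∑ k ∈ S, ‖fc k φ T‖ ^ 2 := Finset.sum_nonneg fun _ _ => sq_nonneg _
  have hN1 : 0 ≤ N / (1 - σ) ^ 2 := by positivity
  have hK0 : 0 ≤ K := by linarith
  have hder : ∀ s, T ≤ s → HasDerivAt (fun s => ∑ k ∈ S, ‖fc k φ s‖ ^ 2 - K * wt σ δ T s)
      (∑ k ∈ S, 2 * (((k + l : ℤ) : ℝ) * ‖fc k φ s‖ ^ 2 + ⟪fc k φ s, fc k e s⟫_ℝ)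
        - K * (-(2 * σ) * Real.exp (-(2 * σ) * (s - T)))) s := fun s hs =>
    (HasDerivAt.fun_sum fun k _ => hasDerivAt_norm_sq_fc hφ hper hd k (hT.trans_le hs)).sub
      ((hasDerivAt_wt σ δ T s).const_mul K)
  have := nonpos_of_deriv_le_neg_mul (c := 1 + σ) hder (fun s hs => ?_) ?_ ht
  · linarith
  · have hsum : ∑ k ∈ S, 2 * (((k + l : ℤ) : ℝ) * ‖fc k φ s‖ ^ 2 + ⟪fc k φ s, fc k e s⟫_ℝ) ≤
        ∑ k ∈ S, (-(1 + σ) * ‖fc k φ s‖ ^ 2 + ‖fc k e s‖ ^ 2 / (1 - σ)) := by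
      refine Finset.sum_le_sum fun k hk => ?_
      have h2 := two_inner_le hσ (fc k φ s) (fc k e s)
      have h3 : ((k + l : ℤ) : ℝ) ≤ -1 := by exact_mod_cast hS k hk
      have h4 := mul_le_mul_of_nonneg_right h3 (sq_nonneg ‖fc k φ s‖)
      have h5 := le_abs_self ⟪fc k φ s, fc k e s⟫_ℝ
      linarith
    have hs2 : ∑ k ∈ S, (-(1 + σ) * ‖fc k φ s‖ ^ 2 + ‖fc k e s‖ ^ 2 / (1 - σ)) =
        -(1 + σ) * ∑ k ∈ S, ‖fc k φ s‖ ^ 2 + (∑ k ∈ S, ‖fc k e s‖ ^ 2) / (1 - σ) := by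
      rw [Finset.sum_add_distrib, ← Finset.mul_sum, ← Finset.sum_div]
    rw [hs2] at hsum
    have h6 : (∑ k ∈ S, ‖fc k e s‖ ^ 2) / (1 - σ) ≤ N * wt σ δ T s / (1 - σ) :=
      div_le_div_of_nonneg_right
        ((sum_norm_sq_fc_le (he s (hT.trans_le hs)) S).trans (hN s hs)) h1σ.le
    have hexp : Real.exp (-(2 * σ) * (s - T)) ≤ wt σ δ T s := le_add_of_nonneg_right hδ
    have h7 : N / (1 - σ) ^ 2 * (1 - σ) = N / (1 - σ) := by field_simp
    have hw : 0 ≤ wt σ δ T s := wt_nonneg hδ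
    have h8 : N * wt σ δ T s / (1 - σ) = (N / (1 - σ)) * wt σ δ T s := by ring
    have h9 : N / (1 - σ) ≤ K * (1 - σ) := by
      rw [← h7, hK]
      exact mul_le_mul_of_nonneg_right (by linarith) h1σ.le
    have h10 := mul_le_mul_of_nonneg_right h9 hw
    have h11 : K * (2 * σ * Real.exp (-(2 * σ) * (s - T))) ≤ K * (2 * σ * wt σ δ T s) := by
      gcongr
    nlinarith
  · have h2 := le_mul_of_one_le_right hK0 (one_le_wt_self (σ := σ) (T := T) hδ)
    linarith

lemma sum_norm_sq_fc_le_of_increasing (hT : 0 < T) (hσ0 : 0 < σ) (hσ : σ < 1) (hδ : 0 ≤ δ)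
    (hN0 : 0 ≤ N) (hφ : Sm halfPlane φ)
    (hper : ∀ t, 0 < t → ∀ θ, φ t (θ + 2 * π) = φ t θ)
    (hd : ∀ t, 0 < t → ∀ θ, dbar φ t θ = l * φ t θ + e t θ)
    (he : ∀ t, 0 < t → Continuous (e t))
    (hB : ∀ t, T ≤ t → 2 * π * circ (fun s r => ‖φ s r‖ ^ 2) t ≤ B)
    (hN : ∀ t, T ≤ t → 2 * π * circ (fun s r => ‖e s r‖ ^ 2) t ≤ N * wt σ δ T t)
    {S : Finset ℤ} (hS : ∀ k ∈ S, 1 ≤ k + l) (ht : T ≤ t) :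
    ∑ k ∈ S, ‖fc k φ t‖ ^ 2 ≤ N / (1 - σ) ^ 2 * wt σ δ T t := by
  have h1σ : 0 < 1 - σ := by linarith
  set K := N / (1 - σ) ^ 2 with hK
  have hK0 : 0 ≤ K := by positivity
  have hder : ∀ s, T ≤ s → HasDerivAt (fun s => ∑ k ∈ S, ‖fc k φ s‖ ^ 2 - K * wt σ δ T s)
      (∑ k ∈ S, 2 * (((k + l : ℤ) : ℝ) * ‖fc k φ s‖ ^ 2 + ⟪fc k φ s, fc k e s⟫_ℝ)
        - K * (-(2 * σ) * Real.exp (-(2 * σ) * (s - T)))) s := fun s hs =>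
    (HasDerivAt.fun_sum fun k _ => hasDerivAt_norm_sq_fc hφ hper hd k (hT.trans_le hs)).sub
      ((hasDerivAt_wt σ δ T s).const_mul K)
  have := nonpos_of_mul_le_deriv (c := 1 + σ) (B := B) (by linarith) hder (fun s hs => ?_)
    (fun s hs => ?_) ht
  · linarith
  · have hsum : ∑ k ∈ S, ((1 + σ) * ‖fc k φ s‖ ^ 2 - ‖fc k e s‖ ^ 2 / (1 - σ)) ≤
        ∑ k ∈ S, 2 * (((k + l : ℤ) : ℝ) * ‖fc k φ s‖ ^ 2 + ⟪fc k φ s, fc k e s⟫_ℝ) := by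
      refine Finset.sum_le_sum fun k hk => ?_
      have h2 := two_inner_le hσ (fc k φ s) (fc k e s)
      have h3 : (1 : ℝ) ≤ ((k + l : ℤ) : ℝ) := by exact_mod_cast hS k hk
      have h4 := mul_le_mul_of_nonneg_right h3 (sq_nonneg ‖fc k φ s‖)
      have h5 := neg_abs_le ⟪fc k φ s, fc k e s⟫_ℝ
      linarith
    have hs2 : ∑ k ∈ S, ((1 + σ) * ‖fc k φ s‖ ^ 2 - ‖fc k e s‖ ^ 2 / (1 - σ)) =
        (1 + σ) * ∑ k ∈ S, ‖fc k φ s‖ ^ 2 - (∑ k ∈ S, ‖fc k e s‖ ^ 2) / (1 - σ) := by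
      rw [Finset.sum_sub_distrib, ← Finset.mul_sum, ← Finset.sum_div]
    rw [hs2] at hsum
    have h6 : (∑ k ∈ S, ‖fc k e s‖ ^ 2) / (1 - σ) ≤ N * wt σ δ T s / (1 - σ) :=
      div_le_div_of_nonneg_right
        ((sum_norm_sq_fc_le (he s (hT.trans_le hs)) S).trans (hN s hs)) h1σ.le
    have h7 : K * (1 - σ) = N / (1 - σ) := by rw [hK]; field_simp
    have hw : 0 ≤ wt σ δ T s := wt_nonneg hδ
    have h8 : N * wt σ δ T s / (1 - σ) = (N / (1 - σ)) * wt σ δ T s := by ring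
    have h11 : 0 ≤ K * (2 * σ * Real.exp (-(2 * σ) * (s - T))) := by positivity
    have h12 : 0 ≤ K * (σ * wt σ δ T s) := by positivity
    rw [h8, ← h7] at h6
    nlinarith
  · have h2 : 0 ≤ K * wt σ δ T s := mul_nonneg hK0 (wt_nonneg hδ)
    have h3 := (sum_norm_sq_fc_le (continuous_slice (I := Ioi 0) hφ (hT.trans_le hs)) S).trans
      (hB s hs)
    linarith

/-- Off the neutral mode, a bounded solution of `∂̄φ = lφ + e` decays as fast as the source. -/
lemma circ_norm_sq_le_of_dbar (hT : 0 < T) (hσ0 : 0 < σ) (hσ : σ < 1) (hδ : 0 ≤ δ)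
    (hN0 : 0 ≤ N) (hφ : Sm halfPlane φ)
    (hper : ∀ t, 0 < t → ∀ θ, φ t (θ + 2 * π) = φ t θ)
    (hd : ∀ t, 0 < t → ∀ θ, dbar φ t θ = l * φ t θ + e t θ)
    (he : ∀ t, 0 < t → Continuous (e t))
    (hB : ∀ t, T ≤ t → 2 * π * circ (fun s r => ‖φ s r‖ ^ 2) t ≤ B)
    (hN : ∀ t, T ≤ t → 2 * π * circ (fun s r => ‖e s r‖ ^ 2) t ≤ N * wt σ δ T t)
    (ht : T ≤ t) :
    2 * π * circ (fun s r => ‖φ s r‖ ^ 2) t ≤ ‖fc (-l) φ t‖ ^ 2 +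
      (B + 2 * (N / (1 - σ) ^ 2)) * wt σ δ T t := by
  refine (hasSum_norm_sq_fc (continuous_slice (I := Ioi 0) hφ (hT.trans_le ht))).summable.hasSum.unique
    (hasSum_norm_sq_fc (continuous_slice (I := Ioi 0) hφ (hT.trans_le ht))) ▸
    Summable.tsum_le_of_sum_le
    (hasSum_norm_sq_fc (continuous_slice (I := Ioi 0) hφ (hT.trans_le ht))).summable fun S => ?_
  have hw : 0 ≤ wt σ δ T t := wt_nonneg hδ
  have hm := sum_norm_sq_fc_le_of_decreasing hT hσ0 hσ hδ hN0 hφ hper hd he hN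
    (S := S.filter fun k => k + l ≤ -1) (fun k hk => (Finset.mem_filter.1 hk).2) ht
  have hp := sum_norm_sq_fc_le_of_increasing hT hσ0 hσ hδ hN0 hφ hper hd he hB hN
    (S := S.filter fun k => 1 ≤ k + l) (fun k hk => (Finset.mem_filter.1 hk).2) ht
  have hTB := (sum_norm_sq_fc_le (continuous_slice (I := Ioi 0) hφ hT)
    (S.filter fun k => k + l ≤ -1)).trans (hB T le_rfl)
  have hm' := mul_le_mul_of_nonneg_right hTB hw
  have hz : ∑ k ∈ S.filter (fun k => k = -l), ‖fc k φ t‖ ^ 2 ≤ ‖fc (-l) φ t‖ ^ 2 := by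
    rw [Finset.filter_eq']
    split_ifs
    · simp
    · simp
  have hsplit : ∑ k ∈ S, ‖fc k φ t‖ ^ 2 = ∑ k ∈ S.filter (fun k => k = -l), ‖fc k φ t‖ ^ 2 +
      ∑ k ∈ S.filter (fun k => k + l ≤ -1), ‖fc k φ t‖ ^ 2 +
      ∑ k ∈ S.filter (fun k => 1 ≤ k + l), ‖fc k φ t‖ ^ 2 := by
    rw [Finset.sum_filter, Finset.sum_filter, Finset.sum_filter, ← Finset.sum_add_distrib,
      ← Finset.sum_add_distrib]
    refine Finset.sum_congr rfl fun k _ => ?_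
    rcases lt_trichotomy (k + l) 0 with h | h | h
    · rw [if_neg (by omega), if_pos (by omega), if_neg (by omega)]; ring
    · rw [if_pos (by omega), if_neg (by omega), if_neg (by omega)]; ring
    · rw [if_neg (by omega), if_neg (by omega), if_pos (by omega)]; ring
  rw [hsplit]
  linarith

end Modes

section Energy

variable {f : ℝ → ℝ → EuclideanSpace ℝ (Fin n)} {u : ℝ → ℝ → ℝ} {t ε T : ℝ} {m : ℕ}
  {L : EuclideanSpace ℝ (Fin n)}

/-- The total quadratic size of the curvature and of its derivative on a circle. -/
def vv (f : ℝ → ℝ → EuclideanSpace ℝ (Fin n)) (u : ℝ → ℝ → ℝ) (t : ℝ) : ℝ :=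
  circ (fun s r => aa f u s r ^ 2 + yy f u s r ^ 2) t

lemma vv_nonneg (f : ℝ → ℝ → EuclideanSpace ℝ (Fin n)) (u : ℝ → ℝ → ℝ) (t : ℝ) :
    0 ≤ vv f u t := circ_nonneg fun θ => by positivity

lemma circ_sq_le {a : ℝ → ℝ → ℝ} (ha : Continuous (a t)) :
    circ a t ^ 2 ≤ 2 * π * circ (fun s r => a s r ^ 2) t := by
  have h := sum_norm_sq_fc_le (φ := fun s r => (a s r : ℂ)) (t := t)
    (Complex.continuous_ofReal.comp ha) {0}
  rw [Finset.sum_singleton] at h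
  have e1 : fc 0 (fun s r => (a s r : ℂ)) t = ((circ a t : ℝ) : ℂ) := by
    rw [fc, ← circ_ofReal]
    exact circ_congr fun θ => by simp
  have e2 : circ (fun s r => ‖(a s r : ℂ)‖ ^ 2) t = circ (fun s r => a s r ^ 2) t :=
    circ_congr fun θ => by rw [Complex.norm_real, Real.norm_eq_abs, sq_abs]
  rw [e1, e2, Complex.norm_real, Real.norm_eq_abs, sq_abs] at h
  exact h

namespace TameCyl

variable (h : TameCyl f u m ε T L)
include h

lemma continuous_density (ht : T ≤ t) : Continuous fun r => aa f u t r ^ 2 + yy f u t r ^ 2 :=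
  ((continuous_aa h.asymp.cyl (h.pos ht)).pow 2).add ((continuous_yy h.asymp.cyl (h.pos ht)).pow 2)

lemma circ_aa_sq_le (ht : T ≤ t) : circ (fun s r => aa f u s r ^ 2) t ≤ vv f u t :=
  circ_mono ((continuous_aa h.asymp.cyl (h.pos ht)).pow 2) (h.continuous_density ht)
    fun _ => le_add_of_nonneg_right (sq_nonneg _)

lemma sz_sq_le (ht : T ≤ t) : sz f u t ^ 2 ≤ 4 * π * vv f u t := by
  have ca := continuous_aa h.asymp.cyl (h.pos ht)
  have cy := continuous_yy h.asymp.cyl (h.pos ht)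
  refine (circ_sq_le (a := fun s r => aa f u s r + yy f u s r) (ca.add cy)).trans ?_
  have h1 : circ (fun s r => (aa f u s r + yy f u s r) ^ 2) t ≤ 2 * vv f u t := by
    rw [vv, ← circ_const_mul]
    refine circ_mono ((ca.add cy).pow 2) (continuous_const.mul (h.continuous_density ht))
      fun θ => ?_
    nlinarith [sq_nonneg (aa f u t θ - yy f u t θ)]
  nlinarith [pi_pos]

lemma vv_le_one (ht : T ≤ t) : vv f u t ≤ 1 := by
  have he := h.asymp.eps_nonneg
  have h1 : vv f u t ≤ circ (fun _ _ => (1 / 10 : ℝ)) t := by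
    refine circ_mono (h.continuous_density ht) continuous_const fun θ => ?_
    have h1 := h.asymp.aa_le t θ ht
    have h2 := h.asymp.yy_le t θ ht
    have h3 := h.eps_le
    have h4 := aa_nonneg f u t θ
    have h5 := yy_nonneg f u t θ
    nlinarith
  rw [circ_const, smul_eq_mul] at h1
  linarith [pi_lt_d2]

/-- A non-neutral component of the system is bounded by the weight, up to its neutral mode. -/
lemma component_le {φ ψ : ℝ → ℝ → ℂ} {l : ℤ} {σ δ K a z : ℝ} (hσ0 : 0 < σ) (hσ : σ < 1)
    (hδ : 0 ≤ δ) (hK0 : 0 ≤ K) (ha0 : 0 ≤ a) (hφ : Sm halfPlane φ)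
    (hper : ∀ t, 0 < t → ∀ θ, φ t (θ + 2 * π) = φ t θ)
    (hK : ∀ t, T ≤ t → vv f u t ≤ K * wt σ δ T t)
    (hb : ∀ t, T ≤ t → ∀ θ, ‖φ t θ‖ ≤ 2 * (aa f u t θ + yy f u t θ))
    (he : ∀ t, T ≤ t → ∀ θ, ‖dbar φ t θ - l * φ t θ‖ ^ 2 ≤
      2 * ‖ψ t θ‖ ^ 2 + 162 * ε ^ 2 * (aa f u t θ ^ 2 + yy f u t θ ^ 2))
    (hψ : Sm halfPlane ψ)
    (ha : ∀ t, T ≤ t → 2 * π * circ (fun s r => ‖ψ s r‖ ^ 2) t ≤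
      a * (1 + ε ^ 2 * K) * wt σ δ T t)
    (hz : ∀ t, T ≤ t → ‖fc (-l) φ t‖ ^ 2 ≤ z * (1 + ε ^ 2 * K) * wt σ δ T t) (ht : T ≤ t) :
    2 * π * circ (fun s r => ‖φ s r‖ ^ 2) t ≤
      (z + 64 + (4 * a + 2100) / (1 - σ) ^ 2) * (1 + ε ^ 2 * K) * wt σ δ T t := by
  have h1σ : 0 < 1 - σ := by linarith
  have hU := isOpen_halfPlane
  have hx : 0 ≤ ε ^ 2 * K := by positivity
  have c0 : ∀ t, 0 < t → Continuous (φ t) := fun t ht => continuous_slice (I := Ioi 0) hφ ht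
  have cψ : ∀ t, 0 < t → Continuous (ψ t) := fun t ht => continuous_slice (I := Ioi 0) hψ ht
  have ce : ∀ t, 0 < t → Continuous (fun θ => dbar φ t θ - l * φ t θ) := fun t ht =>
    (continuous_slice (I := Ioi 0) (hφ.dbar hU) ht).sub (continuous_const.mul (c0 t ht))
  have hN : ∀ t, T ≤ t → 2 * π * circ (fun s r => ‖dbar φ s r - l * φ s r‖ ^ 2) t ≤
      (2 * a * (1 + ε ^ 2 * K) + 1050 * (1 + ε ^ 2 * K)) * wt σ δ T t := fun t ht => by
    have hw : 0 ≤ wt σ δ T t := wt_nonneg hδ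
    have k1 : circ (fun s r => ‖dbar φ s r - l * φ s r‖ ^ 2) t ≤
        2 * circ (fun s r => ‖ψ s r‖ ^ 2) t + 162 * ε ^ 2 * vv f u t := by
      rw [vv, ← circ_const_mul, ← circ_const_mul, ← circ_add]
      · refine circ_mono ((ce t (h.pos ht)).norm.pow 2) ?_ (he t ht)
        exact (continuous_const.mul ((cψ t (h.pos ht)).norm.pow 2)).add
          (continuous_const.mul (h.continuous_density ht))
      · exact continuous_const.mul ((cψ t (h.pos ht)).norm.pow 2)
      · exact continuous_const.mul (h.continuous_density ht)
    have k2 := ha t ht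
    have k3 : 2 * π * (162 * ε ^ 2 * vv f u t) ≤ 1050 * (ε ^ 2 * (K * wt σ δ T t)) := by
      have k4 : 2 * π * 162 ≤ 1050 := by linarith [pi_lt_d2]
      have k5 : ε ^ 2 * vv f u t ≤ ε ^ 2 * (K * wt σ δ T t) :=
        mul_le_mul_of_nonneg_left (hK t ht) (sq_nonneg _)
      have k6 : 0 ≤ ε ^ 2 * vv f u t := mul_nonneg (sq_nonneg _) (vv_nonneg f u t)
      calc 2 * π * (162 * ε ^ 2 * vv f u t) = 2 * π * 162 * (ε ^ 2 * vv f u t) := by ring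
        _ ≤ 1050 * (ε ^ 2 * (K * wt σ δ T t)) := mul_le_mul k4 k5 k6 (by norm_num)
    have k7 := mul_le_mul_of_nonneg_left k1 two_pi_pos.le
    nlinarith
  have hB : ∀ t, T ≤ t → 2 * π * circ (fun s r => ‖φ s r‖ ^ 2) t ≤ 64 := fun t ht => by
    have k1 : circ (fun s r => ‖φ s r‖ ^ 2) t ≤ 8 * vv f u t := by
      rw [vv, ← circ_const_mul]
      refine circ_mono ((c0 t (h.pos ht)).norm.pow 2)
        (continuous_const.mul (h.continuous_density ht)) fun θ => ?_
      have k2 := pow_le_pow_left₀ (norm_nonneg _) (hb t ht θ) 2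
      nlinarith [sq_nonneg (aa f u t θ - yy f u t θ)]
    have k2 := h.vv_le_one ht
    have k3 : circ (fun s r => ‖φ s r‖ ^ 2) t ≤ 8 := by linarith
    nlinarith [pi_lt_d2, pi_pos]
  have key := circ_norm_sq_le_of_dbar h.asymp.pos hσ0 hσ hδ (by positivity) hφ hper
    (e := fun s r => dbar φ s r - l * φ s r) (fun t _ θ => by ring) ce hB hN ht
  have hw : 0 ≤ wt σ δ T t := wt_nonneg hδ
  have hzt := hz t ht
  have e1 : 2 * ((2 * a * (1 + ε ^ 2 * K) + 1050 * (1 + ε ^ 2 * K)) / (1 - σ) ^ 2) =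
      (4 * a + 2100) / (1 - σ) ^ 2 * (1 + ε ^ 2 * K) := by ring
  rw [e1] at key
  have hxw : 0 ≤ ε ^ 2 * K * wt σ δ T t := mul_nonneg hx hw
  nlinarith

lemma norm_conj_gc_add_le (ht : T ≤ t) (θ : ℝ) :
    ‖(starRingEnd ℂ) (gc u t θ) + m‖ ≤ ε := by
  have e : (starRingEnd ℂ) (gc u t θ) + m = (starRingEnd ℂ) (gc u t θ + (m : ℝ)) := by
    simp
  rw [e, Complex.norm_conj]
  exact h.asymp.gc_le t θ ht

end TameCyl

end Energy

section Improve

variable {f : ℝ → ℝ → EuclideanSpace ℝ (Fin n)} {u : ℝ → ℝ → ℝ} {t ε T : ℝ} {m : ℕ}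
  {L : EuclideanSpace ℝ (Fin n)}

lemma periodic_cx_vy (hF : FiniteCyl f u) (j : Fin n) (ht : 0 < t) (θ : ℝ) :
    cx (vy1 f u) (vy2 f u) j t (θ + 2 * π) = cx (vy1 f u) (vy2 f u) j t θ := by
  simp only [cx, vy1, vy2, hF.per_u, periodic_pt (fun t ht => periodic_Hmc hF (t := t) ht) ht,
    periodic_pth (fun t ht => periodic_Hmc hF (t := t) ht) ht]

lemma periodic_cx_vp (hF : FiniteCyl f u) (j : Fin n) (ht : 0 < t) (θ : ℝ) :
    cx (vp f u) (vq f u) j t (θ + 2 * π) = cx (vp f u) (vq f u) j t θ := by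
  obtain ⟨h1, h2, h3⟩ := periodic_A hF ht θ
  simp only [cx, vp, vq, hF.per_u, h1, h2, h3]

/-- The decay constant of the components of `e^u ∇H`. -/
def yConst (σ : ℝ) (m : ℕ) : ℝ := 13 * (1002 * m) ^ 2 + 64 + (4 * 0 + 2100) / (1 - σ) ^ 2

/-- The decay constant of the neutral modes of `e^u H`. -/
def hNeutralConst (n : ℕ) (σ : ℝ) (m : ℕ) : ℝ := 26 * (1000 * m) ^ 2 + 4 * n * yConst σ m

/-- The decay constant of the components of `e^u H`. -/
def hConst (n : ℕ) (σ : ℝ) (m : ℕ) : ℝ :=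
  hNeutralConst n σ m + 64 + (4 * yConst σ m + 2100) / (1 - σ) ^ 2

/-- The decay constant of the components of the Hopf differential. -/
def omConst (n : ℕ) (σ : ℝ) (m : ℕ) : ℝ :=
  2 * hNeutralConst n σ m + 14 * 896 ^ 2 + 64 + (4 * yConst σ m + 2100) / (1 - σ) ^ 2

lemma yConst_nonneg (σ : ℝ) (m : ℕ) : 0 ≤ yConst σ m := by unfold yConst; positivity

namespace TameCyl

variable (h : TameCyl f u m ε T L) {σ δ K : ℝ}
include h

lemma y_component_le (hσ0 : 0 < σ) (hσ : σ < 1) (hδ : 0 ≤ δ) (hK0 : 0 ≤ K)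
    (hK : ∀ t, T ≤ t → vv f u t ≤ K * wt σ δ T t) (j : Fin n) (ht : T ≤ t) :
    2 * π * circ (fun s r => ‖cx (vy1 f u) (vy2 f u) j s r‖ ^ 2) t ≤
      yConst σ m * (1 + ε ^ 2 * K) * wt σ δ T t := by
  have hF := h.asymp.cyl
  have hU := isOpen_halfPlane
  have hε := h.asymp.eps_nonneg
  have hx : 0 ≤ ε ^ 2 * K := by positivity
  refine h.component_le (l := -(m : ℤ)) (ψ := fun _ _ => 0) hσ0 hσ hδ hK0 le_rfl
    ((hF.conf.sm_vy1 hU).cx (hF.conf.sm_vy2 hU) j) (fun t ht => periodic_cx_vy hF j ht) hK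
    (fun t ht θ => ?_) (fun t ht θ => ?_) (sm_const 0) (fun t ht => ?_) (fun t ht => ?_) ht
  · have h1 : ‖cx (vy1 f u) (vy2 f u) j t θ‖ ≤ yy f u t θ := norm_cx_le j
    linarith [aa_nonneg f u t θ, yy_nonneg f u t θ]
  · have h1 := hF.conf.dbar_y hU (h.asymp.mem ht θ) j
    have h2 : ‖cx (vy1 f u) (vy2 f u) j t θ‖ ≤ yy f u t θ := norm_cx_le j
    have h3 := h.norm_conj_gc_add_le ht θ
    have h4 := aa_nonneg f u t θ
    have h5 := yy_nonneg f u t θ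
    have h6 := h.asymp.aa_le t θ ht
    have h7 := h.eps_le
    have e : dbar (cx (vy1 f u) (vy2 f u) j) t θ
        - ((-(m : ℤ) : ℤ) : ℂ) * cx (vy1 f u) (vy2 f u) j t θ =
        (dbar (cx (vy1 f u) (vy2 f u) j) t θ
          - (starRingEnd ℂ) (gc u t θ) * cx (vy1 f u) (vy2 f u) j t θ) +
        ((starRingEnd ℂ) (gc u t θ) + m) * cx (vy1 f u) (vy2 f u) j t θ := by
      push_cast; ring
    have h8 : ‖((starRingEnd ℂ) (gc u t θ) + m) * cx (vy1 f u) (vy2 f u) j t θ‖ ≤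
        ε * yy f u t θ := by
      rw [norm_mul]; exact mul_le_mul h3 h2 (norm_nonneg _) hε
    have h9 : 8 * aa f u t θ * (yy f u t θ + aa f u t θ ^ 2) ≤
        8 * ε * yy f u t θ + ε * aa f u t θ := by
      have k1 : aa f u t θ * yy f u t θ ≤ ε * yy f u t θ := mul_le_mul_of_nonneg_right h6 h5
      have k2 : aa f u t θ * aa f u t θ ≤ ε * (1 / 1000) := mul_le_mul h6 (h6.trans h7) h4 hε
      have k3 := mul_le_mul_of_nonneg_right k2 h4
      have k4 : 0 ≤ ε * aa f u t θ := by positivity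
      nlinarith
    have h10 : ‖dbar (cx (vy1 f u) (vy2 f u) j) t θ
        - ((-(m : ℤ) : ℤ) : ℂ) * cx (vy1 f u) (vy2 f u) j t θ‖ ≤
        9 * (ε * (aa f u t θ + yy f u t θ)) := by
      rw [e]
      have k4 : 0 ≤ ε * aa f u t θ := by positivity
      refine (norm_add_le _ _).trans ?_
      linarith
    have h11 := pow_le_pow_left₀ (norm_nonneg _) h10 2
    have h12 : 0 ≤ ε ^ 2 * (aa f u t θ - yy f u t θ) ^ 2 := by positivity
    rw [norm_zero]
    nlinarith
  · have e0 : circ (fun _ _ : ℝ => ‖(0 : ℂ)‖ ^ 2) t = 0 := by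
      rw [circ_const]; simp
    rw [e0]; simp
  · rw [neg_neg]
    have h1 := pow_le_pow_left₀ (norm_nonneg _) (h.norm_fc_y_le ht j) 2
    have h2 := (h.sz_sq_le ht).trans (mul_le_mul_of_nonneg_left (hK t ht) (by positivity))
    have hw : 0 ≤ wt σ δ T t := wt_nonneg hδ
    have hKw : 0 ≤ K * wt σ δ T t := mul_nonneg hK0 hw
    have h3 : sz f u t ^ 2 ≤ 13 * (K * wt σ δ T t) :=
      h2.trans (mul_le_mul_of_nonneg_right (by linarith [pi_lt_d2]) hKw)
    have h4 := mul_le_mul_of_nonneg_left h3 (by positivity : (0 : ℝ) ≤ (1002 * m * ε) ^ 2)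
    have h5 : 0 ≤ 13 * (1002 * (m : ℝ)) ^ 2 * wt σ δ T t := by positivity
    nlinarith

lemma circ_yy_sq_le (hσ0 : 0 < σ) (hσ : σ < 1) (hδ : 0 ≤ δ) (hK0 : 0 ≤ K)
    (hK : ∀ t, T ≤ t → vv f u t ≤ K * wt σ δ T t) (ht : T ≤ t) :
    2 * π * circ (fun s r => yy f u s r ^ 2) t ≤
      2 * n * yConst σ m * (1 + ε ^ 2 * K) * wt σ δ T t := by
  have hF := h.asymp.cyl
  have hU := isOpen_halfPlane
  have cy : ∀ j, Continuous fun r => ‖cx (vy1 f u) (vy2 f u) j t r‖ ^ 2 := fun j =>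
    (continuous_slice (I := Ioi 0) ((hF.conf.sm_vy1 hU).cx (hF.conf.sm_vy2 hU) j)
      (h.pos ht)).norm.pow 2
  have h1 : circ (fun s r => yy f u s r ^ 2) t ≤
      2 * ∑ j, circ (fun s r => ‖cx (vy1 f u) (vy2 f u) j s r‖ ^ 2) t := by
    have e : ∑ j, circ (fun s r => ‖cx (vy1 f u) (vy2 f u) j s r‖ ^ 2) t =
        circ (fun s r => ∑ j, ‖cx (vy1 f u) (vy2 f u) j s r‖ ^ 2) t :=
      (intervalIntegral.integral_finsetSum fun j _ => (cy j).intervalIntegrable _ _).symm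
    rw [e, ← circ_const_mul]
    refine circ_mono ((continuous_yy hF (h.pos ht)).pow 2)
      (continuous_const.mul (continuous_finsetSum _ fun j _ => cy j)) fun θ => ?_
    rw [sum_norm_sq_cx, yy]
    nlinarith [sq_nonneg (‖vy1 f u t θ‖ - ‖vy2 f u t θ‖)]
  have h2 : ∑ j, 2 * π * circ (fun s r => ‖cx (vy1 f u) (vy2 f u) j s r‖ ^ 2) t ≤
      ∑ _j : Fin n, yConst σ m * (1 + ε ^ 2 * K) * wt σ δ T t :=
    Finset.sum_le_sum fun j _ => h.y_component_le hσ0 hσ hδ hK0 hK j ht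
  rw [← Finset.mul_sum, Finset.sum_const, Finset.card_univ, Fintype.card_fin, nsmul_eq_mul] at h2
  have h3 := mul_le_mul_of_nonneg_left h1 two_pi_pos.le
  linarith

lemma h_neutral_le (hσ0 : 0 < σ) (hσ : σ < 1) (hδ : 0 ≤ δ) (hK0 : 0 ≤ K)
    (hK : ∀ t, T ≤ t → vv f u t ≤ K * wt σ δ T t) (j : Fin n) (ht : T ≤ t) :
    ‖fc m (fun s r => (vh f u s r j : ℂ)) t‖ ^ 2 ≤
      hNeutralConst n σ m * (1 + ε ^ 2 * K) * wt σ δ T t := by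
  have hF := h.asymp.cyl
  have h1 := pow_le_pow_left₀ (norm_nonneg _) (h.norm_fc_h_le ht j) 2
  have h2 := (h.sz_sq_le ht).trans (mul_le_mul_of_nonneg_left (hK t ht) (by positivity))
  have hw : 0 ≤ wt σ δ T t := wt_nonneg hδ
  have hKw : 0 ≤ K * wt σ δ T t := mul_nonneg hK0 hw
  have h3 : sz f u t ^ 2 ≤ 13 * (K * wt σ δ T t) :=
    h2.trans (mul_le_mul_of_nonneg_right (by linarith [pi_lt_d2]) hKw)
  have h4 := mul_le_mul_of_nonneg_left h3 (by positivity : (0 : ℝ) ≤ (1000 * m * ε) ^ 2)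
  have h5 : 0 ≤ 26 * (1000 * (m : ℝ)) ^ 2 * wt σ δ T t := by positivity
  have h6 := (circ_sq_le (continuous_yy hF (h.pos ht))).trans
    (h.circ_yy_sq_le hσ0 hσ hδ hK0 hK ht)
  have h7 := add_sq_le (a := 1000 * m * ε * sz f u t) (b := circ (yy f u) t)
  rw [hNeutralConst]
  nlinarith

lemma h_component_le (hσ0 : 0 < σ) (hσ : σ < 1) (hδ : 0 ≤ δ) (hK0 : 0 ≤ K)
    (hK : ∀ t, T ≤ t → vv f u t ≤ K * wt σ δ T t) (j : Fin n) (ht : T ≤ t) :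
    2 * π * circ (fun s r => ‖cx (vh f u) (fun _ _ => 0) j s r‖ ^ 2) t ≤
      hConst n σ m * (1 + ε ^ 2 * K) * wt σ δ T t := by
  have hF := h.asymp.cyl
  have hU := isOpen_halfPlane
  have hε := h.asymp.eps_nonneg
  have hb : ∀ t θ, ‖cx (vh f u) (fun _ _ => 0) j t θ‖ ≤ 2 * aa f u t θ := fun t θ =>
    (norm_cx_le j).trans (by rw [norm_zero, add_zero]; exact norm_vh_le f u t θ)
  refine h.component_le (l := -(m : ℤ)) (ψ := cx (vy1 f u) (vy2 f u) j) hσ0 hσ hδ hK0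
    (yConst_nonneg σ m) ((hF.conf.sm_vh hU).cx (sm_const 0) j)
    (fun t ht θ => by simp only [cx, periodic_vh hF ht]) hK
    (fun t ht θ => ?_) (fun t ht θ => ?_) ((hF.conf.sm_vy1 hU).cx (hF.conf.sm_vy2 hU) j)
    (fun t ht => h.y_component_le hσ0 hσ hδ hK0 hK j ht) (fun t ht => ?_) ht
  · linarith [hb t θ, yy_nonneg f u t θ]
  · have h3 := h.norm_conj_gc_add_le ht θ
    have h4 := aa_nonneg f u t θ
    have e : dbar (cx (vh f u) (fun _ _ => 0) j) t θ
        - ((-(m : ℤ) : ℤ) : ℂ) * cx (vh f u) (fun _ _ => 0) j t θ =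
        (starRingEnd ℂ) (cx (vy1 f u) (vy2 f u) j t θ) +
        ((starRingEnd ℂ) (gc u t θ) + m) * cx (vh f u) (fun _ _ => 0) j t θ := by
      rw [hF.conf.dbar_h hU (h.asymp.mem ht θ) j]
      push_cast; ring
    have h8 : ‖((starRingEnd ℂ) (gc u t θ) + m) * cx (vh f u) (fun _ _ => 0) j t θ‖ ≤
        ε * (2 * aa f u t θ) := by
      rw [norm_mul]; exact mul_le_mul h3 (hb t θ) (norm_nonneg _) hε
    have h10 : ‖dbar (cx (vh f u) (fun _ _ => 0) j) t θ
        - ((-(m : ℤ) : ℤ) : ℂ) * cx (vh f u) (fun _ _ => 0) j t θ‖ ≤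
        ‖cx (vy1 f u) (vy2 f u) j t θ‖ + ε * (2 * aa f u t θ) := by
      rw [e]
      refine (norm_add_le _ _).trans ?_
      rw [Complex.norm_conj]
      linarith
    have h11 := (pow_le_pow_left₀ (norm_nonneg _) h10 2).trans add_sq_le
    have h12 : 0 ≤ ε ^ 2 * yy f u t θ ^ 2 := by positivity
    have h13 : 0 ≤ ε ^ 2 * aa f u t θ ^ 2 := by positivity
    nlinarith
  · rw [neg_neg]
    have e : fc m (cx (vh f u) (fun _ _ => 0) j) t = fc m (fun s r => (vh f u s r j : ℂ)) t :=
      fc_congr _ fun θ => by simp [cx]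
    rw [e]
    exact h.h_neutral_le hσ0 hσ hδ hK0 hK j ht

lemma om_component_le (hσ0 : 0 < σ) (hσ : σ < 1) (hδ : 0 ≤ δ) (hK0 : 0 ≤ K)
    (hK : ∀ t, T ≤ t → vv f u t ≤ K * wt σ δ T t) (j : Fin n) (ht : T ≤ t) :
    2 * π * circ (fun s r => ‖cx (vp f u) (vq f u) j s r‖ ^ 2) t ≤
      omConst n σ m * (1 + ε ^ 2 * K) * wt σ δ T t := by
  have hF := h.asymp.cyl
  have hU := isOpen_halfPlane
  have hε := h.asymp.eps_nonneg
  have hb : ∀ t θ, ‖cx (vp f u) (vq f u) j t θ‖ ≤ 2 * aa f u t θ := fun t θ =>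
    (norm_cx_le j).trans (by linarith [norm_vp_le f u t θ, norm_vq_le f u t θ])
  refine h.component_le (l := (m : ℤ)) (ψ := cx (vy1 f u) (vy2 f u) j) hσ0 hσ hδ hK0
    (yConst_nonneg σ m) ((hF.conf.sm_vp hU).cx (hF.conf.sm_vq hU) j)
    (fun t ht => periodic_cx_vp hF j ht) hK
    (fun t ht θ => ?_) (fun t ht θ => ?_) ((hF.conf.sm_vy1 hU).cx (hF.conf.sm_vy2 hU) j)
    (fun t ht => h.y_component_le hσ0 hσ hδ hK0 hK j ht) (fun t ht => ?_) ht
  · linarith [hb t θ, yy_nonneg f u t θ]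
  · have h1 := hF.conf.dbar_om hU (h.asymp.mem ht θ) j
    have h3 := h.norm_conj_gc_add_le ht θ
    have h4 := aa_nonneg f u t θ
    have h6 := h.asymp.aa_le t θ ht
    have e : dbar (cx (vp f u) (vq f u) j) t θ - ((m : ℤ) : ℂ) * cx (vp f u) (vq f u) j t θ =
        (dbar (cx (vp f u) (vq f u) j) t θ
          - (-(starRingEnd ℂ) (gc u t θ) * cx (vp f u) (vq f u) j t θ
            + 1 / 2 * cx (vy1 f u) (vy2 f u) j t θ)) +
        (1 / 2 * cx (vy1 f u) (vy2 f u) j t θ -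
        ((starRingEnd ℂ) (gc u t θ) + m) * cx (vp f u) (vq f u) j t θ) := by
      push_cast; ring
    have h8 : ‖((starRingEnd ℂ) (gc u t θ) + m) * cx (vp f u) (vq f u) j t θ‖ ≤
        ε * (2 * aa f u t θ) := by
      rw [norm_mul]; exact mul_le_mul h3 (hb t θ) (norm_nonneg _) hε
    have h9 : ‖1 / 2 * cx (vy1 f u) (vy2 f u) j t θ‖ ≤ ‖cx (vy1 f u) (vy2 f u) j t θ‖ := by
      rw [norm_mul]
      refine mul_le_of_le_one_left (norm_nonneg _) ?_
      norm_num
    have h10 : ‖dbar (cx (vp f u) (vq f u) j) t θ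
        - ((m : ℤ) : ℂ) * cx (vp f u) (vq f u) j t θ‖ ≤
        ‖cx (vy1 f u) (vy2 f u) j t θ‖ + ε * (3 * aa f u t θ) := by
      rw [e]
      refine (norm_add_le _ _).trans ?_
      have k1 := norm_sub_le (1 / 2 * cx (vy1 f u) (vy2 f u) j t θ)
        (((starRingEnd ℂ) (gc u t θ) + m) * cx (vp f u) (vq f u) j t θ)
      have k2 := mul_le_mul_of_nonneg_right h6 h4
      nlinarith
    have h11 := (pow_le_pow_left₀ (norm_nonneg _) h10 2).trans add_sq_le
    have h12 : 0 ≤ ε ^ 2 * yy f u t θ ^ 2 := by positivity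
    have h13 : 0 ≤ ε ^ 2 * aa f u t θ ^ 2 := by positivity
    nlinarith
  · have h1 := (pow_le_pow_left₀ (norm_nonneg _) (h.norm_fc_om_le ht j) 2).trans add_sq_le
    have h2 := h.h_neutral_le hσ0 hσ hδ hK0 hK j ht
    have hw : 0 ≤ wt σ δ T t := wt_nonneg hδ
    have hKw : 0 ≤ K * wt σ δ T t := mul_nonneg hK0 hw
    have h3 := circ_sq_le (continuous_aa hF (h.pos ht))
    have h4 : 2 * π * circ (fun s r => aa f u s r ^ 2) t ≤ 7 * (K * wt σ δ T t) :=
      mul_le_mul (by linarith [pi_lt_d2]) ((h.circ_aa_sq_le ht).trans (hK t ht))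
        (circ_nonneg fun θ => sq_nonneg _) (by norm_num)
    have h5 := mul_le_mul_of_nonneg_left (h3.trans h4) (by positivity : (0 : ℝ) ≤ (896 * ε) ^ 2)
    nlinarith

end TameCyl

end Improve

section Decay

variable {f : ℝ → ℝ → EuclideanSpace ℝ (Fin n)} {u : ℝ → ℝ → ℝ} {t ε T : ℝ} {m : ℕ}
  {L : EuclideanSpace ℝ (Fin n)}

/-- The constant in the self-improving bound for `vv`. -/
def energyConst (n : ℕ) (σ : ℝ) (m : ℕ) : ℝ :=
  n * (2 * yConst σ m + hConst n σ m + 2 * omConst n σ m) + 1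

lemma energyConst_pos (n : ℕ) (σ : ℝ) (m : ℕ) : 0 < energyConst n σ m := by
  have := yConst_nonneg σ m
  unfold energyConst hConst omConst hNeutralConst
  positivity

namespace TameCyl

variable (h : TameCyl f u m ε T L) {σ δ K : ℝ}
include h

lemma vv_le_improved (hσ0 : 0 < σ) (hσ : σ < 1) (hδ : 0 ≤ δ) (hK0 : 0 ≤ K)
    (hK : ∀ t, T ≤ t → vv f u t ≤ K * wt σ δ T t) (ht : T ≤ t) :
    vv f u t ≤ energyConst n σ m * (1 + ε ^ 2 * K) * wt σ δ T t := by
  have hF := h.asymp.cyl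
  have hU := isOpen_halfPlane
  have cc : ∀ {a b : ℝ → ℝ → EuclideanSpace ℝ (Fin n)} (j : Fin n), Sm halfPlane a →
      Sm halfPlane b → Continuous fun r => ‖cx a b j t r‖ ^ 2 := fun j ha hb =>
    (continuous_slice (I := Ioi 0) (ha.cx hb j) (h.pos ht)).norm.pow 2
  have cy := fun j => cc j (hF.conf.sm_vy1 hU) (hF.conf.sm_vy2 hU)
  have ch := fun j => cc j (hF.conf.sm_vh hU) (sm_const 0)
  have co := fun j => cc j (hF.conf.sm_vp hU) (hF.conf.sm_vq hU)
  have e : ∀ {a b : ℝ → ℝ → EuclideanSpace ℝ (Fin n)},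
      (∀ j, Continuous fun r => ‖cx a b j t r‖ ^ 2) →
      ∑ j, circ (fun s r => ‖cx a b j s r‖ ^ 2) t =
        circ (fun s r => ‖a s r‖ ^ 2 + ‖b s r‖ ^ 2) t := fun {a b} hc => by
    rw [← circ_congr (φ := fun s r => ∑ j, ‖cx a b j s r‖ ^ 2) fun θ => sum_norm_sq_cx]
    exact (intervalIntegral.integral_finsetSum fun j _ => (hc j).intervalIntegrable _ _).symm
  have hsum : ∀ {a b : ℝ → ℝ → EuclideanSpace ℝ (Fin n)} {c : ℝ},
      (∀ j, 2 * π * circ (fun s r => ‖cx a b j s r‖ ^ 2) t ≤ c * (1 + ε ^ 2 * K) * wt σ δ T t) →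
      2 * π * ∑ j, circ (fun s r => ‖cx a b j s r‖ ^ 2) t ≤
        n * (c * (1 + ε ^ 2 * K) * wt σ δ T t) := fun {a b c} hc => by
    have h2 := Finset.sum_le_sum fun j (_ : j ∈ Finset.univ) => hc j
    rwa [← Finset.mul_sum, Finset.sum_const, Finset.card_univ, Fintype.card_fin,
      nsmul_eq_mul] at h2
  have sy := hsum fun j => h.y_component_le hσ0 hσ hδ hK0 hK j ht
  have sh := hsum fun j => h.h_component_le hσ0 hσ hδ hK0 hK j ht
  have so := hsum fun j => h.om_component_le hσ0 hσ hδ hK0 hK j ht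
  rw [e cy] at sy
  rw [e ch] at sh
  rw [e co] at so
  have iy : Continuous fun r => ‖vy1 f u t r‖ ^ 2 + ‖vy2 f u t r‖ ^ 2 :=
    ((continuous_slice (I := Ioi 0) (hF.conf.sm_vy1 hU) (h.pos ht)).norm.pow 2).add
      ((continuous_slice (I := Ioi 0) (hF.conf.sm_vy2 hU) (h.pos ht)).norm.pow 2)
  have ih : Continuous fun r => ‖vh f u t r‖ ^ 2 + ‖(0 : EuclideanSpace ℝ (Fin n))‖ ^ 2 :=
    ((continuous_slice (I := Ioi 0) (hF.conf.sm_vh hU) (h.pos ht)).norm.pow 2).add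
      continuous_const
  have io : Continuous fun r => ‖vp f u t r‖ ^ 2 + ‖vq f u t r‖ ^ 2 :=
    ((continuous_slice (I := Ioi 0) (hF.conf.sm_vp hU) (h.pos ht)).norm.pow 2).add
      ((continuous_slice (I := Ioi 0) (hF.conf.sm_vq hU) (h.pos ht)).norm.pow 2)
  have key : vv f u t ≤ 2 * circ (fun s r => ‖vy1 f u s r‖ ^ 2 + ‖vy2 f u s r‖ ^ 2) t +
      (circ (fun s r => ‖vh f u s r‖ ^ 2 + ‖(0 : EuclideanSpace ℝ (Fin n))‖ ^ 2) t +
        2 * circ (fun s r => ‖vp f u s r‖ ^ 2 + ‖vq f u s r‖ ^ 2) t) := by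
    rw [← circ_const_mul, ← circ_const_mul, ← circ_add, ← circ_add]
    · refine circ_mono (h.continuous_density ht) ((continuous_const.mul iy).add
        (ih.add (continuous_const.mul io))) fun θ => ?_
      rw [aa_sq_eq, yy, norm_zero]
      nlinarith [sq_nonneg (‖vy1 f u t θ‖ - ‖vy2 f u t θ‖), sq_nonneg ‖vh f u t θ‖]
    · exact continuous_const.mul iy
    · exact ih.add (continuous_const.mul io)
    · exact ih
    · exact continuous_const.mul io
  have hw : 0 ≤ wt σ δ T t := wt_nonneg hδ
  have hxw : 0 ≤ (1 + ε ^ 2 * K) * wt σ δ T t := by positivity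
  have h1 : vv f u t ≤ 2 * π * vv f u t :=
    le_mul_of_one_le_left (vv_nonneg f u t) (by linarith [pi_gt_three])
  have h2 := mul_le_mul_of_nonneg_left key two_pi_pos.le
  rw [energyConst]
  nlinarith

lemma vv_le_wt (hσ0 : 0 < σ) (hσ : σ < 1) (hδ : 0 < δ)
    (hC : energyConst n σ m * ε ^ 2 ≤ 1 / 2) (ht : T ≤ t) :
    vv f u t ≤ 2 * energyConst n σ m * wt σ δ T t := by
  have hw : ∀ s, 0 < wt σ δ T s := fun s => add_pos (Real.exp_pos _) hδ
  set S : Set ℝ := (fun s => vv f u s / wt σ δ T s) '' Ici T with hS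
  have hne : S.Nonempty := ⟨_, T, self_mem_Ici, rfl⟩
  have hbdd : BddAbove S := by
    refine ⟨1 / δ, ?_⟩
    rintro _ ⟨s, hs, rfl⟩
    exact div_le_div₀ zero_le_one (h.vv_le_one hs) hδ (le_add_of_nonneg_left (Real.exp_pos _).le)
  have hK : ∀ s, T ≤ s → vv f u s ≤ sSup S * wt σ δ T s := fun s hs =>
    (div_le_iff₀ (hw s)).1 (le_csSup hbdd ⟨s, hs, rfl⟩)
  have hK0 : 0 ≤ sSup S := (div_nonneg (vv_nonneg f u T) (hw T).le).trans
    (le_csSup hbdd ⟨T, self_mem_Ici, rfl⟩)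
  have hle : sSup S ≤ energyConst n σ m * (1 + ε ^ 2 * sSup S) := by
    refine csSup_le hne ?_
    rintro _ ⟨s, hs, rfl⟩
    exact (div_le_iff₀ (hw s)).2 (h.vv_le_improved hσ0 hσ hδ.le hK0 hK hs)
  have hfin : sSup S ≤ 2 * energyConst n σ m := by nlinarith
  exact (hK t ht).trans (mul_le_mul_of_nonneg_right hfin (hw t).le)

lemma vv_le_exp (hσ0 : 0 < σ) (hσ : σ < 1)
    (hC : energyConst n σ m * ε ^ 2 ≤ 1 / 2) (ht : T ≤ t) :
    vv f u t ≤ 2 * energyConst n σ m * Real.exp (-(2 * σ) * (t - T)) := by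
  have hc := energyConst_pos n σ m
  refine le_of_forall_pos_le_add fun η hη => ?_
  refine (h.vv_le_wt (δ := η / (2 * energyConst n σ m)) hσ0 hσ (by positivity) hC ht).trans
    (le_of_eq ?_)
  rw [wt]
  field_simp

end TameCyl

/-- Exponential decay of the curvature density on a cylinder of finite curvature and area. -/
lemma FiniteCyl.exists_circ_Adens_le (hF : FiniteCyl f u) {σ : ℝ} (hσ0 : 0 < σ) (hσ : σ < 1) :
    ∃ T C : ℝ, 0 < T ∧ 0 ≤ C ∧
      ∀ t, T ≤ t → circ (Adens f u) t ≤ C * Real.exp (-(2 * σ) * t) := by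
  obtain ⟨m, hm1, hm⟩ := exists_nat_slope hF
  have hc := energyConst_pos n σ m
  have hm1' : (1 : ℝ) ≤ m := by exact_mod_cast hm1
  obtain ⟨ε, hε0, hε1, hε2⟩ : ∃ ε : ℝ, 0 < ε ∧ ε ≤ 1 / 1000 ∧
      energyConst n σ m * ε ^ 2 ≤ 1 / 2 := by
    refine ⟨min (1 / 1000) (1 / (2 * energyConst n σ m)), by positivity, min_le_left _ _, ?_⟩
    set ε := min (1 / 1000) (1 / (2 * energyConst n σ m))
    have h0 : 0 < ε := by positivity
    have h1 : ε ≤ 1 / 1000 := min_le_left _ _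
    have h2 : ε ≤ 1 / (2 * energyConst n σ m) := min_le_right _ _
    rw [le_div_iff₀ (by positivity)] at h2
    nlinarith
  obtain ⟨T, -, hT⟩ := exists_asympCyl hF hm hε0
  obtain ⟨L, hL⟩ := hT.exists_limit hm1' (by linarith)
  have h : TameCyl f u m ε T L :=
    ⟨hT, hm1, hε1, hL, fun a b ha hb t ht => circ_res_eq_zero hF hm hm1' hL ha hb ht⟩
  refine ⟨T, 2 * energyConst n σ m * Real.exp (2 * σ * T), hT.pos, by positivity,
    fun t ht => ?_⟩
  have e : circ (Adens f u) t = circ (fun s r => aa f u s r ^ 2) t :=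
    circ_congr fun θ => (aa_sq f u t θ).symm
  rw [e, mul_assoc, ← Real.exp_add]
  refine ((h.circ_aa_sq_le ht).trans (h.vv_le_exp hσ0 hσ hε2 ht)).trans (le_of_eq ?_)
  ring_nf

lemma cylInt_Adens_eq (hF : FiniteCyl f u) (ht : 0 < t) :
    cylInt (Adens f u) t (t + 1) = ∫ s in t..(t + 1), circ (Adens f u) s := by
  have hc : ContinuousOn (fun p : ℝ × ℝ => Adens f u p.1 p.2)
      (Icc t (t + 1) ×ˢ Icc (0 : ℝ) (2 * π)) :=
    (sm_Adens hF.conf isOpen_halfPlane).continuousOn.mono fun p hp => ht.trans_le hp.1.1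
  rw [cylInt, Measure.volume_eq_prod, setIntegral_prod _
    (hc.integrableOn_compact (isCompact_Icc.prod isCompact_Icc)), integral_Icc_eq_integral_Ioc,
    ← intervalIntegral.integral_of_le (by linarith)]
  refine intervalIntegral.integral_congr fun s hs => ?_
  rw [uIcc_of_le (by linarith)] at hs
  have hs0 : 0 < s := ht.trans_le hs.1
  have hper : ∀ θ, Adens f u s (θ + 2 * π) = Adens f u s θ := fun θ => by
    obtain ⟨h1, h2, h3⟩ := periodic_A hF hs0 θ
    simp only [Adens_eq, h1, h2, h3, hF.per_u]
  rw [circ_eq_integral hper 0]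
  dsimp only
  rw [integral_Icc_eq_integral_Ioc, ← intervalIntegral.integral_of_le two_pi_pos.le, zero_add]

lemma FiniteCyl.exists_cylInt_le (hF : FiniteCyl f u) {q : ℝ} (hq0 : 0 < q) (hq2 : q < 2) :
    ∃ C > (0 : ℝ), ∀ t > (0 : ℝ), cylInt (Adens f u) t (t + 1) ≤ C * Real.exp (-q * t) := by
  obtain ⟨T, C, hT, hC, h⟩ := hF.exists_circ_Adens_le (σ := q / 2) (by linarith) (by linarith)
  have hI : 0 ≤ ∫ s in Ioi (0 : ℝ), circ (Adens f u) s :=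
    integral_nonneg fun s => circ_Adens_nonneg f u s
  refine ⟨C + (∫ s in Ioi (0 : ℝ), circ (Adens f u) s) * Real.exp (q * T) + 1, by positivity,
    fun t ht => ?_⟩
  rw [cylInt_Adens_eq hF ht]
  have hexp := Real.exp_pos (-q * t)
  rcases le_or_gt T t with hTt | hTt
  · have h1 : ∫ s in t..(t + 1), circ (Adens f u) s ≤ ∫ _s in t..(t + 1), C * Real.exp (-q * t) := by
      refine intervalIntegral.integral_mono_on (by linarith)
        ((continuousOn_circ_Adens hF).mono ?_).intervalIntegrable (by simp) fun s hs => ?_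
      · rw [uIcc_of_le (by linarith)]
        exact fun s hs => ht.trans_le hs.1
      · refine (h s (hTt.trans hs.1)).trans (mul_le_mul_of_nonneg_left ?_ hC)
        rw [Real.exp_le_exp]
        nlinarith [hs.1]
    rw [intervalIntegral.integral_const, smul_eq_mul] at h1
    have h2 : 0 ≤ (∫ s in Ioi (0 : ℝ), circ (Adens f u) s) * Real.exp (q * T) := by positivity
    nlinarith
  · have h1 : ∫ s in t..(t + 1), circ (Adens f u) s ≤
        ∫ s in Ioi (0 : ℝ), circ (Adens f u) s := by
      rw [intervalIntegral.integral_of_le (by linarith)]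
      exact setIntegral_mono_set hF.int_A
        (Eventually.of_forall fun s => circ_Adens_nonneg f u s)
        (Eventually.of_forall fun s hs => ht.trans hs.1)
    have h2 : 1 ≤ Real.exp (q * T) * Real.exp (-q * t) := by
      rw [← Real.exp_add]
      exact Real.one_le_exp (by nlinarith)
    have h3 := mul_le_mul_of_nonneg_left h2 hI
    nlinarith

end Decay

end Proof

/-- **Corollary 6.1** (decay of the second fundamental form at an isolated singularity). -/
theorem decay_at_isolated_singularity (n : ℕ)
    (f : ℝ → ℝ → EuclideanSpace ℝ (Fin n)) (w : ℝ → ℝ → ℝ)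
    (hf : DiskConfWillmore f w puncturedDisk)
    (hA : MeasureTheory.IntegrableOn
      (fun p : ℝ × ℝ => Asq f w p.1 p.2 * Real.exp (2 * w p.1 p.2)) puncturedDisk volume)
    (harea : MeasureTheory.IntegrableOn
      (fun p : ℝ × ℝ => Real.exp (2 * w p.1 p.2)) puncturedDisk volume)
    (q : ℝ) (hq0 : 0 < q) (hq2 : q < 2) :
    ∃ C > (0 : ℝ), ∀ t > (0 : ℝ),
      cylInt (Adens (cylOf f) (cylFactor w)) t (t + 1) ≤ C * Real.exp (-q * t) := by
  exact (hf.finiteCyl hA harea).exists_cylInt_le hq0 hq2
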